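/- Let Ω ⊂⊂ ℂ^n be a pseudoconvex domain with smooth boundary and z₀ ∈ ∂Ω, and suppose the Levi form of ∂Ω has constant rank l, 0 ≤ l ≤ n−1, at every boundary point in a neighborhood V of z₀. Then there exist a neighborhood W of z₀ and a constant C > 0, independent of p, X, Y, such that I¹_Ω(p;X) · I¹_Ω(p;Y) ≤ C · I⁰_Ω(p) · I²_Ω(p;X,Y) for all p ∈ W ∩ Ω and all X, Y ∈ ℂ^n. -/

import Mathlib

open MeasureTheory Complex Topology Filter Set

noncomputable section

/-! ### Wirtinger derivatives and complex Hessians on ℂⁿ -/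

/-- The Wirtinger derivative `∂u/∂z_j` of a function `u : ℂⁿ → ℂ` at `z`. -/
def wder (n : ℕ) (j : Fin n) (u : (Fin n → ℂ) → ℂ) (z : Fin n → ℂ) : ℂ :=
  (1 / 2) * (fderiv ℝ u z (Pi.single j 1) - Complex.I * fderiv ℝ u z (Pi.single j Complex.I))

/-- The conjugate Wirtinger derivative `∂u/∂z̄_j` of a function `u : ℂⁿ → ℂ` at `z`. -/
def wderBar (n : ℕ) (j : Fin n) (u : (Fin n → ℂ) → ℂ) (z : Fin n → ℂ) : ℂ :=
  (1 / 2) * (fderiv ℝ u z (Pi.single j 1) + Complex.I * fderiv ℝ u z (Pi.single j Complex.I))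

/-- The complex Hessian `∂²φ/∂z_j∂z̄_k` of a real-valued function `φ` at `z`. -/
def cHess (n : ℕ) (φ : (Fin n → ℂ) → ℝ) (z : Fin n → ℂ) (j k : Fin n) : ℂ :=
  wderBar n k (fun w => wder n j (fun v => (φ v : ℂ)) w) z

/-- The (real part of the) Hermitian form `Σ_{j,k} H_{jk} X_j conj (Y_k)`. -/
def hermForm (n : ℕ) (H : Fin n → Fin n → ℂ) (X Y : Fin n → ℂ) : ℝ :=
  (∑ j, ∑ k, H j k * X j * starRingEnd ℂ (Y k)).re

/-! ### The Bergman space, Bergman kernel, minimum integrals -/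

/-- Membership in the Bergman space `A²(Ω)`: holomorphic and square-integrable on `Ω`. -/
def InBergman (n : ℕ) (Ω : Set (Fin n → ℂ)) (f : (Fin n → ℂ) → ℂ) : Prop :=
  DifferentiableOn ℂ f Ω ∧ IntegrableOn (fun z => ‖f z‖ ^ 2) Ω

/-- The squared `L²(Ω)`-norm `∫_Ω |f|²`. -/
def l2sq (n : ℕ) (Ω : Set (Fin n → ℂ)) (f : (Fin n → ℂ) → ℂ) : ℝ :=
  ∫ z in Ω, ‖f z‖ ^ 2

/-- The holomorphic directional derivative `Σ_i X_i ∂f/∂z_i(p)`. -/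
def holDeriv (n : ℕ) (f : (Fin n → ℂ) → ℂ) (p X : Fin n → ℂ) : ℂ :=
  ∑ i, X i * fderiv ℂ f p (Pi.single i 1)

/-- The second-order holomorphic derivative `Σ_{j,k} X_j Y_k ∂²f/∂z_j∂z_k(p)`. -/
def holDeriv2 (n : ℕ) (f : (Fin n → ℂ) → ℂ) (p X Y : Fin n → ℂ) : ℂ :=
  ∑ j, ∑ k, X j * Y k * fderiv ℂ (fun z => fderiv ℂ f z (Pi.single k 1)) p (Pi.single j 1)

/-- Bergman's minimum integral `I⁰_Ω(p)`. -/
def I0 (n : ℕ) (Ω : Set (Fin n → ℂ)) (p : Fin n → ℂ) : ℝ :=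
  sInf {r | ∃ f, InBergman n Ω f ∧ f p = 1 ∧ r = l2sq n Ω f}

/-- Bergman's minimum integral `I¹_Ω(p; X)`. -/
def I1 (n : ℕ) (Ω : Set (Fin n → ℂ)) (p X : Fin n → ℂ) : ℝ :=
  sInf {r | ∃ f, InBergman n Ω f ∧ f p = 0 ∧ holDeriv n f p X = 1 ∧ r = l2sq n Ω f}

/-- Bergman's minimum integral `I²_Ω(p; X, Y)`. -/
def I2 (n : ℕ) (Ω : Set (Fin n → ℂ)) (p X Y : Fin n → ℂ) : ℝ :=
  sInf {r | ∃ f, InBergman n Ω f ∧ f p = 0 ∧ fderiv ℂ f p = 0 ∧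
    holDeriv2 n f p X Y = 1 ∧ r = l2sq n Ω f}

/-- The Bergman kernel on the diagonal,
`K_Ω(p, p̄) = sup {|f(p)|² : f ∈ A²(Ω), ‖f‖_{L²(Ω)} ≤ 1}`. -/
def bergmanKernel (n : ℕ) (Ω : Set (Fin n → ℂ)) (p : Fin n → ℂ) : ℝ :=
  sSup {r | ∃ f, InBergman n Ω f ∧ l2sq n Ω f ≤ 1 ∧ r = ‖f p‖ ^ 2}

/-- The components `g_{jk̄}(z) = ∂² log K_Ω(z,z̄)/∂z_j∂z̄_k` of the Bergman metric. -/
def bergMetricMat (n : ℕ) (Ω : Set (Fin n → ℂ)) (z : Fin n → ℂ) (j k : Fin n) : ℂ :=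
  cHess n (fun w => Real.log (bergmanKernel n Ω w)) z j k

/-- The Bergman metric `g_Ω(z; X) = Σ_{j,k} g_{jk̄}(z) X_j X̄_k`. -/
def bergMetric (n : ℕ) (Ω : Set (Fin n → ℂ)) (z X : Fin n → ℂ) : ℝ :=
  hermForm n (bergMetricMat n Ω z) X X

/-- The inverse matrix `(g^{νμ̄})` of the Bergman metric. -/
def bergMetricInv (n : ℕ) (Ω : Set (Fin n → ℂ)) (z : Fin n → ℂ) : Matrix (Fin n) (Fin n) ℂ :=
  (Matrix.of (bergMetricMat n Ω z))⁻¹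

/-- The curvature tensor of the Bergman metric,
`R_{h̄jkl̄} = −∂²g_{jh̄}/∂z_k∂z̄_l + g^{νμ̄} (∂g_{jμ̄}/∂z_k)(∂g_{νh̄}/∂z̄_l)`. -/
def bergCurvTensor (n : ℕ) (Ω : Set (Fin n → ℂ)) (z : Fin n → ℂ) (h j k l : Fin n) : ℂ :=
  - wderBar n l (fun w => wder n k (fun v => bergMetricMat n Ω v j h) w) z
  + ∑ ν, ∑ μ, bergMetricInv n Ω z ν μ *
      wder n k (fun v => bergMetricMat n Ω v j μ) z *
      wderBar n l (fun v => bergMetricMat n Ω v ν h) z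

/-- The bisectional curvature of the Bergman metric,
`B_Ω(z;X,Y) = R_{h̄jkl̄} X̄_h X_j Y_k Ȳ_l / (g(z;X) g(z;Y))`. -/
def bisecCurv (n : ℕ) (Ω : Set (Fin n → ℂ)) (z X Y : Fin n → ℂ) : ℝ :=
  (∑ h, ∑ j, ∑ k, ∑ l, bergCurvTensor n Ω z h j k l *
      starRingEnd ℂ (X h) * X j * Y k * starRingEnd ℂ (Y l)).re /
    (bergMetric n Ω z X * bergMetric n Ω z Y)

/-- The holomorphic sectional curvature `H_Ω(z;X) = B_Ω(z;X,X)`. -/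
def holSecCurv (n : ℕ) (Ω : Set (Fin n → ℂ)) (z X : Fin n → ℂ) : ℝ := bisecCurv n Ω z X X

/-- The Ricci curvature `Ric_Ω(z;X) = Σ_j B_Ω(z;E^j,X)` (standard basis). -/
def ricciCurv (n : ℕ) (Ω : Set (Fin n → ℂ)) (z X : Fin n → ℂ) : ℝ :=
  ∑ j, bisecCurv n Ω z (Pi.single j 1) X

/-! ### Plurisubharmonicity and pseudoconvexity -/

/-- `u` is plurisubharmonic on `Ω`: upper semicontinuous and satisfying the sub-mean value
inequality on circles in complex lines contained in `Ω`. -/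
def PSHOn (n : ℕ) (u : (Fin n → ℂ) → ℝ) (Ω : Set (Fin n → ℂ)) : Prop :=
  UpperSemicontinuousOn u Ω ∧
  ∀ z ∈ Ω, ∀ w : Fin n → ℂ, ∀ r : ℝ, 0 < r →
    (∀ t : ℂ, ‖t‖ ≤ r → z + t • w ∈ Ω) →
    u z ≤ (1 / (2 * Real.pi)) *
      ∫ θ in (0:ℝ)..(2 * Real.pi), u (z + ((r : ℂ) * Complex.exp ((θ : ℂ) * Complex.I)) • w)

/-- A `C²` function `φ` is plurisubharmonic on `Ω` iff its complex Hessian is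
positive semidefinite at every point of `Ω`. -/
def PSHOnC2 (n : ℕ) (φ : (Fin n → ℂ) → ℝ) (Ω : Set (Fin n → ℂ)) : Prop :=
  ∀ z ∈ Ω, ∀ X : Fin n → ℂ, 0 ≤ hermForm n (cHess n φ z) X X

/-- `Ω` is pseudoconvex: it admits a continuous plurisubharmonic exhaustion function. -/
def PseudoconvexExh (n : ℕ) (Ω : Set (Fin n → ℂ)) : Prop :=
  ∃ u : (Fin n → ℂ) → ℝ, ContinuousOn u Ω ∧ PSHOn n u Ω ∧
    ∀ c : ℝ, ∃ K : Set (Fin n → ℂ), IsCompact K ∧ K ⊆ Ω ∧ {z ∈ Ω | u z ≤ c} ⊆ K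

/-! ### Smooth boundary, Levi form, Levi rank -/

/-- `ρ` is a (global) smooth defining function for the domain `Ω`. -/
def IsDefining (n : ℕ) (Ω : Set (Fin n → ℂ)) (ρ : (Fin n → ℂ) → ℝ) : Prop :=
  ContDiff ℝ (⊤ : ℕ∞) ρ ∧ (∀ z ∈ Ω, ρ z < 0) ∧ (∀ z ∈ frontier Ω, ρ z = 0) ∧
    ∀ z ∈ frontier Ω, fderiv ℝ ρ z ≠ 0

/-- The coefficient `∂ρ/∂z_j(q)` of `∂ρ` (for a real-valued `ρ`). -/
def dzCoef (n : ℕ) (ρ : (Fin n → ℂ) → ℝ) (q : Fin n → ℂ) (j : Fin n) : ℂ :=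
  wder n j (fun v => (ρ v : ℂ)) q

/-- The ℂ-linear map `X ↦ Σ_j ∂ρ/∂z_j(q) X_j`. -/
def cTangentMap (n : ℕ) (ρ : (Fin n → ℂ) → ℝ) (q : Fin n → ℂ) : (Fin n → ℂ) →ₗ[ℂ] ℂ :=
  ∑ j, dzCoef n ρ q j • (LinearMap.proj j : (Fin n → ℂ) →ₗ[ℂ] ℂ)

/-- The complex tangent space `T^{1,0}_q(∂Ω) = {X : Σ_j ∂ρ/∂z_j(q) X_j = 0}`. -/
def cTangent (n : ℕ) (ρ : (Fin n → ℂ) → ℝ) (q : Fin n → ℂ) : Submodule ℂ (Fin n → ℂ) :=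
  LinearMap.ker (cTangentMap n ρ q)

/-- The Levi form of `ρ` at `q` is positive semidefinite on the complex tangent space. -/
def LeviPSDAt (n : ℕ) (ρ : (Fin n → ℂ) → ℝ) (q : Fin n → ℂ) : Prop :=
  ∀ X ∈ cTangent n ρ q, 0 ≤ hermForm n (cHess n ρ q) X X

/-- The ℂ-linear map `X ↦ Σ_{j,k} ρ_{jk̄}(q) X_j conj (Y_k)` (Levi pairing against `Y`). -/
def leviPairMap (n : ℕ) (ρ : (Fin n → ℂ) → ℝ) (q Y : Fin n → ℂ) : (Fin n → ℂ) →ₗ[ℂ] ℂ :=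
  ∑ j, (∑ k, cHess n ρ q j k * starRingEnd ℂ (Y k)) • (LinearMap.proj j : (Fin n → ℂ) →ₗ[ℂ] ℂ)

/-- The kernel of the Levi form of `ρ` at `q`, as a Hermitian form on `T^{1,0}_q(∂Ω)`. -/
def leviKernel (n : ℕ) (ρ : (Fin n → ℂ) → ℝ) (q : Fin n → ℂ) : Submodule ℂ (Fin n → ℂ) :=
  cTangent n ρ q ⊓ ⨅ Y ∈ cTangent n ρ q, LinearMap.ker (leviPairMap n ρ q Y)

/-- The Levi form of `ρ` at `q`, as a Hermitian form on `T^{1,0}_q(∂Ω)`, has rank `l`. -/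
def LeviRankAt (n : ℕ) (ρ : (Fin n → ℂ) → ℝ) (q : Fin n → ℂ) (l : ℕ) : Prop :=
  Module.finrank ℂ ↥(cTangent n ρ q) - Module.finrank ℂ ↥(leviKernel n ρ q) = l

/-! ### Test functions, polydiscs, Euclidean norms, biholomorphisms -/

/-- A smooth test function compactly supported in `Ω`. -/
def IsTestFun (n : ℕ) (ψ : (Fin n → ℂ) → ℂ) (Ω : Set (Fin n → ℂ)) : Prop :=
  ContDiff ℝ (⊤ : ℕ∞) ψ ∧ HasCompactSupport ψ ∧ tsupport ψ ⊆ Ω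

/-- The polydisc `P(c, β) = {z : |z_j − c_j| < β_j for all j}`. -/
def polydisc (n : ℕ) (c : Fin n → ℂ) (β : Fin n → ℝ) : Set (Fin n → ℂ) :=
  {z | ∀ j, ‖z j - c j‖ < β j}

/-- The Euclidean norm of the components of `ζ` indexed by `s`. -/
def eucNormOn (n : ℕ) (s : Finset (Fin n)) (ζ : Fin n → ℂ) : ℝ :=
  Real.sqrt (∑ j ∈ s, ‖ζ j‖ ^ 2)

/-- The Euclidean ball of radius `r` centered at the origin in ℂⁿ. -/
def eball (n : ℕ) (r : ℝ) : Set (Fin n → ℂ) :=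
  {ζ | eucNormOn n Finset.univ ζ < r}

/-- `f` is a biholomorphism from `A` onto `B`. -/
def Biholo (n : ℕ) (f : (Fin n → ℂ) → (Fin n → ℂ)) (A B : Set (Fin n → ℂ)) : Prop :=
  DifferentiableOn ℂ f A ∧ Set.BijOn f A B ∧
    ∃ g, DifferentiableOn ℂ g B ∧ ∀ z ∈ A, g (f z) = z

/-- The determinant of the complex Jacobian of `f` at `p`. -/
def cJacDet (n : ℕ) (f : (Fin n → ℂ) → (Fin n → ℂ)) (p : Fin n → ℂ) : ℂ :=
  LinearMap.det ((fderiv ℂ f p).toLinearMap)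

/-! ### Mixed derivatives `D^α` in the variables `z_j`, `z̄_j` -/

/-- The multi-index `α : Fin n → ℕ` recording how many of the directions `ι i` hit slot `j`. -/
def multiIdxOf (n : ℕ) {m : ℕ} (ι : Fin m → Fin n) : Fin n → ℕ :=
  fun j => (Finset.univ.filter fun i => ι i = j).card

/-- All mixed derivatives `D^α φ` of total order `≤ mmax`, where in each slot `j` one may
differentiate in the real directions underlying `z_j` and `z̄_j` (i.e. `e_j` and `i·e_j`),
are bounded on `P` by `bound α`. -/
def MixedDerivBound (n : ℕ) (φ : (Fin n → ℂ) → ℝ) (P : Set (Fin n → ℂ))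
    (mmax : ℕ) (bound : (Fin n → ℕ) → ℝ) : Prop :=
  ∀ m : ℕ, m ≤ mmax → ∀ ι : Fin m → Fin n, ∀ ε : Fin m → ℂ,
    (∀ i, ε i = 1 ∨ ε i = Complex.I) → ∀ z ∈ P,
      ‖iteratedFDeriv ℝ m φ z (fun i => Pi.single (ι i) (ε i))‖ ≤ bound (multiIdxOf n ι)

/-- All mixed derivatives `D^α φ` (of any order) are bounded on `P` by `bound α`. -/
def MixedDerivBoundAll (n : ℕ) (φ : (Fin n → ℂ) → ℝ) (P : Set (Fin n → ℂ))
    (bound : (Fin n → ℕ) → ℝ) : Prop :=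
  ∀ m : ℕ, ∀ ι : Fin m → Fin n, ∀ ε : Fin m → ℂ,
    (∀ i, ε i = 1 ∨ ε i = Complex.I) → ∀ z ∈ P,
      ‖iteratedFDeriv ℝ m φ z (fun i => Pi.single (ι i) (ε i))‖ ≤ bound (multiIdxOf n ι)

/-! ### Fu's centering maps and normal forms (constant Levi rank `l`) -/

/-- Lean indices `1,…,l`, i.e. the coordinates `ζ_2,…,ζ_{l+1}` (the block `ζ'`). -/
def primIdx (n l : ℕ) : Finset (Fin n) := Finset.univ.filter fun j => 1 ≤ j.val ∧ j.val ≤ l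

/-- Lean indices `l+1,…,n−1`, i.e. the coordinates `ζ_{l+2},…,ζ_n` (the block `ζ''`). -/
def dprimIdx (n l : ℕ) : Finset (Fin n) := Finset.univ.filter fun j => l + 1 ≤ j.val

/-- Lean indices `1,…,n−l−1`, i.e. the coordinates `ζ_2,…,ζ_{n−l}`. -/
def midIdx (n l : ℕ) : Finset (Fin n) :=
  Finset.univ.filter fun j => 1 ≤ j.val ∧ j.val ≤ n - l - 1

/-- Lean indices `n−l,…,n−1`, i.e. the coordinates `ζ_{n−l+1},…,ζ_n`. -/
def tailIdx (n l : ℕ) : Finset (Fin n) := Finset.univ.filter fun j => n - l ≤ j.val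

/-- `ρ` is a smooth local defining function for the real hypersurface `S` near `0`
(on the Euclidean ball of radius `ε`). -/
def IsLocalDefining (n : ℕ) (S : Set (Fin n → ℂ)) (ρ : (Fin n → ℂ) → ℝ) (ε : ℝ) : Prop :=
  ContDiffOn ℝ (⊤ : ℕ∞) ρ (eball n ε) ∧
    S ∩ eball n ε = {ζ ∈ eball n ε | ρ ζ = 0} ∧
    ∀ ζ ∈ S ∩ eball n ε, fderiv ℝ ρ ζ ≠ 0

/-- `ρ(ζ) = Re ζ₁ + Σ_{j=2}^{l+1} λ_j |ζ_j|² + O(|ζ'|²·|ζ''| + |ζ'|³ + |Im ζ₁|·|ζ|)` near `0`. -/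
def NormalForm (n l : ℕ) [NeZero n] (lam : Fin n → ℝ) (ρ : (Fin n → ℂ) → ℝ) (ε : ℝ) : Prop :=
  ∃ C > (0:ℝ), ∀ ζ ∈ eball n ε,
    |ρ ζ - ((ζ 0).re + ∑ j ∈ primIdx n l, lam j * ‖ζ j‖ ^ 2)| ≤
      C * ((eucNormOn n (primIdx n l) ζ) ^ 2 * eucNormOn n (dprimIdx n l) ζ +
        (eucNormOn n (primIdx n l) ζ) ^ 3 + |(ζ 0).im| * eucNormOn n Finset.univ ζ)

/-- Fu's centering data near a boundary point: for each `q ∈ U ∩ ∂Ω`, `Φ q` is a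
biholomorphism of `U` onto the unit ball with `Φ q q = 0`, depending smoothly on `q`,
such that `Φ q (U ∩ ∂Ω)` has, near `0`, a defining function `ρloc q` in normal form with
positive coefficients `lam q j` (for `j` in the block `ζ'`) depending smoothly on `q`. -/
def CenteringData (n l : ℕ) [NeZero n] (Ω U : Set (Fin n → ℂ))
    (Φ : (Fin n → ℂ) → (Fin n → ℂ) → (Fin n → ℂ))
    (lam : (Fin n → ℂ) → Fin n → ℝ)
    (ρloc : (Fin n → ℂ) → (Fin n → ℂ) → ℝ) (ε : ℝ) : Prop :=
  ContDiffOn ℝ (⊤ : ℕ∞) (fun pq : (Fin n → ℂ) × (Fin n → ℂ) => Φ pq.1 pq.2)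
      ((U ∩ frontier Ω) ×ˢ U) ∧
  (∀ j : Fin n, ContDiffOn ℝ (⊤ : ℕ∞) (fun q => lam q j) (U ∩ frontier Ω)) ∧
  ∀ q ∈ U ∩ frontier Ω,
    Φ q q = 0 ∧ Biholo n (Φ q) U (eball n 1) ∧
    (∀ j ∈ primIdx n l, 0 < lam q j) ∧
    IsLocalDefining n (Φ q '' (U ∩ frontier Ω)) (ρloc q) ε ∧
    NormalForm n l (lam q) (ρloc q) ε

/-- Fu's polydisc-type region
`P_{δ,a} = {ζ : |ζ₁| < aδ, |ζ_j| < aδ^{1/2} (2 ≤ j ≤ n−l), |ζ_k| < a (n−l+1 ≤ k ≤ n)}`. -/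
def PdaSet (n l : ℕ) [NeZero n] (δ a : ℝ) : Set (Fin n → ℂ) :=
  {ζ | ‖ζ 0‖ < a * δ ∧ (∀ j ∈ midIdx n l, ‖ζ j‖ < a * Real.sqrt δ) ∧
    ∀ j ∈ tailIdx n l, ‖ζ j‖ < a}

/-! ### Finite type in the sense of D'Angelo -/

/-- `h` vanishes to order at least `k` at `0`. -/
def vanishGe (E : Type*) [Norm E] (h : ℂ → E) (k : ℕ) : Prop :=
  ∃ C > (0:ℝ), ∃ ε > (0:ℝ), ∀ t : ℂ, ‖t‖ < ε → ‖h t‖ ≤ C * ‖t‖ ^ k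

/-- The vanishing order of `h` at `0`, as an extended natural number. -/
def vOrder (E : Type*) [Norm E] (h : ℂ → E) : ℕ∞ :=
  sSup ((fun k : ℕ => (k : ℕ∞)) '' {k | vanishGe E h k})

/-- `z₀ ∈ ∂Ω` is a point of finite type in the sense of D'Angelo (w.r.t. the defining
function `ρ`): the order of contact of `∂Ω` with nonconstant holomorphic curves through
`z₀` is uniformly bounded. -/
def FiniteTypeAt (n : ℕ) (ρ : (Fin n → ℂ) → ℝ) (z₀ : Fin n → ℂ) : Prop :=
  ∃ T : ℕ, ∀ γ : ℂ → (Fin n → ℂ), AnalyticAt ℂ γ 0 → γ 0 = z₀ →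
    ¬ (∀ᶠ t in 𝓝 (0:ℂ), γ t = z₀) →
    vOrder ℝ (fun t => ρ (γ t)) ≤ (T : ℕ∞) * vOrder (Fin n → ℂ) (fun t => γ t - z₀)

end

open MeasureTheory Complex Topology Filter Set Metric
open scoped ContDiff ENNReal ComplexConjugate Real
open Pi (single)
open Finset (sum_sub_distrib sum_add_distrib mul_sum sum_comm sum_congr sum_mul sum_eq_zero induction_on sum_insert sum_le_sum sum_const_zero sum_nonneg)
open Continuous (integrable_of_hasCompactSupport)
open Real (exp_pos sqrt_nonneg sq_sqrt smoothTransition norm_eq_abs abs_exp exp_le_exp sInf_nonneg log_nonpos log_le_log le_norm_self one_le_exp)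
open HasCompactSupport (of_support_subset_isCompact)
open Homeomorph (subLeft)
open ContinuousLinearMap (integral_apply flip_apply proj toSpanSingleton comp_apply coe_coe le_of_opNorm_le le_opNorm₂)
open Function (comp_def)
open Or (inr inl)
open LinearMap (toContinuousLinearMap)
notation:max "ℂ^" n:max => Fin n → ℂ

variable {n : ℕ} {Ω : Set ℂ^n} {φ ψ ρ G : ℂ^n → ℝ} {f g u v : ℂ^n → ℂ} {z z₁ e p w X : ℂ^n} {β α : Fin n → ℂ^n → ℂ} {P : ℂ^n →L[ℂ] ℂ^n} {A : ℂ^n → ℂ^n →L[ℝ] ℂ^n} {c ε δ r M : ℝ} {j : Fin n} {s k : ℂ^n → ℝ} {K : Set ℂ^n}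

lemma wder_def (j) (u) (z) :
    wder n j u z = (1 / 2) * (fderiv ℝ u z (single j 1) - I * fderiv ℝ u z (single j I)) :=
  rfl

lemma wderBar_def (j) (u) (z) : wderBar n j u z =
      (1 / 2) * (fderiv ℝ u z (single j 1) + I * fderiv ℝ u z (single j I)) :=
  rfl

lemma wder_add (hu : DifferentiableAt ℝ u z) (hv : DifferentiableAt ℝ v z) :
    wder n j (fun y => u y + v y) z = wder n j u z + wder n j v z := by
  simp [wder_def]
  rw [fderiv_fun_add hu hv]
  simp; ring

lemma wder_sub (hu : DifferentiableAt ℝ u z) (hv : DifferentiableAt ℝ v z) :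
    wder n j (fun y => u y - v y) z = wder n j u z - wder n j v z := by
  simp [wder_def]
  rw [fderiv_fun_sub hu hv]
  simp; ring

lemma wderBar_sub (hu : DifferentiableAt ℝ u z) (hv : DifferentiableAt ℝ v z) :
    wderBar n j (fun y => u y - v y) z = wderBar n j u z - wderBar n j v z := by
  simp [wderBar_def]
  rw [fderiv_fun_sub hu hv]
  simp; ring

lemma wder_mul (hu : DifferentiableAt ℝ u z) (hv : DifferentiableAt ℝ v z) :
    wder n j (fun y => u y * v y) z = wder n j u z * v z + u z * wder n j v z := by
  simp [wder_def]
  rw [fderiv_fun_mul hu hv]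
  simp; ring

lemma wderBar_mul (hu : DifferentiableAt ℝ u z) (hv : DifferentiableAt ℝ v z) :
    wderBar n j (fun y => u y * v y) z = wderBar n j u z * v z + u z * wderBar n j v z := by
  simp [wderBar_def]
  rw [fderiv_fun_mul hu hv]
  simp; ring

lemma wder_neg : wder n j (fun y => - u y) z = - wder n j u z := by
  simp only [wder_def]
  simp; ring

lemma fderiv_conj_apply (X) : fderiv ℝ (fun y => conj (u y)) z X = conj (fderiv ℝ u z X) := by
  have := conjCLE.comp_fderiv (f := u) (x := z)
  have h2 : (fun y => conj (u y)) = conjCLE ∘ u := by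
    ext y; simp
  rw [h2, this]; simp

lemma wderBar_conj : wderBar n j (fun y => conj (u y)) z = conj (wder n j u z) := by
  simp [wderBar_def, wder_def, fderiv_conj_apply]
  simp [map_ofNat]

lemma wder_conj : wder n j (fun y => conj (u y)) z = conj (wderBar n j u z) := by
  simp [wderBar_def, wder_def, fderiv_conj_apply]
  simp [sub_eq_add_neg, map_ofNat]

lemma wderBar_ofReal {u : ℂ^n → ℝ} :
    wderBar n j (fun y => u y) z = conj (wder n j (fun y => u y) z) := by
  rw [← wderBar_conj]; simp

lemma fderiv_ofReal_apply {u : ℂ^n → ℝ} (hu : DifferentiableAt ℝ u z) (X) :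
    fderiv ℝ (fun y => (u y : ℂ)) z X = fderiv ℝ u z X := by
  have h2 : HasFDerivAt (fun y => (u y : ℂ)) (ofRealCLM.comp (fderiv ℝ u z)) z :=
    (ofRealCLM.hasFDerivAt).comp z hu.hasFDerivAt
  rw [h2.fderiv]; simp

lemma contDiff_fderiv_apply_const {F} [NormedAddCommGroup F] [NormedSpace ℝ F]
    {u : ℂ^n → F} (hu : ContDiff ℝ ∞ u) (X) : ContDiff ℝ ∞ (fun z => fderiv ℝ u z X) := by
  have : ContDiff ℝ ∞ (fderiv ℝ u) := hu.fderiv_right (by simp)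
  exact this.clm_apply contDiff_const

lemma ContDiff.wder (hu : ContDiff ℝ ∞ u) (j) : ContDiff ℝ ∞ (wder n j u) := by
  exact contDiff_const.mul ((contDiff_fderiv_apply_const hu _).sub
    (contDiff_const.mul (contDiff_fderiv_apply_const hu _)))

lemma ContDiff.wderBar (hu : ContDiff ℝ ∞ u) (j) : ContDiff ℝ ∞ (wderBar n j u) := by
  exact contDiff_const.mul ((contDiff_fderiv_apply_const hu _).add
    (contDiff_const.mul (contDiff_fderiv_apply_const hu _)))

lemma fderiv_eq_zero_of_notMem_tsupport (hz : z ∉ tsupport u) : fderiv ℝ u z = 0 := by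
  by_contra h
  exact hz (support_fderiv_subset ℝ h)

lemma wder_eq_zero_of_notMem (hz : z ∉ tsupport u) : wder n j u z = 0 := by
  simp [wder_def, fderiv_eq_zero_of_notMem_tsupport hz]

lemma wderBar_eq_zero_of_notMem (hz : z ∉ tsupport u) : wderBar n j u z = 0 := by
  simp [wderBar_def, fderiv_eq_zero_of_notMem_tsupport hz]

lemma tsupport_wder_subset (j) (u) : tsupport (wder n j u) ⊆ tsupport u :=
  closure_minimal (fun z hz => by
    by_contra h; exact hz (wder_eq_zero_of_notMem h)) (isClosed_tsupport u)

lemma tsupport_wderBar_subset (j) (u) : tsupport (wderBar n j u) ⊆ tsupport u :=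
  closure_minimal (fun z hz => by
    by_contra h; exact hz (wderBar_eq_zero_of_notMem h)) (isClosed_tsupport u)

lemma HasCompactSupport.wder (hu : HasCompactSupport u) (j) :
    HasCompactSupport (wder n j u) :=
  hu.of_isClosed_subset (isClosed_tsupport _) (tsupport_wder_subset j u)

lemma HasCompactSupport.wderBar (hu : HasCompactSupport u) (j) :
    HasCompactSupport (wderBar n j u) :=
  hu.of_isClosed_subset (isClosed_tsupport _) (tsupport_wderBar_subset j u)

lemma integral_fderiv_eq_zero (hu : ContDiff ℝ ∞ u)
    (hc : HasCompactSupport u) (X) : ∫ z, fderiv ℝ u z X = 0 := by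
  have h1 := (contDiff_fderiv_apply_const hu X).continuous
  have h2 := hc.fderiv_apply ℝ X
  have := integral_mul_fderiv_eq_neg_fderiv_mul_of_integrable (μ := volume)
    (f := fun _ => 1) (by simp)
    (by simpa using h1.integrable_of_hasCompactSupport h2)
    (by simpa using hu.continuous.integrable_of_hasCompactSupport hc)
    (fun x _ => by fun_prop) (fun x _ => (hu.differentiable (by simp)).differentiableAt)
  simpa using this

lemma integral_wder_eq_zero (hu : ContDiff ℝ ∞ u)
    (hc : HasCompactSupport u) (j) : ∫ z, wder n j u z = 0 := by
  have h1 : ∀ X, Integrable fun z => fderiv ℝ u z X := fun X =>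
    ((contDiff_fderiv_apply_const hu X).continuous).integrable_of_hasCompactSupport
      (hc.fderiv_apply ℝ X)
  simp [wder_def]
  rw [integral_const_mul, integral_sub (h1 _) ((h1 _).const_mul _), integral_const_mul,
    integral_fderiv_eq_zero hu hc, integral_fderiv_eq_zero hu hc]
  simp

lemma integral_wderBar_eq_zero (hu : ContDiff ℝ ∞ u)
    (hc : HasCompactSupport u) (j) : ∫ z, wderBar n j u z = 0 := by
  have h1 : ∀ X, Integrable fun z => fderiv ℝ u z X := fun X =>
    ((contDiff_fderiv_apply_const hu X).continuous).integrable_of_hasCompactSupport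
      (hc.fderiv_apply ℝ X)
  simp [wderBar_def]
  rw [integral_const_mul, integral_add (h1 _) ((h1 _).const_mul _), integral_const_mul,
    integral_fderiv_eq_zero hu hc, integral_fderiv_eq_zero hu hc]
  simp

lemma HasCompactSupport.integrable_of_contDiff
    (hc : HasCompactSupport u) (hu : ContDiff ℝ ∞ u) : Integrable u :=
  hu.continuous.integrable_of_hasCompactSupport hc

lemma integral_wder_mul (hu : ContDiff ℝ ∞ u) (hv : ContDiff ℝ ∞ v)
    (hc : HasCompactSupport u) (j) :
    ∫ z, wder n j u z * v z = - ∫ z, u z * wder n j v z := by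
  have h := integral_wder_eq_zero (hu.mul hv) (hc.mul_right) j
  have e : ∀ z, wder n j (fun y => u y * v y) z = wder n j u z * v z + u z * wder n j v z :=
    fun z => wder_mul (hu.differentiable (by simp)).differentiableAt
      (hv.differentiable (by simp)).differentiableAt
  simp [e] at h
  rw [integral_add] at h
  · exact eq_neg_of_add_eq_zero_left h
  · exact ((hc.wder j).mul_right).integrable_of_contDiff ((hu.wder j).mul hv)
  · exact hc.mul_right.integrable_of_contDiff (hu.mul (hv.wder j))

lemma integral_wderBar_mul (hu : ContDiff ℝ ∞ u) (hv : ContDiff ℝ ∞ v)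
    (hc : HasCompactSupport u) (j) :
    ∫ z, wderBar n j u z * v z = - ∫ z, u z * wderBar n j v z := by
  have h := integral_wderBar_eq_zero (hu.mul hv) (hc.mul_right) j
  have e : ∀ z, wderBar n j (fun y => u y * v y) z
      = wderBar n j u z * v z + u z * wderBar n j v z :=
    fun z => wderBar_mul (hu.differentiable (by simp)).differentiableAt
      (hv.differentiable (by simp)).differentiableAt
  simp [e] at h
  rw [integral_add] at h
  · exact eq_neg_of_add_eq_zero_left h
  · exact ((hc.wderBar j).mul_right).integrable_of_contDiff ((hu.wderBar j).mul hv)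
  · exact hc.mul_right.integrable_of_contDiff (hu.mul (hv.wderBar j))

lemma fderiv_fderiv_apply_comm {F} [NormedAddCommGroup F] [NormedSpace ℝ F]
    {u : ℂ^n → F} (hu : ContDiffAt ℝ 2 u z)
    (X Y) : fderiv ℝ (fderiv ℝ u) z X Y = fderiv ℝ (fderiv ℝ u) z Y X :=
  (hu.isSymmSndFDerivAt (by simp)).eq X Y

lemma fderiv_fderiv_const_apply {F} [NormedAddCommGroup F] [NormedSpace ℝ F]
    {u : ℂ^n → F} (hu : ContDiffAt ℝ 2 u z) (X Y) :
    fderiv ℝ (fun y => fderiv ℝ u y X) z Y = fderiv ℝ (fderiv ℝ u) z Y X := by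
  have h1 :=
    (hu.fderiv_right (m := 1) (by norm_num)).differentiableAt (by simp)
  rw [fderiv_clm_apply h1 (by fun_prop)]
  simp

lemma fderiv_wder (hu : ContDiffAt ℝ 2 u z) (j) (X) :
    fderiv ℝ (wder n j u) z X = (1 / 2) * (fderiv ℝ (fderiv ℝ u) z X (single j 1)
      - I * fderiv ℝ (fderiv ℝ u) z X (single j I)) := by
  have h1 :=
    (hu.fderiv_right (m := 1) (by norm_num)).differentiableAt (by simp)
  have h2 : ∀ Y, DifferentiableAt ℝ (fun y => fderiv ℝ u y Y) z := fun Y =>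
    h1.clm_apply (by fun_prop)
  have e : wder n j u = fun y => 1 / 2 * (fderiv ℝ u y (single j 1)
      - I * fderiv ℝ u y (single j I)) := rfl
  rw [e, fderiv_const_mul ((h2 _).fun_sub ((h2 _).const_mul _)),
    fderiv_fun_sub (h2 _) ((h2 _).const_mul _), fderiv_const_mul (h2 _)]
  simp [fderiv_fderiv_const_apply hu]

lemma fderiv_wderBar (hu : ContDiffAt ℝ 2 u z) (j) (X) :
    fderiv ℝ (wderBar n j u) z X = (1 / 2) * (fderiv ℝ (fderiv ℝ u) z X (single j 1)
      + I * fderiv ℝ (fderiv ℝ u) z X (single j I)) := by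
  have h1 :=
    (hu.fderiv_right (m := 1) (by norm_num)).differentiableAt (by simp)
  have h2 : ∀ Y, DifferentiableAt ℝ (fun y => fderiv ℝ u y Y) z := fun Y =>
    h1.clm_apply (by fun_prop)
  have e : wderBar n j u = fun y => 1 / 2 * (fderiv ℝ u y (single j 1)
      + I * fderiv ℝ u y (single j I)) := rfl
  rw [e, fderiv_const_mul ((h2 _).fun_add ((h2 _).const_mul _)),
    fderiv_fun_add (h2 _) ((h2 _).const_mul _), fderiv_const_mul (h2 _)]
  simp [fderiv_fderiv_const_apply hu]
  ring

lemma wderBar_wder_comm (hu : ContDiffAt ℝ 2 u z)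
    (j k) : wderBar n k (wder n j u) z = wder n j (wderBar n k u) z := by
  rw [wderBar_def, wder_def, fderiv_wder hu, fderiv_wder hu, fderiv_wderBar hu, fderiv_wderBar hu,
    fderiv_fderiv_apply_comm hu (single k 1) (single j 1),
    fderiv_fderiv_apply_comm hu (single k 1) (single j I),
    fderiv_fderiv_apply_comm hu (single k I) (single j 1),
    fderiv_fderiv_apply_comm hu (single k I) (single j I)]
  ring

lemma wderBar_wderBar_comm (hu : ContDiffAt ℝ 2 u z)
    (j k) : wderBar n k (wderBar n j u) z = wderBar n j (wderBar n k u) z := by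
  rw [wderBar_def, wderBar_def, fderiv_wderBar hu, fderiv_wderBar hu, fderiv_wderBar hu,
    fderiv_wderBar hu,
    fderiv_fderiv_apply_comm hu (single k 1) (single j 1),
    fderiv_fderiv_apply_comm hu (single k 1) (single j I),
    fderiv_fderiv_apply_comm hu (single k I) (single j 1),
    fderiv_fderiv_apply_comm hu (single k I) (single j I)]
  ring

lemma fderiv_exp_neg_apply (hφ : DifferentiableAt ℝ φ z) (X) :
    fderiv ℝ (fun y => (rexp (-φ y) : ℂ)) z X
      = - fderiv ℝ (fun y => (φ y : ℂ)) z X * rexp (-φ z) := by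
  rw [fderiv_ofReal_apply (by fun_prop), fderiv_ofReal_apply hφ,
    fderiv_exp (by fun_prop)]
  simp; ring

lemma wder_exp_neg (hφ : DifferentiableAt ℝ φ z) (j) :
    wder n j (fun y => (rexp (-φ y) : ℂ)) z
      = - wder n j (fun y => φ y) z * rexp (-φ z) := by
  rw [wder_def, wder_def, fderiv_exp_neg_apply hφ, fderiv_exp_neg_apply hφ]
  ring

lemma two_le_infty : (2 : WithTop ℕ∞) ≤ (⊤ : ℕ∞) := WithTop.coe_le_coe.2 le_top

lemma integral_re_complex (hf : Integrable f) : ∫ z, (f z).re = (∫ z, f z).re := by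
  simpa using reCLM.integral_comp_comm hf

/-- The weighted derivative `∂_j f - (∂_j φ) f`, formally `-1` times the adjoint of `∂̄_j`. -/
noncomputable def wderW (n) (φ : ℂ^n → ℝ) (j) (f) (z) :=
  wder n j f z - wder n j (fun y => φ y) z * f z

lemma wder_mul_exp_neg (hφ : DifferentiableAt ℝ φ z) (hf : DifferentiableAt ℝ f z) (j) :
    wder n j (fun y => f y * (rexp (-φ y) : ℂ)) z = wderW n φ j f z * rexp (-φ z) := by
  have h : DifferentiableAt ℝ (fun y => (rexp (-φ y) : ℂ)) z :=
    ofRealCLM.differentiableAt.comp z (by fun_prop)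
  rw [wder_mul hf h, wder_exp_neg hφ, wderW]
  ring

lemma contDiff_ofReal_comp (hφ : ContDiff ℝ ∞ φ) : ContDiff ℝ ∞ (fun y => (φ y : ℂ)) :=
  ofRealCLM.contDiff.comp hφ

lemma ContDiff.conj_comp (hf : ContDiff ℝ ∞ f) : ContDiff ℝ ∞ (fun y => conj (f y)) :=
  conjCLE.contDiff.comp hf

lemma ContDiff.wderW (hf : ContDiff ℝ ∞ f)
    (hφ : ContDiff ℝ ∞ φ) (j) : ContDiff ℝ ∞ (wderW n φ j f) :=
  (hf.wder j).sub (((contDiff_ofReal_comp hφ).wder j).mul hf)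

lemma HasCompactSupport.wderW
    (hf : HasCompactSupport f) (j) : HasCompactSupport (wderW n φ j f) :=
  (hf.wder j).sub hf.mul_left

lemma HasCompactSupport.conj_comp
    (hf : HasCompactSupport f) : HasCompactSupport (fun y => conj (f y)) :=
  hf.comp_left (map_zero _)

lemma integral_wderBar_mul_conj
    (hφ : ContDiff ℝ ∞ φ) (hf : ContDiff ℝ ∞ f) (hg : ContDiff ℝ ∞ g) (hc : HasCompactSupport f)
    (k) : ∫ z, wderBar n k f z * conj (g z) * rexp (-φ z)
      = - ∫ z, f z * conj (wderW n φ k g z) * rexp (-φ z) := by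
  have hw : ContDiff ℝ ∞ (fun y => (rexp (-φ y) : ℂ)) :=
    contDiff_ofReal_comp (Real.contDiff_exp.comp hφ.neg)
  have h := integral_wderBar_mul hf (hg.mul hw).conj_comp hc k
  simp only [wderBar_conj] at h
  have e : ∀ z, wder n k (fun y => g y * (rexp (-φ y) : ℂ)) z
      = wderW n φ k g z * rexp (-φ z) := fun z =>
    wder_mul_exp_neg (hφ.differentiable (by simp)).differentiableAt
      (hg.differentiable (by simp)).differentiableAt k
  simp only [e, map_mul, conj_ofReal, ← mul_assoc] at h
  exact h

lemma integral_wderW_mul_conj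
    (hφ : ContDiff ℝ ∞ φ) (hf : ContDiff ℝ ∞ f) (hg : ContDiff ℝ ∞ g) (hc : HasCompactSupport f)
    (j) : ∫ z, wderW n φ j f z * conj (g z) * rexp (-φ z)
      = - ∫ z, f z * conj (wderBar n j g z) * rexp (-φ z) := by
  have hw : ContDiff ℝ ∞ (fun y => (rexp (-φ y) : ℂ)) :=
    contDiff_ofReal_comp (Real.contDiff_exp.comp hφ.neg)
  have h := integral_wder_mul (hf.mul hw) hg.conj_comp hc.mul_right j
  simp only [wder_conj] at h
  have e : ∀ z, wder n j (fun y => f y * (rexp (-φ y) : ℂ)) z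
      = wderW n φ j f z * rexp (-φ z) := fun z =>
    wder_mul_exp_neg (hφ.differentiable (by simp)).differentiableAt
      (hf.differentiable (by simp)).differentiableAt j
  simp only [e] at h
  convert h using 2
  · ext z; ring
  · congr 1; ext z; ring

lemma wderBar_wderW (hφ : ContDiff ℝ ∞ φ) (hf : ContDiff ℝ ∞ f) (j k) (z) :
    wderBar n k (wderW n φ j f) z = wderW n φ j (wderBar n k f) z - cHess n φ z j k * f z := by
  have h1 : DifferentiableAt ℝ (wder n j f) z :=
    ((hf.wder j).differentiable (by simp)).differentiableAt
  have h2 : DifferentiableAt ℝ (wder n j (fun y => φ y)) z :=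
    (((contDiff_ofReal_comp hφ).wder j).differentiable (by simp)).differentiableAt
  have h3 : DifferentiableAt ℝ f z := (hf.differentiable (by simp)).differentiableAt
  have e : wderW n φ j f = fun y => wder n j f y - wder n j (fun y => φ y) y * f y := rfl
  rw [e, wderBar_sub h1 (h2.fun_mul h3), wderBar_mul h2 h3,
    wderBar_wder_comm (hf.contDiffAt.of_le two_le_infty), wderW, cHess]
  ring

lemma integral_wderW_wderW
    (hφ : ContDiff ℝ ∞ φ) (hf : ContDiff ℝ ∞ f) (hg : ContDiff ℝ ∞ g) (hc : HasCompactSupport f)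
    (j k) : ∫ z, wderW n φ j f z * conj (wderW n φ k g z) * rexp (-φ z)
      = (∫ z, cHess n φ z j k * f z * conj (g z) * rexp (-φ z))
        + ∫ z, wderBar n k f z * conj (wderBar n j g z) * rexp (-φ z) := by
  have hw :=
    contDiff_ofReal_comp (Real.contDiff_exp.comp hφ.neg)
  have hH :=
    ((contDiff_ofReal_comp hφ).wder j).wderBar k
  have h1 := integral_wderBar_mul_conj hφ (hf.wderW hφ j) hg (hc.wderW j) k
  have h2 := integral_wderW_mul_conj hφ (hf.wderBar k) hg (hc.wderBar k) j
  rw [eq_comm, neg_eq_iff_eq_neg] at h1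
  rw [h1]
  simp only [wderBar_wderW hφ hf, sub_mul]
  rw [integral_sub, h2]
  · ring
  · exact (((hc.wderBar k).wderW j).mul_right.mul_right).integrable_of_contDiff
      ((((hf.wderBar k).wderW hφ j).mul hg.conj_comp).mul hw)
  · exact hc.mul_left.mul_right.mul_right.integrable_of_contDiff
      (((hH.mul hf).mul hg.conj_comp).mul hw)

lemma half_sum_norm_sub_sq (a : Fin n → ℂ^n) : 1 / 2 * ∑ j, ∑ k, ‖a j k - a k j‖ ^ 2
      = ∑ j, ∑ k, ‖a j k‖ ^ 2 - (∑ j, ∑ k, a k j * conj (a j k)).re := by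
  have h : ∀ j k, ‖a j k - a k j‖ ^ 2
      = ‖a j k‖ ^ 2 + ‖a k j‖ ^ 2 - 2 * (a k j * conj (a j k)).re := by
    intro j k
    simp only [← normSq_eq_norm_sq, normSq_apply]
    simp; ring
  simp [h, sum_sub_distrib, sum_add_distrib, ← mul_sum, re_sum]
  rw [sum_comm]
  ring

/-- The Kohn-Morrey-Hörmander inequality for compactly supported `(0,1)`-forms. -/
theorem kohn_morrey_hormander
    (hφ : ContDiff ℝ ∞ φ) (hβ : ∀ j, ContDiff ℝ ∞ (β j)) (hc : ∀ j, HasCompactSupport (β j)) :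
    ∫ z, hermForm n (cHess n φ z) (fun j => β j z) (fun j => β j z) * rexp (-φ z)
      ≤ (∫ z, ‖∑ j, wderW n φ j (β j) z‖ ^ 2 * rexp (-φ z))
        + ∫ z, (1 / 2 * ∑ j, ∑ k, ‖wderBar n j (β k) z - wderBar n k (β j) z‖ ^ 2)
          * rexp (-φ z) := by
  have hw :=
    contDiff_ofReal_comp (Real.contDiff_exp.comp hφ.neg)
  have hH := fun j k =>
    ((contDiff_ofReal_comp hφ).wder j).wderBar k
  have I1 : ∀ j k, Integrable fun z =>
      wderW n φ j (β j) z * conj (wderW n φ k (β k) z) * rexp (-φ z) :=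
    fun j k => (((hc j).wderW j).mul_right.mul_right).integrable_of_contDiff
      ((((hβ j).wderW hφ j).mul ((hβ k).wderW hφ k).conj_comp).mul hw)
  have I2 : ∀ j k, Integrable fun z =>
      cHess n φ z j k * β j z * conj (β k z) * rexp (-φ z) :=
    fun j k => ((hc j).mul_left.mul_right.mul_right).integrable_of_contDiff
      ((((hH j k).mul (hβ j)).mul (hβ k).conj_comp).mul hw)
  have I3 : ∀ j k, Integrable fun z =>
      wderBar n k (β j) z * conj (wderBar n j (β k) z) * rexp (-φ z) :=
    fun j k => (((hc j).wderBar k).mul_right.mul_right).integrable_of_contDiff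
      ((((hβ j).wderBar k).mul ((hβ k).wderBar j).conj_comp).mul hw)
  have J1 := fun j => integrable_finsetSum Finset.univ fun k _ => I1 j k
  have J2 := fun j => integrable_finsetSum Finset.univ fun k _ => I2 j k
  have J3 := fun j => integrable_finsetSum Finset.univ fun k _ => I3 j k
  have K1 := integrable_finsetSum Finset.univ fun j _ => J1 j
  have K2 := integrable_finsetSum Finset.univ fun j _ => J2 j
  have K3 := integrable_finsetSum Finset.univ fun j _ => J3 j
  have key : (∫ z, ∑ j, ∑ k,
        wderW n φ j (β j) z * conj (wderW n φ k (β k) z) * rexp (-φ z))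
      = (∫ z, ∑ j, ∑ k, cHess n φ z j k * β j z * conj (β k z) * rexp (-φ z))
        + ∫ z, ∑ j, ∑ k,
          wderBar n k (β j) z * conj (wderBar n j (β k) z) * rexp (-φ z) := by
    rw [integral_finsetSum _ fun j _ => J1 j, integral_finsetSum _ fun j _ => J2 j,
      integral_finsetSum _ fun j _ => J3 j, ← sum_add_distrib]
    refine sum_congr rfl fun j _ => ?_
    rw [integral_finsetSum _ fun k _ => I1 j k, integral_finsetSum _ fun k _ => I2 j k,
      integral_finsetSum _ fun k _ => I3 j k, ← sum_add_distrib]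
    exact sum_congr rfl fun k _ => integral_wderW_wderW hφ (hβ j) (hβ k) (hc j) j k
  have key2 := congrArg re key
  rw [add_re, ← integral_re_complex K1, ← integral_re_complex K2, ← integral_re_complex K3] at key2
  have e1 : ∀ z, (∑ j, ∑ k, wderW n φ j (β j) z * conj (wderW n φ k (β k) z)
      * (rexp (-φ z) : ℂ)).re
      = ‖∑ j, wderW n φ j (β j) z‖ ^ 2 * rexp (-φ z) := by
    intro z
    simp only [← sum_mul, ← mul_sum, re_mul_ofReal]
    rw [← map_sum, mul_conj, ofReal_re, normSq_eq_norm_sq]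
  have e2 : ∀ z, (∑ j, ∑ k, cHess n φ z j k * β j z * conj (β k z)
      * (rexp (-φ z) : ℂ)).re
      = hermForm n (cHess n φ z) (fun j => β j z) (fun j => β j z) * rexp (-φ z) := by
    intro z
    simp only [← sum_mul, re_mul_ofReal, hermForm]
  have e3 : ∀ z, (∑ j, ∑ k, wderBar n k (β j) z * conj (wderBar n j (β k) z)
      * (rexp (-φ z) : ℂ)).re
      = (∑ j, ∑ k, wderBar n k (β j) z * conj (wderBar n j (β k) z)).re
        * rexp (-φ z) := by
    intro z
    simp only [← sum_mul, re_mul_ofReal]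
  have K3' := by
    have := K3.re
    simpa only [RCLike.re_eq_complex_re, e3] using this
  have K4 : Integrable fun z => (1 / 2 * ∑ j, ∑ k,
      ‖wderBar n j (β k) z - wderBar n k (β j) z‖ ^ 2) * rexp (-φ z) := by
    simp [mul_sum, sum_mul]
    refine integrable_finsetSum _ fun j _ => integrable_finsetSum _ fun k _ => ?_
    refine integrable_of_hasCompactSupport ?_ ?_
    · have := ((hβ k).wderBar j).continuous
      have := ((hβ j).wderBar k).continuous
      fun_prop
    · refine HasCompactSupport.mul_right (HasCompactSupport.mul_left ?_)
      exact (((hc k).wderBar j).sub ((hc j).wderBar k)).comp_left (g := fun x => ‖x‖ ^ 2) (by simp)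
  simp only [e1, e2, e3] at key2
  rw [key2, add_assoc, ← integral_add K3' K4]
  refine le_add_of_nonneg_right (integral_nonneg fun z => ?_)
  have h := half_sum_norm_sub_sq fun j k => wderBar n j (β k) z
  rw [← add_mul, h]
  rw [add_sub_cancel]
  positivity

/-- The squared Euclidean norm on `ℂⁿ`. -/
noncomputable def nsq (z : ℂ^n) := ∑ j, ‖z j‖ ^ 2

lemma contDiff_nsq : ContDiff ℝ ∞ (nsq : ℂ^n → ℝ) := by
  refine ContDiff.sum fun j _ => ?_
  exact (contDiff_norm_sq ℝ).comp (contDiff_apply ℝ ℂ j)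

lemma nsq_nonneg (z : ℂ^n) : 0 ≤ nsq z := by unfold nsq; positivity

lemma norm_sq_le_nsq (z : ℂ^n) : ‖z‖ ^ 2 ≤ nsq z := by
  have h : ‖z‖ ≤ Real.sqrt (nsq z) := by
    refine (pi_norm_le_iff_of_nonneg (sqrt_nonneg _)).2 fun j => ?_
    refine Real.le_sqrt_of_sq_le ?_
    exact Finset.single_le_sum (f := fun j => ‖z j‖ ^ 2) (fun _ _ => by positivity)
      (Finset.mem_univ j)
  calc ‖z‖ ^ 2 ≤ Real.sqrt (nsq z) ^ 2 := by gcongr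
    _ = nsq z := sq_sqrt (nsq_nonneg z)

lemma nsq_le_norm_sq (z : ℂ^n) : nsq z ≤ n * ‖z‖ ^ 2 := by
  calc ∑ j, ‖z j‖ ^ 2 ≤ ∑ _j : Fin n, ‖z‖ ^ 2 := by
        gcongr with j; exact norm_le_pi_norm z j
    _ = n * ‖z‖ ^ 2 := by simp

lemma nsq_smul (c : ℂ) (z : ℂ^n) : nsq (c • z) = ‖c‖ ^ 2 * nsq z := by
  simp [nsq, mul_pow, mul_sum]

/-- A circle-invariant smooth mollifier supported in the closed ball of radius `ε`. -/
structure IsMollifier (n) (ε) (k : ℂ^n → ℝ) where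
  contDiff : ContDiff ℝ ∞ k
  nonneg : ∀ y, 0 ≤ k y
  eq_zero : ∀ y, ε < ‖y‖ → k y = 0
  integral_eq : ∫ y, k y = 1
  rot : ∀ (c : ℂ) y, ‖c‖ = 1 → k (c • y) = k y

lemma exists_isMollifier (n) (hε : 0 < ε) : ∃ k, IsMollifier n ε k := by
  set g : ℂ^n → ℝ := fun y => smoothTransition (ε ^ 2 - nsq y) with hg
  have hgs : ContDiff ℝ ∞ g := smoothTransition.contDiff.comp (contDiff_const.sub contDiff_nsq)
  have hg0 : ∀ y, 0 ≤ g y := fun y => smoothTransition.nonneg _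
  have hgz : ∀ y, ε < ‖y‖ → g y = 0 := fun y hy => by
    refine smoothTransition.zero_of_nonpos ?_
    have := norm_sq_le_nsq y
    nlinarith
  have hgc : HasCompactSupport g :=
    of_support_subset_isCompact (isCompact_closedBall 0 ε) fun y hy => by
      by_contra h
      exact hy (hgz y (by simpa using h))
  have hpos : 0 < ∫ y, g y := by
    refine Continuous.integral_pos_of_hasCompactSupport_nonneg_nonzero (x := 0)
      hgs.continuous hgc hg0 ?_
    exact (smoothTransition.pos_of_pos (by simp [nsq, hε])).ne'
  refine ⟨fun y => (∫ y, g y)⁻¹ * g y, contDiff_const.mul hgs,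
    fun y => mul_nonneg (by positivity) (hg0 y), fun y hy => by simp [hgz y hy], ?_, ?_⟩
  · rw [integral_const_mul]; exact inv_mul_cancel₀ hpos.ne'
  · intro c y hc
    simp [hg, nsq_smul, hc]

namespace IsMollifier

lemma hasCompactSupport (hk : IsMollifier n ε k) : HasCompactSupport k :=
  of_support_subset_isCompact (isCompact_closedBall 0 ε) fun y hy => by
    by_contra h
    exact hy (hk.eq_zero y (by simpa using h))

lemma integrable (hk : IsMollifier n ε k) : Integrable k :=
  hk.contDiff.continuous.integrable_of_hasCompactSupport hk.hasCompactSupport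

lemma contDiff_ofReal (hk : IsMollifier n ε k) : ContDiff ℝ ∞ (fun y => (k y : ℂ)) :=
  contDiff_ofReal_comp hk.contDiff

lemma hasCompactSupport_ofReal (hk : IsMollifier n ε k) : HasCompactSupport (fun y => (k y : ℂ)) :=
  hk.hasCompactSupport.comp_left (g := fun x : ℝ => (x : ℂ)) (by simp)

lemma lintegral_eq (hk : IsMollifier n ε k) : ∫⁻ y, ENNReal.ofReal (k y) = 1 := by
  rw [← ofReal_integral_eq_lintegral_ofReal hk.integrable (Eventually.of_forall hk.nonneg),
    hk.integral_eq]
  simp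

end IsMollifier

/-- Convolution of `f` with the kernel `g`. -/
noncomputable def mol (f g : ℂ^n → ℂ) (z) := ∫ t, f t * g (z - t)

lemma mol_eq_convolution (f g : ℂ^n → ℂ) :
    mol f g = convolution f g (ContinuousLinearMap.mul ℝ ℂ) volume := rfl

lemma contDiff_mol (hf : LocallyIntegrable f) (hg : ContDiff ℝ ∞ g)
    (hc : HasCompactSupport g) : ContDiff ℝ ∞ (mol f g) := by
  rw [mol_eq_convolution]
  exact hc.contDiff_convolution_right _ hf hg

lemma integrable_mul_comp_sub (hf : LocallyIntegrable f)
    (hg : Continuous g) (hc : HasCompactSupport g) (z) :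
    Integrable fun t => f t * g (z - t) := by
  have h : HasCompactSupport fun t => g (z - t) :=
    hc.comp_homeomorph (subLeft z)
  simpa [mul_comm] using hf.integrable_smul_left_of_hasCompactSupport
    (by fun_prop) h

lemma fderiv_mol_apply (hf : LocallyIntegrable f) (hg : ContDiff ℝ ∞ g)
    (hc : HasCompactSupport g) (z X) :
    fderiv ℝ (mol f g) z X = mol f (fun y => fderiv ℝ g y X) z := by
  have h := hc.hasFDerivAt_convolution_right (ContinuousLinearMap.mul ℝ ℂ) hf
    (hg.of_le (by simp)) z
  rw [mol_eq_convolution, h.fderiv, convolution]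
  have hI : Integrable (fun t => ((ContinuousLinearMap.mul ℝ ℂ).precompR ℂ^n) (f t)
      (fderiv ℝ g (z - t))) :=
    (hc.fderiv ℝ).convolutionExists_right _ hf (hg.continuous_fderiv (by simp)) z
  rw [integral_apply hI]
  rfl

lemma wder_mol (hf : LocallyIntegrable f) (hg : ContDiff ℝ ∞ g)
    (hc : HasCompactSupport g) (j) (z) :
    wder n j (mol f g) z = mol f (wder n j g) z := by
  have hI := fun X =>
    integrable_mul_comp_sub hf (contDiff_fderiv_apply_const hg X).continuous
      (hc.fderiv_apply ℝ X) z
  rw [wder_def, fderiv_mol_apply hf hg hc, fderiv_mol_apply hf hg hc, mol, mol, ← integral_const_mul, ← integral_sub (hI _) ((hI _).const_mul _), ← integral_const_mul]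
  congr 1; ext t; rw [wder_def]; ring

lemma wderBar_mol (hf : LocallyIntegrable f) (hg : ContDiff ℝ ∞ g)
    (hc : HasCompactSupport g) (j) (z) :
    wderBar n j (mol f g) z = mol f (wderBar n j g) z := by
  have hI := fun X =>
    integrable_mul_comp_sub hf (contDiff_fderiv_apply_const hg X).continuous
      (hc.fderiv_apply ℝ X) z
  rw [wderBar_def, fderiv_mol_apply hf hg hc, fderiv_mol_apply hf hg hc, mol, mol, ← integral_const_mul, ← integral_add (hI _) ((hI _).const_mul _), ← integral_const_mul]
  congr 1; ext t; rw [wderBar_def]; ring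

lemma fderiv_comp_sub_left (hg : Differentiable ℝ g) (z t X) :
    fderiv ℝ (fun t => g (z - t)) t X = - fderiv ℝ g (z - t) X := by
  have h := (hg (z - t)).hasFDerivAt.comp t ((hasFDerivAt_id t).const_sub z)
  have h2 := h.fderiv
  simp [comp_def] at h2
  rw [h2]; simp

lemma wder_comp_sub_left (hg : Differentiable ℝ g) (j) (z t) :
    wder n j (fun t => g (z - t)) t = - wder n j g (z - t) := by
  simp [wder_def, fderiv_comp_sub_left hg]; ring

lemma wderBar_comp_sub_left (hg : Differentiable ℝ g) (j) (z t) :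
    wderBar n j (fun t => g (z - t)) t = - wderBar n j g (z - t) := by
  simp [wderBar_def, fderiv_comp_sub_left hg]; ring

lemma mol_sub_eq (hk : IsMollifier n ε k) (hf : LocallyIntegrable f) (z) :
    mol f (fun y => k y) z - f z = ∫ y, (f (z - y) - f z) * k y := by
  have h1 := by
    have := (integrable_mul_comp_sub hf hk.contDiff_ofReal.continuous
      hk.hasCompactSupport_ofReal z).comp_sub_left z
    simpa using this
  have h2 : ∫ y, f (z - y) * k y = mol f (fun y => k y) z := by
    have := integral_sub_left_eq_self (fun t => f t * k (z - t)) volume z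
    simpa [mol] using this
  have h3 : Integrable fun y => f z * k y := hk.integrable.ofReal.const_mul _
  simp [sub_mul]
  rw [integral_sub h1 h3, h2, integral_const_mul,
    integral_complex_ofReal, hk.integral_eq]
  simp

lemma enorm_mol_sub_sq_le
    (hk : IsMollifier n ε k) (hf : LocallyIntegrable f) (hm : Measurable f) (z) :
    ‖mol f (fun y => k y) z - f z‖ₑ ^ 2
      ≤ ∫⁻ y, ‖f (z - y) - f z‖ₑ ^ 2 * ENNReal.ofReal (k y) := by
  rw [mol_sub_eq hk hf]
  have hkm :=
    hk.contDiff.continuous.measurable.ennreal_ofReal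
  have hF : Measurable fun y => ‖f (z - y) - f z‖ₑ :=
    ((hm.comp (measurable_const.sub measurable_id)).sub measurable_const).enorm
  have h1 : ‖∫ y, (f (z - y) - f z) * k y‖ₑ
      ≤ ∫⁻ y, ‖f (z - y) - f z‖ₑ * ENNReal.ofReal (k y) := by
    refine (enorm_integral_le_lintegral_enorm _).trans (le_of_eq ?_)
    congr 1; ext y
    congr 1
    rw [← ofReal_norm]; simp [abs_of_nonneg (hk.nonneg y)]
  have h2 : ∫⁻ y, ‖f (z - y) - f z‖ₑ * ENNReal.ofReal (k y)
      ≤ (∫⁻ y, ‖f (z - y) - f z‖ₑ ^ 2 * ENNReal.ofReal (k y)) ^ (1 / 2 : ℝ) := by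
    set ν := volume.withDensity fun y => ENNReal.ofReal (k y) with hν
    have hν1 : ν univ = 1 := by
      rw [withDensity_apply _ MeasurableSet.univ, Measure.restrict_univ, hk.lintegral_eq]
    have e1 : ∀ G, Measurable G →
        ∫⁻ y, G y * ENNReal.ofReal (k y) = ∫⁻ y, G y ∂ν := fun G hG => by
      rw [lintegral_withDensity_eq_lintegral_mul _ hkm hG]
      simp [mul_comm]
    rw [e1 _ hF, e1 _ (hF.pow_const 2)]
    have := ENNReal.lintegral_mul_le_Lp_mul_Lq ν (p := 2) (q := 2)
      (by constructor <;> norm_num) hF.aemeasurable (aemeasurable_const (b := 1))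
    simpa [hν1] using this
  calc ‖∫ y, (f (z - y) - f z) * k y‖ₑ ^ 2
      ≤ ((∫⁻ y, ‖f (z - y) - f z‖ₑ ^ 2 * ENNReal.ofReal (k y)) ^ (1 / 2 : ℝ)) ^ 2 := by
        gcongr; exact h1.trans h2
    _ = _ := by
        rw [← ENNReal.rpow_natCast, ← ENNReal.rpow_mul]; simp

lemma exists_translate_lintegral_le (hf : MemLp f 2) {η} (hη : 0 < η) :
    ∃ ε > 0, ∀ y, ‖y‖ ≤ ε → ∫⁻ z, ‖f (z - y) - f z‖ₑ ^ 2 ≤ η := by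
  set F := hf.toLp f with hF
  set g : ℂ^n → C(ℂ^n, ℂ^n) := fun y => ⟨fun z => z - y, by fun_prop⟩ with hg
  have hgm : ∀ y, MeasurePreserving (g y) volume volume := fun y =>
    measurePreserving_sub_right volume y
  have hgc : Continuous g :=
    ContinuousMap.continuous_of_continuous_uncurry _
      (by simp [hg, ContinuousMap.coe_mk]; fun_prop)
  have hcont := by
    have h1 : Continuous fun y =>
        ‖Lp.compMeasurePreserving (g y) (hgm y) F - F‖ₑ :=
      ((continuous_const.compMeasurePreservingLp hgc hgm (by simp)).sub continuous_const).enorm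
    have h2 := h1.tendsto 0
    have h3 : Lp.compMeasurePreserving (g 0) (hgm 0) F = F := by
      rw [Lp.toLp_compMeasurePreserving]
      congr 1; ext z; simp [hg]
    simpa [h3, sub_self, enorm_zero] using h2
  have hη' : 0 < η ^ (1 / 2 : ℝ) := by
    rcases eq_or_ne η ⊤ with h | h
    · simp [h]
    · exact ENNReal.rpow_pos hη h
  obtain ⟨ε, hε, H⟩ := nhds_basis_closedBall.eventually_iff.1
    (hcont.eventually (gt_mem_nhds hη'))
  refine ⟨ε, hε, fun y hy => ?_⟩
  have h := (H (by simpa using hy)).le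
  rw [Lp.toLp_compMeasurePreserving, ← MemLp.toLp_sub, Lp.enorm_toLp,
    eLpNorm_eq_lintegral_rpow_enorm_toReal (by simp) (by simp)] at h
  have h3 := ENNReal.rpow_le_rpow h (z := 2) (by norm_num)
  rw [← ENNReal.rpow_mul, ← ENNReal.rpow_mul] at h3
  simpa [hg] using h3

lemma exists_mol_lintegral_le (hf : MemLp f 2) (hm : Measurable f) {η} (hη : 0 < η) :
    ∃ ε₀ > 0, ∀ (ε) (k), ε ≤ ε₀ → IsMollifier n ε k →
      ∫⁻ z, ‖mol f (fun y => k y) z - f z‖ₑ ^ 2 ≤ η := by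
  obtain ⟨ε₀, hε₀, H⟩ := exists_translate_lintegral_le hf hη
  refine ⟨ε₀, hε₀, fun ε k hε hk => ?_⟩
  have hloc := hf.locallyIntegrable (by norm_num)
  calc ∫⁻ z, ‖mol f (fun y => k y) z - f z‖ₑ ^ 2
      ≤ ∫⁻ z, ∫⁻ y, ‖f (z - y) - f z‖ₑ ^ 2 * ENNReal.ofReal (k y) :=
        lintegral_mono fun z => enorm_mol_sub_sq_le hk hloc hm z
    _ = ∫⁻ y, ∫⁻ z, ‖f (z - y) - f z‖ₑ ^ 2 * ENNReal.ofReal (k y) := by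
        refine lintegral_lintegral_swap (Measurable.aemeasurable ?_)
        have hkm : Measurable fun p : ℂ^n × ℂ^n => ENNReal.ofReal (k p.2) :=
          (hk.contDiff.continuous.measurable.comp measurable_snd).ennreal_ofReal
        exact ((((hm.comp (measurable_fst.sub measurable_snd)).sub
          (hm.comp measurable_fst)).enorm).pow_const 2).mul hkm
    _ ≤ ∫⁻ y, η * ENNReal.ofReal (k y) := by
        refine lintegral_mono fun y => ?_
        have hF : Measurable fun z => ‖f (z - y) - f z‖ₑ ^ 2 :=
          (((hm.comp (measurable_id.sub measurable_const)).sub hm).enorm).pow_const 2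
        rw [lintegral_mul_const _ hF]
        rcases lt_or_ge ε₀ ‖y‖ with h | h
        · simp [hk.eq_zero y (hε.trans_lt h)]
        · gcongr; exact H y h
    _ = η := by
        rw [lintegral_const_mul _ hk.contDiff.continuous.measurable.ennreal_ofReal,
          hk.lintegral_eq, mul_one]

lemma sum_single_mul (X) (L : ℂ^n →L[ℝ] ℂ) :
    L X = ∑ j, ((X j).re * L (single j 1) + (X j).im * L (single j I)) := by
  have h : X = ∑ j, ((X j).re • (single j 1 : ℂ^n) + (X j).im • (single j I : ℂ^n)) := by
    ext i
    simp [Pi.single_apply, sum_add_distrib]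
  conv_lhs => rw [h]
  simp

lemma sum_mul_sub_I_mul (X) (L : ℂ^n →L[ℝ] ℂ) :
    ∑ j, X j * (L (single j 1) - I * L (single j I)) = L X - I * L (I • X) := by
  rw [sum_single_mul X L, sum_single_mul (I • X) L, mul_sum, ← sum_sub_distrib]
  refine sum_congr rfl fun j _ => ?_
  have h := (re_add_im (X j)).symm
  simp
  linear_combination (L (single j 1) - I * L (single j I)) * h
    - ((X j).im * L (single j I)) * I_mul_I

lemma sum_conj_mul_add_I_mul (X) (L : ℂ^n →L[ℝ] ℂ) :
    ∑ j, conj (X j) * (L (single j 1) + I * L (single j I)) = L X + I * L (I • X) := by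
  rw [sum_single_mul X L, sum_single_mul (I • X) L, mul_sum, ← sum_add_distrib]
  refine sum_congr rfl fun j _ => ?_
  have h : conj (X j) = (X j).re - (X j).im * I := by
    apply Complex.ext <;> simp
  simp
  linear_combination (L (single j 1) + I * L (single j I)) * h
    - ((X j).im * L (single j I)) * I_mul_I

lemma fderiv_fderiv_ofReal_apply (hφ : ContDiffAt ℝ 2 φ z) (X Y) :
    fderiv ℝ (fderiv ℝ (fun y => (φ y : ℂ))) z X Y = fderiv ℝ (fderiv ℝ φ) z X Y := by
  have h0 : ContDiffAt ℝ 2 (fun y => (φ y : ℂ)) z := ofRealCLM.contDiff.contDiffAt.comp z hφ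
  rw [← fderiv_fderiv_const_apply h0, ← fderiv_fderiv_const_apply hφ]
  have hev : (fun y => fderiv ℝ (fun y => (φ y : ℂ)) y Y) =ᶠ[𝓝 z]
      fun y => (fderiv ℝ φ y Y : ℂ) := by
    filter_upwards [hφ.eventually (by simp)] with y hy
    exact fderiv_ofReal_apply (hy.differentiableAt (by simp)) Y
  rw [hev.fderiv_eq, fderiv_ofReal_apply]
  exact ((hφ.fderiv_right (m := 1) (by norm_num)).differentiableAt (by simp)).clm_apply
    (differentiableAt_const _)

/-- The second derivative of `φ`, as a bilinear form. -/
noncomputable def D2 (φ : ℂ^n → ℝ) (z X Y) :=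
  fderiv ℝ (fderiv ℝ φ) z X Y

/-- The polarised Levi form of `φ`. -/
noncomputable def lvp (φ : ℂ^n → ℝ) (z X Y) :=
  (D2 φ z X Y + D2 φ z (I • X) (I • Y)) / 4

/-- The Levi form of `φ`. -/
noncomputable def lv (φ : ℂ^n → ℝ) (z X) := lvp φ z X X

/-- The complex gradient `∂φ(X)`. -/
noncomputable def dz (φ : ℂ^n → ℝ) (z X) :=
  (fderiv ℝ φ z X - I * fderiv ℝ φ z (I • X)) / 2

/-- The square `|∂φ(X)|²`. -/
noncomputable def pg (φ : ℂ^n → ℝ) (z X) :=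
  ((fderiv ℝ φ z X) ^ 2 + (fderiv ℝ φ z (I • X)) ^ 2) / 4

lemma norm_dz_sq (φ : ℂ^n → ℝ) (z X) : ‖dz φ z X‖ ^ 2 = pg φ z X := by
  rw [← normSq_eq_norm_sq, dz, pg, normSq_apply]
  simp
  ring

lemma pg_nonneg (φ : ℂ^n → ℝ) (z X) : 0 ≤ pg φ z X := by
  unfold pg; positivity

lemma sum_wder_mul (hφ : DifferentiableAt ℝ φ z)
    (X) : ∑ j, wder n j (fun y => φ y) z * X j = dz φ z X := by
  have := sum_mul_sub_I_mul X (fderiv ℝ (fun y => φ y) z)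
  rw [fderiv_ofReal_apply hφ, fderiv_ofReal_apply hφ] at this
  rw [dz, ← this, Finset.sum_div]
  refine sum_congr rfl fun j _ => ?_
  rw [wder_def]; ring

lemma cTangentMap_apply (hφ : DifferentiableAt ℝ φ z)
    (X) : cTangentMap n φ z X = dz φ z X := by
  rw [← sum_wder_mul hφ]
  simp [cTangentMap, dzCoef]

lemma sum_cHess_mul (hφ : ContDiffAt ℝ 2 φ z) (X Y) :
    ∑ j, ∑ k, cHess n φ z j k * X j * conj (Y k) = lvp φ z X Y + I * lvp φ z X (I • Y) := by
  have h0 : ContDiffAt ℝ 2 (fun y => (φ y : ℂ)) z := ofRealCLM.contDiff.contDiffAt.comp z hφ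
  set B := fderiv ℝ (fderiv ℝ (fun y => (φ y : ℂ))) z with hB
  have e1 := fun W => sum_mul_sub_I_mul X (B W)
  set L := B.flip X - I • B.flip (I • X) with hL
  have e2 := sum_conj_mul_add_I_mul Y L
  have e3 : ∀ j k, cHess n φ z j k = (1 / 4) * ((B (single k 1) (single j 1)
      - I * B (single k 1) (single j I)) + I * (B (single k I) (single j 1)
      - I * B (single k I) (single j I))) := fun j k => by
    unfold cHess
    rw [wderBar_def]
    erw [fderiv_wder h0, fderiv_wder h0]
    ring
  have e4 : ∑ j, ∑ k, cHess n φ z j k * X j * conj (Y k)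
      = (1 / 4) * ∑ k, conj (Y k) * (L (single k 1) + I * L (single k I)) := by
    rw [sum_comm, mul_sum]
    refine sum_congr rfl fun k _ => ?_
    have h1 : ∀ W, L W = ∑ j, X j * (B W (single j 1) - I * B W (single j I)) := fun W => by
      rw [e1, hL]; simp
    rw [h1, h1, mul_sum, ← sum_add_distrib, mul_sum, mul_sum]
    refine sum_congr rfl fun j _ => ?_
    rw [e3]; ring
  have hr : ∀ U W, B U W = D2 φ z U W := fun U W => fderiv_fderiv_ofReal_apply hφ U W
  have hs : ∀ U W, D2 φ z U W = D2 φ z W U := fun U W => fderiv_fderiv_apply_comm hφ U W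
  have hn : ∀ U, D2 φ z U (I • I • Y) = - D2 φ z U Y := fun U => by
    simp [D2, smul_smul]
  rw [e4, e2, hL]
  simp [sub_apply, smul_apply,
    flip_apply, hr, lvp, hn]
  rw [hs Y X, hs Y (I • X), hs (I • Y) X, hs (I • Y) (I • X)]
  push_cast
  linear_combination (-D2 φ z (I • X) (I • Y) / 4) * I_mul_I

lemma hermForm_cHess (hφ : ContDiffAt ℝ 2 φ z)
    (X Y) : hermForm n (cHess n φ z) X Y = lvp φ z X Y := by
  rw [hermForm, sum_cHess_mul hφ]; simp

lemma leviPairMap_apply (hφ : ContDiffAt ℝ 2 φ z)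
    (X Y) : leviPairMap n φ z Y X = lvp φ z X Y + I * lvp φ z X (I • Y) := by
  rw [← sum_cHess_mul hφ]
  simp [leviPairMap, sum_mul]
  refine sum_congr rfl fun j _ => sum_congr rfl fun k _ => by ring

lemma D2_congr (h : φ =ᶠ[𝓝 z] ψ) (X Y) : D2 φ z X Y = D2 ψ z X Y := by
  have h2 : fderiv ℝ φ =ᶠ[𝓝 z] fderiv ℝ ψ := by
    filter_upwards [h.eventuallyEq_nhds] with y hy using hy.fderiv_eq
  rw [D2, D2, h2.fderiv_eq]

lemma lv_congr (h : φ =ᶠ[𝓝 z] ψ) (X) : lv φ z X = lv ψ z X := by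
  simp [lv, lvp, D2_congr h]

lemma pg_congr (h : φ =ᶠ[𝓝 z] ψ) (X) : pg φ z X = pg ψ z X := by
  simp [pg, h.fderiv_eq]

lemma D2_add (hφ : ContDiffAt ℝ 2 φ z) (hψ : ContDiffAt ℝ 2 ψ z) (X Y) :
    D2 (fun y => φ y + ψ y) z X Y = D2 φ z X Y + D2 ψ z X Y := by
  have h : fderiv ℝ (fun y => φ y + ψ y) =ᶠ[𝓝 z] fun y => fderiv ℝ φ y + fderiv ℝ ψ y := by
    filter_upwards [hφ.eventually (by simp), hψ.eventually (by simp)] with y h1 h2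
    exact fderiv_fun_add (h1.differentiableAt (by simp)) (h2.differentiableAt (by simp))
  rw [D2, h.fderiv_eq, fderiv_fun_add]
  · rfl
  · exact (hφ.fderiv_right (m := 1) (by norm_num)).differentiableAt (by simp)
  · exact (hψ.fderiv_right (m := 1) (by norm_num)).differentiableAt (by simp)

lemma lv_add (hφ : ContDiffAt ℝ 2 φ z) (hψ : ContDiffAt ℝ 2 ψ z) (X) :
    lv (fun y => φ y + ψ y) z X = lv φ z X + lv ψ z X := by
  simp [lv, lvp, D2_add hφ hψ]; ring

lemma fderiv_comp_real {χ} (hφ : DifferentiableAt ℝ φ z) (hχ : DifferentiableAt ℝ χ (φ z)) :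
    fderiv ℝ (fun y => χ (φ y)) z = deriv χ (φ z) • fderiv ℝ φ z :=
  (hχ.hasDerivAt.comp_hasFDerivAt z hφ.hasFDerivAt).fderiv

lemma D2_comp {χ} (hφ : ContDiffAt ℝ 2 φ z) (hχ : ContDiffAt ℝ 2 χ (φ z)) (X Y) :
    D2 (fun y => χ (φ y)) z X Y = deriv χ (φ z) * D2 φ z X Y
      + deriv (deriv χ) (φ z) * (fderiv ℝ φ z X * fderiv ℝ φ z Y) := by
  have h : fderiv ℝ (fun y => χ (φ y)) =ᶠ[𝓝 z] fun y => deriv χ (φ y) • fderiv ℝ φ y := by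
    filter_upwards [hφ.eventually (by simp),
      hφ.continuousAt.eventually (hχ.eventually (by simp))] with y h1 h2
    exact fderiv_comp_real (h1.differentiableAt (by simp)) (h2.differentiableAt (by simp))
  have h1 :=
    (hφ.fderiv_right (m := 1) (by norm_num)).differentiableAt (by simp)
  have h3 : DifferentiableAt ℝ (deriv χ) (φ z) := by
    have := ((hχ.fderiv_right (m := 1) (by norm_num)).differentiableAt (by simp))
    exact this.clm_apply (differentiableAt_const 1)
  have h2 : DifferentiableAt ℝ (fun y => deriv χ (φ y)) z :=
    h3.comp z (hφ.differentiableAt (by simp))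
  rw [D2, h.fderiv_eq, fderiv_fun_smul h2 h1, fderiv_comp_real (hφ.differentiableAt (by simp)) h3]
  simp [D2]
  ring

lemma lv_comp {χ} (hφ : ContDiffAt ℝ 2 φ z) (hχ : ContDiffAt ℝ 2 χ (φ z)) (X) :
    lv (fun y => χ (φ y)) z X = deriv χ (φ z) * lv φ z X + deriv (deriv χ) (φ z) * pg φ z X := by
  simp [lv, lvp, D2_comp hφ hχ, pg]; ring

lemma pg_comp {χ} (hφ : DifferentiableAt ℝ φ z)
    (hχ : DifferentiableAt ℝ χ (φ z)) (X) :
    pg (fun y => χ (φ y)) z X = (deriv χ (φ z)) ^ 2 * pg φ z X := by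
  simp only [pg, fderiv_comp_real hφ hχ]; simp; ring

section Absorb

lemma hasCompactSupport_of_forall {F} [Zero F]
    (hc : ∀ j, HasCompactSupport (β j)) {f : ℂ^n → F}
    (h : ∀ z, (∀ j, z ∉ tsupport (β j)) → f z = 0) : HasCompactSupport f := by
  have hK := isCompact_iUnion hc
  refine of_support_subset_isCompact hK fun z hz => ?_
  by_contra h2
  exact hz (h z (by simpa using h2))

lemma contDiff_cHess (hφ : ContDiff ℝ ∞ φ) (j k) :
    ContDiff ℝ ∞ (fun z => cHess n φ z j k) :=
  ((contDiff_ofReal_comp hφ).wder j).wderBar k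

lemma ContDiff.contDiffAt_two {F} [NormedAddCommGroup F] [NormedSpace ℝ F]
    {f : ℂ^n → F} (hf : ContDiff ℝ ∞ f) (z) : ContDiffAt ℝ 2 f z :=
  (hf.of_le two_le_infty).contDiffAt

lemma continuous_lv (hφ : ContDiff ℝ ∞ φ)
    (hβ : ∀ j, Continuous (β j)) : Continuous fun z => lv φ z (fun j => β j z) := by
  have : (fun z => lv φ z (fun j => β j z))
      = fun z => hermForm n (cHess n φ z) (fun j => β j z) (fun j => β j z) := by
    ext z; rw [hermForm_cHess (hφ.contDiffAt_two z), lv]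
  rw [this]
  unfold hermForm
  have h := fun j k => (contDiff_cHess hφ j k).continuous
  fun_prop

lemma continuous_dz (hφ : ContDiff ℝ ∞ φ)
    (hβ : ∀ j, Continuous (β j)) : Continuous fun z => dz φ z (fun j => β j z) := by
  have h := hφ.continuous_fderiv (by simp)
  unfold dz
  fun_prop

lemma lv_zero (φ : ℂ^n → ℝ) (z) : lv φ z 0 = 0 := by
  simp [lv, lvp, D2]

lemma dz_zero (φ : ℂ^n → ℝ) (z) : dz φ z 0 = 0 := by
  simp [dz]

lemma wderW_half_sq (hφ : ContDiff ℝ ∞ φ) (hψ : ContDiff ℝ ∞ ψ)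
    (j) (f) (z) : wderW n φ j f z = wderW n (fun z => φ z - ψ z) j f z
      - wder n j (fun y => ψ y) z * f z := by
  have h1 := (contDiff_ofReal_comp hφ).differentiable (by simp) z
  have h2 := (contDiff_ofReal_comp hψ).differentiable (by simp) z
  unfold wderW
  have : (fun y => ((φ y - ψ y : ℝ) : ℂ)) = fun y => (φ y : ℂ) - ψ y := by
    push_cast; rfl
  rw [this, wder_sub h1 h2]; ring

lemma lv_half_sq (hψ : ContDiffAt ℝ 2 ψ z)
    (X) : lv (fun y => ψ y ^ 2 / 2) z X = ψ z * lv ψ z X + pg ψ z X := by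
  have h := lv_comp (χ := fun t => t ^ 2 / 2) hψ (by fun_prop) X
  have d1 : deriv (fun t : ℝ => t ^ 2 / 2) = fun t => t := by
    ext t; simp
  rw [h, d1]; simp

/-- The Kohn–Morrey–Hörmander inequality with part of the weight absorbed. -/
theorem absorbed_estimate (hφ : ContDiff ℝ ∞ φ) (hψ : ContDiff ℝ ∞ ψ)
    (hK : ∀ z ∈ K, ∀ X, pg ψ z X ≤ ψ z * lv ψ z X) (hβ : ∀ j, ContDiff ℝ ∞ (β j))
    (hc : ∀ j, HasCompactSupport (β j)) (h0 : ∀ j, ∀ z ∉ K, β j z = 0) :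
    ∫ z, lv φ z (fun j => β j z) * rexp (-(φ z + ψ z ^ 2 / 2))
      ≤ (2 * ∫ z, ‖∑ j, wderW n (fun z => φ z + ψ z ^ 2 / 2 - ψ z) j (β j) z‖ ^ 2
          * rexp (-(φ z + ψ z ^ 2 / 2)))
        + ∫ z, (1 / 2 * ∑ j, ∑ k, ‖wderBar n j (β k) z - wderBar n k (β j) z‖ ^ 2)
          * rexp (-(φ z + ψ z ^ 2 / 2)) := by
  set φ3 := fun z => φ z + ψ z ^ 2 / 2 with hφ3
  have h3 : ContDiff ℝ ∞ φ3 := hφ.add ((hψ.pow 2).div_const 2)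
  have hβc := fun j => (hβ j).continuous
  have hw := Real.continuous_exp.comp h3.continuous.neg
  set φ2 := fun z => φ3 z - ψ z with hφ2
  have h2 := h3.sub hψ
  set A := fun z => ∑ j, wderW n φ2 j (β j) z with hA
  set Z := fun z => dz ψ z (fun j => β j z) with hZ
  have hz0 : ∀ z, (∀ j, z ∉ tsupport (β j)) → (fun j => β j z) = 0 := fun z h => by
    ext j; exact image_eq_zero_of_notMem_tsupport (h j)
  have hAc : Continuous A := by
    have := fun j => (((hβ j).wderW h2 j)).continuous
    fun_prop
  have hA0 : ∀ z, (∀ j, z ∉ tsupport (β j)) → A z = 0 := fun z h => by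
    refine sum_eq_zero fun j _ => ?_
    rw [wderW, wder_eq_zero_of_notMem (h j), image_eq_zero_of_notMem_tsupport (h j)]; simp
  have hZc := continuous_dz hψ hβc
  have hZ0 : ∀ z, (∀ j, z ∉ tsupport (β j)) → Z z = 0 := fun z h => by
    simp [hZ, hz0 z h, dz_zero]
  have I1 : Integrable fun z => lv φ z (fun j => β j z) * rexp (-φ3 z) :=
    integrable_of_hasCompactSupport ((continuous_lv hφ hβc).mul hw)
      (hasCompactSupport_of_forall hc fun z h => by simp [hz0 z h, lv_zero])
  have I2 : Integrable fun z => ‖Z z‖ ^ 2 * rexp (-φ3 z) :=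
    integrable_of_hasCompactSupport ((hZc.norm.pow 2).mul hw)
      (hasCompactSupport_of_forall hc fun z h => by simp [hZ0 z h])
  have I3 : Integrable fun z => lv φ3 z (fun j => β j z) * rexp (-φ3 z) :=
    integrable_of_hasCompactSupport ((continuous_lv h3 hβc).mul hw)
      (hasCompactSupport_of_forall hc fun z h => by simp [hz0 z h, lv_zero])
  have I4 : Integrable fun z => ‖A z‖ ^ 2 * rexp (-φ3 z) :=
    integrable_of_hasCompactSupport ((hAc.norm.pow 2).mul hw)
      (hasCompactSupport_of_forall hc fun z h => by simp [hA0 z h])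
  have I5 : Integrable fun z => ‖A z - Z z‖ ^ 2 * rexp (-φ3 z) :=
    integrable_of_hasCompactSupport (((hAc.sub hZc).norm.pow 2).mul hw)
      (hasCompactSupport_of_forall hc fun z h => by simp [hA0 z h, hZ0 z h])
  have key := kohn_morrey_hormander h3 hβ hc
  simp [hermForm_cHess (h3.contDiffAt_two _)] at key
  have e1 : ∀ z, ∑ j, wderW n φ3 j (β j) z = A z - Z z := fun z => by
    simp [hZ]
    rw [← sum_wder_mul (hψ.differentiable (by simp) z), ← sum_sub_distrib]
    exact sum_congr rfl fun j _ => wderW_half_sq h3 hψ j (β j) z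
  simp [e1] at key
  have c1 : (∫ z, lv φ z (fun j => β j z) * rexp (-φ3 z))
      + 2 * (∫ z, ‖Z z‖ ^ 2 * rexp (-φ3 z))
      ≤ ∫ z, lv φ3 z (fun j => β j z) * rexp (-φ3 z) := by
    rw [← integral_const_mul, ← integral_add I1 (I2.const_mul 2)]
    refine integral_mono (I1.add (I2.const_mul 2)) I3 fun z => ?_
    have : lv φ z (fun j => β j z) + 2 * ‖Z z‖ ^ 2 ≤ lv φ3 z (fun j => β j z) := by
      rw [lv_add (hφ.contDiffAt_two z) (((hψ.pow 2).div_const 2).contDiffAt_two z),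
        lv_half_sq (hψ.contDiffAt_two z)]
      simp [hZ, norm_dz_sq]
      by_cases hz : z ∈ K
      · linarith [hK z hz (fun j => β j z)]
      · have : (fun j => β j z) = 0 := by ext j; exact h0 j z hz
        simp [this, lv_zero, pg]
    calc _ = (lv φ z (fun j => β j z) + 2 * ‖Z z‖ ^ 2) * rexp (-φ3 z) := by ring
      _ ≤ _ := by gcongr
  have c2 : ∫ z, ‖A z - Z z‖ ^ 2 * rexp (-φ3 z)
      ≤ 2 * (∫ z, ‖A z‖ ^ 2 * rexp (-φ3 z)) + 2 * ∫ z, ‖Z z‖ ^ 2 * rexp (-φ3 z) := by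
    rw [← integral_const_mul, ← integral_const_mul,
      ← integral_add (I4.const_mul 2) (I2.const_mul 2)]
    refine integral_mono I5 ((I4.const_mul 2).add (I2.const_mul 2)) fun z => ?_
    have : ‖A z - Z z‖ ^ 2 ≤ 2 * ‖A z‖ ^ 2 + 2 * ‖Z z‖ ^ 2 := by
      have h := norm_sub_le (A z) (Z z)
      nlinarith [norm_nonneg (A z - Z z), sq_nonneg (‖A z‖ - ‖Z z‖), norm_nonneg (A z)]
    calc _ ≤ (2 * ‖A z‖ ^ 2 + 2 * ‖Z z‖ ^ 2) * rexp (-φ3 z) := by gcongr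
      _ = _ := by ring
  have hlv : ∀ z, lvp φ3 z (fun j => β j z) (fun j => β j z) = lv φ3 z (fun j => β j z) :=
    fun z => rfl
  simp [hlv] at key
  linarith

end Absorb

section TendstoL2

/-- Convergence in `L²(ℂⁿ)` of a sequence of functions. -/
structure TendstoL2 (u : ℕ → ℂ^n → ℂ) (f : ℂ^n → ℂ) where
  memLp_seq : ∀ m, MemLp (u m) 2
  memLp : MemLp f 2
  tendsto : Tendsto (fun m => eLpNorm (u m - f) 2) atTop (𝓝 0)

namespace TendstoL2

variable {u v : ℕ → ℂ^n → ℂ}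

lemma toLp (h : TendstoL2 u f) :
    Tendsto (fun m => (h.memLp_seq m).toLp (u m)) atTop (𝓝 (h.memLp.toLp f)) :=
  (Lp.tendsto_Lp_iff_tendsto_eLpNorm'' u h.memLp_seq f h.memLp).2 h.tendsto

lemma of_toLp (h1 : ∀ m, MemLp (u m) 2) (h2 : MemLp f 2)
    (h : Tendsto (fun m => (h1 m).toLp (u m)) atTop (𝓝 (h2.toLp f))) : TendstoL2 u f :=
  ⟨h1, h2, (Lp.tendsto_Lp_iff_tendsto_eLpNorm'' u h1 f h2).1 h⟩

lemma const (h : MemLp f 2) : TendstoL2 (fun _ => f) f :=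
  of_toLp (fun _ => h) h tendsto_const_nhds

lemma sub (h : TendstoL2 u f) (h' : TendstoL2 v g) :
    TendstoL2 (fun m z => u m z - v m z) (fun z => f z - g z) :=
  of_toLp (fun m => (h.memLp_seq m).sub (h'.memLp_seq m)) (h.memLp.sub h'.memLp)
    (h.toLp.sub h'.toLp)

lemma add (h : TendstoL2 u f) (h' : TendstoL2 v g) :
    TendstoL2 (fun m z => u m z + v m z) (fun z => f z + g z) :=
  of_toLp (fun m => (h.memLp_seq m).add (h'.memLp_seq m)) (h.memLp.add h'.memLp)
    (h.toLp.add h'.toLp)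

lemma sum {ι} (s) {u : ι → ℕ → ℂ^n → ℂ} {f : ι → ℂ^n → ℂ}
    (h : ∀ i ∈ s, TendstoL2 (u i) (f i)) :
    TendstoL2 (fun m z => ∑ i ∈ s, u i m z) (fun z => ∑ i ∈ s, f i z) := by
  classical
  induction s using induction_on with
  | empty => simpa using const MemLp.zero'
  | insert a s ha ih =>
    simp [sum_insert ha]
    exact (h a (by simp)).add (ih fun i hi => h i (by simp [hi]))

lemma bmul (h : TendstoL2 u f) {b} (hb : Measurable b) {B}
    (hB : ∀ z, ‖b z‖ ≤ B) : TendstoL2 (fun m z => b z * u m z) (fun z => b z * f z) := by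
  have key : ∀ w, MemLp w 2 →
      eLpNorm (fun z => b z * w z) 2 ≤ ENNReal.ofReal B * eLpNorm w 2 := fun w _ =>
    eLpNorm_le_mul_eLpNorm_of_ae_le_mul (.of_forall fun z => by
      rw [norm_mul]; gcongr; exact hB z) 2
  have hmem : ∀ w, MemLp w 2 → MemLp (fun z => b z * w z) 2 := fun w hw =>
    ⟨hb.aestronglyMeasurable.mul hw.1, (key w hw).trans_lt (ENNReal.mul_lt_top (by simp) hw.2)⟩
  have h0 := by
    have := ENNReal.Tendsto.const_mul (a := ENNReal.ofReal B) h.tendsto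
      (inr ENNReal.ofReal_ne_top)
    rwa [mul_zero] at this
  have hle : ∀ m, eLpNorm ((fun z => b z * u m z) - fun z => b z * f z) 2
      ≤ ENNReal.ofReal B * eLpNorm (u m - f) 2 := fun m => by
    have e : ((fun z => b z * u m z) - fun z => b z * f z) = fun z => b z * (u m - f) z := by
      funext z; simp [Pi.sub_apply, mul_sub]
    rw [e]
    exact key _ ((h.memLp_seq m).sub h.memLp)
  exact ⟨fun m => hmem _ (h.memLp_seq m), hmem _ h.memLp,
    tendsto_of_tendsto_of_tendsto_of_le_of_le tendsto_const_nhds h0 (fun _ => bot_le) hle⟩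

lemma integral_mul_conj (h : TendstoL2 u f) (h' : TendstoL2 v g) :
    Tendsto (fun m => ∫ z, u m z * conj (v m z)) atTop (𝓝 (∫ z, f z * conj (g z))) := by
  have key : ∀ (p q : ℂ^n → ℂ) (hp : MemLp p 2) (hq : MemLp q 2),
      inner ℂ (hq.toLp q) (hp.toLp p) = ∫ z, p z * conj (q z) := fun p q hp hq => by
    refine integral_congr_ae ?_
    filter_upwards [hp.coeFn_toLp, hq.coeFn_toLp] with z h1 h2
    rw [h1, h2]; simp
  have := h'.toLp.inner (𝕜 := ℂ) h.toLp
  simpa [key] using this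

lemma integral_norm_sq (h : TendstoL2 u f) :
    Tendsto (fun m => ∫ z, ‖u m z‖ ^ 2) atTop (𝓝 (∫ z, ‖f z‖ ^ 2)) := by
  have h1 := (continuous_re.tendsto _).comp (h.integral_mul_conj h)
  have e : ∀ p : ℂ^n → ℂ, (∫ z, p z * conj (p z)).re = ∫ z, ‖p z‖ ^ 2 := fun p => by
    simp only [mul_conj, normSq_eq_norm_sq]
    rw [integral_complex_ofReal, ofReal_re]
  simpa [comp_def, e] using h1

end TendstoL2

lemma exists_mollifier_seq (n) (hδ : 0 < δ) : ∃ k : ℕ → ℂ^n → ℝ,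
    ∀ m : ℕ, IsMollifier n (δ / (m + 1)) (k m) := by
  choose k hk using fun m : ℕ => exists_isMollifier n (ε := δ / (m + 1)) (by positivity)
  exact ⟨k, hk⟩

lemma tendstoL2_mol {k : ℕ → ℂ^n → ℝ} (hk : ∀ m : ℕ, IsMollifier n (δ / (m + 1)) (k m))
    (hf : MemLp f 2) (hm : Measurable f) (hmem : ∀ m, MemLp (mol f fun y => k m y) 2) :
    TendstoL2 (fun m => mol f fun y => k m y) f := by
  refine ⟨hmem, hf, ?_⟩
  have h1 : Tendsto (fun m => ∫⁻ z, ‖mol f (fun y => k m y) z - f z‖ₑ ^ 2) atTop (𝓝 0) := by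
    refine ENNReal.tendsto_nhds_zero.2 fun η hη => ?_
    obtain ⟨ε₀, hε₀, H⟩ := exists_mol_lintegral_le hf hm hη
    have := by
      simpa [div_eq_mul_inv] using
        (tendsto_one_div_add_atTop_nhds_zero_nat).const_mul δ
    filter_upwards [this.eventually (gt_mem_nhds hε₀)] with m h
    exact H _ _ h.le (hk m)
  have h2 : ∀ m, eLpNorm ((mol f fun y => k m y) - f) 2
      = (∫⁻ z, ‖mol f (fun y => k m y) z - f z‖ₑ ^ 2) ^ (1 / 2 : ℝ) := fun m => by
    rw [eLpNorm_eq_lintegral_rpow_enorm_toReal (by simp) (by simp)]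
    simp
  simp [h2]
  have h3 := h1.ennrpow_const (1 / 2)
  simpa using h3

end TendstoL2

lemma sq_le_mul_of_forall_pos {x A B : ℝ} (hA : 0 ≤ A) (hB : 0 ≤ B) (hx : 0 ≤ x)
    (h : ∀ t, 0 < t → x ≤ (t * A + B / t) / 2) : x ^ 2 ≤ A * B := by
  have h2 : ∀ t, 0 ≤ A * (t * t) + (-2 * x) * t + B := fun t => by
    rcases le_or_gt t 0 with ht | ht
    · nlinarith
    · have := mul_le_mul_of_nonneg_left (h t ht) ht.le
      have e : t * ((t * A + B / t) / 2) = (A * (t * t) + B) / 2 := by field_simp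
      linarith
  have := discrim_le_zero h2
  rw [discrim] at this
  nlinarith

lemma norm_integral_sq_le {α} [MeasurableSpace α] {μ : Measure α} {F : α → ℂ}
    {a b} (ha : ∀ z, 0 ≤ a z) (hb : ∀ z, 0 ≤ b z) (hai : Integrable a μ)
    (hbi : Integrable b μ) (h : ∀ z, ‖F z‖ ^ 2 ≤ a z * b z) :
    ‖∫ z, F z ∂μ‖ ^ 2 ≤ (∫ z, a z ∂μ) * ∫ z, b z ∂μ := by
  refine sq_le_mul_of_forall_pos (integral_nonneg ha) (integral_nonneg hb) (norm_nonneg _)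
    fun t ht => ?_
  have hi : Integrable (fun z => (t * a z + b z / t) / 2) μ :=
    ((hai.const_mul t).add (hbi.div_const t)).div_const 2
  have h1 := norm_integral_le_of_norm_le hi (.of_forall fun z => by
    have e : a z * b z ≤ ((t * a z + b z / t) / 2) ^ 2 := by
      have : ((t * a z + b z / t) / 2) ^ 2 - a z * b z = ((t * a z - b z / t) / 2) ^ 2 := by
        field_simp; ring
      nlinarith
    refine abs_le_of_sq_le_sq' ((h z).trans e) ?_ |>.2
    have := ha z; have := hb z; positivity)
  refine h1.trans_eq ?_
  rw [integral_div, integral_add (hai.const_mul t) (hbi.div_const t), integral_const_mul,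
    integral_div]

lemma test_estimate (hφ : ContDiff ℝ ∞ φ) (hψ : ContDiff ℝ ∞ ψ)
    (hK : ∀ z ∈ K, ∀ X, pg ψ z X ≤ ψ z * lv ψ z X) (hlv : ∀ z ∈ K, ∀ X, 0 ≤ lv φ z X)
    (hv : ContDiff ℝ ∞ v) (hvc : HasCompactSupport v) (hG : Continuous G)
    (hGc : HasCompactSupport G) (hG0 : ∀ z, 0 ≤ G z) (hvG : ∀ z ∈ K, ∀ X,
      ‖∑ j, wderBar n j v z * conj (X j)‖ ^ 2 ≤ G z * lv φ z X) (hβ : ∀ j, ContDiff ℝ ∞ (β j))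
    (hc : ∀ j, HasCompactSupport (β j)) (h0 : ∀ j, ∀ z ∉ K, β j z = 0) :
    ‖∑ j, ∫ z, wderBar n j v z * rexp (-(φ z + ψ z ^ 2 / 2 - ψ z)) * conj (β j z)‖ ^ 2
      ≤ (∫ z, G z * rexp (-(φ z + ψ z ^ 2 / 2 - 2 * ψ z))) *
        ((2 * ∫ z, ‖∑ j, wderW n (fun z => φ z + ψ z ^ 2 / 2 - ψ z) j (β j) z‖ ^ 2
          * rexp (-(φ z + ψ z ^ 2 / 2)))
        + ∫ z, (1 / 2 * ∑ j, ∑ k, ‖wderBar n j (β k) z - wderBar n k (β j) z‖ ^ 2)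
          * rexp (-(φ z + ψ z ^ 2 / 2))) := by
  have hβc := fun j => (hβ j).continuous
  have hz0 : ∀ z, (∀ j, z ∉ tsupport (β j)) → (fun j => β j z) = 0 := fun z h => by
    ext j; exact image_eq_zero_of_notMem_tsupport (h j)
  have hGi : Integrable fun z => G z * rexp (-(φ z + ψ z ^ 2 / 2 - 2 * ψ z)) :=
    integrable_of_hasCompactSupport (by fun_prop) hGc.mul_right
  have hLi : Integrable fun z => lv φ z (fun j => β j z) * rexp (-(φ z + ψ z ^ 2 / 2)) :=
    integrable_of_hasCompactSupport
      ((continuous_lv hφ hβc).mul (by fun_prop))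
      (hasCompactSupport_of_forall hc fun z h => by simp [hz0 z h, lv_zero])
  have hvb := fun j => (hv.wderBar j).continuous
  have hlv0 : ∀ z, 0 ≤ lv φ z (fun j => β j z) := fun z => by
    by_cases hz : z ∈ K
    · exact hlv z hz _
    · have : (fun j => β j z) = 0 := by ext j; exact h0 j z hz
      rw [this, lv_zero]
  have key := absorbed_estimate hφ hψ hK hβ hc h0
  have hGnn : 0 ≤ ∫ z, G z * rexp (-(φ z + ψ z ^ 2 / 2 - 2 * ψ z)) :=
    integral_nonneg fun z => mul_nonneg (hG0 z) (exp_pos _).le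
  refine le_trans ?_ (mul_le_mul_of_nonneg_left key hGnn)
  rw [← integral_finsetSum]
  swap
  · intro j _
    refine integrable_of_hasCompactSupport ?_ ?_
    · fun_prop
    · exact ((hvc.wderBar j).mul_right).mul_right
  refine norm_integral_sq_le (fun z => mul_nonneg (hG0 z) (exp_pos _).le)
    (fun z => mul_nonneg (hlv0 z) (exp_pos _).le) hGi hLi fun z => ?_
  have e1 : ∑ j, wderBar n j v z * rexp (-(φ z + ψ z ^ 2 / 2 - ψ z)) * conj (β j z)
      = (∑ j, wderBar n j v z * conj (β j z))
        * rexp (-(φ z + ψ z ^ 2 / 2 - ψ z)) := by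
    rw [sum_mul]; exact sum_congr rfl fun j _ => by ring
  have e2 : rexp (-(φ z + ψ z ^ 2 / 2 - ψ z)) ^ 2
      = rexp (-(φ z + ψ z ^ 2 / 2 - 2 * ψ z)) * rexp (-(φ z + ψ z ^ 2 / 2)) := by
    rw [← Real.exp_nat_mul, ← Real.exp_add]; ring
  rw [e1, norm_mul, mul_pow, norm_real, Real.norm_of_nonneg (exp_pos _).le, e2]
  have h3 : ‖∑ j, wderBar n j v z * conj (β j z)‖ ^ 2
      ≤ G z * lv φ z (fun j => β j z) := by
    by_cases hz : z ∈ K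
    · exact hvG z hz _
    · have : (fun j => β j z) = 0 := by ext j; exact h0 j z hz
      rw [this, lv_zero]
      simp [h0 _ z hz]
  calc _ ≤ (G z * lv φ z (fun j => β j z)) * (rexp (-(φ z + ψ z ^ 2 / 2 - 2 * ψ z))
        * rexp (-(φ z + ψ z ^ 2 / 2))) := by gcongr
    _ = _ := by ring

lemma mol_eq_zero (hk : IsMollifier n ε k) (hε : ε ≤ δ) (hf : ∀ z ∉ K, f z = 0)
    (hz : z ∉ cthickening δ K) : mol f (fun y => k y) z = 0 := by
  refine integral_eq_zero_of_ae (.of_forall fun t => ?_)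
  by_cases ht : t ∈ K
  · have := hk.eq_zero _ (by
      by_contra h
      exact hz (mem_cthickening_of_dist_le z t δ K ht
        (by rw [dist_eq_norm]; linarith)))
    simp [this]
  · simp [hf t ht]

/-- The divergence and the curl of the regularizations of a weakly differentiable form. -/
lemma sum_wder_mol (hk : IsMollifier n ε k) {D} (hβ : ∀ j, LocallyIntegrable (β j))
    (hdiv : ∀ τ, ContDiff ℝ ∞ τ → HasCompactSupport τ →
      ∑ j, ∫ z, β j z * wder n j τ z = -∫ z, D z * τ z) (z) :
    ∑ j, wder n j (mol (β j) fun y => k y) z = mol D (fun y => k y) z := by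
  have hs := hk.contDiff_ofReal
  have hd := hs.differentiable (by simp)
  have h1 := hdiv (fun t => k (z - t)) (hs.comp (contDiff_const.sub contDiff_id))
    (hk.hasCompactSupport_ofReal.comp_homeomorph (subLeft z))
  simp [wder_comp_sub_left hd, mul_neg, integral_neg,
    Finset.sum_neg_distrib, neg_inj] at h1
  simp [wder_mol (hβ _) hs hk.hasCompactSupport_ofReal]
  exact h1

lemma wderBar_mol_sub (hk : IsMollifier n ε k)
    {C} (hf : LocallyIntegrable f) (hg : LocallyIntegrable g) (i j)
    (h : ∀ τ, ContDiff ℝ ∞ τ → HasCompactSupport τ →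
      (∫ z, f z * wderBar n i τ z) - (∫ z, g z * wderBar n j τ z) = -∫ z, C z * τ z) (z) :
    wderBar n i (mol f fun y => k y) z - wderBar n j (mol g fun y => k y) z
      = mol C (fun y => k y) z := by
  have hs := hk.contDiff_ofReal
  have hd := hs.differentiable (by simp)
  have h1 := h (fun t => k (z - t)) (hs.comp (contDiff_const.sub contDiff_id))
    (hk.hasCompactSupport_ofReal.comp_homeomorph (subLeft z))
  simp only [wderBar_comp_sub_left hd, mul_neg, integral_neg] at h1
  simp [wderBar_mol hf hs hk.hasCompactSupport_ofReal, wderBar_mol hg hs hk.hasCompactSupport_ofReal]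
  have h2 : ∀ a b c : ℂ, -a - -b = -c → a - b = c := fun a b c h => by linear_combination -h
  exact h2 _ _ _ h1

lemma hasCompactSupport_of_zero {F} [Zero F] {f : ℂ^n → F}
    (hK : IsCompact K) (h : ∀ z ∉ K, f z = 0) : HasCompactSupport f :=
  of_support_subset_isCompact hK fun z hz => by
    by_contra h'
    exact hz (h z h')

lemma tendstoL2_mol_of_zero (hδ : 0 < δ) {k : ℕ → ℂ^n → ℝ}
    (hk : ∀ m : ℕ, IsMollifier n (δ / (m + 1)) (k m)) {K'}
    (hK'c : IsCompact K') (hKK' : cthickening δ K ⊆ K')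
    (hf : MemLp f 2) (hm : Measurable f) (h0 : ∀ z ∉ K, f z = 0) :
    (∀ m, ContDiff ℝ ∞ (mol f fun y => k m y)) ∧
    (∀ m, ∀ z ∉ K', mol f (fun y => k m y) z = 0) ∧
    TendstoL2 (fun m => mol f fun y => k m y) f := by
  have h1 := fun m =>
    contDiff_mol (hf.locallyIntegrable (by norm_num)) (hk m).contDiff_ofReal
      (hk m).hasCompactSupport_ofReal
  have h2 : ∀ m, ∀ z ∉ K', mol f (fun y => k m y) z = 0 := fun m z hz =>
    mol_eq_zero (hk m) (div_le_self hδ.le (by linarith)) h0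
      fun h => hz (hKK' h)
  exact ⟨h1, h2, tendstoL2_mol hk hf hm fun m =>
    (h1 m).continuous.memLp_of_hasCompactSupport (hasCompactSupport_of_zero hK'c (h2 m))⟩

/-- The basic estimate for weakly differentiable forms with compact support. -/
theorem friedrichs_estimate (hφ : ContDiff ℝ ∞ φ) (hψ : ContDiff ℝ ∞ ψ)
    {K'} (hK'c : IsCompact K') (hδ : 0 < δ)
    (hKK' : cthickening δ K ⊆ K') (hK : ∀ z ∈ K', ∀ X, pg ψ z X ≤ ψ z * lv ψ z X)
    (hlv : ∀ z ∈ K', ∀ X, 0 ≤ lv φ z X)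
    (hv : ContDiff ℝ ∞ v) (hvc : HasCompactSupport v) (hG : Continuous G)
    (hGc : HasCompactSupport G) (hG0 : ∀ z, 0 ≤ G z) (hvG : ∀ z ∈ K', ∀ X,
      ‖∑ j, wderBar n j v z * conj (X j)‖ ^ 2 ≤ G z * lv φ z X)
    {D} {C : Fin n → Fin n → ℂ^n → ℂ}
    (hβ : ∀ j, MemLp (β j) 2) (hβm : ∀ j, Measurable (β j)) (hβ0 : ∀ j, ∀ z ∉ K, β j z = 0)
    (hD : MemLp D 2) (hDm : Measurable D) (hD0 : ∀ z ∉ K, D z = 0)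
    (hC : ∀ j k, MemLp (C j k) 2) (hCm : ∀ j k, Measurable (C j k))
    (hC0 : ∀ j k, ∀ z ∉ K, C j k z = 0)
    (hdiv : ∀ τ, ContDiff ℝ ∞ τ → HasCompactSupport τ →
      ∑ j, ∫ z, β j z * wder n j τ z = -∫ z, D z * τ z)
    (hcurl : ∀ τ, ContDiff ℝ ∞ τ → HasCompactSupport τ → ∀ j k,
      (∫ z, β k z * wderBar n j τ z) - (∫ z, β j z * wderBar n k τ z) = -∫ z, C j k z * τ z) :
    ‖∑ j, ∫ z, wderBar n j v z * rexp (-(φ z + ψ z ^ 2 / 2 - ψ z)) * conj (β j z)‖ ^ 2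
      ≤ (∫ z, G z * rexp (-(φ z + ψ z ^ 2 / 2 - 2 * ψ z))) *
        ((2 * ∫ z, ‖D z - ∑ j, wder n j (fun z => (φ z + ψ z ^ 2 / 2 - ψ z : ℝ)) z * β j z‖ ^ 2
          * rexp (-(φ z + ψ z ^ 2 / 2)))
        + 1 / 2 * ∑ j, ∑ k, ∫ z, ‖C j k z‖ ^ 2 * rexp (-(φ z + ψ z ^ 2 / 2))) := by
  obtain ⟨k, hk⟩ := exists_mollifier_seq n hδ
  set φ2 := fun z => φ z + ψ z ^ 2 / 2 - ψ z with hφ2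
  have h2 := (hφ.add ((hψ.pow 2).div_const 2)).sub hψ
  set φ3 := fun z => φ z + ψ z ^ 2 / 2 with hφ3
  have h2c := fun j =>
    ((contDiff_ofReal_comp h2).wder j).continuous
  have hloc : ∀ {f : ℂ^n → ℂ}, MemLp f 2 → LocallyIntegrable f := fun hf =>
    hf.locallyIntegrable (by norm_num)
  have hTβ := fun j => tendstoL2_mol_of_zero hδ hk hK'c hKK' (hβ j) (hβm j) (hβ0 j)
  have hTD := tendstoL2_mol_of_zero hδ hk hK'c hKK' hD hDm hD0
  have hTC := fun i j => tendstoL2_mol_of_zero hδ hk hK'c hKK' (hC i j) (hCm i j) (hC0 i j)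
  set βm := fun m j => mol (β j) fun y => k m y with hβmdef
  set Dm := fun m => mol D fun y => k m y with hDmdef
  set Cm := fun m i j => mol (C i j) fun y => k m y
    with hCmdef
  have hcs := fun m j =>
    hasCompactSupport_of_zero hK'c ((hTβ j).2.1 m)
  have est := fun m => test_estimate hφ hψ hK hlv hv hvc hG hGc hG0 hvG (β := βm m)
    (fun j => (hTβ j).1 m) (hcs m) (fun j => (hTβ j).2.1 m)
  have e1 : ∀ m z, ∑ j, wderW n (fun z => φ z + ψ z ^ 2 / 2 - ψ z) j (βm m j) z
      = Dm m z - ∑ j, wder n j (fun z => φ2 z) z * βm m j z := fun m z => by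
    simp only [wderW, sum_sub_distrib]
    rw [sum_wder_mol (hk m) (fun j => hloc (hβ j)) hdiv]
  have e2 : ∀ m z j l, wderBar n j (βm m l) z - wderBar n l (βm m j) z = Cm m j l z :=
    fun m z j l => wderBar_mol_sub (hk m) (hloc (hβ l)) (hloc (hβ j)) j l
      (fun τ h1 h2 => hcurl τ h1 h2 j l) z
  -- a bounded weight realizing `exp (-φ3 / 2)` on `K'`
  set w := K'.indicator fun z => (rexp (-φ3 z / 2) : ℂ) with hw
  have hK'm := hK'c.isClosed.measurableSet
  have hbdd : ∀ {g : ℂ^n → ℂ}, Continuous g →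
      Measurable (K'.indicator g) ∧ ∃ B, ∀ z, ‖K'.indicator g z‖ ≤ B := fun {g} hg => by
    refine ⟨hg.measurable.indicator hK'm, ?_⟩
    obtain ⟨B, hB⟩ := hK'c.exists_bound_of_continuousOn hg.continuousOn
    refine ⟨max B 0, fun z => ?_⟩
    by_cases hz : z ∈ K'
    · rw [indicator_of_mem hz]; exact (hB z hz).trans (le_max_left _ _)
    · rw [indicator_of_notMem hz]; simp
  have hwc : Continuous fun z => (rexp (-φ3 z / 2) : ℂ) := by fun_prop
  have hwsq : ∀ {a} {z}, (z ∉ K' → a = 0) → ‖w z * a‖ ^ 2 = ‖a‖ ^ 2 * rexp (-φ3 z) :=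
      fun {a z} ha => by
    by_cases hz : z ∈ K'
    · rw [hw, indicator_of_mem hz, norm_mul, mul_pow, norm_real,
        Real.norm_of_nonneg (exp_pos _).le, ← Real.exp_nat_mul]
      ring
    · simp [ha hz]
  obtain ⟨hwm, Bw, hBw⟩ := hbdd hwc
  have L1 := by
    have hj : ∀ j, TendstoL2 (fun m z => K'.indicator (fun z => (rexp (-φ3 z / 2) : ℂ)
        * wder n j (fun z => φ2 z) z) z * βm m j z)
        (fun z => K'.indicator (fun z => (rexp (-φ3 z / 2) : ℂ)
        * wder n j (fun z => φ2 z) z) z * β j z) := fun j => by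
      obtain ⟨hm, B, hB⟩ := hbdd (hwc.mul (h2c j))
      exact (hTβ j).2.2.bmul hm hB
    have := (hTD.2.2.bmul hwm hBw).sub (TendstoL2.sum Finset.univ fun j _ => hj j)
    have ew : ∀ (a) (b : ℂ^n) z,
        K'.indicator (fun z => (rexp (-φ3 z / 2) : ℂ)) z * a -
          ∑ j, K'.indicator (fun z => (rexp (-φ3 z / 2) : ℂ)
            * wder n j (fun z => φ2 z) z) z * b j
        = w z * (a - ∑ j, wder n j (fun z => φ2 z) z * b j) := fun a b z => by
      by_cases hz : z ∈ K'
      · simp [hw, indicator_of_mem hz, mul_sub, mul_sum, mul_assoc]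
      · simp only [hw, indicator_of_notMem hz]; simp
    simp only [ew] at this
    exact this
  have L1' := L1.integral_norm_sq
  have L2 := fun j l => ((hTC j l).2.2.bmul hwm hBw).integral_norm_sq
  have z1 : ∀ z, z ∉ K' → z ∉ K := fun z hz h => hz (hKK' (self_subset_cthickening K h))
  have d1 : ∀ (D : ℂ^n → ℂ) (β : Fin n → ℂ^n → ℂ), (∀ z ∉ K', D z = 0) →
      (∀ j, ∀ z ∉ K', β j z = 0) →
      ∫ z, ‖w z * (D z - ∑ j, wder n j (fun z => φ2 z) z * β j z)‖ ^ 2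
        = ∫ z, ‖D z - ∑ j, wder n j (fun z => φ2 z) z * β j z‖ ^ 2 * rexp (-φ3 z) :=
    fun D β hD hβ => integral_congr_ae (.of_forall fun z => hwsq fun hz => by
      simp [hD z hz, hβ _ z hz])
  have d2 : ∀ C : ℂ^n → ℂ, (∀ z ∉ K', C z = 0) →
      ∫ z, ‖w z * C z‖ ^ 2 = ∫ z, ‖C z‖ ^ 2 * rexp (-φ3 z) :=
    fun C hC => integral_congr_ae (.of_forall fun z => hwsq fun hz => hC z hz)
  rw [d1 D β (fun z hz => hD0 z (z1 z hz)) (fun j z hz => hβ0 j z (z1 z hz))] at L1'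
  have L3 := fun j => TendstoL2.integral_mul_conj (TendstoL2.const
    (f := fun z => wderBar n j v z * rexp (-φ2 z))
    (Continuous.memLp_of_hasCompactSupport (by
      have := (hv.wderBar j).continuous
      fun_prop) ((hvc.wderBar j).mul_right))) (hTβ j).2.2
  have L3' := (tendsto_finsetSum Finset.univ fun j _ => L3 j).norm.pow 2
  have L2' : Tendsto (fun m => 1 / 2 * ∑ j, ∑ l, ∫ z, ‖w z * Cm m j l z‖ ^ 2) atTop
      (𝓝 (1 / 2 * ∑ j, ∑ l, ∫ z, ‖w z * C j l z‖ ^ 2)) :=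
    (tendsto_finsetSum _ fun j _ => tendsto_finsetSum _ fun l _ => L2 j l).const_mul _
  have L4 := ((L1'.const_mul 2).add L2').const_mul
    (∫ z, G z * rexp (-(φ z + ψ z ^ 2 / 2 - 2 * ψ z)))
  simp only [d2 _ (fun z hz => hC0 _ _ z (z1 z hz))] at L4
  have hInt : ∀ m j l, Integrable fun z => ‖Cm m j l z‖ ^ 2 * rexp (-φ3 z) := fun m j l => by
    refine integrable_of_hasCompactSupport ?_ ?_
    · have := ((hTC j l).1 m).continuous
      fun_prop
    · exact hasCompactSupport_of_zero hK'c fun z hz => by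
        simp only [hCmdef, (hTC j l).2.1 m z hz]; simp
  refine le_of_tendsto_of_tendsto' L3' L4 fun m => ?_
  have hm := est m
  simp only [e1, e2] at hm
  rw [d1 (Dm m) (βm m) (hTD.2.1 m) (fun j => (hTβ j).2.1 m)]
  have d3 : ∀ j l, ∫ z, ‖w z * Cm m j l z‖ ^ 2 = ∫ z, ‖Cm m j l z‖ ^ 2 * rexp (-φ3 z) :=
    fun j l => d2 _ ((hTC j l).2.1 m)
  simp only [d3]
  refine hm.trans_eq ?_
  congr 2
  have d4 : ∑ j, ∑ l, ∫ z, ‖Cm m j l z‖ ^ 2 * rexp (-φ3 z)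
      = ∫ z, ∑ j, ∑ l, ‖Cm m j l z‖ ^ 2 * rexp (-φ3 z) := by
    rw [integral_finsetSum _ fun j _ => integrable_finsetSum _ fun l _ => hInt m j l]
    exact sum_congr rfl fun j _ => (integral_finsetSum _ fun l _ => hInt m j l).symm
  rw [d4, ← integral_const_mul]
  simp [sum_mul, mul_assoc, hφ3]

section TestFun

namespace IsTestFun

variable {τ σ : ℂ^n → ℂ}

lemma contDiff (h : IsTestFun n τ Ω) : ContDiff ℝ ∞ τ := h.1

lemma hasCompactSupport (h : IsTestFun n τ Ω) : HasCompactSupport τ := h.2.1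

lemma tsupport_subset (h : IsTestFun n τ Ω) : tsupport τ ⊆ Ω := h.2.2

lemma differentiable (h : IsTestFun n τ Ω) : Differentiable ℝ τ := h.1.differentiable (by simp)

lemma memLp (h : IsTestFun n τ Ω) : MemLp τ 2 :=
  h.contDiff.continuous.memLp_of_hasCompactSupport h.hasCompactSupport

lemma measurable (h : IsTestFun n τ Ω) : Measurable τ := h.contDiff.continuous.measurable

lemma integrable (h : IsTestFun n τ Ω) : Integrable τ :=
  h.contDiff.continuous.integrable_of_hasCompactSupport h.hasCompactSupport

lemma eq_zero (h : IsTestFun n τ Ω) (hz : z ∉ Ω) : τ z = 0 :=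
  image_eq_zero_of_notMem_tsupport fun h' => hz (h.tsupport_subset h')

lemma mul_left (h : IsTestFun n τ Ω) (hΩ : IsOpen Ω)
    (hf : ContDiffOn ℝ ∞ f Ω) : IsTestFun n (fun z => f z * τ z) Ω := by
  have hs : tsupport (fun z => f z * τ z) ⊆ tsupport τ := tsupport_mul_subset_right
  refine ⟨contDiff_iff_contDiffAt.2 fun z => ?_, h.hasCompactSupport.mul_left, hs.trans h.2.2⟩
  by_cases hz : z ∈ Ω
  · exact (hf.contDiffAt (hΩ.mem_nhds hz)).mul h.contDiff.contDiffAt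
  · have h0 := fun h' => hz (h.2.2 (hs h'))
    have := (notMem_tsupport_iff_eventuallyEq.1 h0)
    exact (contDiffAt_const).congr_of_eventuallyEq this

lemma wder (h : IsTestFun n τ Ω) (j) : IsTestFun n (wder n j τ) Ω :=
  ⟨h.contDiff.wder j, h.hasCompactSupport.wder j, (tsupport_wder_subset j τ).trans h.2.2⟩

lemma wderBar (h : IsTestFun n τ Ω) (j) : IsTestFun n (wderBar n j τ) Ω :=
  ⟨h.contDiff.wderBar j, h.hasCompactSupport.wderBar j, (tsupport_wderBar_subset j τ).trans h.2.2⟩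

lemma star (h : IsTestFun n τ Ω) : IsTestFun n (fun z => conj (τ z)) Ω :=
  ⟨h.contDiff.conj_comp, h.hasCompactSupport.conj_comp,
    (tsupport_comp_subset (map_zero _) τ).trans h.2.2⟩

lemma sum {ι} {s} {τ : ι → ℂ^n → ℂ} (h : ∀ i ∈ s, IsTestFun n (τ i) Ω) :
    IsTestFun n (fun z => ∑ i ∈ s, τ i z) Ω := by
  classical
  induction s using induction_on with
  | empty =>
    exact ⟨contDiff_const, HasCompactSupport.zero, by simp⟩
  | insert a s ha ih =>
    have h1 := h a (by simp)
    have h2 := ih fun i hi => h i (by simp [hi])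
    simp [sum_insert ha]
    exact ⟨h1.1.add h2.1, h1.2.1.add h2.2.1, (tsupport_add _ _).trans (union_subset h1.2.2 h2.2.2)⟩

end IsTestFun

/-- Smooth cutoff functions, equal to `1` near a compact set. -/
lemma exists_contDiff_cutoff (hΩ : IsOpen Ω) (hK : IsCompact K) (hKΩ : K ⊆ Ω) :
    ∃ θ : ℂ^n → ℝ, ContDiff ℝ ∞ θ ∧ HasCompactSupport θ ∧ tsupport θ ⊆ Ω ∧
      (∀ z, 0 ≤ θ z ∧ θ z ≤ 1) ∧ ∀ z ∈ K, θ =ᶠ[𝓝 z] fun _ => 1 := by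
  obtain ⟨L, hL, hKL, hLΩ⟩ := exists_compact_between hK hΩ hKΩ
  obtain ⟨f, hf1, hf2, hf3⟩ := exists_contMDiffMap_one_nhds_of_subset_interior
    (modelWithCornersSelf ℝ ℂ^n) hK.isClosed hKL
  have hs : tsupport f ⊆ L := closure_minimal (fun z hz => by_contra fun h => hz (hf2 z h)) hL.isClosed
  exact ⟨f, contMDiff_iff_contDiff.1 f.contMDiff, hL.of_isClosed_subset (isClosed_tsupport _) hs,
    hs.trans hLΩ, hf3, fun z hz => eventually_nhdsSet_iff_forall.1 hf1 z hz⟩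

end TestFun

lemma MemLp.mul_test {α τ : ℂ^n → ℂ} (hα : MemLp α 2) (h : MemLp τ 2) :
    Integrable fun z => α z * τ z :=
  hα.integrable_mul h

lemma memLp_mul_test {α} (hα : MemLp α 2) (hf : IsTestFun n f Ω) :
    MemLp (fun z => f z * α z) 2 := by
  obtain ⟨C, hC⟩ := hf.contDiff.continuous.bounded_above_of_compact_support hf.hasCompactSupport
  exact ((TendstoL2.const hα).bmul hf.measurable hC).memLp

lemma wder_exp_real {p} (hp : DifferentiableAt ℝ p z)
    (j) : wder n j (fun y => (rexp (p y) : ℂ)) z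
      = wder n j (fun y => p y) z * rexp (p z) := by
  have := wder_exp_neg (φ := fun y => - p y) hp.neg j
  simp only [neg_neg] at this
  rw [this]
  have h2 := wder_neg (j := j) (u := fun y => p y) (z := z)
  have h3 : (fun y => ((-p y : ℝ) : ℂ)) = fun y => -(p y : ℂ) := by simp
  rw [h3, h2, neg_neg]

/-- `friedrichs_estimate` applied to `χ e^{p/2} α`, where `p = φ + ψ²/2 - ψ`. -/
lemma cut_estimate_global {p} (hΩ : IsOpen Ω) (hφ : ContDiff ℝ ∞ φ)
    (hψ : ContDiff ℝ ∞ ψ) (hp : p = fun z => φ z + ψ z ^ 2 / 2 - ψ z)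
    (hpg : ∀ z ∈ Ω, ∀ X, pg ψ z X ≤ ψ z * lv ψ z X) (hlv : ∀ z ∈ Ω, ∀ X, 0 ≤ lv φ z X)
    (hv : ContDiff ℝ ∞ v) (hvc : HasCompactSupport v)
    (hG : Continuous G) (hGc : HasCompactSupport G) (hG0 : ∀ z, 0 ≤ G z) (hvG : ∀ z ∈ Ω, ∀ X,
      ‖∑ j, wderBar n j v z * conj (X j)‖ ^ 2 ≤ G z * lv φ z X)
    (hα : ∀ j, MemLp (α j) 2) (hαm : ∀ j, Measurable (α j)) {d} (hd : ContDiff ℝ ∞ d)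
    (hcurl : ∀ τ, IsTestFun n τ Ω → ∀ j k, ∫ z, α k z * (rexp (p z / 2) * wderBar n j τ z)
        = ∫ z, α j z * (rexp (p z / 2) * wderBar n k τ z)) (hdiv : ∀ τ, IsTestFun n τ Ω →
      ∑ j, ∫ z, α j z * (rexp (-(p z / 2)) * wder n j τ z) = -∫ z, d z * τ z)
    {χ} (hχ : IsTestFun n χ Ω) : ‖∑ j, ∫ z, wderBar n j v z * rexp (-p z)
        * conj (χ z * rexp (p z / 2) * α j z)‖ ^ 2
      ≤ (∫ z, G z * rexp (-(φ z + ψ z ^ 2 / 2 - 2 * ψ z))) * ((2 * ∫ z, ‖χ z * rexp (p z) * d z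
            + ∑ j, wder n j χ z * rexp (p z / 2) * α j z‖ ^ 2 * rexp (-(φ z + ψ z ^ 2 / 2)))
        + 1 / 2 * ∑ j, ∑ k, ∫ z, ‖wderBar n j χ z * rexp (p z / 2) * α k z
            - wderBar n k χ z * rexp (p z / 2) * α j z‖ ^ 2 * rexp (-(φ z + ψ z ^ 2 / 2))) := by
  have hps : ContDiff ℝ ∞ p := by rw [hp]; fun_prop
  have hpC := contDiff_ofReal_comp hps
  have he : ContDiff ℝ ∞ fun z => (rexp (p z) : ℂ) :=
    contDiff_ofReal_comp (by fun_prop)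
  have he2 : ContDiff ℝ ∞ fun z => (rexp (p z / 2) : ℂ) :=
    contDiff_ofReal_comp (by fun_prop)
  have hmul : ∀ {f g}, ContDiff ℝ ∞ f → IsTestFun n g Ω →
      IsTestFun n (fun z => g z * f z) Ω := fun hf hg => by
    simpa [mul_comm] using hg.mul_left hΩ hf.contDiffOn
  obtain ⟨δ, hδ, hδΩ⟩ := hχ.hasCompactSupport.exists_cthickening_subset_open hΩ hχ.tsupport_subset
  have hx1 := hmul he2 hχ
  have hx2 :=
    fun j => hmul he2 (hχ.wder j)
  have hx3 :=
    fun j => hmul he2 (hχ.wderBar j)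
  have hx4 :=
    fun j => hmul (hpC.wder j) hx1
  have hx5 := hmul hd (hmul he hχ)
  set β := fun j z => χ z * rexp (p z / 2) * α j z with hβ
  set D := fun z => χ z * rexp (p z) * d z
    + ∑ j, (wder n j χ z * rexp (p z / 2) * α j z
      + χ z * rexp (p z / 2) * wder n j (fun y => p y) z * α j z) with hD
  set C := fun j k z => wderBar n j χ z * rexp (p z / 2) * α k z
            - wderBar n k χ z * rexp (p z / 2) * α j z with hC
  have key := friedrichs_estimate hφ hψ
    (β := β) (D := D) (C := C)
    hχ.hasCompactSupport.isCompact.cthickening hδ subset_rfl (fun z hz => hpg z (hδΩ hz))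
    (fun z hz => hlv z (hδΩ hz)) hv hvc hG hGc hG0 (fun z hz => hvG z (hδΩ hz))
    (fun j => memLp_mul_test (hα j) hx1) (fun j => hx1.measurable.mul (hαm j))
    (fun j z h => by simp [hβ, image_eq_zero_of_notMem_tsupport h])
    (hx5.memLp.add (memLp_finsetSum _ fun j _ => (memLp_mul_test (hα j) (hx2 j)).add
      (memLp_mul_test (hα j) (hx4 j))))
    (hx5.measurable.add (Finset.measurable_fun_sum _ fun j _ => ((hx2 j).measurable.mul (hαm j)).add
      ((hx4 j).measurable.mul (hαm j))))
    (fun z h => by simp [hD, image_eq_zero_of_notMem_tsupport h, wder_eq_zero_of_notMem h])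
    (fun j k => (memLp_mul_test (hα k) (hx3 j)).sub (memLp_mul_test (hα j) (hx3 k)))
    (fun j k => ((hx3 j).measurable.mul (hαm k)).sub ((hx3 k).measurable.mul (hαm j)))
    (fun j k z h => by simp [hC, wderBar_eq_zero_of_notMem h])
    ?_ ?_
  · refine (le_of_eq_of_le ?_ key).trans (le_of_eq ?_)
    · simp [hβ, hp]
    · have e1 : ∀ z, D z - ∑ j, wder n j (fun z => (φ z + ψ z ^ 2 / 2 - ψ z : ℝ)) z * β j z
          = χ z * rexp (p z) * d z + ∑ j, wder n j χ z * rexp (p z / 2) * α j z := fun z => by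
        have : (fun z => ((φ z + ψ z ^ 2 / 2 - ψ z : ℝ) : ℂ)) = fun y => (p y : ℂ) := by rw [hp]
        rw [this]
        simp only [hD, sum_add_distrib]
        rw [add_sub_assoc, add_sub_assoc, ← sum_sub_distrib]
        congr 1
        rw [add_eq_left]
        exact sum_eq_zero fun j _ => by ring
      simp only [e1, hC]
  · intro τ hτ hτc
    have ht : IsTestFun n (fun z => rexp (p z) * χ z * τ z) Ω := by
      have := hmul hτ (hmul he hχ)
      simpa [mul_comm] using this
    have h0 := hdiv _ ht
    have hw : ∀ j z, α j z * (rexp (-(p z / 2)) * wder n j (fun z => rexp (p z) * χ z * τ z) z)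
        = β j z * wder n j τ z + (wder n j χ z * rexp (p z / 2) * α j z
      + χ z * rexp (p z / 2) * wder n j (fun y => p y) z * α j z) * τ z := fun j z => by
      have d1 : DifferentiableAt ℝ (fun z => (rexp (p z) : ℂ)) z :=
        (he.differentiable (by simp)).differentiableAt
      have d2 := hχ.differentiable.differentiableAt (x := z)
      have d3 : DifferentiableAt ℝ τ z := (hτ.differentiable (by simp)).differentiableAt
      rw [wder_mul (d1.fun_mul d2) d3, wder_mul d1 d2,
        wder_exp_real (hps.differentiable (by simp)).differentiableAt]
      have e1 : (rexp (p z) : ℂ) = rexp (p z / 2) * rexp (p z / 2) := by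
        rw [← ofReal_mul, ← Real.exp_add]; ring_nf
      have e2 : (rexp (-(p z / 2)) : ℂ) * rexp (p z / 2) = 1 := by
        rw [← ofReal_mul, ← Real.exp_add]; simp
      rw [e1]
      linear_combination (α j z * (rexp (p z / 2)) * (wder n j (fun y => p y) z * χ z * τ z
        + wder n j χ z * τ z + χ z * wder n j τ z)) * e2
    have i1 : ∀ j, Integrable fun z => β j z * wder n j τ z := fun j => by
      have := MemLp.mul_test (hα j) (hmul (hτ.wder j) hx1).memLp
      refine this.congr (.of_forall fun z => ?_)
      ring
    have i2 : ∀ j, Integrable fun z => (wder n j χ z * rexp (p z / 2) * α j z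
      + χ z * rexp (p z / 2) * wder n j (fun y => p y) z * α j z) * τ z := fun j => by
      have := (MemLp.mul_test (hα j) (hmul hτ (hx2 j)).memLp).add
        (MemLp.mul_test (hα j) (hmul hτ (hx4 j)).memLp)
      refine this.congr (.of_forall fun z => ?_)
      simp [Pi.add_apply]; ring
    have i3 := (hmul hτ hx5).integrable
    have hDτ : ∫ z, D z * τ z = (∫ z, χ z * rexp (p z) * d z * τ z)
        + ∑ j, ∫ z, (wder n j χ z * rexp (p z / 2) * α j z
      + χ z * rexp (p z / 2) * wder n j (fun y => p y) z * α j z) * τ z := by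
      rw [← integral_finset_sum _ fun j _ => i2 j, ← integral_add i3 (integrable_finset_sum _ fun j _ => i2 j)]
      simp [hD, add_mul, sum_mul]
    simp only [hw] at h0
    rw [sum_congr rfl fun j _ => integral_add (i1 j) (i2 j), sum_add_distrib] at h0
    have e3 : ∫ z, d z * (rexp (p z) * χ z * τ z) = ∫ z, χ z * rexp (p z) * d z * τ z :=
      integral_congr_ae (.of_forall fun z => by ring)
    rw [e3] at h0
    rw [hDτ]
    linear_combination h0
  · intro τ hτ hτc j k
    have ht := hmul hτ hχ
    have h0 := hcurl _ ht j k
    have hw : ∀ j k z, α k z * (rexp (p z / 2) * wderBar n j (fun z => χ z * τ z) z)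
        = β k z * wderBar n j τ z + wderBar n j χ z * rexp (p z / 2) * α k z * τ z := fun j k z => by
      have d2 := hχ.differentiable.differentiableAt (x := z)
      have d3 : DifferentiableAt ℝ τ z := (hτ.differentiable (by simp)).differentiableAt
      rw [wderBar_mul d2 d3]; ring
    have i1 : ∀ j k, Integrable fun z => β k z * wderBar n j τ z := fun j k => by
      have := MemLp.mul_test (hα k) (hmul (hτ.wderBar j) hx1).memLp
      refine this.congr (.of_forall fun z => ?_)
      ring
    have i2 : ∀ j k, Integrable fun z => wderBar n j χ z * rexp (p z / 2) * α k z * τ z := fun j k => by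
      have := MemLp.mul_test (hα k) (hmul hτ (hx3 j)).memLp
      refine this.congr (.of_forall fun z => ?_)
      ring
    simp only [hw] at h0
    rw [integral_add (i1 j k) (i2 j k), integral_add (i1 k j) (i2 k j)] at h0
    have : ∫ z, C j k z * τ z = (∫ z, wderBar n j χ z * rexp (p z / 2) * α k z * τ z)
        - ∫ z, wderBar n k χ z * rexp (p z / 2) * α j z * τ z := by
      rw [← integral_sub (i2 j k) (i2 k j)]; simp [hC, sub_mul]
    rw [this]
    linear_combination h0

lemma contDiff_mul_of_tsupport_subset (hΩ : IsOpen Ω) {θ f : ℂ^n → ℝ} (hθ : ContDiff ℝ ∞ θ)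
    (hs : tsupport θ ⊆ Ω) (hf : ContDiffOn ℝ ∞ f Ω) : ContDiff ℝ ∞ fun z => θ z * f z := by
  refine contDiff_iff_contDiffAt.2 fun z => ?_
  by_cases hz : z ∈ Ω
  · exact hθ.contDiffAt.mul (hf.contDiffAt (hΩ.mem_nhds hz))
  · have := notMem_tsupport_iff_eventuallyEq.1 fun h => hz (hs h)
    refine (contDiffAt_const (c := 0)).congr_of_eventuallyEq ?_
    filter_upwards [this] with y hy
    simp [hy]

lemma integrable_norm_sq_mul_exp (hΩ : IsOpen Ω) {d} (hd : IsTestFun n d Ω)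
    {p} (hp : ContDiffOn ℝ ∞ p Ω) : Integrable fun z => ‖d z‖ ^ 2 * rexp (p z) := by
  have he :=
    ofRealCLM.contDiff.comp_contDiffOn (Real.contDiff_exp.comp_contDiffOn hp)
  have h1 := hd.mul_left hΩ he
  have h2 : Integrable fun z => ‖d z‖ * ‖(rexp (p z) : ℂ) * d z‖ :=
    (hd.contDiff.continuous.norm.mul h1.contDiff.continuous.norm).integrable_of_hasCompactSupport
      hd.hasCompactSupport.norm.mul_right
  refine h2.congr (.of_forall fun z => ?_)
  simp [norm_mul, norm_real, norm_eq_abs, abs_exp]; ring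

lemma norm_sum_sq_le_card (x : ℂ^n) : ‖∑ j, x j‖ ^ 2 ≤ n * ∑ j, ‖x j‖ ^ 2 := by
  calc ‖∑ j, x j‖ ^ 2 ≤ (∑ j, ‖x j‖) ^ 2 := by gcongr; exact norm_sum_le _ _
    _ ≤ _ := by simpa using sq_sum_le_card_mul_sum_sq (s := Finset.univ) (f := fun j => ‖x j‖)

lemma norm_add_sq_le_two {x y : ℂ} : ‖x + y‖ ^ 2 ≤ 2 * ‖x‖ ^ 2 + 2 * ‖y‖ ^ 2 := by
  have := norm_add_le x y
  nlinarith [sq_nonneg (‖x‖ - ‖y‖), norm_nonneg (x + y)]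

lemma norm_sub_sq_le_two {x y : ℂ} : ‖x - y‖ ^ 2 ≤ 2 * ‖x‖ ^ 2 + 2 * ‖y‖ ^ 2 := by
  simpa [sub_eq_add_neg] using norm_add_sq_le_two (y := -y)

/-- The basic inequality for a projected form `α`, obtained by letting cutoffs tend to `1`. -/
lemma cut_estimate (hΩ : IsOpen Ω) (hφ : ContDiffOn ℝ ∞ φ Ω) (hψ : ContDiffOn ℝ ∞ ψ Ω)
    (hpg : ∀ z ∈ Ω, ∀ X, pg ψ z X ≤ ψ z * lv ψ z X) (hlv : ∀ z ∈ Ω, ∀ X, 0 ≤ lv φ z X)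
    (hv : IsTestFun n v Ω) (hG : Continuous G) (hGc : HasCompactSupport G) (hG0 : ∀ z, 0 ≤ G z)
    (hGs : tsupport G ⊆ Ω) (hvG : ∀ z ∈ Ω, ∀ X,
      ‖∑ j, wderBar n j v z * conj (X j)‖ ^ 2 ≤ G z * lv φ z X)
    (hα : ∀ j, MemLp (α j) 2) (hαm : ∀ j, Measurable (α j)) {d} (hd : IsTestFun n d Ω)
    (hcurl : ∀ τ, IsTestFun n τ Ω → ∀ j k,
      ∫ z, α k z * (rexp ((φ z + ψ z ^ 2 / 2 - ψ z) / 2) * wderBar n j τ z)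
        = ∫ z, α j z * (rexp ((φ z + ψ z ^ 2 / 2 - ψ z) / 2) * wderBar n k τ z))
    (hdiv : ∀ τ, IsTestFun n τ Ω →
      ∑ j, ∫ z, α j z * (rexp (-((φ z + ψ z ^ 2 / 2 - ψ z) / 2)) * wder n j τ z) = -∫ z, d z * τ z)
    (hχ : ∀ ε, 0 < ε → ∃ χ : ℂ^n → ℝ, IsTestFun n (fun z => χ z) Ω ∧
      (∀ z, 0 ≤ χ z ∧ χ z ≤ 1) ∧ (∀ z ∈ tsupport v, χ z = 1) ∧
      ∀ z ∈ Ω, ∀ j, ‖wder n j (fun y => χ y) z‖ ^ 2 * rexp (-ψ z) ≤ ε) :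
    ‖∑ j, ∫ z, wderBar n j v z * rexp (-((φ z + ψ z ^ 2 / 2 - ψ z) / 2)) * conj (α j z)‖ ^ 2
      ≤ (∫ z, G z * rexp (-(φ z + ψ z ^ 2 / 2 - 2 * ψ z))) *
        (4 * ∫ z, ‖d z‖ ^ 2 * rexp (φ z + ψ z ^ 2 / 2 - 2 * ψ z)) := by
  have hM : 0 ≤ ∫ z, G z * rexp (-(φ z + ψ z ^ 2 / 2 - 2 * ψ z)) :=
    integral_nonneg fun z => mul_nonneg (hG0 z) (exp_pos _).le
  have hαi := fun j => (hα j).integrable_norm_pow (by simp)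
  set S := ∑ j, ∫ z, ‖α j z‖ ^ 2 with hS
  set B := ∫ z, ‖d z‖ ^ 2 * rexp (φ z + ψ z ^ 2 / 2 - 2 * ψ z) with hB
  have hBi : Integrable fun z => ‖d z‖ ^ 2 * rexp (φ z + ψ z ^ 2 / 2 - 2 * ψ z) :=
    integrable_norm_sq_mul_exp hΩ hd (by fun_prop)
  set M := ∫ z, G z * rexp (-(φ z + ψ z ^ 2 / 2 - 2 * ψ z)) with hMdef
  suffices key : ∀ ε, 0 < ε → ‖∑ j, ∫ z, wderBar n j v z
      * rexp (-((φ z + ψ z ^ 2 / 2 - ψ z) / 2)) * conj (α j z)‖ ^ 2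
      ≤ M * (4 * B + ε * (6 * n * S)) by
    have ht := by
      have : Continuous fun ε => M * (4 * B + ε * (6 * n * S)) := by fun_prop
      have := (this.tendsto 0).mono_left (nhdsWithin_le_nhds (s := Ioi 0))
      simpa using this
    exact ge_of_tendsto ht (by filter_upwards [self_mem_nhdsWithin] with ε hε using key ε hε)
  intro ε hε
  obtain ⟨χ, hχt, hχ01, hχ1, hχε⟩ := hχ ε hε
  set χc : ℂ^n → ℂ := fun z => χ z with hχc
  obtain ⟨θ, hθ, -, hθΩ, -, hθ1⟩ := exists_contDiff_cutoff
    hΩ (hχt.hasCompactSupport.isCompact.union (hGc.isCompact.union hd.hasCompactSupport.isCompact))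
    (union_subset hχt.tsupport_subset (union_subset hGs hd.tsupport_subset))
  set U := interior {z | θ z = 1} ∩ Ω with hU
  have hUo : IsOpen U := isOpen_interior.inter hΩ
  have hUΩ : U ⊆ Ω := inter_subset_right
  have hKU : tsupport χc ∪ (tsupport G ∪ tsupport d) ⊆ U := fun z hz =>
    ⟨mem_interior_iff_mem_nhds.2 (hθ1 z hz), union_subset hχt.tsupport_subset
      (union_subset hGs hd.tsupport_subset) hz⟩
  have hθU : ∀ z ∈ U, θ z = 1 := fun z hz => (interior_subset hz.1 : z ∈ {z | θ z = 1})
  have hθφ : ∀ f, ∀ z ∈ U, (fun z => θ z * f z) =ᶠ[𝓝 z] f := fun f z hz => by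
    filter_upwards [hUo.mem_nhds hz] with y hy
    rw [hθU y hy, one_mul]
  have hG0' : ∀ z ∉ U, G z = 0 := fun z hz =>
    image_eq_zero_of_notMem_tsupport fun h => hz (hKU (inr (inl h)))
  have hχ0' : ∀ z ∉ U, z ∉ tsupport χc := fun z hz h => hz (hKU (inl h))
  have hvU : tsupport v ⊆ tsupport χc := fun z hz => subset_tsupport _ (by simp [hχc, hχ1 z hz])
  have hτ0 : ∀ τ, IsTestFun n τ U → ∀ z ∉ U, z ∉ tsupport τ := fun τ hτ z hz h =>
    hz (hτ.tsupport_subset h)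
  have key := cut_estimate_global hUo
    (contDiff_mul_of_tsupport_subset hΩ hθ hθΩ hφ) (contDiff_mul_of_tsupport_subset hΩ hθ hθΩ hψ) rfl
    (fun z hz X => by
      rw [pg_congr (hθφ ψ z hz), lv_congr (hθφ ψ z hz), hθU z hz, one_mul]; exact hpg z (hUΩ hz) X)
    (fun z hz X => by rw [lv_congr (hθφ φ z hz)]; exact hlv z (hUΩ hz) X)
    hv.contDiff hv.hasCompactSupport hG hGc hG0
    (fun z hz X => by rw [lv_congr (hθφ φ z hz)]; exact hvG z (hUΩ hz) X) hα hαm hd.contDiff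
    (fun τ hτ j k => by
      have hh := hcurl τ ⟨hτ.1, hτ.2.1, hτ.2.2.trans hUΩ⟩ j k
      refine (integral_congr_ae (.of_forall fun z => ?_)).trans
        (hh.trans (integral_congr_ae (.of_forall fun z => ?_)))
      all_goals
        by_cases hz : z ∈ U
        · simp [hθU z hz, one_mul]
        · simp [wderBar_eq_zero_of_notMem (hτ0 τ hτ z hz), mul_zero])
    (fun τ hτ => by
      rw [← hdiv τ ⟨hτ.1, hτ.2.1, hτ.2.2.trans hUΩ⟩]
      refine sum_congr rfl fun j _ => integral_congr_ae (.of_forall fun z => ?_)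
      by_cases hz : z ∈ U
      · simp [hθU z hz, one_mul]
      · simp [wder_eq_zero_of_notMem (hτ0 τ hτ z hz), mul_zero])
    ⟨hχt.1, hχt.2.1, fun z hz => hKU (inl hz)⟩
  have e1 : ∀ j, ∫ z, wderBar n j v z * rexp (-((φ z + ψ z ^ 2 / 2 - ψ z) / 2))
        * conj (α j z) = ∫ z, wderBar n j v z
          * rexp (-(θ z * φ z + (θ z * ψ z) ^ 2 / 2 - θ z * ψ z)) * conj (χc z
          * rexp ((θ z * φ z + (θ z * ψ z) ^ 2 / 2 - θ z * ψ z) / 2) * α j z) := fun j => by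
    refine integral_congr_ae (.of_forall fun z => ?_)
    by_cases hz : z ∈ tsupport v
    · have hzU := hKU (inl (hvU hz))
      simp only [hθU z hzU, one_mul, hχc, hχ1 z hz, map_mul, conj_ofReal]
      set q := φ z + ψ z ^ 2 / 2 - ψ z
      have : rexp (-(q / 2)) = rexp (-q) * rexp (q / 2) := by
        rw [← Real.exp_add]; ring_nf
      rw [this]; push_cast; ring
    · simp [wderBar_eq_zero_of_notMem hz, zero_mul]
  have e2 : ∫ z, G z * rexp (-(θ z * φ z + (θ z * ψ z) ^ 2 / 2 - 2 * (θ z * ψ z))) = M := by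
    refine integral_congr_ae (.of_forall fun z => ?_)
    by_cases hz : z ∈ U
    · simp [hθU z hz, one_mul]
    · simp [hG0' z hz, zero_mul]
  simp only [e1]
  refine key.trans ?_
  rw [e2]
  refine mul_le_mul_of_nonneg_left ?_ hM
  have hχn : ∀ z, ‖χc z‖ ≤ 1 := fun z => by
    simp [hχc, norm_real, norm_eq_abs, abs_le]; constructor <;> linarith [(hχ01 z).1, (hχ01 z).2]
  have hbar : ∀ j z, ‖wderBar n j χc z‖ = ‖wder n j χc z‖ := fun j z => by
    rw [wderBar_ofReal, RCLike.norm_conj]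
  have hsum : ∫ z, ∑ j, ‖α j z‖ ^ 2 = S := integral_finsetSum _ fun j _ => hαi j
  have hsi : Integrable fun z => ∑ j, ‖α j z‖ ^ 2 := integrable_finsetSum _ fun j _ => hαi j
  -- the common pointwise bound for one commutator term
  have hterm : ∀ z ∈ U, ∀ j k, ‖wder n j χc z * rexp ((φ z + ψ z ^ 2 / 2 - ψ z) / 2) * α k z‖ ^ 2
      * rexp (-(φ z + ψ z ^ 2 / 2)) ≤ ε * ‖α k z‖ ^ 2 := fun z hz j k => by
    have h1 := hχε z (hUΩ hz) j
    have h2 : rexp ((φ z + ψ z ^ 2 / 2 - ψ z) / 2) ^ 2 * rexp (-(φ z + ψ z ^ 2 / 2))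
        = rexp (-ψ z) := by
      rw [← Real.exp_nat_mul, ← Real.exp_add]; ring_nf
    rw [norm_mul, norm_mul, norm_real, norm_eq_abs, abs_exp]
    calc _ = ‖wder n j χc z‖ ^ 2 * (rexp ((φ z + ψ z ^ 2 / 2 - ψ z) / 2) ^ 2
          * rexp (-(φ z + ψ z ^ 2 / 2))) * ‖α k z‖ ^ 2 := by ring
      _ ≤ _ := by rw [h2]; gcongr
  have b1 : ∫ z, ‖χc z * rexp (θ z * φ z + (θ z * ψ z) ^ 2 / 2 - θ z * ψ z) * d z
            + ∑ j, wder n j χc z * rexp ((θ z * φ z + (θ z * ψ z) ^ 2 / 2 - θ z * ψ z) / 2) * α j z‖ ^ 2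
          * rexp (-(θ z * φ z + (θ z * ψ z) ^ 2 / 2)) ≤ 2 * B + ε * (2 * n * S) := by
    have hi : Integrable fun z => 2 * (‖d z‖ ^ 2 * rexp (φ z + ψ z ^ 2 / 2 - 2 * ψ z))
        + (ε * (2 * n)) * ∑ j, ‖α j z‖ ^ 2 := (hBi.const_mul 2).add (hsi.const_mul _)
    have hval : ∫ z, (2 * (‖d z‖ ^ 2 * rexp (φ z + ψ z ^ 2 / 2 - 2 * ψ z))
        + (ε * (2 * n)) * ∑ j, ‖α j z‖ ^ 2) = 2 * B + ε * (2 * n * S) := by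
      rw [integral_add (hBi.const_mul 2) (hsi.const_mul _), integral_const_mul, integral_const_mul, hsum]
      ring
    rw [← hval]
    refine integral_mono_of_nonneg (.of_forall fun z => by positivity) hi
      (.of_forall fun z => ?_)
    by_cases hz : z ∈ U
    · simp only [hθU z hz, one_mul]
      have h3 : ‖χc z * rexp (φ z + ψ z ^ 2 / 2 - ψ z) * d z‖ ^ 2 * rexp (-(φ z + ψ z ^ 2 / 2))
          ≤ ‖d z‖ ^ 2 * rexp (φ z + ψ z ^ 2 / 2 - 2 * ψ z) := by
        have h2 : rexp (φ z + ψ z ^ 2 / 2 - ψ z) ^ 2 * rexp (-(φ z + ψ z ^ 2 / 2))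
            = rexp (φ z + ψ z ^ 2 / 2 - 2 * ψ z) := by
          rw [← Real.exp_nat_mul, ← Real.exp_add]; ring_nf
        rw [norm_mul, norm_mul, norm_real (rexp _), norm_eq_abs (rexp _), abs_exp]
        calc _ = ‖χc z‖ ^ 2 * (‖d z‖ ^ 2 * (rexp (φ z + ψ z ^ 2 / 2 - ψ z) ^ 2
              * rexp (-(φ z + ψ z ^ 2 / 2)))) := by ring
          _ ≤ 1 * (‖d z‖ ^ 2 * (rexp (φ z + ψ z ^ 2 / 2 - ψ z) ^ 2
              * rexp (-(φ z + ψ z ^ 2 / 2)))) := by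
            gcongr
            exact pow_le_one₀ (norm_nonneg _) (hχn z)
          _ = _ := by rw [h2, one_mul]
      have h4 : ‖∑ j, wder n j χc z * rexp ((φ z + ψ z ^ 2 / 2 - ψ z) / 2) * α j z‖ ^ 2
          * rexp (-(φ z + ψ z ^ 2 / 2)) ≤ n * (ε * ∑ j, ‖α j z‖ ^ 2) := by
        calc _ ≤ (n * ∑ j, ‖wder n j χc z * rexp ((φ z + ψ z ^ 2 / 2 - ψ z) / 2) * α j z‖ ^ 2)
              * rexp (-(φ z + ψ z ^ 2 / 2)) := by gcongr; exact norm_sum_sq_le_card _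
          _ ≤ _ := by
            rw [mul_assoc, sum_mul]
            refine mul_le_mul_of_nonneg_left ?_ (Nat.cast_nonneg n)
            rw [mul_sum]
            exact sum_le_sum fun j _ => hterm z hz j j
      refine (mul_le_mul_of_nonneg_right norm_add_sq_le_two (exp_pos _).le).trans ?_
      nlinarith
    · have hz' := hχ0' z hz
      simp [wder_eq_zero_of_notMem hz', image_eq_zero_of_notMem_tsupport hz', zero_mul,
        sum_const_zero, add_zero, norm_zero, ne_eq, OfNat.ofNat_ne_zero, not_false_eq_true,
        zero_pow]
      positivity
  have b2 : ∀ j k, ∫ z, ‖wderBar n j χc z * rexp ((θ z * φ z + (θ z * ψ z) ^ 2 / 2 - θ z * ψ z) / 2) * α k z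
            - wderBar n k χc z * rexp ((θ z * φ z + (θ z * ψ z) ^ 2 / 2 - θ z * ψ z) / 2) * α j z‖ ^ 2
          * rexp (-(θ z * φ z + (θ z * ψ z) ^ 2 / 2))
        ≤ 2 * ε * (∫ z, ‖α k z‖ ^ 2) + 2 * ε * ∫ z, ‖α j z‖ ^ 2 := fun j k => by
    rw [← integral_const_mul, ← integral_const_mul,
      ← integral_add ((hαi k).const_mul _) ((hαi j).const_mul _)]
    refine integral_mono_of_nonneg (.of_forall fun z => by positivity)
      (((hαi k).const_mul _).add ((hαi j).const_mul _)) (.of_forall fun z => ?_)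
    by_cases hz : z ∈ U
    · simp [hθU z hz]
      refine (mul_le_mul_of_nonneg_right norm_sub_sq_le_two (exp_pos _).le).trans ?_
      have h1 := hterm z hz j k
      have h2 := hterm z hz k j
      simp [norm_mul, hbar] at h1 h2 ⊢
      linarith
    · have hz' := hχ0' z hz
      simp [wderBar_eq_zero_of_notMem hz', zero_mul, sub_zero, norm_zero, ne_eq, OfNat.ofNat_ne_zero,
        not_false_eq_true, zero_pow]
      positivity
  have b3 : ∑ j : Fin n, ∑ k : Fin n, (2 * ε * (∫ z, ‖α k z‖ ^ 2) + 2 * ε * ∫ z, ‖α j z‖ ^ 2)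
      = 4 * n * ε * S := by
    simp [sum_add_distrib, ← mul_sum, Finset.sum_const, Finset.card_univ,
      Fintype.card_fin, nsmul_eq_mul]
    ring
  have b4 := sum_le_sum fun j (_ : j ∈ Finset.univ) =>
    sum_le_sum fun k (_ : k ∈ Finset.univ) => b2 j k
  linarith

lemma integral_wderBar_wderBar_comm {w} (hu : IsTestFun n u Ω)
    (hw : IsTestFun n w Ω) (j k) :
    ∫ z, wderBar n j u z * wderBar n k w z = ∫ z, wderBar n k u z * wderBar n j w z := by
  rw [integral_wderBar_mul hu.contDiff (hw.contDiff.wderBar k) hu.hasCompactSupport,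
    integral_wderBar_mul hu.contDiff (hw.contDiff.wderBar j) hu.hasCompactSupport]
  simp [fun z => wderBar_wderBar_comm (hw.contDiff.contDiffAt_two z) j k]

/-- The element of `L²(ℂⁿ)ⁿ` defined by square integrable components. -/
noncomputable def formLp (hα : ∀ j, MemLp (α j) 2) :
    PiLp 2 (fun _ : Fin n => Lp ℂ 2 (volume : Measure ℂ^n)) :=
  WithLp.toLp 2 fun j => (hα j).toLp (α j)

lemma inner_formLp (hα : ∀ j, MemLp (α j) 2)
    (y) :
    inner ℂ (formLp hα) y = ∑ j, ∫ z, y j z * conj (α j z) := by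
  refine sum_congr rfl fun j _ => ?_
  refine integral_congr_ae ?_
  filter_upwards [(hα j).coeFn_toLp] with z hz
  simp only [formLp, RCLike.inner_apply]
  rw [hz]

lemma inner_formLp_formLp (hα : ∀ j, MemLp (α j) 2) (hβ : ∀ j, MemLp (β j) 2) :
    inner ℂ (formLp hα) (formLp hβ) = ∑ j, ∫ z, β j z * conj (α j z) := by
  rw [inner_formLp]
  refine sum_congr rfl fun j _ => integral_congr_ae ?_
  filter_upwards [(hβ j).coeFn_toLp] with z hz
  simp only [formLp]
  rw [hz]

/-- Orthogonal projection of a test form onto the weakly `∂̄`-closed forms in `L²(e^{-p})`, after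
multiplication by `e^{p/2}`. -/
lemma exists_closed_projection (hΩ : IsOpen Ω) {p} (hp : ContDiffOn ℝ ∞ p Ω)
    {a : Fin n → ℂ^n → ℂ} (ha : ∀ j, IsTestFun n (a j) Ω) :
    ∃ α : Fin n → ℂ^n → ℂ, (∀ j, MemLp (α j) 2) ∧ (∀ j, Measurable (α j)) ∧
      (∀ τ, IsTestFun n τ Ω → ∀ j k, ∫ z, α k z * (rexp (p z / 2) * wderBar n j τ z)
          = ∫ z, α j z * (rexp (p z / 2) * wderBar n k τ z)) ∧ ∀ u, IsTestFun n u Ω →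
        ∑ j, ∫ z, α j z * (rexp (-(p z / 2)) * conj (wderBar n j u z))
          = ∑ j, ∫ z, a j z * conj (wderBar n j u z) := by
  have he : ContDiffOn ℝ ∞ (fun z => (rexp (p z / 2) : ℂ)) Ω :=
    ofRealCLM.contDiff.comp_contDiffOn (Real.contDiff_exp.comp_contDiffOn (hp.div_const 2))
  have he' :=
    ofRealCLM.contDiff.comp_contDiffOn (Real.contDiff_exp.comp_contDiffOn (hp.div_const 2).neg)
  have hee : ∀ z, (rexp (p z / 2) : ℂ) * rexp (-(p z / 2)) = 1 := fun z => by
    rw [← ofReal_mul, ← Real.exp_add]; simp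
  have hE := fun {f} (hf : IsTestFun n f Ω) => hf.mul_left hΩ he
  have hE' := fun {f} (hf : IsTestFun n f Ω) => hf.mul_left hΩ he'
  let F := fun τ j k i z =>
    rexp (p z / 2) * ((if i = j then wder n k τ z else 0) - (if i = k then wder n j τ z else 0))
  have hF0 : ∀ τ, IsTestFun n τ Ω → ∀ j k i, IsTestFun n
      (fun z => (if i = j then wder n k τ z else 0) - (if i = k then wder n j τ z else 0)) Ω :=
    fun τ hτ j k i => by
      have h0 : IsTestFun n (fun _ => 0) Ω := ⟨contDiff_const, HasCompactSupport.zero, by simp⟩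
      have h1 : IsTestFun n (fun z => if i = j then wder n k τ z else 0) Ω := by
        split_ifs
        · exact hτ.wder k
        · exact h0
      have h2 : IsTestFun n (fun z => if i = k then wder n j τ z else 0) Ω := by
        split_ifs
        · exact hτ.wder j
        · exact h0
      exact ⟨h1.1.sub h2.1, h1.2.1.sub h2.2.1, (tsupport_sub _ _).trans (union_subset h1.2.2 h2.2.2)⟩
  have hF :=
    fun τ hτ j k i => hE (hF0 τ hτ j k i)
  have hFm :=
    fun τ hτ j k i => (hF τ hτ j k i).memLp
  let S :=
    {x | ∃ τ, ∃ hτ, ∃ j k, x = formLp (hFm τ hτ j k)}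
  let Kr := (Submodule.span ℂ S)ᗮ
  haveI hKo := Submodule.HasOrthogonalProjection.ofCompleteSpace Kr
  have hKr : ∀ y, (∀ x ∈ S, inner ℂ x y = 0) → y ∈ Kr := fun y hy => by
    intro x hx
    induction hx using Submodule.span_induction with
    | mem x hx => exact hy x hx
    | zero => simp
    | add x x' _ _ h h' => rw [inner_add_left, h, h', add_zero]
    | smul c x _ h => rw [inner_smul_left, h, mul_zero]
  -- splitting the pairing with `F`
  have hsplit : ∀ (y : Fin n → ℂ^n → ℂ), (∀ i, MemLp (y i) 2) → ∀ τ, IsTestFun n τ Ω → ∀ j k,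
      ∑ i, ∫ z, y i z * conj (F τ j k i z)
        = (∫ z, y j z * (rexp (p z / 2) * wderBar n k (fun x => conj (τ x)) z))
          - ∫ z, y k z * (rexp (p z / 2) * wderBar n j (fun x => conj (τ x)) z) := by
    intro y hy τ hτ j k
    have h1 : ∀ i, ∫ z, y i z * conj (F τ j k i z)
        = (if i = j then ∫ z, y j z * (rexp (p z / 2) * wderBar n k (fun x => conj (τ x)) z)
            else 0)
          - (if i = k then ∫ z, y k z * (rexp (p z / 2) * wderBar n j (fun x => conj (τ x)) z)
            else 0) := fun i => by
      have e1 : ∀ z, y i z * conj (F τ j k i z)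
          = (if i = j then y i z * (rexp (p z / 2) * wderBar n k (fun x => conj (τ x)) z) else 0)
            - (if i = k then y i z * (rexp (p z / 2) * wderBar n j (fun x => conj (τ x)) z)
              else 0) := fun z => by
        simp only [F, map_mul, conj_ofReal, wderBar_conj]
        split_ifs <;> simp <;> ring
      simp [e1]
      split_ifs with h h' h'
      · subst h; subst h'; simp
      · subst h; simp
      · subst h'; simp [integral_neg]
      · simp
    rw [sum_congr rfl fun i _ => h1 i]
    simp
  have hβ : ∀ u, IsTestFun n u Ω → ∀ j, MemLp (fun z => rexp (-(p z / 2)) * wderBar n j u z) 2 :=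
    fun u hu j => (hE' (hu.wderBar j)).memLp
  have hβK : ∀ u (hu), formLp (hβ u hu) ∈ Kr := fun u hu => by
    refine hKr _ ?_
    rintro x ⟨τ, hτ, j, k, rfl⟩
    rw [inner_formLp_formLp, hsplit _ (hβ u hu) τ hτ, sub_eq_zero]
    refine Eq.trans (integral_congr_ae (.of_forall fun z => ?_))
      ((integral_wderBar_wderBar_comm hu hτ.star j k).trans
      (integral_congr_ae (.of_forall fun z => ?_)))
    · linear_combination (wderBar n j u z * wderBar n k (fun x => conj (τ x)) z) * hee z
    · linear_combination -(wderBar n k u z * wderBar n j (fun x => conj (τ x)) z) * hee z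
  have hα0 := fun j => (hE (ha j)).memLp
  set x0 := formLp hα0 with hx0
  set x1 := Kr.starProjection x0 with hx1
  have hm := fun j => Lp.memLp (x1 j)
  refine ⟨fun j z => x1 j z, hm,
    fun j => (Lp.stronglyMeasurable (x1 j)).measurable, fun τ hτ j k => ?_, fun u hu => ?_⟩
  · have h1 := Kr.starProjection_apply_mem x0
    have h2 := (Submodule.mem_orthogonal _ _).1 h1 (formLp (hFm _ hτ.star k j))
      (Submodule.subset_span ⟨_, hτ.star, k, j, rfl⟩)
    rw [inner_formLp, hsplit (fun j z => x1 j z) hm _ hτ.star, sub_eq_zero] at h2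
    simpa using h2
  · have h1 : x0 - x1 ∈ Krᗮ := Kr.sub_starProjection_mem_orthogonal x0
    have h2 := (Submodule.mem_orthogonal _ _).1 h1 _ (hβK u hu)
    rw [inner_sub_right, sub_eq_zero, inner_formLp_formLp, inner_formLp] at h2
    refine Eq.trans (sum_congr rfl fun j _ => integral_congr_ae (.of_forall fun z => ?_))
      (h2.symm.trans (sum_congr rfl fun j _ => integral_congr_ae (.of_forall fun z => ?_)))
    · simp only [map_mul, conj_ofReal]
    · simp only [map_mul, conj_ofReal]
      linear_combination (a j z * conj (wderBar n j u z)) * hee z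

/-- A smooth exhaustion function whose logarithm is plurisubharmonic, with controlled gradient. -/
structure IsGoodExhaustion (s : ℂ^n → ℝ) (Ω) where
  contDiffOn : ContDiffOn ℝ ∞ s Ω
  nonneg : ∀ z ∈ Ω, 0 ≤ s z
  isCompact : ∀ R, IsCompact {z | z ∈ Ω ∧ s z ≤ R}
  pg_le : ∀ z ∈ Ω, ∀ X, pg s z X ≤ s z * lv s z X
  pg_le_pow : ∃ C, ∀ z ∈ Ω, ∀ X, pg s z X ≤ C * s z ^ 4 * ‖X‖ ^ 2

lemma pow_four_mul_exp_neg_le {x l} (hx : 0 ≤ x) (hl : 0 < l) :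
    x ^ 4 * rexp (-(l * x)) ≤ 24 / l ^ 4 := by
  have h := Real.pow_div_factorial_le_exp (l * x) (by positivity) 4
  rw [Real.exp_neg, ← div_eq_mul_inv, div_le_div_iff₀ (exp_pos _) (by positivity)]
  nlinarith

lemma exists_deriv_bound_smoothTransition : ∃ C, 0 ≤ C ∧ ∀ t ∈ Icc 0 2,
    (deriv (fun t => smoothTransition (2 - t)) t) ^ 2 ≤ C := by
  have h : ContDiff ℝ 1 (fun t => smoothTransition (2 - t)) :=
    smoothTransition.contDiff.comp (contDiff_const.sub contDiff_id)
  have hc :=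
    (h.continuous_deriv le_rfl).pow 2
  obtain ⟨C, hC⟩ := (isCompact_Icc).bddAbove_image hc.continuousOn
  exact ⟨max C 0, le_max_right _ _, fun t ht => (hC ⟨t, ht, rfl⟩).trans (le_max_left _ _)⟩

lemma IsGoodExhaustion.exists_cutoff (hs : IsGoodExhaustion s Ω)
    (hΩ : IsOpen Ω) (hK : IsCompact K) (hKΩ : K ⊆ Ω) {l} (hl : 0 < l) (hε : 0 < ε) :
    ∃ χ : ℂ^n → ℝ, IsTestFun n (fun z => χ z) Ω ∧
      (∀ z, 0 ≤ χ z ∧ χ z ≤ 1) ∧ (∀ z ∈ K, χ z = 1) ∧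
      ∀ z ∈ Ω, ∀ j, ‖wder n j (fun y => χ y) z‖ ^ 2 * rexp (-(l * s z)) ≤ ε := by
  classical
  obtain ⟨R0, hR0⟩ := hK.bddAbove_image (hs.contDiffOn.continuousOn.mono hKΩ)
  obtain ⟨C, hC⟩ := hs.pg_le_pow
  obtain ⟨D, hD0, hD⟩ := exists_deriv_bound_smoothTransition
  set η := fun t => smoothTransition (2 - t) with hη
  have hηc : ContDiff ℝ ∞ η := smoothTransition.contDiff.comp (contDiff_const.sub contDiff_id)
  set A := D * (|C| * (24 / l ^ 4)) / ε with hA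
  set R := max (max R0 1) A with hR
  have hR1 : 1 ≤ R := (le_max_right _ _).trans (le_max_left _ _)
  have hRpos := one_pos.trans_le hR1
  have hRR0 : R0 ≤ R := (le_max_left _ _).trans (le_max_left _ _)
  have hRA : A ≤ R := le_max_right _ _
  set L := {z | z ∈ Ω ∧ s z ≤ 2 * R} with hL
  have hLc : IsCompact L := hs.isCompact _
  set χ := fun z => if z ∈ Ω then η (s z / R) else 0 with hχ
  have hχΩ : ∀ z ∈ Ω, χ =ᶠ[𝓝 z] fun z => η (s z / R) := fun z hz => by
    filter_upwards [hΩ.mem_nhds hz] with y hy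
    simp [hχ, hy]
  have hχL : ∀ z ∉ L, χ z = 0 := fun z hz => by
    by_cases h : z ∈ Ω
    · simp [hχ, if_pos h]
      refine smoothTransition.zero_of_nonpos ?_
      have := not_le.1 fun h' => hz ⟨h, h'⟩
      have := (lt_div_iff₀ hRpos).2 this
      linarith
    · simp [hχ, h]
  have hsupp : tsupport (fun z => (χ z : ℂ)) ⊆ L := closure_minimal
    (fun z hz => by_contra fun h => hz (by simp [hχL z h])) hLc.isClosed
  have hχs := fun z hz =>
    (hηc.contDiffAt.comp z ((hs.contDiffOn.contDiffAt (hΩ.mem_nhds hz)).div_const R)).congr_of_eventuallyEq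
      (hχΩ z hz)
  refine ⟨χ, ⟨contDiff_iff_contDiffAt.2 fun z => ?_, hLc.of_isClosed_subset (isClosed_tsupport _) hsupp,
    hsupp.trans fun z hz => hz.1⟩, fun z => ?_, fun z hz => ?_, fun z hz j => ?_⟩
  · by_cases hz : z ∈ Ω
    · exact ofRealCLM.contDiff.contDiffAt.comp z (hχs z hz)
    · have h0 := fun h' => hz (hsupp h').1
      exact (contDiffAt_const).congr_of_eventuallyEq (notMem_tsupport_iff_eventuallyEq.1 h0)
  · simp [hχ]
    split_ifs
    · exact ⟨smoothTransition.nonneg _, smoothTransition.le_one _⟩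
    · simp
  · simp [hχ, if_pos (hKΩ hz)]
    refine smoothTransition.one_of_one_le ?_
    have := (hR0 ⟨z, hz, rfl⟩).trans hRR0
    have := (div_le_one hRpos).2 this
    linarith
  · by_cases hzL : z ∈ L
    · have hsd :=
        (hs.contDiffOn.contDiffAt (hΩ.mem_nhds hz)).differentiableAt (by simp)
      have h1 : wder n j (fun y => χ y) z = dz χ z (single j 1) := by
        rw [← sum_wder_mul ((hχs z hz).differentiableAt (by simp))]
        simp [Pi.single_apply]
      have hζ : deriv (fun t => η (t / R)) (s z) = deriv η (s z / R) / R := by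
        have h2 : HasDerivAt η (deriv η (s z / R)) (s z / R) :=
          (hηc.differentiable (by simp) _).hasDerivAt
        have := h2.comp (s z) ((hasDerivAt_id (s z)).div_const R)
        rw [show (fun t => η (t / R)) = η ∘ (fun t => id t / R) from rfl, this.deriv]
        ring
      have h3 : pg χ z (single j 1) = (deriv η (s z / R) / R) ^ 2 * pg s z (single j 1) := by
        rw [pg_congr (hχΩ z hz), ← hζ]
        exact pg_comp (χ := fun t => η (t / R)) hsd
          ((hηc.differentiable (by simp)).differentiableAt.comp _ (differentiableAt_id.div_const R)) _
      rw [h1, norm_dz_sq, h3]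
      have h4 : pg s z (single j 1) ≤ |C| * s z ^ 4 := by
        refine (hC z hz _).trans ?_
        have h5 : ‖(single j 1 : ℂ^n)‖ = 1 := by
          rw [Pi.norm_single]; simp
        rw [h5]
        have := hs.nonneg z hz
        nlinarith [le_abs_self C, pow_nonneg this 4]
      have h6 := hD _ ⟨div_nonneg (hs.nonneg z hz) hRpos.le,
        (div_le_iff₀ hRpos).2 hzL.2⟩
      have h7 := pow_four_mul_exp_neg_le (hs.nonneg z hz) hl
      calc (deriv η (s z / R) / R) ^ 2 * pg s z (single j 1) * rexp (-(l * s z))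
          ≤ (D / R ^ 2) * (|C| * s z ^ 4) * rexp (-(l * s z)) := by
            rw [div_pow]
            have := pg_nonneg s z (single j 1)
            gcongr
        _ = D * |C| * (s z ^ 4 * rexp (-(l * s z))) / R ^ 2 := by ring
        _ ≤ D * |C| * (24 / l ^ 4) / R ^ 2 := by gcongr
        _ = A * ε / R ^ 2 := by rw [hA]; field_simp
        _ ≤ ε := by
            rw [div_le_iff₀ (by positivity)]
            nlinarith [mul_nonneg hε.le hRpos.le]
    · have h0 := fun h' => hzL (hsupp h')
      rw [wder_eq_zero_of_notMem h0]
      simpa using hε.le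

lemma integrable_mul_of_tsupport_subset (hΩ : IsOpen Ω) {f} (hG : Continuous G)
    (hGc : HasCompactSupport G) (hGs : tsupport G ⊆ Ω) (hf : ContinuousOn f Ω) :
    Integrable fun z => G z * f z := by
  have hs : tsupport (fun z => G z * f z) ⊆ tsupport G := tsupport_mul_subset_left
  exact ((hG.continuousOn.mul hf).continuous_of_tsupport_subset hΩ (hs.trans hGs)).integrable_of_hasCompactSupport
    hGc.mul_right

/-- The a priori estimate with the auxiliary weight. -/
lemma weighted_estimate (hΩ : IsOpen Ω) (hφ : ContDiffOn ℝ ∞ φ Ω)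
    (hs : IsGoodExhaustion s Ω) (hlv : ∀ z ∈ Ω, ∀ X, 0 ≤ lv φ z X) (hv : IsTestFun n v Ω)
    (hG : Continuous G) (hGc : HasCompactSupport G) (hG0 : ∀ z, 0 ≤ G z) (hGs : tsupport G ⊆ Ω)
    (hvG : ∀ z ∈ Ω, ∀ X, ‖∑ j, wderBar n j v z * conj (X j)‖ ^ 2 ≤ G z * lv φ z X)
    {a : Fin n → ℂ^n → ℂ} (ha : ∀ j, IsTestFun n (a j) Ω) {l} (hl : 0 < l) :
    ‖∑ j, ∫ z, wderBar n j v z * conj (a j z)‖ ^ 2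
      ≤ (∫ z, G z * rexp (-(φ z + (l * s z) ^ 2 / 2 - 2 * (l * s z)))) *
        (4 * ∫ z, ‖∑ j, wder n j (a j) z‖ ^ 2
          * rexp (φ z + (l * s z) ^ 2 / 2 - 2 * (l * s z))) := by
  have hsd := hs.contDiffOn
  obtain ⟨α, hα, hαm, hcurl, hpair⟩ := exists_closed_projection hΩ
    (p := fun z => φ z + (l * s z) ^ 2 / 2 - l * s z) (by fun_prop) ha
  have key := cut_estimate hΩ hφ (by fun_prop) ?_ hlv hv hG hGc hG0
    hGs hvG hα hαm (d := fun z => ∑ j, wder n j (a j) z) (IsTestFun.sum fun j _ => (ha j).wder j) hcurl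
    ?_ fun ε hε => hs.exists_cutoff hΩ hv.hasCompactSupport.isCompact hv.tsupport_subset hl hε
  · refine le_trans (le_of_eq ?_) key
    congr 1
    have h1 := congrArg (starRingEnd ℂ) (hpair v hv)
    rw [map_sum, map_sum] at h1
    simp only [← integral_conj, map_mul, conj_ofReal, conj_conj] at h1
    congr 1
    refine Eq.trans (sum_congr rfl fun j _ => ?_) (h1.symm.trans (sum_congr rfl fun j _ => ?_))
    · exact integral_congr_ae (.of_forall fun z => mul_comm _ _)
    · exact integral_congr_ae (.of_forall fun z => by ring)
  · intro z hz X
    have hz2 := (hsd.contDiffAt (hΩ.mem_nhds hz)).of_le two_le_infty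
    have hlin : ContDiff ℝ 2 (fun t => l * t) := by fun_prop
    have hd1 : deriv (fun t => l * t) = fun _ => l := by
      simpa using ((hasDerivAt_id t).const_mul l).deriv
    rw [pg_comp (hz2.differentiableAt (by simp)) (hlin.differentiable (by simp) _),
      lv_comp hz2 hlin.contDiffAt]
    simp [deriv_const]
    nlinarith [hs.pg_le z hz X, sq_nonneg l]
  · intro τ hτ
    have h1 := hpair _ hτ.star
    simp only [wderBar_conj, conj_conj] at h1
    rw [h1]
    have h2 : ∀ j, ∫ z, a j z * wder n j τ z = -∫ z, wder n j (a j) z * τ z := fun j => by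
      rw [integral_wder_mul (ha j).contDiff hτ.contDiff (ha j).hasCompactSupport, neg_neg]
    simp only [h2, sum_mul]
    rw [Finset.sum_neg_distrib, integral_finsetSum]
    exact fun j _ => (((ha j).wder j).contDiff.continuous.mul hτ.contDiff.continuous).integrable_of_hasCompactSupport
      hτ.hasCompactSupport.mul_left

/-- The a priori estimate for the `∂̄`-equation with a bounded psh weight. -/
lemma dbar_estimate (hΩ : IsOpen Ω) (hφ : ContDiffOn ℝ ∞ φ Ω)
    (hs : IsGoodExhaustion s Ω) (hlv : ∀ z ∈ Ω, ∀ X, 0 ≤ lv φ z X) (hv : IsTestFun n v Ω)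
    (hG : Continuous G) (hGc : HasCompactSupport G) (hG0 : ∀ z, 0 ≤ G z) (hGs : tsupport G ⊆ Ω)
    (hvG : ∀ z ∈ Ω, ∀ X, ‖∑ j, wderBar n j v z * conj (X j)‖ ^ 2 ≤ G z * lv φ z X)
    {a : Fin n → ℂ^n → ℂ} (ha : ∀ j, IsTestFun n (a j) Ω) :
    ‖∑ j, ∫ z, wderBar n j v z * conj (a j z)‖ ^ 2 ≤ (∫ z, G z * rexp (-φ z)) *
        (4 * ∫ z, ‖∑ j, wder n j (a j) z‖ ^ 2 * rexp (φ z)) := by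
  have hd : IsTestFun n (fun z => ∑ j, wder n j (a j) z) Ω := IsTestFun.sum fun j _ => (ha j).wder j
  set d := fun z => ∑ j, wder n j (a j) z with hdd
  have hsd := hs.contDiffOn
  have hK := hGc.isCompact.union hd.hasCompactSupport.isCompact
  obtain ⟨R0, hR0⟩ := hK.bddAbove_image (hsd.continuousOn.mono (union_subset hGs hd.tsupport_subset))
  set R := max R0 0 with hR
  have hsR : ∀ z ∈ tsupport G ∪ tsupport d, s z ≤ R := fun z hz => (hR0 ⟨z, hz, rfl⟩).trans (le_max_left _ _)
  have hs0 := fun z hz =>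
    hs.nonneg z (union_subset hGs hd.tsupport_subset hz)
  set M := ∫ z, G z * rexp (-φ z) with hM
  set B := ∫ z, ‖d z‖ ^ 2 * rexp (φ z) with hB
  have hMn : 0 ≤ M := integral_nonneg fun z => mul_nonneg (hG0 z) (exp_pos _).le
  have key : ∀ l, 0 < l → ‖∑ j, ∫ z, wderBar n j v z * conj (a j z)‖ ^ 2
      ≤ (rexp (2 * (l * R)) * M) * (4 * (rexp ((l * R) ^ 2 / 2) * B)) := by
    intro l hl
    refine (weighted_estimate hΩ hφ hs hlv hv hG hGc hG0 hGs hvG ha hl).trans ?_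
    have hφc := hφ.continuousOn
    have hsc := hsd.continuousOn
    have h1 : ∫ z, G z * rexp (-(φ z + (l * s z) ^ 2 / 2 - 2 * (l * s z)))
        ≤ rexp (2 * (l * R)) * M := by
      rw [← integral_const_mul]
      refine integral_mono (integrable_mul_of_tsupport_subset hΩ hG hGc hGs (by fun_prop))
        ((integrable_mul_of_tsupport_subset hΩ hG hGc hGs (by fun_prop)).const_mul _) fun z => ?_
      by_cases hz : z ∈ tsupport G
      · have h2 := hsR z (inl hz)
        rw [mul_left_comm (rexp (2 * (l * R))), ← Real.exp_add]
        refine mul_le_mul_of_nonneg_left (exp_le_exp.2 ?_) (hG0 z)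
        nlinarith
      · simp [image_eq_zero_of_notMem_tsupport hz]
    have h2 : ∫ z, ‖d z‖ ^ 2 * rexp (φ z + (l * s z) ^ 2 / 2 - 2 * (l * s z))
        ≤ rexp ((l * R) ^ 2 / 2) * B := by
      rw [← integral_const_mul]
      refine integral_mono (integrable_norm_sq_mul_exp hΩ hd (by fun_prop))
        ((integrable_norm_sq_mul_exp hΩ hd hφ).const_mul _) fun z => ?_
      by_cases hz : z ∈ tsupport d
      · have h2 := hsR z (inr hz)
        have h3 := hs0 z (inr hz)
        rw [mul_left_comm (rexp ((l * R) ^ 2 / 2)), ← Real.exp_add]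
        refine mul_le_mul_of_nonneg_left (exp_le_exp.2 ?_) (by positivity)
        have h4 : 0 ≤ l * s z := by positivity
        have h5 : l * s z ≤ l * R := by gcongr
        nlinarith
      · simp [image_eq_zero_of_notMem_tsupport hz]
    gcongr
  have ht := by
    have : Continuous fun l => (rexp (2 * (l * R)) * M) * (4 * (rexp ((l * R) ^ 2 / 2) * B)) := by
      fun_prop
    have := (this.tendsto 0).mono_left (nhdsWithin_le_nhds (s := Ioi 0))
    simpa using this
  exact ge_of_tendsto ht (by filter_upwards [self_mem_nhdsWithin] with l hl using key l hl)

lemma measurePreserving_smul_of_norm_eq_one {c : ℂ} (hc : ‖c‖ = 1) :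
    MeasurePreserving (fun z : ℂ^n => c • z) volume volume := by
  have h1 := by
    exact (rotation ⟨c, by simp [Submonoid.unitSphere, hc]⟩).measurePreserving
  exact volume_preserving_pi fun _ => h1

/-- The reproducing formula of circle-invariant mollifiers for holomorphic functions. -/
lemma IsMollifier.mol_eq_self (hk : IsMollifier n ε k)
    {h} (hh : Continuous h) (hr : ε < r) (hd : DifferentiableOn ℂ h (ball z r)) :
    mol h (fun y => k y) z = h z := by
  have hmol : mol h (fun y => k y) z = ∫ t, h (z - t) * k t := by
    have := integral_sub_left_eq_self (fun t => h t * k (z - t)) volume z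
    rw [mol, ← this]
    simp
  have hrot : ∀ c : ℂ, ‖c‖ = 1 → ∫ t, h (z - c • t) * k t = mol h (fun y => k y) z := by
    intro c hc
    have h0 : c ≠ 0 := fun h => by simp [h] at hc
    have he : MeasurableEmbedding fun z : ℂ^n => c • z :=
      (Homeomorph.smulOfNeZero c h0).measurableEmbedding
    have := (measurePreserving_smul_of_norm_eq_one hc).integral_comp he
      (fun t => h (z - t) * k t)
    rw [hmol, ← this]
    simp [hk.rot c _ hc]
  set f := fun θ t => h (z - circleMap 0 1 θ • t) * k t with hf
  have hcm := continuous_circleMap 0 1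
  have hk0 := hk.contDiff_ofReal.continuous
  have hfc : Continuous (Function.uncurry f) := by
    exact (hh.comp (continuous_const.sub ((hcm.comp continuous_fst).smul continuous_snd))).mul
      (hk0.comp continuous_snd)
  obtain ⟨C, hC⟩ := (isCompact_closedBall z ε).exists_bound_of_continuousOn hh.continuousOn
  have hitg : Integrable (Function.uncurry f)
      ((volume.restrict (Ioc 0 (2 * Real.pi))).prod volume) := by
    refine Integrable.mono' ((hk.integrable.comp_snd _).const_mul C)
      hfc.aestronglyMeasurable (.of_forall fun q => ?_)
    simp [Function.uncurry, hf, norm_mul, norm_real, norm_eq_abs, abs_of_nonneg (hk.nonneg _)]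
    by_cases hq : ε < ‖q.2‖
    · simp [hk.eq_zero _ hq]
    · refine mul_le_mul_of_nonneg_right (hC _ ?_) (hk.nonneg _)
      simpa [norm_smul] using hq
  have h1 : ∫ θ in Ioc 0 (2 * Real.pi), ∫ t, f θ t = (2 * Real.pi) • mol h (fun y => k y) z := by
    have : ∀ θ, ∫ t, f θ t = mol h (fun y => k y) z := fun θ => hrot _ (by simp)
    simp [this]
    simp [Real.pi_pos.le]
  have h2 : ∀ t, ∫ θ in Ioc 0 (2 * Real.pi), f θ t = (2 * Real.pi) • (h z * k t) := fun t => by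
    by_cases ht : ε < ‖t‖
    · simp [hf, hk.eq_zero _ ht]
    · have hdc : DiffContOnCl ℂ (fun u : ℂ => h (z - u • t)) (ball 0 |1|) := by
        refine ⟨?_, (by fun_prop : Continuous fun u => h (z - u • t)).continuousOn⟩
        refine hd.comp (by fun_prop) fun u hu => ?_
        rw [mem_ball_iff_norm]
        simp [abs_one, mem_ball, dist_zero_right] at hu
        rw [sub_sub_cancel_left, norm_neg, norm_smul]
        nlinarith [norm_nonneg t]
      have h3 := hdc.circleAverage
      rw [Real.circleAverage_def, intervalIntegral.integral_of_le (by positivity)] at h3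
      simp only [zero_smul, sub_zero] at h3
      rw [integral_mul_const, ← smul_mul_assoc, ← h3, smul_inv_smul₀ (by positivity)]
  rw [integral_integral_swap hitg] at h1
  simp only [h2] at h1
  rw [integral_smul, integral_const_mul] at h1
  have h4 : ∫ t, (k t : ℂ) = 1 := by
    rw [integral_complex_ofReal, hk.integral_eq]; simp
  rw [h4, mul_one] at h1
  exact (smul_right_injective ℂ (by positivity : 2 * Real.pi ≠ 0) h1).symm

lemma differentiableAt_complex_of_wderBar
    (hg : DifferentiableAt ℝ g z) (h0 : ∀ j, wderBar n j g z = 0) : DifferentiableAt ℂ g z := by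
  rw [differentiableAt_iff_restrictScalars ℝ hg]
  set L := fderiv ℝ g z with hL
  have hI : ∀ X, L (I • X) = I * L X := fun X => by
    have h1 := sum_conj_mul_add_I_mul X L
    have h2 := fun j => by
      have := h0 j
      rw [wderBar_def] at this
      simpa [← hL] using this
    simp [h2, mul_zero, sum_const_zero] at h1
    linear_combination I * h1 + L (I • X) * I_mul_I
  have hs : ∀ (c) X, L (c • X) = c * L X := fun c X => by
    have hc := re_add_im c
    conv_lhs => rw [← hc]
    rw [add_smul, mul_smul, map_add, coe_smul, coe_smul, map_smul, map_smul, hI]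
    simp [real_smul]
    linear_combination (L X) * hc
  exact ⟨{ toFun := L, map_add' := map_add L, map_smul' := hs }, by rfl⟩

lemma IsMollifier.isTestFun_sub (hk : IsMollifier n ε k) {U} (hU : closedBall z ε ⊆ U) :
    IsTestFun n (fun t => k (z - t)) U := by
  have hs : tsupport (fun t => (k (z - t) : ℂ)) ⊆ closedBall z ε :=
    closure_minimal (fun t ht => by
      by_contra h
      refine ht ?_
      simp [ofReal_eq_zero]
      refine hk.eq_zero _ ?_
      rw [norm_sub_rev, ← mem_closedBall_iff_norm.not.trans not_le]
      exact h) isClosed_closedBall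
  refine ⟨hk.contDiff_ofReal.comp (contDiff_const.sub contDiff_id), ?_, hs.trans hU⟩
  exact (isCompact_closedBall z ε).of_isClosed_subset (isClosed_tsupport _) hs

lemma differentiableAt_mol (hf : LocallyIntegrable f) {U}
    (hfU : ∀ τ, IsTestFun n τ U → ∀ j, ∫ z, f z * wderBar n j τ z = 0) (hk : IsMollifier n ε k)
    (hz : closedBall z ε ⊆ U) : DifferentiableAt ℂ (mol f fun y => k y) z := by
  refine differentiableAt_complex_of_wderBar
    ((contDiff_mol hf hk.contDiff_ofReal hk.hasCompactSupport_ofReal).differentiable (by simp) z) fun j => ?_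
  rw [wderBar_mol hf hk.contDiff_ofReal hk.hasCompactSupport_ofReal]
  have h := hfU _ (hk.isTestFun_sub hz) j
  simp [wderBar_comp_sub_left (hk.contDiff_ofReal.differentiable (by simp)) j z,
    mul_neg, integral_neg, neg_eq_zero] at h
  exact h

/-- Weyl's lemma near a point. -/
lemma weyl_local (hf : MemLp f 2) (hm : Measurable f) (hK : IsCompact K) (hfK : ∀ z ∉ K, f z = 0)
    {z₀} (hr : 0 < r)
    (hfU : ∀ τ, IsTestFun n τ (ball z₀ (4 * r)) → ∀ j, ∫ z, f z * wderBar n j τ z = 0) :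
    ∃ g, DifferentiableOn ℂ g (ball z₀ r) ∧ ∀ᵐ z, z ∈ ball z₀ r → f z = g z := by
  have hl := hf.locallyIntegrable (by norm_num)
  obtain ⟨κ, hκ⟩ := exists_isMollifier n hr
  obtain ⟨k, hk⟩ := exists_mollifier_seq n hr
  obtain ⟨hs, -, hT⟩ := tendstoL2_mol_of_zero hr hk hK.cthickening subset_rfl hf hm hfK
  have hsub : ∀ {z w} {ε}, ε ≤ r → z ∈ ball z₀ r → w ∈ ball z (2 * r) →
      closedBall w ε ⊆ ball z₀ (4 * r) := by
    intro z w ε hε hz hw x hx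
    simp [mem_ball, mem_closedBall] at *
    linarith [dist_triangle x w z₀, dist_triangle w z z₀]
  refine ⟨mol f fun y => κ y, fun z hz => ?_, ?_⟩
  · exact (differentiableAt_mol hl hfU hκ (hsub le_rfl hz (mem_ball_self (by linarith)))).differentiableWithinAt
  have h1 : ∀ m, ∀ z ∈ ball z₀ r,
      mol (mol f fun y => k m y) (fun y => κ y) z = mol f (fun y => k m y) z := by
    intro m z hz
    refine hκ.mol_eq_self (hs m).continuous (r := 2 * r) (by linarith) fun w hw => ?_
    refine (differentiableAt_mol hl hfU (hk m) (hsub ?_ hz hw)).differentiableWithinAt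
    exact div_le_self hr.le (by linarith)
  have h2 : ∀ z, Tendsto (fun m => mol (mol f fun y => k m y) (fun y => κ y) z) atTop
      (𝓝 (mol f (fun y => κ y) z)) := by
    intro z
    have hτ : MemLp (fun t => (κ (z - t) : ℂ)) 2 :=
      (hκ.isTestFun_sub (subset_univ _)).memLp
    have := hT.integral_mul_conj (TendstoL2.const hτ)
    simpa [mol] using this
  have h3 := tendstoInMeasure_of_tendsto_eLpNorm (by norm_num)
    (fun m => (hs m).continuous.aestronglyMeasurable) hf.1 hT.tendsto
  obtain ⟨ns, hns, hae⟩ := h3.exists_seq_tendsto_ae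
  filter_upwards [hae] with z hz hzb
  refine tendsto_nhds_unique hz ?_
  have := (h2 z).comp hns.tendsto_atTop
  simpa [comp_def, h1 _ z hzb] using this

/-- Weyl's lemma: weakly holomorphic functions are holomorphic. -/
lemma weyl (hΩ : IsOpen Ω) (hm : Measurable f)
    (hf : ∀ σ, IsTestFun n σ Ω → MemLp (fun z => σ z * f z) 2)
    (hfΩ : ∀ τ, IsTestFun n τ Ω → ∀ j, ∫ z, f z * wderBar n j τ z = 0) :
    ∃ g, DifferentiableOn ℂ g Ω ∧ ∀ᵐ z, z ∈ Ω → f z = g z := by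
  have hloc : ∀ z : Ω, ∃ r > 0, ∃ g, ball (z : ℂ^n) r ⊆ Ω ∧
      DifferentiableOn ℂ g (ball (z : ℂ^n) r) ∧
      ∀ᵐ y, y ∈ ball (z : ℂ^n) r → f y = g y := by
    rintro ⟨z, hz⟩
    obtain ⟨R, hR, hRΩ⟩ := nhds_basis_closedBall.mem_iff.1 (hΩ.mem_nhds hz)
    obtain ⟨θ, hθ, hθc, hθs, -, hθ1⟩ := exists_contDiff_cutoff hΩ (isCompact_closedBall z R) hRΩ
    have hθt : IsTestFun n (fun y => θ y) Ω :=
      ⟨contDiff_ofReal_comp hθ, hθc.comp_left (g := fun x : ℝ => (x : ℂ)) (by simp),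
        (tsupport_comp_subset (g := fun x : ℝ => (x : ℂ)) (by simp) θ).trans hθs⟩
    obtain ⟨g, hg, hgf⟩ := weyl_local (hf _ hθt) (hθt.measurable.mul hm) hθc.isCompact
      (fun y hy => by simp [image_eq_zero_of_notMem_tsupport hy]) (r := R / 4) (by linarith)
      (fun τ hτ j => by
        rw [← hfΩ τ ⟨hτ.1, hτ.2.1, hτ.2.2.trans ((ball_subset_closedBall.trans
          (closedBall_subset_closedBall (by linarith))).trans hRΩ)⟩ j]
        congr 1; ext y
        by_cases hy : y ∈ closedBall z R
        · rw [(hθ1 y hy).eq_of_nhds]; simp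
        · rw [(hτ.wderBar j).eq_zero (fun h => hy (ball_subset_closedBall
            (by simpa [mul_div_cancel₀] using h)))]
          simp)
    refine ⟨R / 4, by linarith, g, (ball_subset_closedBall.trans
          (closedBall_subset_closedBall (by linarith))).trans hRΩ, hg, ?_⟩
    filter_upwards [hgf] with y hy hyb
    rw [← hy hyb, (hθ1 y (closedBall_subset_closedBall (by linarith)
      (ball_subset_closedBall hyb))).eq_of_nhds]
    simp
  choose r hr g hrΩ hg hgf using hloc
  classical
  set G := fun z => if h : z ∈ Ω then g ⟨z, h⟩ z else 0 with hG
  have hGg : ∀ z : Ω, ∀ y ∈ ball (z : ℂ^n) (r z), G y = g z y := by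
    intro z y hy
    have hyΩ := hrΩ z hy
    simp [hG, dif_pos hyΩ]
    set U := ball (z : ℂ^n) (r z) ∩ ball y (r ⟨y, hyΩ⟩) with hU
    have hUo : IsOpen U := isOpen_ball.inter isOpen_ball
    have hae : g ⟨y, hyΩ⟩ =ᵐ[volume.restrict U] g z := by
      rw [EventuallyEq, ae_restrict_iff' hUo.measurableSet]
      filter_upwards [hgf z, hgf ⟨y, hyΩ⟩] with x h1 h2 hx
      rw [← h1 hx.1, ← h2 hx.2]
    exact Measure.eqOn_open_of_ae_eq hae hUo ((hg ⟨y, hyΩ⟩).continuousOn.mono inter_subset_right)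
      ((hg z).continuousOn.mono inter_subset_left) ⟨hy, mem_ball_self (hr ⟨y, hyΩ⟩)⟩
  refine ⟨G, fun z hz => ?_, ?_⟩
  · have hb := isOpen_ball.mem_nhds (mem_ball_self (x := z) (hr ⟨z, hz⟩))
    refine (((hg ⟨z, hz⟩).differentiableAt hb).congr_of_eventuallyEq ?_).differentiableWithinAt
    filter_upwards [hb] with y hy using hGg ⟨z, hz⟩ y hy
  · have : volume {z | z ∈ Ω ∧ f z ≠ G z} = 0 := by
      refine measure_null_of_locally_null _ fun z hz => ?_
      refine ⟨_, inter_mem_nhdsWithin _ (ball_mem_nhds z (hr ⟨z, hz.1⟩)), ?_⟩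
      refine measure_mono_null ?_
        (hgf ⟨z, hz.1⟩)
      rintro y ⟨hy1, hy2⟩ h
      exact hy1.2 ((h hy2).trans (hGg ⟨z, hz.1⟩ y hy2).symm)
    rw [ae_iff]
    simpa using this

lemma exists_riesz_of_norm_le {V H} [AddCommGroup V] [Module ℂ V] [NormedAddCommGroup H]
    [InnerProductSpace ℂ H] [CompleteSpace H] (D : V →ₗ[ℂ] H) (l : V →ₗ[ℂ] ℂ) (hM : 0 ≤ M)
    (h : ∀ a, ‖l a‖ ≤ M * ‖D a‖) : ∃ w, ‖w‖ ≤ M ∧ ∀ a, l a = inner ℂ w (D a) := by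
  obtain ⟨g, hg⟩ := D.rangeRestrict.exists_rightInverse_of_surjective D.range_rangeRestrict
  have hDg := fun y => by
    simpa using congrArg Subtype.val (LinearMap.congr_fun hg y)
  let f := (l ∘ₗ g).mkContinuous M fun y => by
    simpa [hDg] using h (g y)
  obtain ⟨F, hF, hFn⟩ := exists_extension_norm_eq D.range f
  refine ⟨(InnerProductSpace.toDual ℂ H).symm F, ?_, fun a => ?_⟩
  · rw [LinearIsometryEquiv.norm_map, hFn]
    exact LinearMap.mkContinuous_norm_le _ hM _
  · rw [InnerProductSpace.toDual_symm_apply]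
    have h1 := hF ⟨D a, LinearMap.mem_range_self D a⟩
    rw [h1]
    have h2 := h (a - g ⟨D a, LinearMap.mem_range_self D a⟩)
    rw [map_sub, map_sub, hDg, sub_self, norm_zero, mul_zero] at h2
    exact sub_eq_zero.1 (norm_le_zero_iff.1 h2)

def testForms (n) (Ω : Set ℂ^n) : Submodule ℂ (Fin n → ℂ^n → ℂ) where
  carrier := {a | ∀ j, IsTestFun n (a j) Ω}
  add_mem' {a b} ha hb j :=
    ⟨(ha j).1.add (hb j).1, (ha j).2.1.add (hb j).2.1,
      (tsupport_add (a j) (b j)).trans (union_subset (ha j).2.2 (hb j).2.2)⟩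
  zero_mem' j := ⟨contDiff_const, HasCompactSupport.zero, by simp⟩
  smul_mem' c a ha j :=
    ⟨(ha j).1.const_smul c, (ha j).2.1.smul_left (f := fun _ => c),
      (tsupport_smul_subset_right (fun _ => c) (a j)).trans (ha j).2.2⟩

lemma testForms_apply (a : testForms n Ω) (j) : IsTestFun n (a.1 j) Ω :=
  a.2 j

lemma wder_const_mul {c} (hu : Differentiable ℝ u) (j) (z) :
    wder n j (fun z => c * u z) z = c * wder n j u z := by
  simp [wder_def, fderiv_const_mul (hu z), _root_.smul_apply]
  ring

lemma testForms_div (hΩ : IsOpen Ω) (hφ : ContDiffOn ℝ ∞ φ Ω)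
    {a : Fin n → ℂ^n → ℂ} (ha : ∀ j, IsTestFun n (a j) Ω) :
    IsTestFun n (fun z => (rexp (φ z / 2) : ℂ) * ∑ j, wder n j (a j) z) Ω :=
  (IsTestFun.sum fun j _ => (ha j).wder j).mul_left hΩ
    (ofRealCLM.contDiff.comp_contDiffOn (hφ.div_const 2).exp)

noncomputable def weightedDiv (hΩ : IsOpen Ω) (hφ : ContDiffOn ℝ ∞ φ Ω) :
    testForms n Ω →ₗ[ℂ] Lp ℂ 2 (volume : Measure ℂ^n) where
  toFun a := (testForms_div hΩ hφ (testForms_apply a)).memLp.toLp _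
  map_add' a b := by
    rw [← MemLp.toLp_add]
    refine MemLp.toLp_congr _ _ (.of_forall fun z => ?_)
    have : ∀ j, wder n j ((a + b).1 j) z = wder n j (a.1 j) z + wder n j (b.1 j) z :=
      fun j => wder_add ((testForms_apply a j).differentiable z) ((testForms_apply b j).differentiable z)
    simp only [this, sum_add_distrib, mul_add, Pi.add_apply]
  map_smul' c a := by
    rw [RingHom.id_apply, ← MemLp.toLp_const_smul]
    refine MemLp.toLp_congr _ _ (.of_forall fun z => ?_)
    have : ∀ j, wder n j ((c • a).1 j) z = c * wder n j (a.1 j) z :=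
      fun j => wder_const_mul (testForms_apply a j).differentiable j z
    simp only [this, ← mul_sum, Pi.smul_apply]
    ring

noncomputable def pairDbar (hv : IsTestFun n v Ω) : testForms n Ω →ₗ[ℂ] ℂ where
  toFun a := ∑ j, ∫ z, conj (wderBar n j v z) * a.1 j z
  map_add' a b := by
    rw [← sum_add_distrib]
    refine sum_congr rfl fun j _ => ?_
    refine (integral_congr_ae (.of_forall fun z => mul_add _ _ _)).trans (integral_add ((hv.wderBar j).star.memLp.integrable_mul (testForms_apply a j).memLp)
      ((hv.wderBar j).star.memLp.integrable_mul (testForms_apply b j).memLp))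
  map_smul' c a := by
    simp [smul_eq_mul, mul_sum, ← integral_const_mul]
    refine sum_congr rfl fun j _ => integral_congr_ae (.of_forall fun z => ?_)
    simp; ring

lemma exists_dbar_solution (hΩ : IsOpen Ω) (hφ : ContDiffOn ℝ ∞ φ Ω)
    (hs : IsGoodExhaustion s Ω) (hlv : ∀ z ∈ Ω, ∀ X, 0 ≤ lv φ z X) (hv : IsTestFun n v Ω)
    (hG : Continuous G) (hGc : HasCompactSupport G) (hG0 : ∀ z, 0 ≤ G z) (hGs : tsupport G ⊆ Ω)
    (hvG : ∀ z ∈ Ω, ∀ X, ‖∑ j, wderBar n j v z * conj (X j)‖ ^ 2 ≤ G z * lv φ z X) :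
    ∃ w : Lp ℂ 2 volume, ‖w‖ ^ 2 ≤ 4 * ∫ z, G z * rexp (-φ z) ∧
      ∀ a : Fin n → ℂ^n → ℂ, (∀ j, IsTestFun n (a j) Ω) → ∑ j, ∫ z, conj (wderBar n j v z) * a j z
          = ∫ z, conj (w z) * ((rexp (φ z / 2) : ℂ) * ∑ j, wder n j (a j) z) := by
  set M := ∫ z, G z * rexp (-φ z) with hM
  have hM0 : 0 ≤ M := integral_nonneg fun z => mul_nonneg (hG0 z) (exp_pos _).le
  obtain ⟨w, hw, hwa⟩ := exists_riesz_of_norm_le (weightedDiv hΩ hφ) (pairDbar hv)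
    (sqrt_nonneg (4 * M)) fun a => by
    refine abs_le_of_sq_le_sq' ?_ (by positivity) |>.2
    rw [mul_pow, sq_sqrt (by positivity)]
    have h1 := dbar_estimate hΩ hφ hs hlv hv hG hGc hG0 hGs hvG (testForms_apply a)
    have h2 : ‖weightedDiv hΩ hφ a‖ ^ 2 = ∫ z, ‖∑ j, wder n j (a.1 j) z‖ ^ 2 * rexp (φ z) := by
      change ‖(testForms_div hΩ hφ (testForms_apply a)).memLp.toLp _‖ ^ 2 = _
      rw [norm_sq_eq_re_inner (𝕜 := ℂ), L2.inner_def]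
      rw [integral_congr_ae (g := fun z => ((‖∑ j, wder n j (a.1 j) z‖ ^ 2 * rexp (φ z) : ℝ) : ℂ)) ?_]
      · rw [integral_complex_ofReal]; simp
      · filter_upwards [(testForms_div hΩ hφ (testForms_apply a)).memLp.coeFn_toLp] with z hz
        rw [hz, inner_self_eq_norm_sq_to_K, norm_mul, norm_real]
        have : rexp (φ z) = rexp (φ z / 2) ^ 2 := by
          rw [← Real.exp_nat_mul]; ring
        rw [this]; simp; ring
    have h3 : ‖pairDbar hv a‖ = ‖∑ j, ∫ z, wderBar n j v z * conj (a.1 j z)‖ := by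
      change ‖∑ j, ∫ z, conj (wderBar n j v z) * a.1 j z‖ = _
      rw [← RCLike.norm_conj, map_sum]
      congr 1
      refine sum_congr rfl fun j _ => ?_
      rw [← integral_conj]
      simp
    rw [h2, h3]
    refine h1.trans (le_of_eq ?_)
    ring
  refine ⟨w, ?_, fun a ha => ?_⟩
  · calc ‖w‖ ^ 2 ≤ Real.sqrt (4 * M) ^ 2 := by gcongr
      _ = 4 * M := sq_sqrt (by positivity)
  · have h1 := hwa ⟨a, fun j => ha j⟩
    refine h1.trans (integral_congr_ae ?_)
    filter_upwards [(testForms_div hΩ hφ ha).memLp.coeFn_toLp] with z hz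
    change inner ℂ (w z) ((testForms_div hΩ hφ ha).memLp.toLp _ z) = _
    rw [hz, RCLike.inner_apply']

theorem hormander (hΩ : IsOpen Ω) (hφ : ContDiffOn ℝ ∞ φ Ω)
    (hs : IsGoodExhaustion s Ω) (hlv : ∀ z ∈ Ω, ∀ X, 0 ≤ lv φ z X) (hv : IsTestFun n v Ω)
    (hG : Continuous G) (hGc : HasCompactSupport G) (hG0 : ∀ z, 0 ≤ G z) (hGs : tsupport G ⊆ Ω)
    (hvG : ∀ z ∈ Ω, ∀ X, ‖∑ j, wderBar n j v z * conj (X j)‖ ^ 2 ≤ G z * lv φ z X) :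
    ∃ f, DifferentiableOn ℂ f Ω ∧ IntegrableOn (fun z => ‖v z - f z‖ ^ 2 * rexp (-φ z)) Ω ∧
      ∫ z in Ω, ‖v z - f z‖ ^ 2 * rexp (-φ z) ≤ 4 * ∫ z, G z * rexp (-φ z) := by
  obtain ⟨w, hw, hwa⟩ := exists_dbar_solution hΩ hφ hs hlv hv hG hGc hG0 hGs hvG
  set E := fun z => (rexp (φ z / 2) : ℂ) with hE
  have hEd := ofRealCLM.contDiff.comp_contDiffOn (hφ.div_const 2).exp
  classical
  have hEm : Measurable (Ω.indicator E) := by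
    exact hEd.continuousOn.measurable_piecewise continuousOn_const hΩ.measurableSet
  have hwm := (Lp.stronglyMeasurable w).measurable
  have hwL := Lp.memLp w
  set f0 := fun z => v z + Ω.indicator E z * w z with hf0
  have hind : ∀ σ, IsTestFun n σ Ω → ∀ z, σ z * Ω.indicator E z = E z * σ z := fun σ hσ z => by
    by_cases hz : z ∈ Ω
    · rw [indicator_of_mem hz, mul_comm]
    · rw [hσ.eq_zero hz]; simp
  obtain ⟨f, hf, hff⟩ := weyl hΩ (f := f0) (hv.measurable.add (hEm.mul hwm)) (fun σ hσ => by
      have h1 : (fun z => σ z * f0 z) = (fun z => σ z * v z) + fun z => (E z * σ z) * w z := by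
        ext z; simp [hf0, Pi.add_apply, mul_add, ← mul_assoc, hind σ hσ z]
      rw [h1]
      exact (hσ.mul_left hΩ hv.contDiff.contDiffOn |>.memLp.ae_eq
        (.of_forall fun z => mul_comm _ _)).add ((memLp_mul_test hwL (hσ.mul_left hΩ hEd))))
    (fun τ hτ j => by
      have h1 := hwa (single j fun z => conj (τ z)) fun k => by
        by_cases hk : k = j
        · subst hk; simpa using hτ.star
        · simp [Pi.single_eq_of_ne hk]
          exact testForms_apply 0 j
      have h0 : ∀ k, k ≠ j → (single j (fun z => conj (τ z)) :
          Fin n → ℂ^n → ℂ) k = 0 := fun k hk => Pi.single_eq_of_ne hk _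
      rw [Finset.sum_eq_single j (fun k _ hk => by simp [h0 k hk]) (by simp)] at h1
      have h2 : ∀ z, ∑ k, wder n k ((single j (fun z => conj (τ z)) :
          Fin n → ℂ^n → ℂ) k) z = conj (wderBar n j τ z) := fun z => by
        rw [Finset.sum_eq_single j (fun k _ hk => by rw [h0 k hk]; simp [wder_def]) (by simp)]
        rw [Pi.single_eq_same, wder_conj]
      simp only [h2, Pi.single_eq_same] at h1
      have hEt := (hτ.wderBar j).mul_left hΩ hEd
      have h3 := by
        have h4 := congrArg (starRingEnd ℂ) h1
        rw [← integral_conj, ← integral_conj] at h4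
        simpa only [map_mul, conj_conj, conj_ofReal] using h4.symm
      have h5 : ∀ z, f0 z * wderBar n j τ z = v z * wderBar n j τ z + w z * (E z * wderBar n j τ z) :=
        fun z => by
          rw [← hind _ (hτ.wderBar j) z]
          ring
      have h6 : Integrable fun z => v z * wderBar n j τ z := hv.memLp.integrable_mul (hτ.wderBar j).memLp
      have h7 : Integrable fun z => w z * (E z * wderBar n j τ z) := hwL.integrable_mul hEt.memLp
      simp [h5]
      rw [integral_add h6 h7, h3, integral_wderBar_mul hv.contDiff hτ.contDiff hv.hasCompactSupport]
      ring)
  have hwv : ∀ᵐ z, z ∈ Ω → ‖v z - f z‖ ^ 2 * rexp (-φ z) = ‖w z‖ ^ 2 := by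
    filter_upwards [hff] with z hz hzΩ
    rw [← hz hzΩ]
    simp only [hf0, indicator_of_mem hzΩ, sub_add_cancel_left, norm_neg, norm_mul, hE, norm_real,
      Real.norm_of_nonneg (exp_pos _).le, mul_pow]
    rw [← Real.exp_nat_mul, mul_comm, ← mul_assoc, ← Real.exp_add]
    simp [mul_div_cancel₀]
  have hwi := (memLp_two_iff_integrable_sq_norm hwL.1).1 hwL
  refine ⟨f, hf, ?_, ?_⟩
  · exact hwi.integrableOn.congr ((ae_restrict_iff' hΩ.measurableSet).2
      (hwv.mono fun z hz hzΩ => (hz hzΩ).symm))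
  · rw [setIntegral_congr_ae hΩ.measurableSet hwv]
    refine (setIntegral_le_integral hwi (.of_forall fun z => by positivity)).trans ?_
    refine le_trans (le_of_eq ?_) hw
    rw [norm_sq_eq_re_inner (𝕜 := ℂ), L2.inner_def]
    rw [integral_congr_ae (g := fun z => ((‖w z‖ ^ 2 : ℝ) : ℂ))
      (.of_forall fun z => by simp)]
    rw [integral_complex_ofReal]; simp

section Cauchy

lemma differentiableAt_complex_of_fderiv_I_smul {E F} [NormedAddCommGroup E] [NormedSpace ℂ E]
    [NormedAddCommGroup F] [NormedSpace ℂ F] {g : E → F} {z} (hg : DifferentiableAt ℝ g z)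
    (hI : ∀ X, fderiv ℝ g z (I • X) = I • fderiv ℝ g z X) : DifferentiableAt ℂ g z := by
  rw [differentiableAt_iff_restrictScalars ℝ hg]
  set L := fderiv ℝ g z with hL
  have hs : ∀ (c) X, L (c • X) = c • L X := fun c X => by
    have hc := re_add_im c
    conv_lhs => rw [← hc]
    conv_rhs => rw [← hc]
    rw [add_smul, mul_smul, map_add, coe_smul, coe_smul, map_smul, map_smul, hI,
      add_smul, mul_smul, coe_smul, coe_smul]
  exact ⟨{ toFun := L, map_add' := map_add L, map_smul' := hs }, by rfl⟩

lemma fderiv_I_smul_of_differentiableAt {E F} [NormedAddCommGroup E] [NormedSpace ℂ E]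
    [NormedAddCommGroup F] [NormedSpace ℂ F] {g : E → F} {z} (hg : DifferentiableAt ℂ g z) (X) :
    fderiv ℝ g z (I • X) = I • fderiv ℝ g z X := by
  rw [hg.fderiv_restrictScalars ℝ]; simp

variable {U : Set ℂ^n}

/-- Near the centre of a ball, a holomorphic function is a mollification of a cut-off of itself. -/
lemma exists_mol_eq {R} (hR : 0 < R) (hg : DifferentiableOn ℂ g (ball z R)) :
    ∃ F, Continuous F ∧ HasCompactSupport F ∧ (∀ y, ‖F y‖ ≤ ‖g y‖) ∧ (∀ y ∉ ball z R, F y = 0) ∧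
      ∀ k, IsMollifier n (R / 4) k → ∀ y ∈ ball z (R / 4), mol F (fun y => k y) y = g y := by
  obtain ⟨θ, hθ, hθc, hθs, hθ0, hθ1⟩ := exists_contDiff_cutoff isOpen_ball
    (isCompact_closedBall z (3 * R / 4)) (closedBall_subset_ball (by linarith) :
      closedBall z (3 * R / 4) ⊆ ball z R)
  have hF : Continuous fun y => θ y * g y := by
    refine continuous_iff_continuousAt.2 fun y => ?_
    by_cases hy : y ∈ ball z R
    · exact ((continuous_ofReal.comp hθ.continuous).continuousAt).mul
        (hg.continuousOn.continuousAt (isOpen_ball.mem_nhds hy))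
    · have := notMem_tsupport_iff_eventuallyEq.1 fun h => hy (hθs h)
      refine (continuousAt_const (y := 0)).congr ?_
      filter_upwards [this] with y hy
      simp [hy]
  refine ⟨fun y => θ y * g y, hF, (hθc.comp_left (g := fun x : ℝ => (x : ℂ)) (by simp)).mul_right,
    fun y => ?_, fun y hy => ?_, fun k hk y hy => ?_⟩
  · rw [norm_mul, norm_real, Real.norm_of_nonneg (hθ0 y).1]
    exact mul_le_of_le_one_left (norm_nonneg _) (hθ0 y).2
  · simp [image_eq_zero_of_notMem_tsupport fun h => hy (hθs h)]
  · have hsub : ball y (R / 2) ⊆ closedBall z (3 * R / 4) := fun x hx => by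
      have := dist_triangle x y z
      rw [mem_ball] at hx hy
      rw [mem_closedBall]; linarith
    have h1 : ∀ x ∈ closedBall z (3 * R / 4), θ x * g x = g x := fun x hx => by
      rw [(hθ1 x hx).eq_of_nhds]; simp
    rw [hk.mol_eq_self hF (by linarith)
      ((hg.mono (hsub.trans (closedBall_subset_ball (by linarith)))).congr
        fun x hx => h1 x (hsub hx))]
    exact h1 y (hsub (mem_ball_self (by linarith)))

lemma DifferentiableOn.contDiffAt_real (hg : DifferentiableOn ℂ g U) (hU : IsOpen U)
    (hz : z ∈ U) : ContDiffAt ℝ ∞ g z := by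
  obtain ⟨R, hR, hRU⟩ := isOpen_iff.1 hU z hz
  obtain ⟨F, hF, -, -, -, hFk⟩ := exists_mol_eq hR (hg.mono hRU)
  obtain ⟨k, hk⟩ := exists_isMollifier n (show 0 < R / 4 by linarith)
  refine (contDiff_mol hF.locallyIntegrable hk.contDiff_ofReal hk.hasCompactSupport_ofReal).contDiffAt.congr_of_eventuallyEq ?_
  filter_upwards [ball_mem_nhds z (show 0 < R / 4 by linarith)] with y hy
  exact (hFk k hk y hy).symm

lemma DifferentiableOn.fderiv_apply_complex (hg : DifferentiableOn ℂ g U) (hU : IsOpen U) (Y) :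
    DifferentiableOn ℂ (fun z => fderiv ℂ g z Y) U := by
  intro z hz
  have h2 : ∀ X, (fun z => fderiv ℂ g z X) =ᶠ[𝓝 z] fun z => fderiv ℝ g z X := fun X => by
    filter_upwards [hU.mem_nhds hz] with y hy
    rw [((hg y hy).differentiableAt (hU.mem_nhds hy)).fderiv_restrictScalars ℝ]
    rfl
  have hc := (hg.contDiffAt_real hU hz).of_le two_le_infty
  refine DifferentiableAt.differentiableWithinAt ?_
  refine DifferentiableAt.congr_of_eventuallyEq ?_ (h2 Y)
  refine differentiableAt_complex_of_fderiv_I_smul ?_ fun X => ?_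
  · have h1 :=
      (hc.fderiv_right (m := 1) (by norm_num)).differentiableAt (by simp)
    exact h1.clm_apply (differentiableAt_const Y)
  · rw [fderiv_fderiv_const_apply hc, fderiv_fderiv_const_apply hc, fderiv_fderiv_apply_comm hc,
      ← fderiv_fderiv_const_apply hc, fderiv_fderiv_apply_comm hc X, ← fderiv_fderiv_const_apply hc]
    have h3 : (fun y => fderiv ℝ g y (I • X)) =ᶠ[𝓝 z] fun y => I • fderiv ℝ g y X := by
      filter_upwards [hU.mem_nhds hz] with y hy
      exact fderiv_I_smul_of_differentiableAt ((hg y hy).differentiableAt (hU.mem_nhds hy)) X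
    rw [h3.fderiv_eq]
    have h4 := ((hc.fderiv_right (m := 1) (by norm_num)).differentiableAt (by simp)).clm_apply
      (differentiableAt_const X)
    rw [fderiv_fun_const_smul h4]
    rfl

lemma norm_mol_sq_le {F} (hF : MemLp F 2) (hu : MemLp u 2) (z) :
    ‖mol F u z‖ ^ 2 ≤ (∫ y, ‖F y‖ ^ 2) * ∫ y, ‖u y‖ ^ 2 := by
  have h1 := norm_integral_sq_le
    (fun _ => by positivity) (fun _ => by positivity)
    ((memLp_two_iff_integrable_sq_norm hF.1).1 hF)
    (((memLp_two_iff_integrable_sq_norm hu.1).1 hu).comp_sub_left z) fun t => by rw [norm_mul, mul_pow]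
  rwa [integral_sub_left_eq_self (fun t => ‖u t‖ ^ 2)] at h1

lemma integral_norm_sq_le_of_le {E} [NormedAddCommGroup E]
    {D : ℂ^n → E} (hD : Continuous D) (hDc : HasCompactSupport D)
    (hu : Continuous u) (h : ∀ y, ‖u y‖ ≤ ‖D y‖ * c) :
    MemLp u 2 ∧ ∫ y, ‖u y‖ ^ 2 ≤ (∫ y, ‖D y‖ ^ 2) * c ^ 2 := by
  have hc := hDc.mono fun y hy h0 => hy (norm_le_zero_iff.1 ((h y).trans (by simp [h0])))
  refine ⟨hu.memLp_of_hasCompactSupport hc, ?_⟩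
  have h1 : Integrable fun y => ‖u y‖ ^ 2 := by
    have h0 : HasCompactSupport fun y => ‖u y‖ ^ 2 := hc.mono fun y hy h0 => hy (by simp [h0])
    have h00 := hu.norm.pow 2
    exact h00.integrable_of_hasCompactSupport h0
  have h2 : Integrable fun y => ‖D y‖ ^ 2 := by
    have h0 : HasCompactSupport fun y => ‖D y‖ ^ 2 := hDc.mono fun y hy h0 => hy (by simp [h0])
    have h00 := hD.norm.pow 2
    exact h00.integrable_of_hasCompactSupport h0
  rw [← integral_mul_const]
  refine integral_mono h1 (h2.mul_const _) fun y => ?_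
  · rw [← mul_pow]
    gcongr
    exact h y

/-- Cauchy estimates in the mean on the unit ball. -/
theorem exists_cauchy_estimates (n) : ∃ C > 0, ∀ g : ℂ^n → ℂ,
    DifferentiableOn ℂ g (ball 0 1) → IntegrableOn (fun z => ‖g z‖ ^ 2) (ball 0 1) →
      ‖g 0‖ ^ 2 ≤ C * ∫ z in ball 0 1, ‖g z‖ ^ 2 ∧
      (∀ X, ‖fderiv ℂ g 0 X‖ ^ 2 ≤ C * ‖X‖ ^ 2 * ∫ z in ball 0 1, ‖g z‖ ^ 2) ∧
      ∀ X Y, ‖fderiv ℂ (fun z => fderiv ℂ g z Y) 0 X‖ ^ 2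
        ≤ C * (‖X‖ ^ 2 * ‖Y‖ ^ 2) * ∫ z in ball 0 1, ‖g z‖ ^ 2 := by
  obtain ⟨k, hk⟩ := exists_isMollifier n (show 0 < 1 / 4 by norm_num)
  set u : ℂ^n → ℂ := fun y => k y with hu
  have huc := hk.contDiff_ofReal
  have hus := hk.hasCompactSupport_ofReal
  have hd1 : ContDiff ℝ ∞ (fderiv ℝ u) := huc.fderiv_right (by simp)
  have hd2 : ContDiff ℝ ∞ (fderiv ℝ (fderiv ℝ u)) := hd1.fderiv_right (by simp)
  have hs1 := hus.fderiv (𝕜 := ℝ)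
  have hs2 := hs1.fderiv (𝕜 := ℝ)
  set A0 := ∫ y, ‖u y‖ ^ 2 with hA0
  set A1 := ∫ y, ‖fderiv ℝ u y‖ ^ 2 with hA1
  set A2 := ∫ y, ‖fderiv ℝ (fderiv ℝ u) y‖ ^ 2 with hA2
  have h0 : 0 ≤ A0 := integral_nonneg fun _ => by positivity
  have h1 : 0 ≤ A1 := integral_nonneg fun _ => by positivity
  have h2 : 0 ≤ A2 := integral_nonneg fun _ => by positivity
  refine ⟨A0 + A1 + A2 + 1, by positivity, fun g hg hgi => ?_⟩
  obtain ⟨F, hF, hFc, hFg, hF0, hFk⟩ := exists_mol_eq one_pos hg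
  set B := ∫ z in ball 0 1, ‖g z‖ ^ 2 with hB
  have hFL : MemLp F 2 := hF.memLp_of_hasCompactSupport hFc
  have hFB : ∫ y, ‖F y‖ ^ 2 ≤ B := by
    rw [← setIntegral_eq_integral_of_forall_compl_eq_zero
      fun y hy => by rw [hF0 y hy]; simp]
    exact setIntegral_mono_on (((memLp_two_iff_integrable_sq_norm hFL.1).1 hFL).integrableOn) hgi
      isOpen_ball.measurableSet fun y _ => by gcongr; exact hFg y
  have hgu := hFk k hk
  have hev : ∀ y ∈ ball 0 (1 / 4), g =ᶠ[𝓝 y] mol F u := fun y hy => by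
    filter_upwards [isOpen_ball.mem_nhds hy] with x hx using (hgu x hx).symm
  have hm0 : (0 : ℂ^n) ∈ ball 0 (1 / 4) := mem_ball_self (by norm_num)
  have hd : ∀ y ∈ ball 0 (1 / 4), ∀ X,
      fderiv ℂ g y X = mol F (fun t => fderiv ℝ u t X) y := fun y hy X => by
    rw [← fderiv_mol_apply hF.locallyIntegrable huc hus, ← (hev y hy).fderiv_eq,
      ((hg y (ball_subset_ball (by norm_num) hy)).differentiableAt
        (isOpen_ball.mem_nhds (ball_subset_ball (by norm_num) hy))).fderiv_restrictScalars ℝ]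
    rfl
  refine ⟨?_, fun X => ?_, fun X Y => ?_⟩
  · rw [← hgu 0 hm0]
    refine (norm_mol_sq_le hFL (huc.continuous.memLp_of_hasCompactSupport hus) 0).trans ?_
    rw [mul_comm]
    gcongr; linarith
  · rw [hd 0 hm0]
    obtain ⟨h3, h4⟩ := integral_norm_sq_le_of_le hd1.continuous hs1
      (contDiff_fderiv_apply_const huc X).continuous fun y => (fderiv ℝ u y).le_opNorm X
    refine (norm_mol_sq_le hFL h3 0).trans ?_
    rw [mul_comm]
    gcongr
    refine h4.trans ?_
    gcongr; linarith
  · have hcY := contDiff_fderiv_apply_const huc Y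
    have hsY := hus.fderiv_apply (𝕜 := ℝ) Y
    have e : fderiv ℂ (fun z => fderiv ℂ g z Y) 0 X
        = mol F (fun t => fderiv ℝ (fderiv ℝ u) t X Y) 0 := by
      have h3 : (fun z => fderiv ℂ g z Y) =ᶠ[𝓝 0] mol F (fun t => fderiv ℝ u t Y) := by
        filter_upwards [isOpen_ball.mem_nhds hm0] with y hy using hd y hy Y
      have h4 := (hg.fderiv_apply_complex isOpen_ball Y 0 (by simp)).differentiableAt
        (isOpen_ball.mem_nhds (by simp))
      have h5 : fderiv ℂ (fun z => fderiv ℂ g z Y) 0 X = fderiv ℝ (fun z => fderiv ℂ g z Y) 0 X := by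
        rw [h4.fderiv_restrictScalars ℝ]; rfl
      rw [h5, h3.fderiv_eq, fderiv_mol_apply hF.locallyIntegrable hcY hsY]
      congr 1
      ext t
      exact fderiv_fderiv_const_apply (huc.contDiffAt_two t) Y X
    rw [e]
    obtain ⟨h3, h4⟩ := integral_norm_sq_le_of_le hd2.continuous hs2
     
      ((hd2.continuous.clm_apply continuous_const).clm_apply continuous_const)
      fun y => ((fderiv ℝ (fderiv ℝ u) y).le_opNorm₂ X Y).trans (by rw [mul_assoc])
    refine (norm_mol_sq_le hFL h3 0).trans ?_
    rw [mul_comm]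
    gcongr
    refine h4.trans ?_
    rw [mul_pow]
    gcongr; linarith

end Cauchy

section Charts

/-- A holomorphic embedding of the unit polydisc into `Ω`, centred at `p`, of constant Jacobian `J`,
together with a bounded plurisubharmonic function whose Levi form is large along the image. -/
structure IsChart (Ω) (c) (p) (Φ : ℂ^n → ℂ^n) (J : ℝ)
    (φ : ℂ^n → ℝ) where
  diff : DifferentiableOn ℂ Φ (ball 0 1)
  mapsTo : MapsTo Φ (ball 0 1) Ω
  injOn : InjOn Φ (ball 0 1)
  map_zero : Φ 0 = p
  J_pos : 0 < J
  abs_det : ∀ ξ ∈ ball 0 1, |(fderiv ℝ Φ ξ).det| = J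
  contDiffOn : ContDiffOn ℝ ∞ φ Ω
  mem_Icc : ∀ z ∈ Ω, φ z ∈ Icc 0 1
  lv_nonneg : ∀ z ∈ Ω, ∀ X, 0 ≤ lv φ z X
  le_lv : ∀ ξ ∈ ball 0 1, ∀ Y, c * ‖Y‖ ^ 2 ≤ lv φ (Φ ξ) (fderiv ℝ Φ ξ Y)

/-- Transport of a function from the unit polydisc to the image of a chart, extended by zero. -/
noncomputable def pull {F} [Zero F] (Φ : ℂ^n → ℂ^n) (H : ℂ^n → F) :=
  (Φ '' ball 0 1).indicator fun z => H (Function.invFunOn Φ (ball 0 1) z)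

namespace IsChart

variable {Φ : ℂ^n → ℂ^n} {J : ℝ} (h : IsChart Ω c p Φ J φ) {ξ : ℂ^n}
include h

lemma contDiffAt (hξ : ξ ∈ ball 0 1) : ContDiffAt ℝ ∞ Φ ξ :=
  contDiffAt_pi.2 fun i => (differentiableOn_pi.1 h.diff i).contDiffAt_real isOpen_ball hξ

lemma differentiableAt (hξ : ξ ∈ ball 0 1) : DifferentiableAt ℂ Φ ξ :=
  h.diff.differentiableAt (isOpen_ball.mem_nhds hξ)

lemma fderiv_real_apply (hξ : ξ ∈ ball 0 1) (Y) :
    fderiv ℝ Φ ξ Y = fderiv ℂ Φ ξ Y := by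
  rw [(h.differentiableAt hξ).fderiv_restrictScalars ℝ]; rfl

lemma det_ne_zero (hξ : ξ ∈ ball 0 1) : (fderiv ℝ Φ ξ).det ≠ 0 := by
  intro h0
  have := h.abs_det ξ hξ
  rw [h0, abs_zero] at this
  exact h.J_pos.ne this

lemma surjective_fderiv (hξ : ξ ∈ ball 0 1) : Function.Surjective (fderiv ℝ Φ ξ) := by
  intro X
  refine ⟨((fderiv ℝ Φ ξ).toContinuousLinearEquivOfDetNeZero (h.det_ne_zero hξ)).symm X, ?_⟩
  exact ((fderiv ℝ Φ ξ).toContinuousLinearEquivOfDetNeZero (h.det_ne_zero hξ)).apply_symm_apply X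

lemma exists_localInverse (hξ : ξ ∈ ball 0 1) :
    ∃ g, ContDiffAt ℝ ∞ g (Φ ξ) ∧ g (Φ ξ) = ξ ∧ ∀ᶠ y in 𝓝 (Φ ξ), Φ (g y) = y := by
  have hd : HasFDerivAt Φ ((fderiv ℝ Φ ξ).toContinuousLinearEquivOfDetNeZero (h.det_ne_zero hξ) :
      ℂ^n →L[ℝ] ℂ^n) ξ := by
    exact ((h.contDiffAt hξ).differentiableAt (by simp)).hasFDerivAt
  refine ⟨(h.contDiffAt hξ).localInverse hd (by simp), (h.contDiffAt hξ).to_localInverse hd (by simp),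
    (h.contDiffAt hξ).localInverse_apply_image hd (by simp), ?_⟩
  exact ((h.contDiffAt hξ).hasStrictFDerivAt' hd (by simp)).eventually_right_inverse

lemma pull_apply {F} [Zero F] (H : ℂ^n → F) (hξ : ξ ∈ ball 0 1) :
    pull Φ H (Φ ξ) = H ξ := by
  rw [pull, indicator_of_mem (mem_image_of_mem Φ hξ)]
  congr 1
  exact h.injOn.leftInvOn_invFunOn hξ

lemma pull_comp_eventuallyEq {F} [Zero F] (H : ℂ^n → F)
    (hξ : ξ ∈ ball 0 1) : (fun ζ => pull Φ H (Φ ζ)) =ᶠ[𝓝 ξ] H := by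
  filter_upwards [isOpen_ball.mem_nhds hξ] with ζ hζ using h.pull_apply H hζ

section smooth

variable {F : Type*} [NormedAddCommGroup F] {H : ℂ^n → F} (hc : HasCompactSupport H) (hs : tsupport H ⊆ ball 0 1)

lemma pull_eq_zero (hz : z ∉ Φ '' tsupport H) : pull Φ H z = 0 := by
  by_cases hz1 : z ∈ Φ '' ball 0 1
  · obtain ⟨ξ, hξ, rfl⟩ := hz1
    rw [h.pull_apply H hξ]
    exact image_eq_zero_of_notMem_tsupport fun hξ' => hz ⟨ξ, hξ', rfl⟩
  · rw [pull, indicator_of_notMem hz1]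

include hc hs in
lemma isCompact_image_tsupport : IsCompact (Φ '' tsupport H) :=
  hc.isCompact.image_of_continuousOn (h.diff.continuousOn.mono hs)

include hc hs in
lemma tsupport_pull_subset : tsupport (pull Φ H) ⊆ Φ '' tsupport H :=
  closure_minimal (fun z hz => by
    by_contra hz'
    exact hz (h.pull_eq_zero hz')) (h.isCompact_image_tsupport hc hs).isClosed

include hc hs in
lemma tsupport_pull_subset_image : tsupport (pull Φ H) ⊆ Φ '' ball 0 1 :=
  (h.tsupport_pull_subset hc hs).trans (image_mono hs)

include hc hs in
lemma tsupport_pull_subset_domain : tsupport (pull Φ H) ⊆ Ω :=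
  (h.tsupport_pull_subset_image hc hs).trans h.mapsTo.image_subset

include hc hs in
lemma hasCompactSupport_pull : HasCompactSupport (pull Φ H) :=
  (h.isCompact_image_tsupport hc hs).of_isClosed_subset (isClosed_tsupport _)
    (h.tsupport_pull_subset hc hs)

include hc hs in
lemma pull_eventuallyEq_zero (hz : z ∉ Φ '' ball 0 1) : pull Φ H =ᶠ[𝓝 z] 0 :=
  notMem_tsupport_iff_eventuallyEq.1 fun hz' => hz (h.tsupport_pull_subset_image hc hs hz')

include hc hs in
lemma contDiff_pull [NormedSpace ℝ F] {m : ℕ∞} (hH : ContDiff ℝ m H) : ContDiff ℝ m (pull Φ H) := by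
  refine contDiff_iff_contDiffAt.2 fun z => ?_
  by_cases hz : z ∈ Φ '' ball 0 1
  · obtain ⟨ξ, hξ, rfl⟩ := hz
    obtain ⟨g, hg, hgξ, hgy⟩ := h.exists_localInverse hξ
    have h1 :=
      hg.continuousAt.eventually_mem (by rw [hgξ]; exact isOpen_ball.mem_nhds hξ)
    refine (hH.contDiffAt.comp (Φ ξ) (hg.of_le (by exact_mod_cast le_top))).congr_of_eventuallyEq ?_
    filter_upwards [hgy, h1] with y hy h1y
    conv_lhs => rw [← hy]
    exact h.pull_apply H h1y
  · exact contDiffAt_const.congr_of_eventuallyEq (h.pull_eventuallyEq_zero hc hs hz)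

end smooth

lemma integral_image {F} [NormedAddCommGroup F] [NormedSpace ℝ F] {s}
    (hs : MeasurableSet s) (hs1 : s ⊆ ball 0 1) (g : ℂ^n → F) :
    ∫ z in Φ '' s, g z = J • ∫ ξ in s, g (Φ ξ) := by
  rw [integral_image_eq_integral_abs_det_fderiv_smul volume hs
    (fun ξ hξ => ((h.contDiffAt (hs1 hξ)).differentiableAt (by simp)).hasFDerivAt.hasFDerivWithinAt)
    (h.injOn.mono hs1), ← integral_smul]
  exact setIntegral_congr_fun hs fun ξ hξ => by simp [h.abs_det ξ (hs1 hξ)]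

lemma integrableOn_image {F} [NormedAddCommGroup F] [NormedSpace ℝ F] {s}
    (hs : MeasurableSet s) (hs1 : s ⊆ ball 0 1) (g : ℂ^n → F) :
    IntegrableOn g (Φ '' s) ↔ IntegrableOn (fun ξ => g (Φ ξ)) s := by
  rw [integrableOn_image_iff_integrableOn_abs_det_fderiv_smul volume hs
    (fun ξ hξ => ((h.contDiffAt (hs1 hξ)).differentiableAt (by simp)).hasFDerivAt.hasFDerivWithinAt)
    (h.injOn.mono hs1), IntegrableOn, IntegrableOn,
    ← integrable_smul_iff h.J_pos.ne' (fun ξ => g (Φ ξ))]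
  exact integrableOn_congr_fun (fun ξ hξ => by simp [h.abs_det ξ (hs1 hξ), Pi.smul_apply]) hs

/-- The complex Hessian transforms by the derivative of a holomorphic map. -/
lemma lv_comp_chart (hξ : ξ ∈ ball 0 1) (hψ : ContDiffAt ℝ 2 ψ (Φ ξ)) (Y) :
    lv (fun ζ => ψ (Φ ζ)) ξ Y = lv ψ (Φ ξ) (fderiv ℝ Φ ξ Y) := by
  have hΦ := (h.contDiffAt hξ).of_le two_le_infty
  have hd1 : fderiv ℝ (fun ζ => ψ (Φ ζ)) =ᶠ[𝓝 ξ] fun ζ => (fderiv ℝ ψ (Φ ζ)).comp (fderiv ℝ Φ ζ) := by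
    have h1 :=
      hΦ.continuousAt.eventually (hψ.eventually (by simp))
    filter_upwards [isOpen_ball.mem_nhds hξ, h1] with ζ hζ h1ζ
    exact fderiv_comp ζ (h1ζ.differentiableAt (by simp)) ((h.contDiffAt hζ).differentiableAt (by simp))
  have hψ2 :=
    (hψ.fderiv_right (m := 1) (by norm_num)).differentiableAt (by simp)
  have hΦ2 :=
    (hΦ.fderiv_right (m := 1) (by norm_num)).differentiableAt (by simp)
  have hΦd := hΦ.differentiableAt (by simp)
  have key : ∀ X Z, D2 (fun ζ => ψ (Φ ζ)) ξ X Z = D2 ψ (Φ ξ) (fderiv ℝ Φ ξ X) (fderiv ℝ Φ ξ Z)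
      + fderiv ℝ ψ (Φ ξ) (fderiv ℝ (fderiv ℝ Φ) ξ X Z) := fun X Z => by
    have h2 : HasFDerivAt (fun ζ => fderiv ℝ ψ (Φ ζ))
        ((fderiv ℝ (fderiv ℝ ψ) (Φ ξ)).comp (fderiv ℝ Φ ξ)) ξ :=
      hψ2.hasFDerivAt.comp ξ hΦd.hasFDerivAt
    have h3 := h2.clm_comp hΦ2.hasFDerivAt
    rw [D2, hd1.fderiv_eq, h3.fderiv]
    simp [D2, add_comm]
  have hI : fderiv ℝ (fderiv ℝ Φ) ξ (I • Y) (I • Y) = -fderiv ℝ (fderiv ℝ Φ) ξ Y Y := by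
    have hs := fun X Z => by
      have e1 : (fun ζ => fderiv ℝ Φ ζ (I • Z)) =ᶠ[𝓝 ξ] fun ζ => I • fderiv ℝ Φ ζ Z := by
        filter_upwards [isOpen_ball.mem_nhds hξ] with ζ hζ
        exact fderiv_I_smul_of_differentiableAt (h.differentiableAt hζ) Z
      have e2 : ∀ V, HasFDerivAt (fun ζ => fderiv ℝ Φ ζ V)
          ((ContinuousLinearMap.apply ℝ _ V).comp (fderiv ℝ (fderiv ℝ Φ) ξ)) ξ := fun V =>
        (ContinuousLinearMap.hasFDerivAt (ContinuousLinearMap.apply ℝ ℂ^n V)).comp ξ hΦ2.hasFDerivAt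
      have e3 := e1.fderiv_eq (𝕜 := ℝ)
      have e4 : HasFDerivAt (fun ζ => I • fderiv ℝ Φ ζ Z) _ ξ := (e2 Z).const_smul I
      rw [(e2 (I • Z)).fderiv, e4.fderiv] at e3
      simpa using congrArg (fun L => L X) e3
    have hsym := fun X Z =>
      (hΦ.isSymmSndFDerivAt (by simp)).eq X Z
    rw [hs, hsym, hs, smul_smul, I_mul_I, neg_one_smul]
  rw [lv, lv, lvp, lvp, key, key, hI, fderiv_I_smul_of_differentiableAt (h.differentiableAt hξ), map_neg]
  ring

end IsChart

end Charts

section MinimumIntegrals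

lemma holDeriv_eq (f) (p X) : holDeriv n f p X = fderiv ℂ f p X := by
  conv_rhs => rw [← Finset.univ_sum_single X]
  rw [map_sum]
  refine sum_congr rfl fun i _ => ?_
  have : single i (X i) = X i • single i 1 := by
    rw [← Pi.single_smul, smul_eq_mul, mul_one]
  rw [this, map_smul, smul_eq_mul]

lemma fderiv_apply_eq_sum (f : ℂ^n → ℂ) (z X) :
    fderiv ℂ f z X = ∑ i, X i * fderiv ℂ f z (single i 1) := (holDeriv_eq f z X).symm

lemma holDeriv2_eq (hf : DifferentiableOn ℂ f Ω) (hΩ : IsOpen Ω) (hp : p ∈ Ω) (X Y) :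
    holDeriv2 n f p X Y = fderiv ℂ (fun z => fderiv ℂ f z Y) p X := by
  have hd := fun V =>
    (hf.fderiv_apply_complex hΩ V).differentiableAt (hΩ.mem_nhds hp)
  have h1 := by
    funext z; exact fderiv_apply_eq_sum f z Y
  have h2 : HasFDerivAt (fun z => ∑ k, Y k * fderiv ℂ f z (single k 1))
      (∑ k, Y k • fderiv ℂ (fun z => fderiv ℂ f z (single k 1)) p) p :=
    HasFDerivAt.fun_sum fun k _ => (hd _).hasFDerivAt.const_mul (Y k)
  rw [h1, h2.fderiv, holDeriv2, sum_comm, sum_apply]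
  refine sum_congr rfl fun k _ => ?_
  rw [smul_apply, fderiv_apply_eq_sum _ p X, smul_eq_mul, mul_sum]
  exact sum_congr rfl fun j _ => by ring

lemma differentiableAt_fderiv_complex (hf : DifferentiableOn ℂ f Ω) (hΩ : IsOpen Ω)
    (hp : p ∈ Ω) : DifferentiableAt ℂ (fderiv ℂ f) p := by
  have h1 : fderiv ℂ f = fun z => ∑ k, fderiv ℂ f z (single k 1) •
      proj k := by
    funext z
    ext X
    rw [fderiv_apply_eq_sum f z X, sum_apply]
    exact sum_congr rfl fun k _ => by simp [mul_comm]
  rw [h1]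
  exact DifferentiableAt.fun_sum fun k _ =>
    ((hf.fderiv_apply_complex hΩ _).differentiableAt (hΩ.mem_nhds hp)).smul_const _

lemma l2sq_nonneg (f) : 0 ≤ l2sq n Ω f := integral_nonneg fun z => by positivity

lemma I0_nonneg (p) : 0 ≤ I0 n Ω p :=
  sInf_nonneg (by rintro r ⟨f, -, -, rfl⟩; exact l2sq_nonneg f)

lemma I1_nonneg (p X) : 0 ≤ I1 n Ω p X :=
  sInf_nonneg (by rintro r ⟨f, -, -, -, rfl⟩; exact l2sq_nonneg f)

lemma I2_nonneg (p X Y) : 0 ≤ I2 n Ω p X Y :=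
  sInf_nonneg (by rintro r ⟨f, -, -, -, -, rfl⟩; exact l2sq_nonneg f)

lemma I1_zero (p) : I1 n Ω p 0 = 0 := by
  have : {r | ∃ f, InBergman n Ω f ∧ f p = 0 ∧ holDeriv n f p 0 = 1 ∧ r = l2sq n Ω f} = ∅ := by
    simp [holDeriv]
  rw [I1, this, Real.sInf_empty]

lemma inBergman_of_differentiable (hb : Bornology.IsBounded Ω)
    (hf : Differentiable ℂ f) : InBergman n Ω f := by
  refine ⟨hf.differentiableOn, ?_⟩
  have : IntegrableOn (fun z => ‖f z‖ ^ 2) (closure Ω) :=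
    ((hf.continuous.norm.pow 2).continuousOn).integrableOn_compact hb.isCompact_closure
  exact this.mono_set subset_closure

lemma exists_linear_ne_zero {Y} (hX : X ≠ 0) (hY : Y ≠ 0) :
    ∃ L : ℂ^n →L[ℂ] ℂ, L X ≠ 0 ∧ L Y ≠ 0 := by
  obtain ⟨j⟩ := Function.ne_iff.1 hX
  obtain ⟨k⟩ := Function.ne_iff.1 hY
  by_cases h1 : Y j = 0
  · by_cases h2 : X k = 0
    · refine ⟨(proj j : ℂ^n →L[ℂ] ℂ) + proj k, ?_, ?_⟩
      · simpa [h2]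
      · simpa [h1]
    · exact ⟨proj k, by simpa, by simpa⟩
  · exact ⟨proj j, by simpa, by simpa⟩

lemma I2_set_nonempty (hΩ : IsOpen Ω) (hb : Bornology.IsBounded Ω) {Y} (hp : p ∈ Ω)
    (hX : X ≠ 0) (hY : Y ≠ 0) :
    {r | ∃ f, InBergman n Ω f ∧ f p = 0 ∧ fderiv ℂ f p = 0 ∧ holDeriv2 n f p X Y = 1 ∧
      r = l2sq n Ω f}.Nonempty := by
  obtain ⟨L, hLX, hLY⟩ := exists_linear_ne_zero hX hY
  set a := (2 * L X * L Y)⁻¹ with ha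
  set f := fun z => a * L (z - p) ^ 2 with hf
  have hL := fun z =>
    L.hasFDerivAt.comp z ((hasFDerivAt_id z).sub_const p)
  have hfd : ∀ z, HasFDerivAt f ((2 * a * L (z - p)) • L) z := fun z => by
    refine (((hL z).pow 2).const_mul a).congr_fderiv ?_
    ext V
    simp
    ring
  have hd : Differentiable ℂ f := fun z => (hfd z).differentiableAt
  have hfd2 : HasFDerivAt (fun z => fderiv ℂ f z Y) ((2 * a * L Y) • L) p := by
    have : (fun z => fderiv ℂ f z Y) = fun z => (2 * a * L Y) * L (z - p) := by
      funext z
      rw [(hfd z).fderiv]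
      simp
      ring
    rw [this]
    exact (hL p).const_mul _
  refine ⟨_, f, inBergman_of_differentiable hb hd, by simp [hf], ?_, ?_, rfl⟩
  · rw [(hfd p).fderiv, sub_self, map_zero, mul_zero]
    exact zero_smul ℂ L
  · rw [holDeriv2_eq hd.differentiableOn hΩ hp, hfd2.fderiv]
    simp [ha]
    field_simp

namespace IsChart

variable {Φ : ℂ^n → ℂ^n} {J : ℝ} (h : IsChart Ω c p Φ J φ)
include h

lemma mem : p ∈ Ω := by
  rw [← h.map_zero]; exact h.mapsTo (mem_ball_self one_pos)

lemma differentiableOn_comp (hf : DifferentiableOn ℂ f Ω) :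
    DifferentiableOn ℂ (fun ξ => f (Φ ξ)) (ball 0 1) := hf.comp h.diff h.mapsTo

lemma integrableOn_comp (hf : InBergman n Ω f) : IntegrableOn (fun ξ => ‖f (Φ ξ)‖ ^ 2) (ball 0 1) :=
  (h.integrableOn_image measurableSet_ball subset_rfl (fun z => ‖f z‖ ^ 2)).1
    (hf.2.mono_set h.mapsTo.image_subset)

lemma integral_comp_le (hf : InBergman n Ω f) :
    J * ∫ ξ in ball 0 1, ‖f (Φ ξ)‖ ^ 2 ≤ l2sq n Ω f := by
  have := h.integral_image measurableSet_ball subset_rfl (fun z => ‖f z‖ ^ 2)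
  rw [smul_eq_mul] at this
  rw [← this]
  exact setIntegral_mono_set hf.2 (.of_forall fun z => by positivity)
    h.mapsTo.image_subset.eventuallyLE

lemma fderiv_comp_chart (hΩ : IsOpen Ω) (hf : DifferentiableOn ℂ f Ω) {ξ}
    (hξ : ξ ∈ ball 0 1) (Y) :
    fderiv ℂ (fun ξ => f (Φ ξ)) ξ Y = fderiv ℂ f (Φ ξ) (fderiv ℂ Φ ξ Y) := by
  rw [fderiv_fun_comp ξ (hf.differentiableAt (hΩ.mem_nhds (h.mapsTo hξ))) (h.differentiableAt hξ)]
  rfl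

lemma fderiv_fderiv_comp_chart (hΩ : IsOpen Ω) (hf : DifferentiableOn ℂ f Ω)
    (hfp : fderiv ℂ f p = 0) (X Y) : fderiv ℂ (fun ξ => fderiv ℂ (fun ξ => f (Φ ξ)) ξ Y) 0 X
      = fderiv ℂ (fun z => fderiv ℂ f z (fderiv ℂ Φ 0 Y)) p (fderiv ℂ Φ 0 X) := by
  have h0 : (0 : ℂ^n) ∈ ball 0 1 := mem_ball_self one_pos
  have e1 : (fun ξ => fderiv ℂ (fun ξ => f (Φ ξ)) ξ Y) =ᶠ[𝓝 0]
      fun ξ => fderiv ℂ f (Φ ξ) (fderiv ℂ Φ ξ Y) := by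
    filter_upwards [isOpen_ball.mem_nhds h0] with ξ hξ using h.fderiv_comp_chart hΩ hf hξ Y
  have hΦY : DifferentiableAt ℂ (fun ξ => fderiv ℂ Φ ξ Y) 0 := by
    refine differentiableAt_pi.2 fun i => ?_
    have e2 : (fun ξ => fderiv ℂ Φ ξ Y i) =ᶠ[𝓝 0] fun ξ => fderiv ℂ (fun ζ => Φ ζ i) ξ Y := by
      filter_upwards [isOpen_ball.mem_nhds h0] with ξ hξ
      rw [fderiv_apply (h.differentiableAt hξ) i]; rfl
    exact (((differentiableOn_pi.1 h.diff i).fderiv_apply_complex isOpen_ball Y).differentiableAt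
      (isOpen_ball.mem_nhds h0)).congr_of_eventuallyEq e2
  have hf2 : HasFDerivAt (fun ξ => fderiv ℂ f (Φ ξ)) ((fderiv ℂ (fderiv ℂ f) p).comp (fderiv ℂ Φ 0)) 0 := by
    have := differentiableAt_fderiv_complex hf hΩ h.mem
    rw [← h.map_zero] at this ⊢
    exact this.hasFDerivAt.comp 0 (h.differentiableAt h0).hasFDerivAt
  have h3 := hf2.clm_apply hΦY.hasFDerivAt
  have h4 :=
    (differentiableAt_fderiv_complex hf hΩ h.mem).hasFDerivAt.clm_apply
      (hasFDerivAt_const (fderiv ℂ Φ 0 Y) p)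
  rw [e1.fderiv_eq, h3.fderiv, h4.fderiv, h.map_zero, hfp]
  simp

end IsChart

/-- Lower bounds for `I⁰` and `I²` in a chart. -/
theorem exists_lower_bounds (n : ℕ) : ∃ C > 0, ∀ (Ω : Set ℂ^n), IsOpen Ω → Bornology.IsBounded Ω →
    ∀ c p Φ J φ, IsChart Ω c p Φ J φ → J ≤ C * I0 n Ω p ∧ ∀ X Y, X ≠ 0 → Y ≠ 0 →
      J ≤ C * (‖X‖ ^ 2 * ‖Y‖ ^ 2) * I2 n Ω p (fderiv ℝ Φ 0 X) (fderiv ℝ Φ 0 Y) := by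
  obtain ⟨C, hC, hCauchy⟩ := exists_cauchy_estimates n
  refine ⟨C, hC, fun Ω hΩ hb c p Φ J φ h => ⟨?_, fun X Y hX hY => ?_⟩⟩
  · rw [← div_le_iff₀' hC]
    refine le_csInf ⟨_, fun _ => 1, inBergman_of_differentiable hb (differentiable_const 1), rfl, rfl⟩ ?_
    rintro _ ⟨f, hf, hfp, rfl⟩
    have h1 := (hCauchy _ (h.differentiableOn_comp hf.1) (h.integrableOn_comp hf)).1
    rw [h.map_zero, hfp] at h1
    have h2 := h.integral_comp_le hf
    rw [div_le_iff₀' hC]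
    calc J = J * ‖(1 : ℂ)‖ ^ 2 := by simp
      _ ≤ J * (C * ∫ ξ in ball 0 1, ‖f (Φ ξ)‖ ^ 2) := by gcongr; exact h.J_pos.le
      _ = C * (J * ∫ ξ in ball 0 1, ‖f (Φ ξ)‖ ^ 2) := by ring
      _ ≤ _ := by gcongr
  · have h0 : (0 : ℂ^n) ∈ ball 0 1 := mem_ball_self one_pos
    have hinj : ∀ V, V ≠ 0 → fderiv ℝ Φ 0 V ≠ 0 := fun V hV hV0 => by
      have := ((fderiv ℝ Φ 0).toContinuousLinearEquivOfDetNeZero (h.det_ne_zero h0)).injective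
      exact hV (this (by simpa using hV0))
    have hK : 0 < C * (‖X‖ ^ 2 * ‖Y‖ ^ 2) := by
      positivity
    rw [← div_le_iff₀' hK]
    refine le_csInf (I2_set_nonempty hΩ hb h.mem (hinj X hX) (hinj Y hY)) ?_
    rintro _ ⟨f, hf, -, hf', hf2, rfl⟩
    have h1 := (hCauchy _ (h.differentiableOn_comp hf.1) (h.integrableOn_comp hf)).2.2 X Y
    rw [h.fderiv_fderiv_comp_chart hΩ hf.1 hf', ← h.fderiv_real_apply h0, ← h.fderiv_real_apply h0,
      ← holDeriv2_eq hf.1 hΩ h.mem, hf2] at h1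
    have h2 := h.integral_comp_le hf
    rw [div_le_iff₀' hK]
    calc J = J * ‖(1 : ℂ)‖ ^ 2 := by simp
      _ ≤ J * (C * (‖X‖ ^ 2 * ‖Y‖ ^ 2) * ∫ ξ in ball 0 1, ‖f (Φ ξ)‖ ^ 2) := by
          gcongr; exact h.J_pos.le
      _ = C * (‖X‖ ^ 2 * ‖Y‖ ^ 2) * (J * ∫ ξ in ball 0 1, ‖f (Φ ξ)‖ ^ 2) := by ring
      _ ≤ _ := by gcongr

end MinimumIntegrals

lemma fderiv_nsq_apply (z X : ℂ^n) : fderiv ℝ nsq z X = 2 * (∑ j, conj (z j) * X j).re := by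
  have h : HasFDerivAt nsq
      (∑ j, 2 • (innerSL ℝ (z j)).comp (proj j)) z :=
    HasFDerivAt.fun_sum fun j _ => (hasFDerivAt_apply j z).norm_sq
  rw [h.fderiv, sum_apply, re_sum, mul_sum]
  refine sum_congr rfl fun j _ => ?_
  simp
  ring

lemma pg_nsq (z X : ℂ^n) : pg nsq z X = ‖∑ j, conj (z j) * X j‖ ^ 2 := by
  have h : ∑ j, conj (z j) * (I • X) j = I * ∑ j, conj (z j) * X j := by
    rw [mul_sum]
    exact sum_congr rfl fun j _ => by simp; ring
  rw [pg, fderiv_nsq_apply, fderiv_nsq_apply, h, ← normSq_eq_norm_sq, normSq_apply]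
  simp
  ring

lemma pg_nsq_le (z X : ℂ^n) : pg nsq z X ≤ nsq z * nsq X := by
  rw [pg_nsq]
  calc ‖∑ j, conj (z j) * X j‖ ^ 2 ≤ (∑ j, ‖z j‖ * ‖X j‖) ^ 2 := by
        gcongr
        exact (norm_sum_le _ _).trans_eq (sum_congr rfl fun j _ => by simp)
    _ ≤ _ := Finset.sum_mul_sq_le_sq_mul_sq _ _ _

lemma lv_nsq (z X : ℂ^n) : lv nsq z X = nsq X := by
  have h : fderiv ℝ (nsq : ℂ^n → ℝ) = fun z => ∑ j, 2 • (innerSL ℝ (z j)).comp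
      (proj j) := by
    funext z
    exact (HasFDerivAt.fun_sum fun j _ => (hasFDerivAt_apply j z).norm_sq :
      HasFDerivAt nsq _ z).fderiv
  have hD : ∀ X, D2 nsq z X X = 2 * nsq X := fun X => by
    have h0 :=
      ((contDiff_nsq.contDiffAt_two z).fderiv_right (m := 1) (by norm_num)).differentiableAt (by simp)
    have h2 : D2 nsq z X X = fderiv ℝ (fun y => fderiv ℝ nsq y X) z X := by
      have := (h0.hasFDerivAt.clm_apply (hasFDerivAt_const X z)).fderiv
      rw [this]; simp [D2]
    have h1 : HasFDerivAt (fun y => fderiv ℝ nsq y X)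
        (∑ j, (2 : ℝ) • ((innerSL ℝ (X j)).comp (proj j))) z := by
      have : (fun y => fderiv ℝ nsq y X) = fun y => ∑ j, (2 : ℝ) • innerSL ℝ (X j) (y j) := by
        funext y
        rw [h]
        simp [real_inner_comm]
        ring
      rw [this]
      exact HasFDerivAt.fun_sum fun j _ =>
        (((innerSL ℝ (X j)).hasFDerivAt.comp z (hasFDerivAt_apply j z)).const_smul (2 : ℝ))
    rw [h2, h1.fderiv, nsq, mul_sum]
    simp
  rw [lv, lvp, hD, hD, nsq_smul]
  simp
  ring

/-- The logarithm, cut off to vanish beyond `1/2`. -/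
noncomputable def logCut (u) := Real.log u * smoothTransition (2 - 4 * u)

lemma contDiffAt_logCut {u} (hu : 0 < u) : ContDiffAt ℝ ∞ logCut u :=
  (Real.contDiffAt_log.2 hu.ne').mul (smoothTransition.contDiff.comp
    (contDiff_const.sub (contDiff_const.mul contDiff_id))).contDiffAt

lemma logCut_eq_log {u} (hu : u ≤ 1 / 4) : logCut u = Real.log u := by
  rw [logCut, smoothTransition.one_of_one_le (by linarith), mul_one]

lemma logCut_eq_zero {u} (hu : 1 / 2 ≤ u) : logCut u = 0 := by
  rw [logCut, smoothTransition.zero_of_nonpos (by linarith), mul_zero]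

lemma logCut_nonpos {u} (hu : 0 < u) : logCut u ≤ 0 := by
  rcases le_total (1 / 2) u with h | h
  · exact (logCut_eq_zero h).le
  · exact mul_nonpos_of_nonpos_of_nonneg (log_nonpos hu.le (by linarith))
      (smoothTransition.nonneg _)

lemma log_le_logCut {a u} (ha : 0 < a) (ha1 : a ≤ 1) (hau : a ≤ u) : Real.log a ≤ logCut u := by
  rcases le_total (1 / 2) u with h | h
  · rw [logCut_eq_zero h]; exact log_nonpos ha.le ha1
  · have h1 := log_le_log ha hau
    have h2 := log_nonpos (ha.le.trans hau) (by linarith)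
    have h3 := smoothTransition.le_one (2 - 4 * u)
    rw [logCut]
    nlinarith

lemma exists_bound_deriv_logCut : ∃ K, 0 ≤ K ∧ ∀ u ∈ Icc (1 / 4) 1,
    -K ≤ deriv logCut u ∧ -K ≤ deriv (deriv logCut) u := by
  have hopen : IsOpen (Ioi (0 : ℝ)) := isOpen_Ioi
  have h0 : ContDiffOn ℝ 2 logCut (Ioi 0) := fun u hu =>
    ((contDiffAt_logCut hu).of_le two_le_infty).contDiffWithinAt
  have h1 : ContDiffOn ℝ 1 (deriv logCut) (Ioi 0) := h0.deriv_of_isOpen hopen (by norm_num)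
  have h2 := h1.continuousOn_deriv_of_isOpen hopen le_rfl
  have hsub : Icc (1 / 4 : ℝ) 1 ⊆ Ioi 0 := fun u hu => lt_of_lt_of_le (by norm_num) hu.1
  obtain ⟨C1, hC1⟩ := isCompact_Icc.exists_bound_of_continuousOn (h1.continuousOn.mono hsub)
  obtain ⟨C2, hC2⟩ := isCompact_Icc.exists_bound_of_continuousOn (h2.mono hsub)
  refine ⟨max (max C1 C2) 0, le_max_right _ _, fun u hu => ⟨?_, ?_⟩⟩
  · exact (abs_le.1 ((hC1 u hu).trans ((le_max_left _ _).trans (le_max_left _ _)))).1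
  · exact (abs_le.1 ((hC2 u hu).trans ((le_max_right _ _).trans (le_max_left _ _)))).1

lemma contDiff_logCut_nsq (hε : 0 < ε) : ContDiff ℝ ∞ fun ξ : ℂ^n => logCut (nsq ξ + ε) :=
  contDiff_iff_contDiffAt.2 fun ξ =>
    (contDiffAt_logCut (by have := nsq_nonneg ξ; linarith)).comp ξ (contDiff_nsq.add contDiff_const).contDiffAt

lemma tsupport_logCut_nsq_subset (hε : 0 < ε) :
    tsupport (fun ξ : ℂ^n => logCut (nsq ξ + ε)) ⊆ {ξ | nsq ξ ≤ 1 / 2} := by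
  refine closure_minimal (fun ξ hξ => ?_) (isClosed_le contDiff_nsq.continuous continuous_const)
  by_contra h
  simp [mem_ofPred_eq] at h
  exact hξ (logCut_eq_zero (by linarith))

lemma nsq_le_half_subset : {ξ : ℂ^n | nsq ξ ≤ 1 / 2} ⊆ ball 0 1 := fun ξ hξ => by
  have h1 := norm_sq_le_nsq ξ
  have h2 : nsq ξ ≤ 1 / 2 := hξ
  rw [mem_ball_zero_iff]
  nlinarith

lemma hasCompactSupport_logCut_nsq (hε : 0 < ε) :
    HasCompactSupport fun ξ : ℂ^n => logCut (nsq ξ + ε) :=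
  (isCompact_closedBall 0 1).of_isClosed_subset (isClosed_tsupport _)
    (((tsupport_logCut_nsq_subset hε).trans nsq_le_half_subset).trans ball_subset_closedBall)

lemma exists_le_lv_logCut : ∃ K, 0 ≤ K ∧ ∀ (n) (ε), 0 < ε → ∀ ξ Y : ℂ^n,
    -(K * nsq Y) ≤ lv (fun ξ => logCut (nsq ξ + ε)) ξ Y := by
  obtain ⟨K, hK0, hK⟩ := exists_bound_deriv_logCut
  refine ⟨2 * K, by positivity, fun n ε hε ξ Y => ?_⟩
  have hN := nsq_nonneg ξ
  have hY := nsq_nonneg Y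
  have hu0 : 0 < nsq ξ + ε := by linarith
  have hpg := pg_nsq_le ξ Y
  have hpg0 := pg_nonneg nsq ξ Y
  have hc : ContDiffAt ℝ 2 (fun t => logCut (t + ε)) (nsq ξ) :=
    ((contDiffAt_logCut hu0).of_le two_le_infty).comp (nsq ξ) (contDiffAt_id.add contDiffAt_const)
  have hd := by
    funext t; exact deriv_comp_add_const (f := logCut) (a := ε) (x := t)
  have hlv : lv (fun ξ => logCut (nsq ξ + ε)) ξ Y = deriv logCut (nsq ξ + ε) * nsq Y
      + deriv (deriv logCut) (nsq ξ + ε) * pg nsq ξ Y := by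
    rw [lv_comp (contDiff_nsq.contDiffAt_two ξ) hc Y, hd, lv_nsq]
    congr 2
    exact deriv_comp_add_const (f := deriv logCut) (a := ε) (x := nsq ξ)
  rw [hlv]
  rcases lt_or_ge (nsq ξ + ε) (1 / 4) with h1 | h1
  · have e1 : logCut =ᶠ[𝓝 (nsq ξ + ε)] Real.log := by
      filter_upwards [Iio_mem_nhds h1] with t ht using logCut_eq_log (le_of_lt ht)
    have e2 : deriv logCut =ᶠ[𝓝 (nsq ξ + ε)] fun t => t⁻¹ := by
      filter_upwards [e1.eventuallyEq_nhds] with t ht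
      rw [ht.deriv_eq, Real.deriv_log]
    rw [e2.eq_of_nhds, e2.deriv_eq, deriv_inv]
    have h2 : -((nsq ξ + ε) ^ 2)⁻¹ * pg nsq ξ Y ≥ -((nsq ξ + ε)⁻¹ * nsq Y) := by
      have : ((nsq ξ + ε) ^ 2)⁻¹ * pg nsq ξ Y ≤ (nsq ξ + ε)⁻¹ * nsq Y := by
        calc ((nsq ξ + ε) ^ 2)⁻¹ * pg nsq ξ Y ≤ ((nsq ξ + ε) ^ 2)⁻¹ * ((nsq ξ + ε) * nsq Y) := by
              gcongr; nlinarith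
          _ = _ := by field_simp
      linarith
    have : 0 ≤ 2 * K * nsq Y := by positivity
    linarith
  · rcases le_or_gt (nsq ξ + ε) 1 with h2 | h2
    · obtain ⟨k1⟩ := hK _ ⟨h1, h2⟩
      nlinarith [mul_nonneg hK0 hY]
    · have e1 : logCut =ᶠ[𝓝 (nsq ξ + ε)] fun _ => 0 := by
        filter_upwards [Ioi_mem_nhds h2] with t ht
        exact logCut_eq_zero (by have : 1 < t := ht; linarith)
      have e2 : deriv logCut =ᶠ[𝓝 (nsq ξ + ε)] fun _ => 0 := by
        filter_upwards [e1.eventuallyEq_nhds] with t ht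
        rw [ht.deriv_eq]; simp
      rw [e2.eq_of_nhds, e2.deriv_eq]
      have : 0 ≤ 2 * K * nsq Y := by positivity
      simp [deriv_const, zero_mul]
      linarith

section Approximation

lemma lv_const_mul (hφ : ContDiffAt ℝ 2 φ z) (a) (X) :
    lv (fun y => a * φ y) z X = a * lv φ z X := by
  have hd : deriv (fun t => a * t) = fun _ => a := by simp
  rw [lv_comp (χ := fun t => a * t) hφ (contDiffAt_const.mul contDiffAt_id) X]
  simp

/-- The weight with an almost logarithmic pole at the centre of a chart. -/
noncomputable def chartWeight (Φ) (φ : ℂ^n → ℝ) (M e) (z) :=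
  M * φ z + (n + 2) * pull Φ (fun ξ => logCut (nsq ξ + e)) z

namespace IsChart

variable {Φ : ℂ^n → ℂ^n} {J : ℝ} (h : IsChart Ω c p Φ J φ)
include h

lemma contDiff_pull_logCut {e} (he : 0 < e) : ContDiff ℝ ∞ (pull Φ fun ξ => logCut (nsq ξ + e)) :=
  h.contDiff_pull (hasCompactSupport_logCut_nsq he)
    ((tsupport_logCut_nsq_subset he).trans nsq_le_half_subset) (contDiff_logCut_nsq he)

lemma contDiffOn_chartWeight {e} (he : 0 < e) : ContDiffOn ℝ ∞ (chartWeight Φ φ M e) Ω :=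
  (contDiffOn_const.mul h.contDiffOn).add (contDiff_const.mul (h.contDiff_pull_logCut he)).contDiffOn

lemma chartWeight_apply {e} {ξ} (hξ : ξ ∈ ball 0 1) :
    chartWeight Φ φ M e (Φ ξ) = M * φ (Φ ξ) + (n + 2) * logCut (nsq ξ + e) := by
  rw [chartWeight, h.pull_apply _ hξ]

lemma chartWeight_le {e} (hM : 0 ≤ M) (he : 0 < e) (hz : z ∈ Ω) :
    chartWeight Φ φ M e z ≤ M := by
  have h1 := (h.mem_Icc z hz).2
  have h2 : pull Φ (fun ξ => logCut (nsq ξ + e)) z ≤ 0 := by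
    by_cases hz1 : z ∈ Φ '' ball 0 1
    · obtain ⟨ξ, hξ, rfl⟩ := hz1
      rw [h.pull_apply _ hξ]
      exact logCut_nonpos (by have := nsq_nonneg ξ; linarith)
    · rw [pull, indicator_of_notMem hz1]
  rw [chartWeight]
  nlinarith

lemma lv_chartWeight (hΩ : IsOpen Ω) {e} (he : 0 < e) (hz : z ∈ Ω) (X) :
    lv (chartWeight Φ φ M e) z X
      = M * lv φ z X + (n + 2) * lv (pull Φ fun ξ => logCut (nsq ξ + e)) z X := by
  have hφ := (h.contDiffOn.contDiffAt (hΩ.mem_nhds hz)).of_le two_le_infty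
  have hp := (h.contDiff_pull_logCut he).contDiffAt_two z
  have := lv_add (φ := fun z => M * φ z) (ψ := fun z => (n + 2) * pull Φ (fun ξ => logCut (nsq ξ + e)) z)
    (contDiffAt_const.mul hφ) (contDiffAt_const.mul hp) X
  rw [lv_const_mul hφ, lv_const_mul hp] at this
  exact this

lemma norm_sq_le_lv_chartWeight (hΩ : IsOpen Ω) {K e} (he : 0 < e) (hM0 : 0 ≤ M)
    (hK0 : 0 ≤ K) (hK : ∀ ξ Y : ℂ^n, -(K * nsq Y) ≤ lv (fun ξ => logCut (nsq ξ + e)) ξ Y)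
    (hM : 1 + (n + 2) * (K * n) ≤ M * c) {ξ} (hξ : ξ ∈ ball 0 1)
    (Y) : ‖Y‖ ^ 2 ≤ lv (chartWeight Φ φ M e) (Φ ξ) (fderiv ℝ Φ ξ Y) := by
  rw [h.lv_chartWeight hΩ he (h.mapsTo hξ), ← h.lv_comp_chart hξ
    ((h.contDiff_pull_logCut he).contDiffAt_two _), lv_congr (h.pull_comp_eventuallyEq _ hξ)]
  have h1 := h.le_lv ξ hξ Y
  have h2 := hK ξ Y
  have h3 : K * nsq Y ≤ K * n * ‖Y‖ ^ 2 := by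
    rw [mul_assoc]; exact mul_le_mul_of_nonneg_left (nsq_le_norm_sq Y) hK0
  nlinarith

lemma lv_chartWeight_nonneg (hΩ : IsOpen Ω) {K e} (he : 0 < e) (hM0 : 0 ≤ M)
    (hK0 : 0 ≤ K) (hK : ∀ ξ Y : ℂ^n, -(K * nsq Y) ≤ lv (fun ξ => logCut (nsq ξ + e)) ξ Y)
    (hM : 1 + (n + 2) * (K * n) ≤ M * c) (hz : z ∈ Ω) (X) :
    0 ≤ lv (chartWeight Φ φ M e) z X := by
  by_cases hz1 : z ∈ Φ '' ball 0 1
  · obtain ⟨ξ, hξ, rfl⟩ := hz1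
    obtain ⟨Y, rfl⟩ := h.surjective_fderiv hξ X
    exact (sq_nonneg _).trans (h.norm_sq_le_lv_chartWeight hΩ he hM0 hK0 hK hM hξ Y)
  · have h0 : lv (pull Φ fun ξ => logCut (nsq ξ + e)) z X = 0 := by
      rw [lv_congr (h.pull_eventuallyEq_zero (hasCompactSupport_logCut_nsq he)
        ((tsupport_logCut_nsq_subset he).trans nsq_le_half_subset) hz1)]
      have h1 : fderiv ℝ (0 : ℂ^n → ℝ) = 0 := by simp
      simp [lv, lvp, D2]
    rw [h.lv_chartWeight hΩ he hz, h0, mul_zero, add_zero]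
    exact mul_nonneg hM0 (h.lv_nonneg z hz X)

lemma dbar_pull_le {χ : ℂ^n → ℝ} (hχ : ContDiff ℝ ∞ χ)
    (L : ℂ^n →L[ℂ] ℂ) {a} (ha0 : 0 ≤ a) (ha : ∀ ξ, ‖L ξ‖ ≤ a * ‖ξ‖)
    (hv : ContDiff ℝ ∞ v) {ξ} (hξ : ξ ∈ ball 0 1)
    (hvξ : (fun ζ => v (Φ ζ)) =ᶠ[𝓝 ξ] fun ζ => χ ζ * L ζ) (Y) :
    ‖∑ j, wderBar n j v (Φ ξ) * conj (fderiv ℝ Φ ξ Y j)‖ ^ 2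
      ≤ (a * ‖fderiv ℝ χ ξ‖) ^ 2 * ‖Y‖ ^ 2 := by
  set X := fderiv ℝ Φ ξ Y with hX
  have hd : ∀ Z, fderiv ℝ v (Φ ξ) (fderiv ℝ Φ ξ Z) = fderiv ℝ χ ξ Z * L ξ + χ ξ * L Z := fun Z => by
    have h1 : HasFDerivAt (fun ζ => v (Φ ζ)) ((fderiv ℝ v (Φ ξ)).comp (fderiv ℝ Φ ξ)) ξ :=
      ((hv.differentiable (by simp)) (Φ ξ)).hasFDerivAt.comp ξ
        ((h.contDiffAt hξ).differentiableAt (by simp)).hasFDerivAt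
    have h0 :=
      ofRealCLM.hasFDerivAt.comp ξ ((hχ.differentiable (by simp)) ξ).hasFDerivAt
    have h2 := h0.mul (L.restrictScalars ℝ).hasFDerivAt
    have h3 := hvξ.fderiv_eq (𝕜 := ℝ)
    rw [h1.fderiv, HasFDerivAt.fderiv (f := fun ζ => χ ζ * L ζ) h2] at h3
    have h4 := congrArg (fun T => T Z) h3
    simp at h4
    rw [h4]
    ring
  have hsum : ∑ j, wderBar n j v (Φ ξ) * conj (X j)
      = (1 / 2) * ((fderiv ℝ χ ξ Y + I * fderiv ℝ χ ξ (I • Y)) * L ξ) := by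
    have h1 := sum_conj_mul_add_I_mul X (fderiv ℝ v (Φ ξ))
    have h2 : fderiv ℝ v (Φ ξ) (I • X) = fderiv ℝ v (Φ ξ) (fderiv ℝ Φ ξ (I • Y)) := by
      rw [fderiv_I_smul_of_differentiableAt (h.differentiableAt hξ)]
    rw [h2, hd, hd, show L (I • Y) = I * L Y from L.map_smul I Y] at h1
    have h3 : ∑ j, wderBar n j v (Φ ξ) * conj (X j) = (1 / 2) *
        ∑ j, conj (X j) * (fderiv ℝ v (Φ ξ) (single j 1)
          + I * fderiv ℝ v (Φ ξ) (single j I)) := by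
      rw [mul_sum]
      exact sum_congr rfl fun j _ => by rw [wderBar_def]; ring
    rw [h3, h1]
    linear_combination (1 / 2) * χ ξ * L Y * I_mul_I
  rw [hsum, ← mul_pow]
  have hξ1 := (mem_ball_zero_iff.1 hξ).le
  have e1 : ‖(fderiv ℝ χ ξ Y + I * fderiv ℝ χ ξ (I • Y))‖ ≤ 2 * (‖fderiv ℝ χ ξ‖ * ‖Y‖) := by
    refine (norm_add_le _ _).trans ?_
    rw [norm_mul, norm_I, norm_real, norm_real]
    have e2 := (fderiv ℝ χ ξ).le_opNorm Y
    have e3 := (fderiv ℝ χ ξ).le_opNorm (I • Y)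
    rw [norm_smul, norm_I] at e3
    linarith
  have e4 : ‖L ξ‖ * ‖fderiv ℝ χ ξ‖ ≤ a * ‖fderiv ℝ χ ξ‖ := by
    gcongr
    exact (ha ξ).trans (mul_le_of_le_one_right ha0 hξ1)
  gcongr
  rw [norm_mul, norm_mul]
  have : ‖(1 / 2 : ℂ)‖ = 1 / 2 := by norm_num
  rw [this]
  nlinarith [norm_nonneg (L ξ), norm_nonneg Y]

end IsChart

end Approximation

section UpperBound

namespace IsChart

variable {Φ : ℂ^n → ℂ^n} {J : ℝ} (h : IsChart Ω c p Φ J φ)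
include h

lemma integral_eq_of_support {F} [NormedAddCommGroup F] [NormedSpace ℝ F] {g : ℂ^n → F}
    (hg : ∀ z ∉ Φ '' ball 0 1, g z = 0) : ∫ z, g z = J • ∫ ξ in ball 0 1, g (Φ ξ) := by
  rw [← h.integral_image measurableSet_ball Subset.rfl, setIntegral_eq_integral_of_forall_compl_eq_zero hg]

lemma exists_holomorphic_approx {χ : ℂ^n → ℝ} (hΩ : IsOpen Ω)
    (hs : IsGoodExhaustion s Ω) (hχ : ContDiff ℝ ∞ χ)
    (hχc : HasCompactSupport χ) (hχs : tsupport χ ⊆ ball 0 1)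
    (hχ1 : ∀ ξ ∈ closedBall 0 (1 / 4), χ =ᶠ[𝓝 ξ] 1) {A} (hA : ∀ ξ, ‖fderiv ℝ χ ξ‖ ≤ A)
    {K e} (he : 0 < e) (hM0 : 0 ≤ M)
    (hK0 : 0 ≤ K) (hK : ∀ ξ Y : ℂ^n, -(K * nsq Y) ≤ lv (fun ξ => logCut (nsq ξ + e)) ξ Y)
    (hM : 1 + (n + 2) * (K * n) ≤ M * c) (L : ℂ^n →L[ℂ] ℂ) {a} (ha0 : 0 ≤ a)
    (ha : ∀ ξ, ‖L ξ‖ ≤ a * ‖ξ‖) : ∃ f, DifferentiableOn ℂ f Ω ∧ IntegrableOn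
      (fun z => ‖pull Φ (fun ξ => χ ξ * L ξ) z - f z‖ ^ 2 * rexp (-chartWeight Φ φ M e z)) Ω ∧
      ∫ z in Ω, ‖pull Φ (fun ξ => χ ξ * L ξ) z - f z‖ ^ 2 * rexp (-chartWeight Φ φ M e z)
        ≤ 4 * (J * ((a * A) ^ 2 * rexp (-((n + 2) * Real.log (1 / 16)))
          * volume.real (ball (0 : ℂ^n) 1))) := by
  set H := fun ξ => χ ξ * L ξ with hH
  set D := fun ξ => (a * ‖fderiv ℝ χ ξ‖) ^ 2 with hD
  have hχC := hχc.comp_left (g := fun x : ℝ => (x : ℂ)) (by simp)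
  have hHc : HasCompactSupport H := hχC.mul_right
  have hHs : tsupport H ⊆ ball 0 1 :=
    (tsupport_mul_subset_left.trans (tsupport_comp_subset (g := fun x : ℝ => (x : ℂ)) (by simp) χ)).trans hχs
  have hHd := (contDiff_ofReal_comp hχ).mul (L.restrictScalars ℝ).contDiff
  have hDsub : Function.support D ⊆ Function.support (fderiv ℝ χ) := fun ξ hξ hξ0 => hξ (by
    change (a * ‖fderiv ℝ χ ξ‖) ^ 2 = 0
    rw [show fderiv ℝ χ ξ = 0 from hξ0]; simp)
  have hDt := (closure_mono hDsub).trans (tsupport_fderiv_subset ℝ)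
  have hDc := hχc.of_isClosed_subset (isClosed_tsupport _) hDt
  have hDs := hDt.trans hχs
  have hDd : ContDiff ℝ 0 D := contDiff_zero.2
    ((continuous_const.mul (hχ.continuous_fderiv (by simp)).norm).pow 2)
  have hvt : IsTestFun n (pull Φ H) Ω := ⟨h.contDiff_pull hHc hHs hHd, h.hasCompactSupport_pull hHc hHs,
    h.tsupport_pull_subset_domain hHc hHs⟩
  have hG0 : ∀ z, 0 ≤ pull Φ D z := fun z => indicator_nonneg (fun _ _ => sq_nonneg _) z
  obtain ⟨f, hf, hfi, hfb⟩ := hormander hΩ (h.contDiffOn_chartWeight he) hs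
    (fun z hz => h.lv_chartWeight_nonneg hΩ he hM0 hK0 hK hM hz) hvt
    (h.contDiff_pull hDc hDs hDd).continuous (h.hasCompactSupport_pull hDc hDs) hG0
    (h.tsupport_pull_subset_domain hDc hDs) (fun z hz X => by
      by_cases hz1 : z ∈ Φ '' ball 0 1
      · obtain ⟨ξ, hξ, rfl⟩ := hz1
        obtain ⟨Y, rfl⟩ := h.surjective_fderiv hξ X
        refine (h.dbar_pull_le hχ L ha0 ha hvt.1 hξ (h.pull_comp_eventuallyEq H hξ) Y).trans ?_
        rw [h.pull_apply D hξ]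
        exact mul_le_mul_of_nonneg_left (h.norm_sq_le_lv_chartWeight hΩ he hM0 hK0 hK hM hξ Y) (sq_nonneg _)
      · have h0 : ∀ j, wderBar n j (pull Φ H) z = 0 := fun j => by
          rw [wderBar_def, (h.pull_eventuallyEq_zero hHc hHs hz1).fderiv_eq]
          simp
        simp only [h0, zero_mul, sum_const_zero, norm_zero]
        rw [zero_pow two_ne_zero]
        exact mul_nonneg (hG0 z) (h.lv_chartWeight_nonneg hΩ he hM0 hK0 hK hM hz X))
  refine ⟨f, hf, hfi, hfb.trans (mul_le_mul_of_nonneg_left ?_ (by norm_num))⟩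
  rw [h.integral_eq_of_support (fun z hz => by rw [pull, indicator_of_notMem hz, zero_mul])]
  refine mul_le_mul_of_nonneg_left ?_ h.J_pos.le
  have hV : volume (ball (0 : ℂ^n) 1) < ⊤ := measure_ball_lt_top
  refine (le_norm_self _).trans (norm_setIntegral_le_of_norm_le_const hV fun ξ hξ => ?_)
  rw [h.pull_apply D hξ, h.chartWeight_apply hξ, norm_mul, Real.norm_of_nonneg (sq_nonneg _),
    Real.norm_of_nonneg (exp_pos _).le]
  by_cases hξ4 : ‖ξ‖ ≤ 1 / 4
  · have : fderiv ℝ χ ξ = 0 := by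
      rw [(hχ1 ξ (mem_closedBall_zero_iff.2 hξ4)).fderiv_eq]
      exact fderiv_const_apply 1
    simp only [this, norm_zero, mul_zero]
    rw [zero_pow two_ne_zero, zero_mul]
    positivity
  · have h1 : 1 / 16 ≤ nsq ξ + e := by
      have := norm_sq_le_nsq ξ
      nlinarith
    have h2 := log_le_logCut (by norm_num) (by norm_num) h1
    have h3 := (h.mem_Icc _ (h.mapsTo hξ)).1
    have h5 := hA ξ
    refine mul_le_mul (by gcongr) (exp_le_exp.2 ?_) (exp_pos _).le (sq_nonneg _)
    nlinarith

end IsChart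

end UpperBound

open scoped Pointwise in
lemma cauchy_estimate_scaled {C} (hC : ∀ g : ℂ^n → ℂ,
    DifferentiableOn ℂ g (ball 0 1) → IntegrableOn (fun z => ‖g z‖ ^ 2) (ball 0 1) →
      ‖g 0‖ ^ 2 ≤ C * ∫ z in ball 0 1, ‖g z‖ ^ 2 ∧
      (∀ X, ‖fderiv ℂ g 0 X‖ ^ 2 ≤ C * ‖X‖ ^ 2 * ∫ z in ball 0 1, ‖g z‖ ^ 2))
    (hε : 0 < ε) (hε1 : ε < 1) (hg : DifferentiableOn ℂ g (ball 0 1)) :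
      ‖g 0‖ ^ 2 ≤ C * ((ε ^ (2 * n))⁻¹ * ∫ z in ball 0 ε, ‖g z‖ ^ 2) ∧
      ∀ X, ε ^ 2 * ‖fderiv ℂ g 0 X‖ ^ 2
        ≤ C * ‖X‖ ^ 2 * ((ε ^ (2 * n))⁻¹ * ∫ z in ball 0 ε, ‖g z‖ ^ 2) := by
  have hball : ε • ball (0 : ℂ^n) 1 = ball 0 ε := by
    rw [_root_.smul_ball hε.ne', smul_zero, Real.norm_of_nonneg hε.le, mul_one]
  have hmap : MapsTo (fun ξ : ℂ^n => (ε : ℂ) • ξ) (ball 0 1) (ball 0 1) := fun ξ hξ => by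
    rw [mem_ball_zero_iff] at hξ ⊢
    rw [norm_smul, norm_real, Real.norm_of_nonneg hε.le]
    nlinarith
  have hmc : Continuous fun ξ : ℂ^n => (ε : ℂ) • ξ := continuous_const_smul _
  have hk : DifferentiableOn ℂ (fun ξ => g ((ε : ℂ) • ξ)) (ball 0 1) :=
    hg.comp (differentiable_id.const_smul ε).differentiableOn hmap
  have hi : IntegrableOn (fun ξ => ‖g (ε • ξ)‖ ^ 2) (ball 0 1) := by
    have h1 : ContinuousOn (fun ξ => ‖g (ε • ξ)‖ ^ 2) (closedBall 0 1) :=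
      ((hg.continuousOn.comp hmc.continuousOn fun ξ hξ => by
        rw [mem_closedBall_zero_iff] at hξ
        rw [mem_ball_zero_iff, norm_smul, norm_real, Real.norm_of_nonneg hε.le]
        nlinarith).norm).pow 2
    exact (h1.integrableOn_compact (isCompact_closedBall _ _)).mono_set ball_subset_closedBall
  have hitg : ∫ ξ in ball 0 1, ‖g ((ε : ℂ) • ξ)‖ ^ 2
      = (ε ^ (2 * n))⁻¹ * ∫ z in ball 0 ε, ‖g z‖ ^ 2 := by
    have h1 := Measure.setIntegral_comp_smul_of_pos volume (fun z => ‖g z‖ ^ 2)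
      (ball 0 1) hε
    have h2 : Module.finrank ℝ ℂ^n = 2 * n := by
      rw [Module.finrank_pi_fintype]; simp [mul_comm]
    rw [hball, h2] at h1
    exact h1
  obtain ⟨e1, e2⟩ := hC _ hk hi
  rw [hitg] at e1
  refine ⟨by simpa using e1, fun X => ?_⟩
  have e3 := e2 X
  rw [hitg] at e3
  have h0 : DifferentiableAt ℂ g (ε • 0) := by
    rw [smul_zero]; exact hg.differentiableAt (isOpen_ball.mem_nhds (mem_ball_self one_pos))
  have h4 : fderiv ℂ (fun ξ => g ((ε : ℂ) • ξ)) 0 X = ε * fderiv ℂ g 0 X := by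
    have h5 : HasFDerivAt (fun ξ => ε • ξ) (ε • ContinuousLinearMap.id ℂ ℂ^n) 0 :=
      (ε • ContinuousLinearMap.id ℂ ℂ^n).hasFDerivAt
    have h6 := (h0.hasFDerivAt.comp 0 h5).fderiv
    have h7 : fderiv ℂ (fun ξ => g ((ε : ℂ) • ξ)) 0 = _ := h6
    rw [h7]
    simp
  rw [h4, norm_mul, norm_real, mul_pow, Real.norm_of_nonneg hε.le] at e3
  exact e3

lemma norm_sq_le_two_mul (a b : ℂ) : ‖b‖ ^ 2 ≤ 2 * ‖a - b‖ ^ 2 + 2 * ‖a‖ ^ 2 := by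
  have h1 : ‖b‖ ≤ ‖a - b‖ + ‖a‖ := by
    have := norm_sub_le a (a - b)
    rw [sub_sub_cancel] at this
    linarith
  nlinarith [norm_nonneg b, sq_nonneg (‖a - b‖ - ‖a‖)]

/-- Linear functions in a chart are approximated to second order by Bergman functions of controlled norm. -/
theorem exists_bergman_approx (n) (hc : 0 < c) : ∃ C > 0, ∀ (Ω) (s),
    IsOpen Ω → IsGoodExhaustion s Ω → ∀ p Φ J φ, IsChart Ω c p Φ J φ →
    ∀ (L : ℂ^n →L[ℂ] ℂ) (a), 0 ≤ a → (∀ ξ, ‖L ξ‖ ≤ a * ‖ξ‖) →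
    ∀ ε : ℝ, 0 < ε → ε ≤ 1 / 4 → (n + 1) * ε ^ 2 ≤ 1 / 4 → ∃ f, InBergman n Ω f ∧ l2sq n Ω f ≤ C * J * a ^ 2 ∧
      ∫ ξ in ball 0 ε, ‖f (Φ ξ) - L ξ‖ ^ 2 ≤ C * a ^ 2 * (ε ^ 2) ^ (n + 2) := by
  obtain ⟨χ, hχ, hχc, hχs, hχ01, hχ1⟩ := exists_contDiff_cutoff (isOpen_ball (ε := 1))
    (isCompact_closedBall 0 (1 / 4)) (closedBall_subset_ball (by norm_num))
  obtain ⟨A, hA⟩ := (hχ.continuous_fderiv (by simp)).bounded_above_of_compact_support (hχc.fderiv (𝕜 := ℝ))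
  obtain ⟨K, hK0, hK⟩ := exists_le_lv_logCut
  set M := (1 + (n + 2) * (K * n)) / c with hM
  have hM0 : 0 ≤ M := by positivity
  set V := volume.real (ball (0 : ℂ^n) 1) with hV
  set B := 4 * (A ^ 2 * rexp (-((n + 2) * Real.log (1 / 16))) * V) with hB
  refine ⟨2 * (rexp M * B) + 2 * V + rexp M * B * (n + 1) ^ (n + 2) + 1, by positivity, ?_⟩
  intro Ω s hΩ hs p Φ J φ h L a ha0 ha ε hε hε4 hεn
  have hJ := h.J_pos.le
  obtain ⟨f, hf, hfi, hfb⟩ := h.exists_holomorphic_approx hΩ hs hχ hχc hχs hχ1 hA (sq_pos_of_pos hε) hM0 hK0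
    (hK n _ (sq_pos_of_pos hε)) (by rw [div_mul_cancel₀ _ hc.ne']) L ha0 ha
  set v := pull Φ (fun ξ => χ ξ * L ξ) with hv
  set w := chartWeight Φ φ M (ε ^ 2) with hw
  have hfb' : ∫ z in Ω, ‖v z - f z‖ ^ 2 * rexp (-w z) ≤ B * J * a ^ 2 := by
    refine hfb.trans (le_of_eq ?_); rw [hB]; ring
  have hvi : Integrable fun z => ‖v z‖ ^ 2 := by
    have hχC := hχc.comp_left (g := fun x : ℝ => (x : ℂ)) (by simp)
    have hs' := (tsupport_mul_subset_left (g := L)).trans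
      ((tsupport_comp_subset (g := fun x : ℝ => (x : ℂ)) (by simp) χ).trans hχs)
    have hvc : Continuous v := by rw [hv]; exact (h.contDiff_pull hχC.mul_right hs'
      ((contDiff_ofReal_comp hχ).mul (L.restrictScalars ℝ).contDiff)).continuous
    have hvs : HasCompactSupport v := by rw [hv]; exact h.hasCompactSupport_pull hχC.mul_right hs'
    have hvs2 := hvs.comp_left (g := fun x => ‖x‖ ^ 2) (by simp)
    exact (hvc.norm.pow 2).integrable_of_hasCompactSupport hvs2
  have hvle : ∫ z in Ω, ‖v z‖ ^ 2 ≤ J * (a ^ 2 * V) := by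
    refine (setIntegral_le_integral hvi (.of_forall fun z => sq_nonneg _)).trans ?_
    have h1 := h.integral_eq_of_support (g := fun z => ‖v z‖ ^ 2) fun z hz => by
      rw [hv, pull, indicator_of_notMem hz, norm_zero, zero_pow two_ne_zero]
    rw [h1]
    refine mul_le_mul_of_nonneg_left ?_ hJ
    rw [hV]
    refine (le_norm_self _).trans (norm_setIntegral_le_of_norm_le_const measure_ball_lt_top fun ξ hξ => ?_)
    rw [hv, h.pull_apply _ hξ, norm_pow, norm_norm, norm_mul, norm_real, Real.norm_of_nonneg (hχ01 ξ).1]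
    have hξ1 := (mem_ball_zero_iff.1 hξ).le
    have h2 := (ha ξ).trans (mul_le_of_le_one_right ha0 hξ1)
    have h3 := mul_le_mul (hχ01 ξ).2 h2 (norm_nonneg _) zero_le_one
    rw [one_mul] at h3
    have := (hχ01 ξ).1
    gcongr
  have hdle : ∀ z ∈ Ω, ‖v z - f z‖ ^ 2 ≤ rexp M * (‖v z - f z‖ ^ 2 * rexp (-w z)) := fun z hz => by
    have h1 : 1 ≤ rexp M * rexp (-w z) := by
      rw [← Real.exp_add]
      have := h.chartWeight_le hM0 (sq_pos_of_pos hε) hz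
      rw [← hw] at this
      exact one_le_exp (by linarith)
    nlinarith
  have hle : ∀ z ∈ Ω, ‖f z‖ ^ 2 ≤ 2 * (rexp M * (‖v z - f z‖ ^ 2 * rexp (-w z))) + 2 * ‖v z‖ ^ 2 :=
    fun z hz => by have := hdle z hz; have := norm_sq_le_two_mul (v z) (f z); linarith
  have hRi : IntegrableOn
      (fun z => 2 * (rexp M * (‖v z - f z‖ ^ 2 * rexp (-w z))) + 2 * ‖v z‖ ^ 2) Ω :=
    ((hfi.const_mul _).const_mul _).add (hvi.integrableOn.const_mul _)
  have hfI : IntegrableOn (fun z => ‖f z‖ ^ 2) Ω :=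
    hRi.mono' ((hf.continuousOn.norm.pow 2).aestronglyMeasurable hΩ.measurableSet)
      ((ae_restrict_mem hΩ.measurableSet).mono fun z hz => by
        rw [Real.norm_of_nonneg (sq_nonneg _)]; exact hle z hz)
  refine ⟨f, ⟨hf, hfI⟩, ?_, ?_⟩
  · have h1 : l2sq n Ω f ≤ ∫ z in Ω, (2 * (rexp M * (‖v z - f z‖ ^ 2 * rexp (-w z))) + 2 * ‖v z‖ ^ 2) :=
      setIntegral_mono_on hfI hRi hΩ.measurableSet hle
    rw [integral_add ((hfi.const_mul _).const_mul _) (hvi.integrableOn.const_mul _), integral_const_mul,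
      integral_const_mul, integral_const_mul] at h1
    have h2 := mul_le_mul_of_nonneg_left hfb' (exp_pos M).le
    have h3 : 0 ≤ (rexp M * B * (n + 1) ^ (n + 2) + 1) * J * a ^ 2 := by positivity
    nlinarith
  · have hsub : ball (0 : ℂ^n) ε ⊆ ball 0 1 := ball_subset_ball (by linarith)
    set q := rexp M * ((n + 1) * ε ^ 2) ^ (n + 2) with hq
    have hpt : ∀ ξ ∈ ball 0 ε,
        ‖f (Φ ξ) - L ξ‖ ^ 2 ≤ q * (‖v (Φ ξ) - f (Φ ξ)‖ ^ 2 * rexp (-w (Φ ξ))) := fun ξ hξ => by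
      have hξε := mem_ball_zero_iff.1 hξ
      have hv1 : v (Φ ξ) = L ξ := by
        have h1 := (hχ1 ξ (mem_closedBall_zero_iff.2 (by linarith))).self_of_nhds
        rw [hv, h.pull_apply _ (hsub hξ), show χ ξ = 1 from h1]
        simp
      have hu : nsq ξ + ε ^ 2 ≤ (n + 1) * ε ^ 2 := by
        have h1 := nsq_le_norm_sq ξ
        have h2 : n * ‖ξ‖ ^ 2 ≤ n * ε ^ 2 := by gcongr
        linarith
      have hu0 : 0 < nsq ξ + ε ^ 2 := by have := nsq_nonneg ξ; positivity
      have hw1 : w (Φ ξ) ≤ M + (n + 2) * Real.log ((n + 1) * ε ^ 2) := by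
        rw [hw, h.chartWeight_apply (hsub hξ), logCut_eq_log (hu.trans hεn)]
        have h1 := (h.mem_Icc _ (h.mapsTo (hsub hξ))).2
        have h2 := log_le_log hu0 hu
        nlinarith
      have hexp : 1 ≤ q * rexp (-w (Φ ξ)) := by
        have h1 : q = rexp (M + (n + 2) * Real.log ((n + 1) * ε ^ 2)) := by
          rw [hq, Real.exp_add, mul_comm ((n : ℝ) + 2), ← Real.rpow_def_of_pos (by positivity)]
          exact_mod_cast congrArg (rexp M * ·) (Real.rpow_natCast _ (n + 2)).symm
        rw [h1, ← Real.exp_add]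
        exact one_le_exp (by linarith)
      rw [hv1, norm_sub_rev]
      nlinarith
    have hi := h.integrableOn_image measurableSet_ball hsub (fun z => ‖v z - f z‖ ^ 2 * rexp (-w z))
    have himg := (image_mono hsub).trans h.mapsTo.image_subset
    have hi1 := hi.1 (hfi.mono_set himg)
    have h2 := h.integral_image measurableSet_ball hsub (fun z => ‖v z - f z‖ ^ 2 * rexp (-w z))
    have h3 :=
      (setIntegral_mono_set hfi (.of_forall fun z => by positivity) himg.eventuallyLE).trans hfb'
    rw [h2, smul_eq_mul] at h3
    have h4 : ∫ ξ in ball 0 ε, ‖v (Φ ξ) - f (Φ ξ)‖ ^ 2 * rexp (-w (Φ ξ)) ≤ B * a ^ 2 := by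
      refine le_of_mul_le_mul_left ?_ h.J_pos
      linarith
    have h5 :=
      integral_mono_of_nonneg (.of_forall fun ξ => sq_nonneg _) (hi1.const_mul q)
        ((ae_restrict_mem measurableSet_ball).mono hpt)
    rw [integral_const_mul] at h5
    have h6 : q * ∫ ξ in ball 0 ε, ‖v (Φ ξ) - f (Φ ξ)‖ ^ 2 * rexp (-w (Φ ξ)) ≤ q * (B * a ^ 2) := by
      gcongr
    refine (h5.trans h6).trans ?_
    rw [hq, mul_pow]
    have h7 : 0 ≤ (2 * (rexp M * B) + 2 * V + 1) * a ^ 2 * (ε ^ 2) ^ (n + 2) := by positivity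
    nlinarith

lemma exists_clm_apply_eq_one (hX : X ≠ 0) :
    ∃ L : ℂ^n →L[ℂ] ℂ, L X = 1 ∧ ∀ ξ, ‖L ξ‖ ≤ ‖X‖⁻¹ * ‖ξ‖ := by
  have hne : Nonempty (Fin n) := by
    by_contra hne
    rw [not_nonempty_iff] at hne
    exact hX (Subsingleton.elim _ _)
  obtain ⟨j, hj⟩ := Finite.exists_max fun j => ‖X j‖
  have hjX := le_antisymm (norm_le_pi_norm X j) ((pi_norm_le_iff_of_nonneg (norm_nonneg _)).2 hj)
  have h0 := norm_ne_zero_iff.1 (by rw [hjX]; exact norm_ne_zero_iff.2 hX)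
  refine ⟨(X j)⁻¹ • proj j, ?_, fun ξ => ?_⟩
  · exact inv_mul_cancel₀ h0
  · change ‖(X j)⁻¹ * ξ j‖ ≤ _
    rw [norm_mul, norm_inv, hjX]
    gcongr
    exact norm_le_pi_norm ξ j

lemma exists_small_radius (n : ℕ) (C V) {J} (hJ : 0 < J) :
    ∃ ε : ℝ, 0 < ε ∧ ε ≤ 1 / 4 ∧ (n + 1) * ε ^ 2 ≤ 1 / 4 ∧ C * ε ^ 2 ≤ 1 / 4 ∧ V * (C * ε ^ 4) ≤ J := by
  have h1 : ∀ᶠ ε : ℝ in 𝓝[>] 0, ε < 1 / 4 :=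
    nhdsWithin_le_nhds (eventually_lt_nhds (by norm_num))
  have hf : ∀ (g : ℝ → ℝ) (b), Continuous g → g 0 < b → ∀ᶠ ε : ℝ in 𝓝[>] 0, g ε < b := fun g b hg hb =>
    nhdsWithin_le_nhds (hg.continuousAt.eventually_lt continuousAt_const hb)
  have h2 := hf (fun ε => (n + 1) * ε ^ 2) (1 / 4) (by fun_prop) (by norm_num)
  have h3 := hf (fun ε => C * ε ^ 2) (1 / 4) (by fun_prop) (by norm_num)
  have h4 := hf (fun ε => V * (C * ε ^ 4)) J (by fun_prop) (by simpa using hJ)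
  obtain ⟨ε, e1, e2, e3, e4, e5⟩ := (h1.and (h2.and (h3.and (h4.and self_mem_nhdsWithin)))).exists
  exact ⟨ε, e5, e1.le, e2.le, e3.le, e4.le⟩

theorem exists_upper_bound (n) (hc : 0 < c) : ∃ C > 0, ∀ (Ω) (s),
    IsOpen Ω → Bornology.IsBounded Ω → IsGoodExhaustion s Ω → ∀ p Φ J φ, IsChart Ω c p Φ J φ →
    ∀ X ≠ 0, ‖X‖ ^ 2 * I1 n Ω p (fderiv ℝ Φ 0 X) ≤ C * J := by
  obtain ⟨C, hC, happ⟩ := exists_bergman_approx n hc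
  obtain ⟨C0, hC0, hCau⟩ := exists_cauchy_estimates n
  refine ⟨8 * C + 8, by positivity, fun Ω s hΩ hb hs p Φ J φ h X hX => ?_⟩
  obtain ⟨L, hLX, hL⟩ := exists_clm_apply_eq_one hX
  set V := volume.real Ω with hV
  have hV0 : 0 ≤ V := measureReal_nonneg
  obtain ⟨ε, hε, hε4, hεn, hεC, hεV⟩ := exists_small_radius n (C0 * C) V h.J_pos
  obtain ⟨f, hf, hfn, hfL⟩ := happ Ω s hΩ hs p Φ J φ h L ‖X‖⁻¹ (by positivity) hL ε hε hε4 hεn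
  have h0 : (0 : ℂ^n) ∈ ball 0 1 := mem_ball_self one_pos
  have hg : DifferentiableOn ℂ (fun ξ => f (Φ ξ) - L ξ) (ball 0 1) :=
    (h.differentiableOn_comp hf.1).sub L.differentiable.differentiableOn
  obtain ⟨hg0, hg1⟩ := cauchy_estimate_scaled (fun g hg hgi => ⟨(hCau g hg hgi).1, (hCau g hg hgi).2.1⟩)
    hε (by linarith) hg
  have hT : (ε ^ (2 * n))⁻¹ * ∫ ξ in ball 0 ε, ‖f (Φ ξ) - L ξ‖ ^ 2 ≤ C * ‖X‖⁻¹ ^ 2 * ε ^ 4 := by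
    rw [inv_mul_le_iff₀ (by positivity)]
    refine hfL.trans (le_of_eq ?_)
    ring
  have hfp := by
    have := hg0.trans (mul_le_mul_of_nonneg_left hT hC0.le)
    rwa [map_zero, sub_zero, h.map_zero] at this
  set d := fderiv ℂ f p (fderiv ℝ Φ 0 X) with hd
  have hDg : fderiv ℂ (fun ξ => f (Φ ξ) - L ξ) 0 X = d - 1 := by
    rw [fderiv_fun_sub ((h.differentiableOn_comp hf.1).differentiableAt (isOpen_ball.mem_nhds h0))
      L.differentiableAt, sub_apply, L.fderiv, hLX, h.fderiv_comp_chart hΩ hf.1 h0,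
      h.map_zero, ← h.fderiv_real_apply h0]
  have hd1 := by
    have h1 := (hg1 X).trans (mul_le_mul_of_nonneg_left hT (by positivity))
    rw [hDg] at h1
    have h2 : C0 * ‖X‖ ^ 2 * (C * ‖X‖⁻¹ ^ 2 * ε ^ 4) = ε ^ 2 * (C0 * C * ε ^ 2) := by
      field_simp
    rw [h2] at h1
    exact (le_of_mul_le_mul_left h1 (by positivity)).trans hεC
  have hd2 : 1 / 2 ≤ ‖d‖ := by
    have h1 : ‖d - 1‖ ≤ 1 / 2 := by nlinarith
    have h2 := norm_sub_norm_le 1 d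
    rw [norm_sub_rev, norm_one] at h2
    linarith
  have hd0 := norm_pos_iff.1 (by linarith)
  set F := fun z => d⁻¹ * (f z - f p) with hF
  have hFle : ∀ z, ‖F z‖ ^ 2 ≤ 8 * ‖f z‖ ^ 2 + 8 * ‖f p‖ ^ 2 := fun z => by
    rw [hF]
    simp [norm_mul, norm_inv]
    have h1 : ‖d‖⁻¹ ^ 2 ≤ 4 := by
      have : ‖d‖⁻¹ ≤ 2 := by rw [inv_le_comm₀ (by linarith) two_pos]; linarith
      have h0 : 0 ≤ ‖d‖⁻¹ := by positivity
      nlinarith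
    have h2 := norm_sq_le_two_mul (-f p) (f z - f p)
    have h3 : -f p - (f z - f p) = -f z := by ring
    rw [h3, norm_neg, norm_neg] at h2
    nlinarith
  have hΩv : volume Ω ≠ ⊤ := hb.measure_lt_top.ne
  have hRi : IntegrableOn (fun z => 8 * ‖f z‖ ^ 2 + 8 * ‖f p‖ ^ 2) Ω :=
    (hf.2.const_mul 8).add (integrableOn_const hΩv)
  have hFd : DifferentiableOn ℂ F Ω := (hf.1.sub_const _).const_mul _
  have hFI : InBergman n Ω F := ⟨hFd, hRi.mono' ((hFd.continuousOn.norm.pow 2).aestronglyMeasurable hΩ.measurableSet)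
    (.of_forall fun z => by rw [Real.norm_of_nonneg (sq_nonneg _)]; exact hFle z)⟩
  have hFn : l2sq n Ω F ≤ (8 * C + 8) * J * ‖X‖⁻¹ ^ 2 := by
    have h1 : l2sq n Ω F ≤ ∫ z in Ω, (8 * ‖f z‖ ^ 2 + 8 * ‖f p‖ ^ 2) := integral_mono hFI.2 hRi hFle
    rw [integral_add (hf.2.const_mul 8) (integrableOn_const hΩv), integral_const_mul, setIntegral_const,
      smul_eq_mul] at h1
    have h2 : ∫ z in Ω, ‖f z‖ ^ 2 ≤ C * J * ‖X‖⁻¹ ^ 2 := hfn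
    nlinarith
  have hFp : F p = 0 := by simp [hF]
  have hFX : holDeriv n F p (fderiv ℝ Φ 0 X) = 1 := by
    rw [holDeriv_eq, fderiv_const_mul ((hf.1.differentiableAt (hΩ.mem_nhds h.mem)).sub_const _),
      fderiv_sub_const, smul_apply]
    exact inv_mul_cancel₀ hd0
  have hI : I1 n Ω p (fderiv ℝ Φ 0 X) ≤ l2sq n Ω F := by
    refine csInf_le ⟨0, ?_⟩ ⟨F, hFI, hFp, hFX, rfl⟩
    rintro _ ⟨g, -, -, -, rfl⟩
    exact l2sq_nonneg g
  calc ‖X‖ ^ 2 * I1 n Ω p (fderiv ℝ Φ 0 X) ≤ ‖X‖ ^ 2 * ((8 * C + 8) * J * ‖X‖⁻¹ ^ 2) := by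
        gcongr; exact hI.trans hFn
    _ = _ := by field_simp

/-- Existence of charts of uniform size implies comparability of the minimum integrals. -/
theorem exists_minimum_integral_bound (hΩ : IsOpen Ω)
    (hb : Bornology.IsBounded Ω) (hs : IsGoodExhaustion s Ω) (hc : 0 < c) : ∃ C > 0,
    ∀ p Φ J φ, IsChart Ω c p Φ J φ → ∀ X Y, I1 n Ω p X * I1 n Ω p Y ≤ C * (I0 n Ω p * I2 n Ω p X Y) := by
  obtain ⟨C, hC, hup⟩ := exists_upper_bound n hc
  obtain ⟨B, hB, hlow⟩ := exists_lower_bounds n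
  refine ⟨C ^ 2 * B ^ 2, by positivity, fun p Φ J φ h X Y => ?_⟩
  have hJ := h.J_pos
  have hI0 := I0_nonneg (Ω := Ω) p
  have hI2 := I2_nonneg (Ω := Ω) p X Y
  by_cases hX : X = 0
  · rw [hX, I1_zero, zero_mul]; rw [hX] at hI2; positivity
  by_cases hY : Y = 0
  · rw [hY, I1_zero, mul_zero]; rw [hY] at hI2; positivity
  have h0 : (0 : ℂ^n) ∈ ball 0 1 := mem_ball_self one_pos
  obtain ⟨U, rfl⟩ := h.surjective_fderiv h0 X
  obtain ⟨W, rfl⟩ := h.surjective_fderiv h0 Y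
  have hU : U ≠ 0 := fun hU => hX (by rw [hU, map_zero])
  have hW : W ≠ 0 := fun hW => hY (by rw [hW, map_zero])
  obtain ⟨l0, l2⟩ := hlow Ω hΩ hb c p Φ J φ h
  have l2' := l2 U W hU hW
  have u1 := hup Ω s hΩ hb hs p Φ J φ h U hU
  have u2 := hup Ω s hΩ hb hs p Φ J φ h W hW
  have p1 : 0 < ‖U‖ ^ 2 := by positivity
  have p2 : 0 < ‖W‖ ^ 2 := by positivity
  refine le_of_mul_le_mul_left ?_ (mul_pos p1 p2)
  have i2 := I1_nonneg (Ω := Ω) p (fderiv ℝ Φ 0 W)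
  calc ‖U‖ ^ 2 * ‖W‖ ^ 2 * (I1 n Ω p (fderiv ℝ Φ 0 U) * I1 n Ω p (fderiv ℝ Φ 0 W))
      = (‖U‖ ^ 2 * I1 n Ω p (fderiv ℝ Φ 0 U)) * (‖W‖ ^ 2 * I1 n Ω p (fderiv ℝ Φ 0 W)) := by ring
    _ ≤ (C * J) * (C * J) := by gcongr
    _ = C ^ 2 * (J * J) := by ring
    _ ≤ C ^ 2 * ((B * I0 n Ω p) * (B * (‖U‖ ^ 2 * ‖W‖ ^ 2) * I2 n Ω p (fderiv ℝ Φ 0 U) (fderiv ℝ Φ 0 W))) := by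
        gcongr
    _ = _ := by ring

section TaylorBounds

variable {E F : Type*} [NormedAddCommGroup E] [NormedSpace ℝ E] [NormedAddCommGroup F] [NormedSpace ℝ F]

/-- Uniform first and second order bounds for `f` on `B` with constant `M`. -/
structure TaylorOn (f : E → F) (B : Set E) (M) where
  diff : ∀ y ∈ B, DifferentiableAt ℝ f y
  norm_le : ∀ y ∈ B, ‖f y‖ ≤ M
  norm_fderiv_le : ∀ y ∈ B, ‖fderiv ℝ f y‖ ≤ M
  lip : ∀ y ∈ B, ∀ z ∈ B, ‖f z - f y‖ ≤ M * ‖z - y‖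
  taylor : ∀ y ∈ B, ∀ z ∈ B, ‖f z - f y - fderiv ℝ f y (z - y)‖ ≤ M * ‖z - y‖ ^ 2

lemma TaylorOn.mono {f : E → F} {B B'} {M'} (h : TaylorOn f B M) (hB : B' ⊆ B)
    (hM : M ≤ M') : TaylorOn f B' M' where
  diff y hy := h.diff y (hB hy)
  norm_le y hy := (h.norm_le y (hB hy)).trans hM
  norm_fderiv_le y hy := (h.norm_fderiv_le y (hB hy)).trans hM
  lip y hy z hz := (h.lip y (hB hy) z (hB hz)).trans (by gcongr)
  taylor y hy z hz := (h.taylor y (hB hy) z (hB hz)).trans (by gcongr)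

lemma ContDiffAt.exists_taylorOn {f : E → F} {x} (hf : ContDiffAt ℝ 2 f x) :
    ∃ M > 0, ∃ r > 0, TaylorOn f (ball x r) M := by
  have hf' : ContDiffAt ℝ 1 (fderiv ℝ f) x := hf.fderiv_right (by norm_num)
  obtain ⟨K, t, ht, hK⟩ := hf'.exists_lipschitzOnWith
  obtain ⟨K', t', ht', hK'⟩ := (hf.of_le one_le_two).exists_lipschitzOnWith
  have h1 : ∀ᶠ y in 𝓝 x, y ∈ t ∧ y ∈ t' ∧ DifferentiableAt ℝ f y ∧ ‖f y‖ < ‖f x‖ + 1 ∧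
      ‖fderiv ℝ f y‖ < ‖fderiv ℝ f x‖ + 1 := by
    filter_upwards [ht, ht', hf.eventually (by simp),
      hf.continuousAt.norm.eventually_lt_const (lt_add_one _),
      hf'.continuousAt.norm.eventually_lt_const (lt_add_one _)] with y a b c d e
    exact ⟨a, b, c.differentiableAt (by simp), d, e⟩
  obtain ⟨r, hr, hB⟩ := eventually_nhds_iff_ball.1 h1
  have hp := norm_nonneg (f x)
  have hp' := norm_nonneg (fderiv ℝ f x)
  refine ⟨K + K' + ‖f x‖ + ‖fderiv ℝ f x‖ + 1, by positivity, r, hr, ⟨fun y hy => (hB y hy).2.2.1,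
    fun y hy => by linarith [(hB y hy).2.2.2.1], fun y hy => by linarith [(hB y hy).2.2.2.2],
    fun y hy z hz => ?_, fun y hy z hz => ?_⟩⟩
  · refine (hK'.norm_sub_le (hB z hz).2.1 (hB y hy).2.1).trans ?_
    gcongr; linarith
  · have hs := (convex_ball x r).segment_subset hy hz
    have := (convex_segment y z).norm_image_sub_le_of_norm_fderiv_le'
      (C := K * ‖z - y‖) (fun w hw => (hB w (hs hw)).2.2.1)
      (fun w hw => by
        refine (hK.norm_sub_le (hB w (hs hw)).1 (hB y hy).1).trans ?_
        gcongr
        obtain ⟨s, hs0, hs1⟩ := segment_eq_image' ℝ y z ▸ hw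
        rw [← hs1, add_sub_cancel_left, norm_smul, Real.norm_of_nonneg hs0.1]
        exact mul_le_of_le_one_left (norm_nonneg _) hs0.2)
      (left_mem_segment ℝ y z) (right_mem_segment ℝ y z)
    refine this.trans ?_
    rw [sq, ← mul_assoc]
    gcongr; linarith

end TaylorBounds

section ComplexGradient

/-- The complex part of a real functional, as a continuous linear map. -/
noncomputable def dzT (n) : (ℂ^n →L[ℝ] ℝ) →L[ℝ] ℂ^n →L[ℝ] ℂ :=
  toContinuousLinearMap
    { toFun := fun L => (1 / 2 : ℂ) • (ofRealCLM.comp L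
        - I • ofRealCLM.comp (L.comp (I • ContinuousLinearMap.id ℝ ℂ^n)))
      map_add' := fun L L' => by ext X; simp; ring
      map_smul' := fun c L => by ext X; simp; ring }

lemma dzT_apply (L) (X) : dzT n L X = (L X - I * L (I • X)) / 2 := by
  simp [dzT]; ring

/-- The complex gradient as a real linear map. -/
noncomputable def dzL (ρ) (z) :=
  dzT n (fderiv ℝ ρ z)

lemma dzL_apply (z X) : dzL ρ z X = dz ρ z X := dzT_apply _ _

lemma dzL_I_smul (z X) : dzL ρ z (I • X) = I * dzL ρ z X := by
  simp [dzL, dzT_apply, smul_smul, I_mul_I, neg_smul, one_smul, map_neg]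
  push_cast
  linear_combination (fderiv ℝ ρ z (I • X) / 2) * I_mul_I

lemma map_smul_of_I {G} [AddCommGroup G] [Module ℝ G] [Module ℂ G] [IsScalarTower ℝ ℂ G]
    {E} [AddCommGroup E] [Module ℝ E] [Module ℂ E] [IsScalarTower ℝ ℂ E]
    (L : E →ₗ[ℝ] G) (h : ∀ X, L (I • X) = I • L X) (c : ℂ) (X) : L (c • X) = c • L X := by
  have hc := (re_add_im c).symm
  have hr : ∀ (r : ℝ) (Y : E), ((r : ℂ)) • Y = r • Y := fun r Y => by
    rw [← algebraMap_smul ℂ r Y]; rfl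
  have hr' : ∀ (r : ℝ) (Y : G), ((r : ℂ)) • Y = r • Y := fun r Y => by
    rw [← algebraMap_smul ℂ r Y]; rfl
  rw [hc, add_smul, add_smul, mul_smul, mul_smul, hr, hr, hr', hr', map_add, L.map_smul,
    L.map_smul, h]

lemma dzL_smul (z X) (c) : dzL ρ z (c • X) = c * dzL ρ z X :=
  map_smul_of_I (dzL ρ z : ℂ^n →ₗ[ℝ] ℂ) (fun X => dzL_I_smul z X) c X

lemma contDiff_dzL (hρ : ContDiff ℝ ∞ ρ) : ContDiff ℝ ∞ (dzL ρ) :=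
  (dzT n).contDiff.comp (hρ.fderiv_right (by simp))

lemma fderiv_dzL (hρ : ContDiff ℝ ∞ ρ) (z U X) :
    fderiv ℝ (dzL ρ) z U X = (D2 ρ z U X - I * D2 ρ z U (I • X)) / 2 := by
  have h :=
    (hρ.fderiv_right (m := ∞) (by simp)).differentiable (by simp) z
  have : HasFDerivAt (dzL ρ) ((dzT n).comp (fderiv ℝ (fderiv ℝ ρ) z)) z :=
    (dzT n).hasFDerivAt.comp z h.hasFDerivAt
  rw [this.fderiv]
  exact dzT_apply _ _

lemma fderiv_eq_re_dzL (z X) : fderiv ℝ ρ z X = 2 * (dzL ρ z X).re := by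
  rw [dzL, dzT_apply]; simp; ring

lemma pg_eq_norm_dzL_sq (z X) : pg ρ z X = ‖dzL ρ z X‖ ^ 2 := by
  rw [dzL_apply, norm_dz_sq]

lemma D2_comm (hρ : ContDiff ℝ ∞ ρ) (z X Y) : D2 ρ z X Y = D2 ρ z Y X :=
  fderiv_fderiv_apply_comm (hρ.contDiffAt.of_le two_le_infty) X Y

lemma lvp_comm (hρ : ContDiff ℝ ∞ ρ) (z X Y) : lvp ρ z X Y = lvp ρ z Y X := by
  rw [lvp, lvp, D2_comm hρ, D2_comm hρ z (I • X)]

lemma lvp_add_left (z X X' Y) : lvp ρ z (X + X') Y = lvp ρ z X Y + lvp ρ z X' Y := by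
  simp [lvp, D2, smul_add, map_add, add_apply]; ring

lemma lvp_smul_left (z X Y) (c) : lvp ρ z (c • X) Y = c * lvp ρ z X Y := by
  simp [lvp, D2, smul_comm I c, map_smul, smul_apply]; ring

lemma lvp_I_smul_left (z X Y) : lvp ρ z (I • X) Y = - lvp ρ z X (I • Y) := by
  simp [lvp, D2, smul_smul, I_mul_I, neg_smul, one_smul, map_neg, neg_apply]; ring

/-- If `U` and `V` are complex tangent vectors and `U` is a null vector for the Levi form paired with
`V`, then the derivatives of `∂ρ` are symmetric in `U` and `V`. -/
lemma fderiv_dzL_symm (hρ : ContDiff ℝ ∞ ρ) {U V}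
    (h : lvp ρ z U (I • V) = 0) : fderiv ℝ (dzL ρ) z U V = fderiv ℝ (dzL ρ) z V U := by
  rw [fderiv_dzL hρ, fderiv_dzL hρ, D2_comm hρ z V U]
  have : D2 ρ z U (I • V) = D2 ρ z V (I • U) := by
    simp [lvp, smul_smul, I_mul_I, neg_smul, one_smul, D2, map_neg] at h
    have h2 := D2_comm hρ z (I • U) V
    simp [D2] at h2 ⊢
    linarith
  rw [this]

lemma fderiv_dzL_I_smul (hρ : ContDiff ℝ ∞ ρ) {U V} (h : lvp ρ z U V = 0)
    (h' : lvp ρ z U (I • V) = 0) : fderiv ℝ (dzL ρ) z (I • U) V = I * fderiv ℝ (dzL ρ) z U V := by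
  rw [fderiv_dzL hρ, fderiv_dzL hρ]
  simp [lvp, D2, smul_smul, I_mul_I, neg_smul, one_smul, map_neg] at h h' ⊢
  have e1 : fderiv ℝ (fderiv ℝ ρ) z (I • U) V = fderiv ℝ (fderiv ℝ ρ) z U (I • V) := by linarith
  have e2 : fderiv ℝ (fderiv ℝ ρ) z (I • U) (I • V) = - fderiv ℝ (fderiv ℝ ρ) z U V := by linarith
  rw [e1, e2]
  push_cast
  linear_combination fderiv ℝ (fderiv ℝ ρ) z U (I • V) / 2 * I_mul_I

end ComplexGradient

lemma IsDefining.subset_of_isPreconnected (hΩ : IsOpen Ω) (hρ : IsDefining n Ω ρ)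
    {S} (hS : IsPreconnected S) (hneg : ∀ z ∈ S, ρ z < 0)
    (hne : (S ∩ Ω).Nonempty) : S ⊆ Ω := by
  refine hS.subset_left_of_subset_union hΩ isClosed_closure.isOpen_compl
    (disjoint_compl_right.mono_left subset_closure) (fun z hz => ?_) hne
  by_cases h : z ∈ Ω
  · exact inl h
  · refine inr fun hc => (hneg z hz).ne (hρ.2.2.1 z ?_)
    rw [hΩ.frontier_eq]
    exact ⟨hc, h⟩

lemma IsDefining.mem_of_path (hΩ : IsOpen Ω) (hρ : IsDefining n Ω ρ) {γ : ℝ → ℂ^n}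
    (hγ : Continuous γ) (hneg : ∀ t ∈ Icc 0 1, ρ (γ t) < 0) (h0 : γ 0 ∈ Ω) : γ 1 ∈ Ω :=
  hρ.subset_of_isPreconnected hΩ (isPreconnected_Icc.image γ hγ.continuousOn)
    (forall_mem_image.2 hneg) ⟨γ 0, mem_image_of_mem γ ⟨le_rfl, zero_le_one⟩, h0⟩
    (mem_image_of_mem γ ⟨zero_le_one, le_rfl⟩)

lemma exists_slope (hρ : ContDiff ℝ ∞ ρ) (he : 0 < fderiv ℝ ρ z₁ e) :
    ∃ c > 0, ∃ r > 0, ∀ z ∈ ball z₁ r, c ≤ fderiv ℝ ρ z e ∧ ∀ t, 0 ≤ t →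
      z + t • e ∈ ball z₁ r → ρ z + c * t ≤ ρ (z + t • e) := by
  have hc : Continuous fun z => fderiv ℝ ρ z e :=
    (hρ.continuous_fderiv (by simp)).clm_apply continuous_const
  obtain ⟨r, hr, hB⟩ := eventually_nhds_iff_ball.1
    (hc.continuousAt.eventually_const_lt (half_lt_self he))
  refine ⟨fderiv ℝ ρ z₁ e / 2, half_pos he, r, hr, fun z hz => ⟨(hB z hz).le, fun t ht hzt => ?_⟩⟩
  obtain ⟨w, hw, h⟩ := domain_mvt (fun x _ =>
    ((hρ.differentiable (by simp)) x).hasFDerivAt.hasFDerivWithinAt) (convex_ball z₁ r) hz hzt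
  have := hB w ((convex_ball z₁ r).segment_subset hz hzt hw)
  rw [add_sub_cancel_left, map_smul, smul_eq_mul] at h
  nlinarith

/-- Near a boundary point, `Ω` is the sublevel set of its defining function. -/
lemma IsDefining.eventually_mem (hΩ : IsOpen Ω) (hρ : IsDefining n Ω ρ)
    (hz₁ : z₁ ∈ frontier Ω) (he : 0 < fderiv ℝ ρ z₁ e) : ∀ᶠ z in 𝓝 z₁, (ρ z < 0 → z ∈ Ω) := by
  obtain ⟨c, hc, r, hr, hB⟩ := exists_slope hρ.1 he
  obtain ⟨L, hL, r', hr', hT⟩ :=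
    ContDiffAt.exists_taylorOn (hρ.1.contDiffAt |>.of_le two_le_infty)
  set R := min r r' with hR
  have hRpos := lt_min hr hr'
  set D := 1 + (L + 1) / c * ‖e‖ with hD
  have hDpos : 0 < D := by positivity
  have hD1 : 1 ≤ D := by linarith [show 0 ≤ (L + 1) / c * ‖e‖ by positivity]
  set s := R / D with hs
  have hspos := div_pos hRpos hDpos
  have hsD : s * D = R := div_mul_cancel₀ _ hDpos.ne'
  have hsR : s ≤ R := by nlinarith
  set M := (L + 1) / c * s with hM
  have hMpos : 0 < M := by positivity
  have hcM : c * M = (L + 1) * s := by rw [hM]; field_simp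
  have key : ∀ y ∈ ball z₁ s, ∀ t ∈ Icc 0 M,
      y - t • e ∈ ball z₁ r ∧ ρ (y - t • e) + c * t ≤ ρ y := by
    intro y hy t ht
    have h1 : y - t • e ∈ ball z₁ r := by
      rw [mem_ball_iff_norm] at hy ⊢
      calc ‖y - t • e - z₁‖ = ‖(y - z₁) - t • e‖ := by abel
        _ ≤ ‖y - z₁‖ + ‖t • e‖ := norm_sub_le _ _
        _ < s + M * ‖e‖ := by
          rw [norm_smul, Real.norm_of_nonneg ht.1]
          exact add_lt_add_of_lt_of_le hy (mul_le_mul_of_nonneg_right ht.2 (norm_nonneg _))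
        _ = R := by rw [← hsD, hD]; ring
        _ ≤ r := min_le_left _ _
    have := (hB _ h1).2 t ht.1
    rw [sub_add_cancel] at this
    exact ⟨h1, this (ball_subset_ball (hsR.trans (min_le_left _ _)) hy)⟩
  obtain ⟨p, hp, hps⟩ := mem_closure_iff.1 (frontier_subset_closure hz₁) s hspos
  have hp1 : p ∈ ball z₁ s := by rwa [mem_ball, dist_comm]
  filter_upwards [ball_mem_nhds z₁ hspos] with z hz hneg
  have a1 := by
    have := hρ.mem_of_path hΩ (γ := fun t => p - (t * M) • e) (by fun_prop) (fun t ht => by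
      have := (key p hp1 (t * M) ⟨mul_nonneg ht.1 hMpos.le,
        mul_le_of_le_one_left hMpos.le ht.2⟩).2
      nlinarith [hρ.2.1 p hp, mul_nonneg hc.le (mul_nonneg ht.1 hMpos.le)]) (by simpa using hp)
    simpa using this
  have a2 := by
    have := hρ.mem_of_path hΩ (γ := fun t => (p + t • (z - p)) - M • e) (by fun_prop)
      (fun t ht => by
        have hy :=
          (convex_ball z₁ s).segment_subset hp1 hz
            (segment_eq_image' ℝ p z ▸ mem_image_of_mem _ ht)
        have h2 := (key _ hy M ⟨hMpos.le, le_rfl⟩).2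
        have hsub : ball z₁ s ⊆ ball z₁ r' :=
          ball_subset_ball (hsR.trans (min_le_right _ _))
        have h3 := hT.lip z₁ (mem_ball_self hr') _ (hsub hy)
        rw [hρ.2.2.1 z₁ hz₁] at h3
        have h4 := (le_abs_self _).trans h3
        have h5 := mul_lt_mul_of_pos_left (mem_ball_iff_norm.1 hy) hL
        nlinarith) (by simpa using a1)
    simpa using this
  have := hρ.mem_of_path hΩ (γ := fun t => z - ((1 - t) * M) • e) (by fun_prop) (fun t ht => by
      have h0 := sub_nonneg.2 ht.2
      have := (key z hz ((1 - t) * M) ⟨mul_nonneg h0 hMpos.le,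
        mul_le_of_le_one_left hMpos.le (by linarith [ht.1])⟩).2
      nlinarith [mul_nonneg hc.le (mul_nonneg h0 hMpos.le)]) (by simpa using a2)
  simpa using this

lemma IsDefining.eventually_mem_frontier (hΩ : IsOpen Ω) (hρ : IsDefining n Ω ρ)
    (hz₁ : z₁ ∈ frontier Ω) (he : 0 < fderiv ℝ ρ z₁ e) :
    ∀ᶠ z in 𝓝 z₁, (ρ z = 0 → z ∈ frontier Ω) := by
  obtain ⟨c, hc, r, hr, hB⟩ := exists_slope hρ.1 he
  filter_upwards [(hρ.eventually_mem hΩ hz₁ he).eventually_nhds, ball_mem_nhds z₁ hr]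
    with z hz hzr h0
  rw [hΩ.frontier_eq]
  refine ⟨?_, fun h => (hρ.2.1 z h).ne h0⟩
  have ht : Tendsto (fun t : ℝ => z - t • e) (𝓝[>] 0) (𝓝 z) := by
    refine tendsto_nhdsWithin_of_tendsto_nhds ?_
    have : Continuous fun t : ℝ => z - t • e := by fun_prop
    simpa using this.tendsto 0
  refine mem_closure_of_tendsto ht ?_
  filter_upwards [ht.eventually hz, ht.eventually (isOpen_ball.mem_nhds hzr),
    self_mem_nhdsWithin] with t h1 h2 h3
  refine h1 ?_
  have := (hB _ h2).2 t (le_of_lt h3)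
  rw [sub_add_cancel] at this
  nlinarith [this hzr, mul_pos hc h3]

/-- Points of `Ω` near the boundary reach the boundary in the direction `e`, in time comparable to
the defining function. -/
lemma IsDefining.exists_hit (hΩ : IsOpen Ω) (hρ : IsDefining n Ω ρ)
    (hz₁ : z₁ ∈ frontier Ω) (he : 0 < fderiv ℝ ρ z₁ e) : ∃ C > 0, ∀ᶠ z in 𝓝 z₁, z ∈ Ω →
      ∃ t > 0, t ≤ C * |ρ z| ∧ ρ (z + t • e) = 0 ∧ z + t • e ∈ frontier Ω := by
  obtain ⟨c, hc, r, hr, hB⟩ := exists_slope hρ.1 he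
  have h0 := hρ.2.2.1 z₁ hz₁
  have hcont := hρ.1.continuous
  have hev :=
    Filter.Eventually.and (ball_mem_nhds z₁ hr) (hρ.eventually_mem_frontier hΩ hz₁ he)
  obtain ⟨r', hr', hB'⟩ := eventually_nhds_iff_ball.1 hev
  have hsmall := by
    have : ContinuousAt (fun z => ‖z - z₁‖ + (2 / c * |ρ z|) * ‖e‖) z₁ := by fun_prop
    exact this.eventually_lt_const (by simpa [h0] using hr')
  refine ⟨2 / c, by positivity, ?_⟩
  filter_upwards [hsmall] with z hz hzΩ
  have hneg := hρ.2.1 z hzΩ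
  have hpos : 0 < 2 / c * |ρ z| := by have := abs_pos.2 hneg.ne; positivity
  set T := 2 / c * |ρ z| with hT
  have hmem : ∀ t ∈ Icc 0 T, z + t • e ∈ ball z₁ r' := fun t ht => by
    rw [mem_ball_iff_norm]
    calc ‖z + t • e - z₁‖ = ‖(z - z₁) + t • e‖ := by abel
      _ ≤ ‖z - z₁‖ + ‖t • e‖ := norm_add_le _ _
      _ ≤ ‖z - z₁‖ + T * ‖e‖ := by
        rw [norm_smul, Real.norm_of_nonneg ht.1]; gcongr; exact ht.2
      _ < r' := hz
  have hend : 0 ≤ ρ (z + T • e) := by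
    have := (hB z (by simpa using (hB' _ (hmem 0 ⟨le_rfl, hpos.le⟩)).1)).2 T hpos.le
      (hB' _ (hmem T ⟨hpos.le, le_rfl⟩)).1
    have h2 : c * T = 2 * |ρ z| := by rw [hT]; field_simp
    rw [abs_of_neg hneg] at h2
    linarith
  obtain ⟨t, ht, hρt⟩ := intermediate_value_Icc hpos.le (f := fun t => ρ (z + t • e))
    (by fun_prop) (show 0 ∈ Icc _ _ from ⟨by simpa using hneg.le, hend⟩)
  refine ⟨t, lt_of_le_of_ne ht.1 ?_, ht.2, hρt, (hB' _ (hmem t ht)).2 hρt⟩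
  rintro rfl
  simp [zero_smul, add_zero] at hρt
  exact hneg.ne hρt

/-- The inclusion of the complex line spanned by `e`. -/
noncomputable def lineC (e : ℂ^n) : ℂ →L[ℝ] ℂ^n :=
  (toSpanSingleton ℂ e).restrictScalars ℝ

lemma lineC_apply (e : ℂ^n) (c) : lineC e c = c • e := rfl

/-- The coordinate along `e` with respect to the splitting `E = ker ∂ρ ⊕ ℂ e`. -/
noncomputable def tcoord (ρ : ℂ^n → ℝ) (e z) :=
  (dzL ρ z e)⁻¹ • dzL ρ z

/-- The projection onto `ker ∂ρ` along `e`. -/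
noncomputable def tproj (ρ : ℂ^n → ℝ) (e z) :=
  ContinuousLinearMap.id ℝ _ - (lineC e).comp (tcoord ρ e z)

lemma tcoord_apply (X) : tcoord ρ e z X = (dzL ρ z e)⁻¹ * dzL ρ z X := rfl

lemma tproj_apply (X) : tproj ρ e z X = X - tcoord ρ e z X • e := rfl

lemma tcoord_I_smul (X) : tcoord ρ e z (I • X) = I * tcoord ρ e z X := by
  rw [tcoord_apply, tcoord_apply, dzL_I_smul]; ring

lemma tproj_I_smul (X) : tproj ρ e z (I • X) = I • tproj ρ e z X := by
  rw [tproj_apply, tproj_apply, tcoord_I_smul, smul_sub, mul_smul]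

lemma tcoord_smul (c) (X) : tcoord ρ e z (c • X) = c * tcoord ρ e z X := by
  rw [tcoord_apply, tcoord_apply, dzL_smul]; ring

lemma tcoord_self (h : dzL ρ z e ≠ 0) : tcoord ρ e z e = 1 := inv_mul_cancel₀ h

lemma tproj_smul_self (h : dzL ρ z e ≠ 0) (c : ℂ) : tproj ρ e z (c • e) = 0 := by
  rw [tproj_apply, tcoord_smul, tcoord_self h, mul_one, sub_self]

lemma dzL_eq_tcoord (h : dzL ρ z e ≠ 0) (X) : dzL ρ z X = tcoord ρ e z X * dzL ρ z e := by
  rw [tcoord_apply]; field_simp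

lemma dzL_tproj (h : dzL ρ z e ≠ 0) (X) : dzL ρ z (tproj ρ e z X) = 0 := by
  rw [tproj_apply, map_sub, dzL_smul, dzL_eq_tcoord h X, sub_self]

lemma tproj_of_dzL_eq_zero (hX : dzL ρ z X = 0) : tproj ρ e z X = X := by
  rw [tproj_apply, tcoord_apply, hX, mul_zero, zero_smul, sub_zero]

lemma dzL_ne_zero_of_pos (h : 0 < fderiv ℝ ρ z e) : dzL ρ z e ≠ 0 := fun h0 => by
  rw [fderiv_eq_re_dzL, h0] at h; simp at h

lemma contDiffAt_tcoord (hρ : ContDiff ℝ ∞ ρ) (h : dzL ρ z e ≠ 0) :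
    ContDiffAt ℝ ∞ (tcoord ρ e) z := by
  have h1 : ContDiffAt ℝ ∞ (fun z => dzL ρ z e) z :=
    ((contDiff_dzL hρ).clm_apply contDiff_const).contDiffAt
  exact (h1.inv h).smul (contDiff_dzL hρ).contDiffAt

lemma contDiffAt_tproj (hρ : ContDiff ℝ ∞ ρ) (h : dzL ρ z e ≠ 0) : ContDiffAt ℝ ∞ (tproj ρ e) z :=
  contDiffAt_const.sub (contDiffAt_const.clm_comp (contDiffAt_tcoord hρ h))

lemma eventually_dzL_ne_zero (hρ : ContDiff ℝ ∞ ρ) (h : dzL ρ z₁ e ≠ 0) :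
    ∀ᶠ z in 𝓝 z₁, dzL ρ z e ≠ 0 :=
  ((contDiff_dzL hρ).continuous.clm_apply continuous_const).continuousAt.eventually_ne h

lemma mem_cTangent_iff (hρ : ContDiff ℝ ∞ ρ) : X ∈ cTangent n ρ z ↔ dzL ρ z X = 0 := by
  rw [cTangent, LinearMap.mem_ker, cTangentMap_apply (hρ.differentiable (by simp) z), dzL_apply]

lemma LeviPSDAt.lv_nonneg (hρ : ContDiff ℝ ∞ ρ) (h : LeviPSDAt n ρ z)
    (hX : dzL ρ z X = 0) : 0 ≤ lv ρ z X := by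
  have := h X ((mem_cTangent_iff hρ).2 hX)
  rwa [hermForm_cHess (hρ.contDiffAt.of_le two_le_infty)] at this

lemma abs_lvp_le (X Y) : |lvp ρ z X Y| ≤ ‖fderiv ℝ (fderiv ℝ ρ) z‖ * ‖X‖ * ‖Y‖ := by
  have h1 := (fderiv ℝ (fderiv ℝ ρ) z).le_opNorm₂ X Y
  have h2 := (fderiv ℝ (fderiv ℝ ρ) z).le_opNorm₂ (I • X) (I • Y)
  simp [norm_smul, norm_I, norm_eq_abs] at h1 h2
  rw [lvp, D2, D2, abs_le]
  rw [abs_le] at h1 h2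
  constructor <;> linarith

lemma abs_lvp_sub_le (w X Y) : |lvp ρ z X Y - lvp ρ w X Y| ≤
    ‖fderiv ℝ (fderiv ℝ ρ) z - fderiv ℝ (fderiv ℝ ρ) w‖ * ‖X‖ * ‖Y‖ := by
  set L := fderiv ℝ (fderiv ℝ ρ) z - fderiv ℝ (fderiv ℝ ρ) w with hL
  have h1 := L.le_opNorm₂ X Y
  have h2 := L.le_opNorm₂ (I • X) (I • Y)
  have e : lvp ρ z X Y - lvp ρ w X Y = (L X Y + L (I • X) (I • Y)) / 4 := by
    simp [lvp, D2, hL, sub_apply]; ring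
  simp [norm_smul, norm_I, norm_eq_abs] at h1 h2
  rw [abs_le]
  rw [abs_le] at h1 h2
  constructor <;> linarith

/-- Up to an error controlled by `∂ρ`, the Levi form only depends on the tangential part. -/
lemma exists_lv_tproj_le (hρ : ContDiff ℝ ∞ ρ) (h : dzL ρ z₁ e ≠ 0) :
    ∃ C > 0, ∀ᶠ z in 𝓝 z₁, ∀ X, lv ρ z (tproj ρ e z X) ≤ lv ρ z X + C * ‖dzL ρ z X‖ * ‖X‖ := by
  obtain ⟨M, hM, r, hr, hT⟩ := ((contDiffAt_tproj hρ h).of_le two_le_infty).exists_taylorOn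
  have hD : ContDiff ℝ ∞ (fderiv ℝ (fderiv ℝ ρ)) :=
    (hρ.fderiv_right (m := ∞) (by simp)).fderiv_right (by simp)
  obtain ⟨M', hM', r', hr', hT'⟩ := (hD.contDiffAt.of_le two_le_infty).exists_taylorOn
  have hc : ContinuousAt (fun z => ‖(dzL ρ z e)⁻¹‖) z₁ :=
    ((((contDiff_dzL hρ).continuous.clm_apply continuous_const).continuousAt).inv₀ h).norm
  obtain ⟨B, hB⟩ : ∃ B, ‖(dzL ρ z₁ e)⁻¹‖ < B := exists_gt _
  have hB0 := (norm_nonneg _).trans_lt hB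
  refine ⟨M' * (1 + M) * (B * (‖e‖ + 1)), by positivity, ?_⟩
  filter_upwards [ball_mem_nhds z₁ hr, ball_mem_nhds z₁ hr',
    hc.eventually_lt_const hB] with z h1 h2 h3 X
  have hX := tproj_apply (ρ := ρ) (e := e) (z := z) X
  set S := tproj ρ e z X with hS
  set w := tcoord ρ e z X • e with hw
  have hXe : X = S + w := by rw [hX]; abel
  have key : lv ρ z X - lv ρ z S = lvp ρ z (X + S) w := by
    rw [hXe, lv, lv, lvp_add_left, lvp_add_left, lvp_comm hρ z S (S + w),
      lvp_comm hρ z w (S + w), lvp_add_left, lvp_add_left, lvp_comm hρ z w S]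
    ring
  have hb := abs_lvp_le (ρ := ρ) (z := z) (X + S) w
  rw [← key] at hb
  have hS' : ‖X + S‖ ≤ (1 + M) * ‖X‖ := by
    have := (tproj ρ e z).le_of_opNorm_le (hT.norm_le z h1) X
    calc ‖X + S‖ ≤ ‖X‖ + ‖S‖ := norm_add_le _ _
      _ ≤ ‖X‖ + M * ‖X‖ := by gcongr
      _ = _ := by ring
  have hw' : ‖w‖ ≤ B * (‖e‖ + 1) * ‖dzL ρ z X‖ := by
    rw [norm_smul, tcoord_apply, norm_mul]
    calc ‖(dzL ρ z e)⁻¹‖ * ‖dzL ρ z X‖ * ‖e‖ ≤ B * ‖dzL ρ z X‖ * (‖e‖ + 1) := by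
          gcongr; linarith
      _ = _ := by ring
  have hfin : |lv ρ z X - lv ρ z S| ≤ M' * (1 + M) * (B * (‖e‖ + 1)) * ‖dzL ρ z X‖ * ‖X‖ :=
    calc _ ≤ _ := hb
      _ ≤ M' * ((1 + M) * ‖X‖) * (B * (‖e‖ + 1) * ‖dzL ρ z X‖) := by
        gcongr; exact hT'.norm_le z h2
      _ = _ := by ring
  linarith [(abs_le.1 hfin).1]

/-- Lower bounds for the Levi form on the boundary extend to the interior with an error controlled
by `|ρ|` and `∂ρ`. -/
lemma IsDefining.exists_le_lv (hΩ : IsOpen Ω) (hρ : IsDefining n Ω ρ) (hz₁ : z₁ ∈ frontier Ω)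
    (he : 0 < fderiv ℝ ρ z₁ e) {R : ℂ^n → ℂ^n →L[ℝ] ℂ^n}
    (hR : ContDiffAt ℝ 2 R z₁) (hq : ∀ᶠ q in 𝓝 z₁, q ∈ frontier Ω → ∀ X,
      ‖R q X‖ ^ 2 ≤ lv ρ q (tproj ρ e q X) + pg ρ q X) : ∃ C > 0, ∀ᶠ z in 𝓝 z₁, z ∈ Ω → ∀ X,
      ‖R z X‖ ^ 2 ≤ lv ρ z X + C * (|ρ z| * ‖X‖ ^ 2 + ‖dzL ρ z X‖ * ‖X‖) := by
  obtain ⟨C₁, hC₁, h1⟩ := exists_lv_tproj_le hρ.1 (dzL_ne_zero_of_pos he)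
  obtain ⟨C₂, hC₂, h2⟩ := hρ.exists_hit hΩ hz₁ he
  obtain ⟨M, hM, r, hr, hT⟩ := hR.exists_taylorOn
  have hD : ContDiff ℝ ∞ (fderiv ℝ (fderiv ℝ ρ)) :=
    (hρ.1.fderiv_right (m := ∞) (by simp)).fderiv_right (by simp)
  obtain ⟨M', hM', r', hr', hT'⟩ := (hD.contDiffAt.of_le two_le_infty).exists_taylorOn
  obtain ⟨N, hN, r'', hr'', hT''⟩ :=
    ((contDiff_dzL hρ.1).contDiffAt.of_le two_le_infty).exists_taylorOn
  obtain ⟨s, hs, hB⟩ := eventually_nhds_iff_ball.1 ((h1.and hq).and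
    (Filter.Eventually.and (ball_mem_nhds z₁ hr)
    (Filter.Eventually.and (ball_mem_nhds z₁ hr') (ball_mem_nhds z₁ hr''))))
  have hsmall := by
    have hcont := hρ.1.continuous
    have : ContinuousAt (fun z => ‖z - z₁‖ + (C₂ * |ρ z|) * ‖e‖) z₁ := by fun_prop
    exact this.eventually_lt_const (by simpa [hρ.2.2.1 z₁ hz₁] using hs)
  set K := C₁ + N with hK
  refine ⟨(M' + 2 * M * M + K * N) * (C₂ * (‖e‖ + 1)) + K, by positivity, ?_⟩
  filter_upwards [h2, hsmall] with z hz hzs hzΩ X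
  obtain ⟨t, ht, htC, -, htf⟩ := hz hzΩ
  set q := z + t • e with hqd
  have hpos : 0 ≤ C₂ * |ρ z| * ‖e‖ := by positivity
  have hzb : z ∈ ball z₁ s := by rw [mem_ball_iff_norm]; linarith
  have hzq : ‖z - q‖ ≤ C₂ * |ρ z| * ‖e‖ := by
    rw [sub_add_cancel_left, norm_neg, norm_smul, Real.norm_of_nonneg ht.le]; gcongr
  have hqb : q ∈ ball z₁ s := by
    rw [mem_ball_iff_norm]
    calc ‖q - z₁‖ = ‖(z - z₁) - (z - q)‖ := by abel
      _ ≤ ‖z - z₁‖ + ‖z - q‖ := norm_sub_le _ _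
      _ < s := by linarith
  obtain ⟨⟨a1, a2⟩, a3, a4, a5⟩ := hB q hqb
  obtain ⟨-, b3, b4, b5⟩ := hB z hzb
  have f1 := a1 X
  have f2 := a2 htf X
  have f3 : |lv ρ z X - lv ρ q X| ≤ M' * ‖z - q‖ * ‖X‖ * ‖X‖ :=
    (abs_lvp_sub_le q X X).trans (by gcongr; exact hT'.lip q a4 z b4)
  have f4 : ‖dzL ρ q X‖ ≤ ‖dzL ρ z X‖ + N * ‖z - q‖ * ‖X‖ := by
    have := (dzL ρ z - dzL ρ q).le_of_opNorm_le (hT''.lip q a5 z b5) X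
    have e1 : dzL ρ q X = dzL ρ z X - (dzL ρ z - dzL ρ q) X := by simp
    rw [e1]
    exact (norm_sub_le _ _).trans (by gcongr)
  have f5 := (dzL ρ q).le_of_opNorm_le (hT''.norm_le q a5) X
  have f6 : ‖R z X‖ ≤ ‖R q X‖ + M * ‖z - q‖ * ‖X‖ := by
    have := (R z - R q).le_of_opNorm_le (hT.lip q a3 z b3) X
    have e1 : R z X = R q X + (R z - R q) X := by simp
    rw [e1]
    exact (norm_add_le _ _).trans (by gcongr)
  have f7 := (R q).le_of_opNorm_le (hT.norm_le q a3) X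
  have f8 := (R z).le_of_opNorm_le (hT.norm_le z b3) X
  have g1 : ‖R z X‖ ^ 2 ≤ ‖R q X‖ ^ 2 + 2 * M * M * ‖z - q‖ * ‖X‖ ^ 2 := by
    have h3 : (‖R z X‖ - ‖R q X‖) * (‖R z X‖ + ‖R q X‖) ≤
        (M * ‖z - q‖ * ‖X‖) * (M * ‖X‖ + M * ‖X‖) := by
      gcongr
      linarith
    linarith
  have g2 : pg ρ q X ≤ N * ‖dzL ρ q X‖ * ‖X‖ := by
    rw [pg_eq_norm_dzL_sq, sq]
    calc ‖dzL ρ q X‖ * ‖dzL ρ q X‖ ≤ ‖dzL ρ q X‖ * (N * ‖X‖) := by gcongr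
      _ = _ := by ring
  have g3 : K * ‖dzL ρ q X‖ * ‖X‖ ≤ K * (‖dzL ρ z X‖ + N * ‖z - q‖ * ‖X‖) * ‖X‖ := by gcongr
  have g4 : (M' + 2 * M * M + K * N) * ‖z - q‖ * ‖X‖ ^ 2 ≤
      (M' + 2 * M * M + K * N) * (C₂ * (‖e‖ + 1)) * (|ρ z| * ‖X‖ ^ 2) := by
    calc _ ≤ (M' + 2 * M * M + K * N) * (C₂ * |ρ z| * (‖e‖ + 1)) * ‖X‖ ^ 2 := by
          gcongr
          exact hzq.trans (by linarith)
      _ = _ := by ring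
  have g5 : 0 ≤ (M' + 2 * M * M + K * N) * (C₂ * (‖e‖ + 1)) * (‖dzL ρ z X‖ * ‖X‖) := by positivity
  have g6 : 0 ≤ K * (|ρ z| * ‖X‖ ^ 2) := by positivity
  have f3' := (abs_le.1 f3).1
  linarith

lemma contDiffAt_logExhaustion (hρ : ContDiff ℝ ∞ ρ) (hz : ρ z < 0) (K) :
    ContDiffAt ℝ ∞ (fun w => -Real.log (-ρ w) + K * nsq w) z :=
  ((hρ.contDiffAt.neg.log (neg_pos.2 hz).ne').neg).add
    (contDiffAt_const.mul contDiff_nsq.contDiffAt)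

lemma hasDerivAt_neg_log_neg {u} (hu : u < 0) :
    HasDerivAt (fun v => -Real.log (-v)) (-u⁻¹) u := by
  have h : HasDerivAt (fun v => -Real.log (-v)) (-(-1 / -u)) u :=
    ((hasDerivAt_neg u).log (neg_pos.2 hu).ne').neg
  convert h using 1
  field_simp

lemma contDiffAt_neg_log_neg {u} (hu : u < 0) :
    ContDiffAt ℝ 2 (fun v => -Real.log (-v)) u :=
  (contDiffAt_id.neg.log (neg_pos.2 hu).ne').neg

lemma lv_logExhaustion (hρ : ContDiff ℝ ∞ ρ) (hz : ρ z < 0) (K) (X) :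
    lv (fun w => -Real.log (-ρ w) + K * nsq w) z X =
      lv ρ z X / (-ρ z) + pg ρ z X / ρ z ^ 2 + K * nsq X := by
  have hρ2 : ContDiffAt ℝ 2 ρ z := hρ.contDiffAt.of_le two_le_infty
  have hn : ContDiffAt ℝ 2 (nsq) z := contDiff_nsq.contDiffAt.of_le two_le_infty
  have hd : deriv (fun v => -Real.log (-v)) =ᶠ[𝓝 (ρ z)] fun v => -v⁻¹ := by
    filter_upwards [gt_mem_nhds hz] with v hv using (hasDerivAt_neg_log_neg hv).deriv
  have hd2 : deriv (fun v => -v⁻¹) (ρ z) = (ρ z ^ 2)⁻¹ := by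
    rw [(hasDerivAt_inv hz.ne).fun_neg.deriv, neg_neg]
  rw [lv_add (φ := fun w => -Real.log (-ρ w)) ((contDiffAt_neg_log_neg hz).comp z hρ2) (contDiffAt_const.mul hn),
    lv_const_mul hn, lv_nsq, lv_comp hρ2 (contDiffAt_neg_log_neg hz), hd.deriv_eq, hd2,
    hd.eq_of_nhds]
  field_simp

lemma pg_logExhaustion_le (hρ : ContDiff ℝ ∞ ρ) (hz : ρ z < 0) (K) (X) :
    pg (fun w => -Real.log (-ρ w) + K * nsq w) z X ≤
      2 * (pg ρ z X / ρ z ^ 2 + K ^ 2 * (nsq z * nsq X)) := by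
  have h1 := hρ.differentiable (by simp) z
  have h2 := contDiff_nsq.differentiable (by simp) z
  have h3 : HasFDerivAt (fun w => -Real.log (-ρ w) + K * nsq w)
      ((-(ρ z)⁻¹) • fderiv ℝ ρ z + K • fderiv ℝ nsq z) z :=
    ((hasDerivAt_neg_log_neg hz).comp_hasFDerivAt z h1.hasFDerivAt).add
      (h2.hasFDerivAt.const_mul K)
  have h4 := pg_nsq_le z X
  have h5 : pg ρ z X / ρ z ^ 2 = (-(ρ z)⁻¹) ^ 2 * pg ρ z X := by
    ring
  rw [h5]
  refine le_trans ?_ (mul_le_mul_of_nonneg_left (add_le_add_right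
    (mul_le_mul_of_nonneg_left h4 (sq_nonneg K)) _) zero_le_two)
  simp only [pg, h3.fderiv, add_apply, smul_apply, smul_eq_mul]
  generalize -(ρ z)⁻¹ = a
  nlinarith [sq_nonneg (a * fderiv ℝ ρ z X - K * fderiv ℝ nsq z X),
    sq_nonneg (a * fderiv ℝ ρ z (I • X) - K * fderiv ℝ nsq z (I • X))]

lemma IsDefining.exists_direction (hρ : IsDefining n Ω ρ) (hz₁ : z₁ ∈ frontier Ω) :
    ∃ e, 0 < fderiv ℝ ρ z₁ e := by
  obtain ⟨v, hv⟩ := DFunLike.ne_iff.1 (hρ.2.2.2 z₁ hz₁)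
  rcases lt_or_gt_of_ne hv with h | h
  · exact ⟨-v, by simpa using h⟩
  · exact ⟨v, by simpa using h⟩

lemma IsDefining.exists_le_logLevi (hΩ : IsOpen Ω) (hρ : IsDefining n Ω ρ)
    (hz₁ : z₁ ∈ frontier Ω) (he : 0 < fderiv ℝ ρ z₁ e) {R : ℂ^n → ℂ^n →L[ℝ] ℂ^n}
    (hR : ContDiffAt ℝ 2 R z₁) (hq : ∀ᶠ q in 𝓝 z₁, q ∈ frontier Ω → ∀ X,
      ‖R q X‖ ^ 2 ≤ lv ρ q (tproj ρ e q X) + pg ρ q X) :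
    ∃ K > 0, ∀ᶠ z in 𝓝 z₁, z ∈ Ω → ∀ X, ‖R z X‖ ^ 2 / |ρ z| + pg ρ z X / ρ z ^ 2 / 2 ≤
      lv ρ z X / (-ρ z) + pg ρ z X / ρ z ^ 2 + K * ‖X‖ ^ 2 := by
  obtain ⟨C, hC, h⟩ := hρ.exists_le_lv hΩ hz₁ he hR hq
  refine ⟨C + C ^ 2 / 2, by positivity, ?_⟩
  filter_upwards [h] with z hz hzΩ X
  have hneg := hρ.2.1 z hzΩ
  have := hz hzΩ X
  rw [pg_eq_norm_dzL_sq, abs_of_neg hneg]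
  rw [abs_of_neg hneg] at this
  rw [← neg_sq (ρ z)]
  have hm := neg_pos.2 hneg
  generalize -ρ z = m at *
  generalize ‖dzL ρ z X‖ = d at *
  have h1 : ‖R z X‖ ^ 2 / m ≤ lv ρ z X / m + C * ‖X‖ ^ 2 + C * ‖X‖ * (d / m) := by
    rw [div_le_iff₀ hm]
    refine this.trans (le_of_eq ?_)
    field_simp
    ring
  rw [← div_pow]
  nlinarith [sq_nonneg (d / m - C * ‖X‖)]

lemma IsDefining.exists_le_logLevi_interior (hρ : IsDefining n Ω ρ) (hz₁ : ρ z₁ < 0) :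
    ∃ K > 0, ∀ᶠ z in 𝓝 z₁, z ∈ Ω → ∀ X, pg ρ z X / ρ z ^ 2 / 2 ≤
      lv ρ z X / (-ρ z) + pg ρ z X / ρ z ^ 2 + K * ‖X‖ ^ 2 := by
  have hD : ContDiff ℝ ∞ (fderiv ℝ (fderiv ℝ ρ)) :=
    (hρ.1.fderiv_right (m := ∞) (by simp)).fderiv_right (by simp)
  obtain ⟨M, hM, r, hr, hT⟩ := (hD.contDiffAt.of_le two_le_infty).exists_taylorOn
  have hm₁ : 0 < -ρ z₁ / 2 := by linarith
  refine ⟨M / (-ρ z₁ / 2), by positivity, ?_⟩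
  filter_upwards [ball_mem_nhds z₁ hr, hρ.1.continuous.neg.continuousAt.eventually_const_lt
    (show -ρ z₁ / 2 < -ρ z₁ by linarith)] with z hzr hz hzΩ X
  have hm : 0 < -ρ z := hm₁.trans hz
  have h1 : |lv ρ z X| ≤ M * ‖X‖ * ‖X‖ := (abs_lvp_le X X).trans (by gcongr; exact hT.norm_le z hzr)
  have h2 : -(M / (-ρ z₁ / 2) * ‖X‖ ^ 2) ≤ lv ρ z X / (-ρ z) := by
    rw [le_div_iff₀ hm]
    have h5 : M / (-ρ z₁ / 2) * (-ρ z₁ / 2) ≤ M / (-ρ z₁ / 2) * (-ρ z) := by gcongr; exact hz.le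
    rw [div_mul_cancel₀ _ hm₁.ne'] at h5
    nlinarith [(abs_le.1 h1).1]
  have h3 : 0 ≤ pg ρ z X / ρ z ^ 2 := div_nonneg (pg_nonneg _ _ _) (sq_nonneg _)
  linarith

lemma IsDefining.exists_uniform_le_logLevi (hΩ : IsOpen Ω) (hb : Bornology.IsBounded Ω)
    (hρ : IsDefining n Ω ρ) (hpsc : ∀ q ∈ frontier Ω, LeviPSDAt n ρ q) :
    ∃ K > 0, ∀ z ∈ Ω, ∀ X, pg ρ z X / ρ z ^ 2 / 2 ≤
      lv ρ z X / (-ρ z) + pg ρ z X / ρ z ^ 2 + K * ‖X‖ ^ 2 := by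
  have key : ∃ K > 0, ∀ z ∈ closure Ω, z ∈ Ω → ∀ X, pg ρ z X / ρ z ^ 2 / 2 ≤
      lv ρ z X / (-ρ z) + pg ρ z X / ρ z ^ 2 + K * ‖X‖ ^ 2 := by
    refine hb.isCompact_closure.induction_on ?_ ?_ ?_ ?_
    · exact ⟨1, by simp⟩
    · rintro S T hST ⟨K, hK, h⟩
      exact ⟨K, hK, fun z hz => h z (hST hz)⟩
    · rintro S T ⟨K, hK, h⟩ ⟨K', hK', h'⟩
      refine ⟨K + K', by positivity, fun z hz hzΩ X => ?_⟩
      have e1 : 0 ≤ K * ‖X‖ ^ 2 := by positivity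
      have e2 : 0 ≤ K' * ‖X‖ ^ 2 := by positivity
      rcases hz with hz | hz
      · linarith [h z hz hzΩ X]
      · linarith [h' z hz hzΩ X]
    · intro z₁ hz₁
      have : ∃ K > 0, ∀ᶠ z in 𝓝 z₁, z ∈ Ω → ∀ X, pg ρ z X / ρ z ^ 2 / 2 ≤
          lv ρ z X / (-ρ z) + pg ρ z X / ρ z ^ 2 + K * ‖X‖ ^ 2 := by
        by_cases h : z₁ ∈ Ω
        · exact hρ.exists_le_logLevi_interior (hρ.2.1 z₁ h)
        · have hf : z₁ ∈ frontier Ω := by rw [hΩ.frontier_eq]; exact ⟨hz₁, h⟩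
          obtain ⟨e, he⟩ := hρ.exists_direction hf
          obtain ⟨K, hK, h⟩ := hρ.exists_le_logLevi hΩ hf he (R := fun _ => 0) contDiffAt_const (by
            filter_upwards [eventually_dzL_ne_zero hρ.1 (dzL_ne_zero_of_pos he)] with q hq hqf X
            have := (hpsc q hqf).lv_nonneg hρ.1 (dzL_tproj hq X)
            have := pg_nonneg ρ q X
            simp [zero_apply, norm_zero]
            linarith)
          refine ⟨K, hK, h.mono fun z hz hzΩ X => ?_⟩
          simpa using hz hzΩ X
      obtain ⟨K, hK, h⟩ := this
      exact ⟨_, mem_nhdsWithin_of_mem_nhds h, K, hK, fun z hz => hz⟩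
  obtain ⟨K, hK, h⟩ := key
  exact ⟨K, hK, fun z hz => h z (subset_closure hz) hz⟩

/-- A strictly plurisubharmonic exhaustion with self-bounded gradient, controlled near a boundary
point where the Levi form is bounded below. -/
lemma IsDefining.exists_exhaustion (hΩ : IsOpen Ω) (hb : Bornology.IsBounded Ω)
    (hρ : IsDefining n Ω ρ) (hpsc : ∀ q ∈ frontier Ω, LeviPSDAt n ρ q)
    (hz₁ : z₁ ∈ frontier Ω) (he : 0 < fderiv ℝ ρ z₁ e) {R : ℂ^n → ℂ^n →L[ℝ] ℂ^n}
    (hR : ContDiffAt ℝ 2 R z₁) (hq : ∀ᶠ q in 𝓝 z₁, q ∈ frontier Ω → ∀ X,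
      ‖R q X‖ ^ 2 ≤ lv ρ q (tproj ρ e q X) + pg ρ q X) :
    ∃ η, ∃ C > 0, ContDiffOn ℝ ∞ η Ω ∧ IsGoodExhaustion (fun z => rexp (η z)) Ω ∧
      (∀ z ∈ Ω, -Real.log (-ρ z) ≤ η z ∧ η z ≤ -Real.log (-ρ z) + C) ∧
      (∀ z ∈ Ω, ∀ X, pg η z X ≤ C * lv η z X) ∧ ∀ᶠ z in 𝓝 z₁, z ∈ Ω → ∀ X,
        ‖R z X‖ ^ 2 / |ρ z| + pg ρ z X / ρ z ^ 2 / 2 + ‖X‖ ^ 2 ≤ lv η z X := by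
  obtain ⟨K₁, hK₁, h1⟩ := hρ.exists_uniform_le_logLevi hΩ hb hpsc
  obtain ⟨K₂, hK₂, h2⟩ := hρ.exists_le_logLevi hΩ hz₁ he hR hq
  have hcpt := hb.isCompact_closure
  obtain ⟨B₀, hB₀⟩ := hcpt.exists_bound_of_continuousOn
    (contDiff_nsq).continuous.continuousOn
  obtain ⟨m₀, hm₀⟩ := hcpt.exists_bound_of_continuousOn hρ.1.continuous.continuousOn
  set B := max B₀ 1 with hBd
  set m := max m₀ 1 with hmd
  have hB : 1 ≤ B := le_max_right _ _
  have hnB : ∀ z ∈ closure Ω, nsq z ≤ B := fun z hz =>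
    ((le_norm_self _).trans (hB₀ z hz)).trans (le_max_left _ _)
  have hρm : ∀ z ∈ Ω, -ρ z ≤ m := fun z hz =>
    ((neg_le_abs _).trans (hm₀ z (subset_closure hz))).trans (le_max_left _ _)
  set K := K₁ + K₂ + 1 with hK
  set η := fun w => -Real.log (-ρ w) + K * nsq w with hη
  have hsm : ∀ z ∈ Ω, ContDiffAt ℝ ∞ η z := fun z hz =>
    contDiffAt_logExhaustion hρ.1 (hρ.2.1 z hz) K
  have hlv := fun z hz => lv_logExhaustion hρ.1 (hρ.2.1 z hz) K
  have hpg := fun z hz => pg_logExhaustion_le hρ.1 (hρ.2.1 z hz) K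
  have hK0 : 1 ≤ K := by linarith
  have hlow : ∀ z ∈ Ω, ∀ X, pg ρ z X / ρ z ^ 2 / 2 + nsq X ≤ lv η z X := fun z hz X => by
    rw [hlv z hz X]
    have := h1 z hz X
    have h3 := mul_le_mul_of_nonneg_left (norm_sq_le_nsq X) hK₁.le
    have h4 := mul_nonneg hK₂.le (nsq_nonneg X)
    linarith
  have hcmp : ∀ z ∈ Ω, ∀ X, pg η z X ≤ (4 + 2 * K ^ 2 * B) * lv η z X := fun z hz X => by
    have a1 := hpg z hz X
    have a2 := hlow z hz X
    have a3 : 0 ≤ pg ρ z X / ρ z ^ 2 := div_nonneg (pg_nonneg _ _ _) (sq_nonneg _)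
    have a4 := nsq_nonneg X
    have a5 : nsq z * nsq X ≤ B * nsq X := by gcongr; exact hnB z (subset_closure hz)
    have a6 : (4 + 2 * K ^ 2 * B) * (pg ρ z X / ρ z ^ 2 / 2 + nsq X) ≤
      (4 + 2 * K ^ 2 * B) * lv η z X := by gcongr
    have a7 : 2 * K ^ 2 * (nsq z * nsq X) ≤ 2 * K ^ 2 * (B * nsq X) := by gcongr
    have a8 : 0 ≤ 2 * K ^ 2 * B * (pg ρ z X / ρ z ^ 2 / 2) := by positivity
    linarith
  have hlv0 : ∀ z ∈ Ω, ∀ X, 0 ≤ lv η z X := fun z hz X => by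
    have a3 : 0 ≤ pg ρ z X / ρ z ^ 2 := div_nonneg (pg_nonneg _ _ _) (sq_nonneg _)
    linarith [hlow z hz X, nsq_nonneg X]
  have hexp : ∀ z ∈ Ω, rexp (η z) = rexp (K * nsq z) / (-ρ z) := fun z hz => by
    rw [Real.exp_add, Real.exp_neg, Real.exp_log (neg_pos.2 (hρ.2.1 z hz))]
    ring
  have hge : ∀ z ∈ Ω, 1 ≤ rexp (η z) * (-ρ z) := fun z hz => by
    have := hρ.2.1 z hz
    rw [hexp z hz, div_mul_cancel₀ _ (neg_pos.2 this).ne']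
    exact one_le_exp (mul_nonneg (by linarith) (nsq_nonneg z))
  have hpgexp : ∀ z ∈ Ω, ∀ X, pg (fun w => rexp (η w)) z X = rexp (η z) ^ 2 * pg η z X :=
    fun z hz X => by
      rw [pg_comp ((hsm z hz).differentiableAt (by simp)) Real.differentiableAt_exp, Real.deriv_exp]
  have hCm : 4 + 2 * K ^ 2 * B ≤ 4 + 2 * K ^ 2 * B + K * B := by
    have : 0 ≤ K * B := by positivity
    linarith
  refine ⟨η, 4 + 2 * K ^ 2 * B + K * B, by positivity,
    fun z hz => (hsm z hz).contDiffWithinAt, ?_, ?_, ?_, ?_⟩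
  · refine ⟨fun z hz => ((hsm z hz).exp).contDiffWithinAt, fun z _ => (exp_pos _).le,
      fun R' => ?_, fun z hz X => ?_, ?_⟩
    · have : {z | z ∈ Ω ∧ rexp (η z) ≤ R'} =
          closure Ω ∩ {z | rexp (K * nsq z) ≤ R' * (-ρ z)} := by
        ext z
        constructor
        · rintro ⟨hz, h⟩
          refine ⟨subset_closure hz, ?_⟩
          rw [hexp z hz, div_le_iff₀ (neg_pos.2 (hρ.2.1 z hz))] at h
          exact h
        · rintro ⟨hz, h⟩
          have hzΩ : z ∈ Ω := by
            by_contra hn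
            have := hρ.2.2.1 z (by rw [hΩ.frontier_eq]; exact ⟨hz, hn⟩)
            rw [mem_ofPred_eq, this] at h
            have := exp_pos (K * nsq z)
            linarith
          refine ⟨hzΩ, ?_⟩
          rw [hexp z hzΩ, div_le_iff₀ (neg_pos.2 (hρ.2.1 z hzΩ))]
          exact h
      rw [this]
      have c1 := hρ.1.continuous
      have c2 := (contDiff_nsq (n := n)).continuous
      exact hcpt.inter_right (isClosed_le (by fun_prop) (by fun_prop))
    · have h2 := (hsm z hz).of_le two_le_infty
      rw [hpgexp z hz, lv_comp h2 Real.contDiff_exp.contDiffAt]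
      simp [Real.deriv_exp]
      have := mul_nonneg (sq_nonneg (rexp (η z))) (hlv0 z hz X)
      linarith
    · obtain ⟨D, hD⟩ := hcpt.exists_bound_of_continuousOn
        (contDiff_dzL hρ.1).continuous.continuousOn
      refine ⟨2 * (D ^ 2 + K ^ 2 * (B * n) * m ^ 2), fun z hz X => ?_⟩
      have hneg := hρ.2.1 z hz
      set s := rexp (η z) with hs
      have hs1 : (-ρ z)⁻¹ ≤ s := by
        rw [inv_le_iff_one_le_mul₀ (neg_pos.2 hneg)]; exact hge z hz
      have hs2 : 1 ≤ s * m := (hge z hz).trans (by gcongr; exact hρm z hz)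
      have a1 := hpg z hz X
      have a2 : pg ρ z X ≤ D ^ 2 * ‖X‖ ^ 2 := by
        rw [pg_eq_norm_dzL_sq, ← mul_pow]
        gcongr
        exact (dzL ρ z).le_of_opNorm_le (hD z (subset_closure hz)) X
      have a3 : pg ρ z X / ρ z ^ 2 ≤ D ^ 2 * ‖X‖ ^ 2 * s ^ 2 := by
        rw [← neg_sq, div_eq_mul_inv, ← inv_pow]
        have := inv_nonneg.2 (neg_pos.2 hneg).le
        gcongr
      have a4 := by
        have : 1 ≤ (s * m) ^ 2 := one_le_pow₀ hs2
        calc nsq z * nsq X ≤ B * (n * ‖X‖ ^ 2) :=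
              mul_le_mul (hnB z (subset_closure hz)) (nsq_le_norm_sq X) (nsq_nonneg X) (by linarith)
          _ ≤ _ := le_mul_of_one_le_right (by positivity) this
      rw [hpgexp z hz]
      calc s ^ 2 * pg η z X ≤ s ^ 2 * (2 * (D ^ 2 * ‖X‖ ^ 2 * s ^ 2 +
            K ^ 2 * (B * (n * ‖X‖ ^ 2) * (s * m) ^ 2))) := by
            gcongr
            exact a1.trans (by gcongr)
        _ = _ := by ring
  · intro z hz
    have a1 := mul_nonneg (zero_le_one.trans hK0) (nsq_nonneg z)
    have a2 : K * nsq z ≤ K * B := by gcongr; exact hnB z (subset_closure hz)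
    have a3 : 0 ≤ 2 * K ^ 2 * B := by positivity
    constructor <;> simp [hη] <;> linarith
  · exact fun z hz X => (hcmp z hz X).trans (mul_le_mul_of_nonneg_right hCm (hlv0 z hz X))
  · filter_upwards [h2] with z hz hzΩ X
    rw [hlv z hzΩ X]
    have := hz hzΩ X
    have h3 := mul_le_mul_of_nonneg_left (norm_sq_le_nsq X) hK₂.le
    have h4 := mul_nonneg hK₁.le (nsq_nonneg X)
    linarith [norm_sq_le_nsq X]

/-- Bounded weights adapted to a level of the exhaustion. -/
lemma exists_level_weight {η} {C} (hΩ : IsOpen Ω) (hC : 0 < C)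
    (hη : ContDiffOn ℝ ∞ η Ω) (hpg : ∀ z ∈ Ω, ∀ X, pg η z X ≤ C * lv η z X) (B) :
    ∃ c > 0, ∀ u, ∃ φ, ContDiffOn ℝ ∞ φ Ω ∧ (∀ z ∈ Ω, φ z ∈ Icc 0 1) ∧
      (∀ z ∈ Ω, ∀ X, 0 ≤ lv φ z X) ∧ ∀ z ∈ Ω, |η z - u| ≤ B → ∀ X, c * lv η z X ≤ lv φ z X := by
  set τ := 1 / (2 * C) with hτ
  have hτ0 : 0 < τ := by positivity
  refine ⟨1 / 2 * (τ * rexp (-(τ * B)) * rexp (-rexp (τ * B))), by positivity,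
    fun u => ?_⟩
  set χ := fun v => rexp (-rexp (-(τ * (v - u)))) with hχ
  have hy : ∀ v, HasDerivAt (fun v => rexp (-(τ * (v - u))))
      (-(τ * rexp (-(τ * (v - u))))) v := fun v => by
    convert ((((hasDerivAt_id' v).sub_const u).const_mul τ).fun_neg).exp using 1
    ring
  have hd : ∀ v, HasDerivAt χ (τ * rexp (-(τ * (v - u))) * χ v) v := fun v => by
    convert ((hy v).fun_neg).exp using 1
    ring
  have hd1 := funext fun v => (hd v).deriv
  have hd2 : ∀ v, -(τ * deriv χ v) ≤ deriv (deriv χ) v := fun v => by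
    have : HasDerivAt (deriv χ) (τ * (-(τ * rexp (-(τ * (v - u))))) * χ v +
        τ * rexp (-(τ * (v - u))) * (τ * rexp (-(τ * (v - u))) * χ v)) v := by
      rw [hd1]
      exact ((hy v).const_mul τ).mul (hd v)
    rw [this.deriv, hd1]
    have : 0 ≤ τ * rexp (-(τ * (v - u))) * (τ * rexp (-(τ * (v - u))) * χ v) := by
      positivity
    linarith
  have hdpos : ∀ v, 0 ≤ deriv χ v := fun v => by rw [hd1]; positivity
  have hχs : ContDiff ℝ ∞ χ := by fun_prop
  have hlvη := fun z hz X =>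
    nonneg_of_mul_nonneg_right ((pg_nonneg _ _ _).trans (hpg z hz X)) hC
  have hmain : ∀ z ∈ Ω, ∀ X, 1 / 2 * deriv χ (η z) * lv η z X ≤ lv (fun w => χ (η w)) z X := by
    intro z hz X
    have h2 := (hη.contDiffAt (hΩ.mem_nhds hz)).of_le two_le_infty
    rw [lv_comp h2 (hχs.contDiffAt.of_le two_le_infty)]
    have a1 := mul_le_mul_of_nonneg_right (hd2 (η z)) (pg_nonneg η z X)
    have a2 : τ * deriv χ (η z) * pg η z X ≤ τ * deriv χ (η z) * (C * lv η z X) :=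
      mul_le_mul_of_nonneg_left (hpg z hz X) (mul_nonneg hτ0.le (hdpos _))
    have a3 : τ * deriv χ (η z) * (C * lv η z X) = 1 / 2 * deriv χ (η z) * lv η z X := by
      rw [hτ]; field_simp
    linarith
  refine ⟨fun w => χ (η w), hχs.comp_contDiffOn hη, fun z _ => ⟨(exp_pos _).le, ?_⟩,
    fun z hz X => le_trans ?_ (hmain z hz X), fun z hz hzB X => le_trans ?_ (hmain z hz X)⟩
  · exact Real.exp_le_one_iff.2 (neg_nonpos.2 (exp_pos _).le)
  · exact mul_nonneg (mul_nonneg (by norm_num) (hdpos _)) (hlvη z hz X)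
  · rw [abs_le] at hzB
    have := hlvη z hz X
    rw [hd1]
    simp [hχ]
    have b1 : -(τ * B) ≤ -(τ * (η z - u)) := neg_le_neg (by gcongr; exact hzB.2)
    have b2 : -(τ * (η z - u)) ≤ τ * B := by
      rw [neg_le, ← mul_neg]; gcongr; exact hzB.1
    gcongr

section FormInverse

variable {E : Type*} [NormedAddCommGroup E] [NormedSpace ℝ E] [FiniteDimensional ℝ E]

lemma exists_smooth_form_inverse {L : E → E →L[ℝ] E →L[ℝ] ℝ} (G : E →L[ℝ] E →L[ℝ] ℝ) {x}
    (hL : ∀ᶠ z in 𝓝 x, ContDiffAt ℝ ∞ L z) (hpos : ∀ Y ≠ 0, 0 < L x Y Y) :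
    ∃ A : E → E →L[ℝ] E, ∃ c > 0, ∀ᶠ z in 𝓝 x, ContDiffAt ℝ ∞ A z ∧
      (∀ X Y, L z (A z X) Y = G X Y) ∧ ∀ Y, c * ‖Y‖ ^ 2 ≤ L z Y Y := by
  obtain ⟨c, hc, hcoer⟩ : ∃ c > 0, ∀ Y, c * ‖Y‖ ^ 2 ≤ L x Y Y := by
    rcases (sphere (0 : E) 1).eq_empty_or_nonempty with h0 | h0
    · refine ⟨1, one_pos, fun Y => ?_⟩
      by_cases hY : Y = 0
      · simp [hY]
      · have : ‖Y‖⁻¹ • Y ∈ sphere 0 1 := by simp [norm_smul, hY]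
        simp [h0] at this
    · obtain ⟨v, hv, hmin⟩ := (isCompact_sphere 0 1).exists_isMinOn h0
        (f := fun Y => L x Y Y) (by fun_prop)
      refine ⟨L x v v, hpos v (by rintro rfl; simp at hv), fun Y => ?_⟩
      by_cases hY : Y = 0
      · simp [hY]
      · have h1 := hmin (show ‖Y‖⁻¹ • Y ∈ sphere 0 1 by simp [norm_smul, hY])
        simp [map_smul, smul_apply, smul_eq_mul, mem_ofPred_eq] at h1
        calc _ ≤ ‖Y‖⁻¹ * (‖Y‖⁻¹ * L x Y Y) * ‖Y‖ ^ 2 := by gcongr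
          _ = _ := by field_simp
  have hinv : ∀ z, (∀ Y, c / 2 * ‖Y‖ ^ 2 ≤ L z Y Y) → (L z).IsInvertible := fun z hz => by
    have hinj : Function.Injective (toContinuousLinearMap.symm.toLinearMap
        ∘ₗ (L z).toLinearMap) := by
      refine toContinuousLinearMap.symm.injective.comp ?_
      refine (injective_iff_map_eq_zero (L z)).2 fun Y hY => ?_
      have h1 := hz Y
      rw [hY, zero_apply] at h1
      have : ‖Y‖ ^ 2 ≤ 0 := by nlinarith
      exact norm_eq_zero.1 (by nlinarith)
    refine ⟨(LinearEquiv.ofBijective (L z).toLinearMap ⟨fun a b h => hinj (by simpa using h), fun y => ?_⟩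
      ).toContinuousLinearEquiv, by rfl⟩
    have hs := (LinearMap.injective_iff_surjective_of_finrank_eq_finrank
      Subspace.dual_finrank_eq.symm).1 hinj (toContinuousLinearMap.symm y)
    obtain ⟨w, hw⟩ := hs
    exact ⟨w, toContinuousLinearMap.symm.injective hw⟩
  refine ⟨fun z => (L z).inverse.comp G, c / 2, by positivity, ?_⟩
  have hnear := by
    have := hL.self_of_nhds.continuousAt
    simpa [dist_eq_norm] using tendsto_nhds.1 this (c / 2) (by positivity)
  filter_upwards [hL, hnear] with z hz hzx
  have hco : ∀ Y, c / 2 * ‖Y‖ ^ 2 ≤ L z Y Y := fun Y => by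
    have h1 := (L z - L x).le_opNorm₂ Y Y
    have h2 : ‖L z - L x‖ * ‖Y‖ * ‖Y‖ ≤ c / 2 * ‖Y‖ * ‖Y‖ := by gcongr
    have h3 := (abs_le.1 (h1.trans h2)).1
    simp [sub_apply] at h3
    nlinarith [hcoer Y]
  refine ⟨((hinv z hco).contDiffAt_map_inverse.comp z hz).clm_comp contDiffAt_const, fun X Y => ?_, hco⟩
  obtain ⟨f, hf⟩ := hinv z hco
  simp [← hf]

end FormInverse

/-- `A z` projects onto a subspace of the complex tangent space of the level set of `ρ` at `z`,
along the kernel of the fixed projection `P`, and the subspace is Levi-orthogonal to that kernel. -/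
structure IsLeviFrame (P : ℂ^n →L[ℂ] ℂ^n)
    (A : ℂ^n → ℂ^n →L[ℝ] ℂ^n) (c) (ρ)
    (e z) where
  ne : dzL ρ z e ≠ 0
  smooth : ContDiffAt ℝ ∞ A z
  proj : ∀ X, P (A z X) = P X
  tang : ∀ X, dzL ρ z (A z X) = 0
  null : ∀ X Y, P Y = 0 → lvp ρ z (A z X) (tproj ρ e z Y) = 0
  coer : ∀ Y, P Y = 0 → c * ‖Y‖ ^ 2 ≤ lv ρ z (tproj ρ e z Y) + pg ρ z Y

namespace IsLeviFrame

lemma eq_zero (h : IsLeviFrame P A c ρ e z) (hc : 0 < c) {W} (hP : P W = 0)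
    (hd : dzL ρ z W = 0) (hl : ∀ Y, P Y = 0 → lvp ρ z W (tproj ρ e z Y) = 0) : W = 0 := by
  have h1 := h.coer W hP
  rw [lv, pg_eq_norm_dzL_sq, hd, tproj_of_dzL_eq_zero hd] at h1
  have h2 := hl W hP
  rw [tproj_of_dzL_eq_zero hd] at h2
  have h3 : ‖W‖ ^ 2 ≤ 0 := by
    by_contra hn
    push Not at hn
    have := mul_pos hc hn
    norm_num at h1
    linarith
  exact norm_eq_zero.1 (pow_eq_zero_iff two_ne_zero |>.1 (le_antisymm h3 (sq_nonneg _)))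

lemma apply_eq (h : IsLeviFrame P A c ρ e z) (hc : 0 < c) {W} (hP : P W = P X)
    (hd : dzL ρ z W = 0) (hl : ∀ Y, P Y = 0 → lvp ρ z W (tproj ρ e z Y) = 0) : A z X = W := by
  rw [← sub_eq_zero]
  refine h.eq_zero hc (by rw [map_sub, h.proj, hP, sub_self])
    (by rw [map_sub, h.tang, hd, sub_self]) fun Y hY => ?_
  rw [sub_eq_add_neg, lvp_add_left, h.null X Y hY, ← neg_one_smul ℝ, lvp_smul_left, hl Y hY]
  simp

lemma apply_I_smul (h : IsLeviFrame P A c ρ e z) (hc : 0 < c) (X) : A z (I • X) = I • A z X :=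
  h.apply_eq hc (by rw [map_smul, h.proj, map_smul]) (by rw [dzL_smul, h.tang, mul_zero])
    fun Y hY => by rw [lvp_I_smul_left, ← tproj_I_smul, h.null X _ (by rw [map_smul, hY, smul_zero]),
      neg_zero]

lemma apply_proj (h : IsLeviFrame P A c ρ e z) (hc : 0 < c) (hPP : ∀ X, P (P X) = P X)
    (X) : A z (P X) = A z X :=
  h.apply_eq hc (by rw [h.proj, hPP]) (h.tang X) (h.null X)

end IsLeviFrame

lemma mem_leviKernel_iff (hρ : ContDiff ℝ ∞ ρ) : X ∈ leviKernel n ρ z ↔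
    dzL ρ z X = 0 ∧ ∀ Y, dzL ρ z Y = 0 → lvp ρ z X Y = 0 := by
  simp only [leviKernel, Submodule.mem_inf, mem_cTangent_iff hρ, Submodule.mem_iInf, LinearMap.mem_ker,
    leviPairMap_apply (hρ.contDiffAt_two z)]
  refine and_congr_right fun _ => ⟨fun h Y hY => ?_, fun h Y hY => ?_⟩
  · simpa using congrArg re (h Y hY)
  · have hIY : dzL ρ z (I • Y) = 0 := by rw [dzL_smul, hY, mul_zero]
    rw [h Y hY, h _ hIY]
    simp

lemma LeviPSDAt.mem_leviKernel (hρ : ContDiff ℝ ∞ ρ) (h : LeviPSDAt n ρ z)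
    (hX : dzL ρ z X = 0) (h0 : lv ρ z X = 0) : X ∈ leviKernel n ρ z := by
  refine (mem_leviKernel_iff hρ).2 ⟨hX, fun Y hY => ?_⟩
  have key : ∀ t, 0 ≤ 2 * t * lvp ρ z X Y + t ^ 2 * lv ρ z Y := fun t => by
    have h1 : 0 ≤ lv ρ z (X + t • Y) := h.lv_nonneg hρ (by rw [map_add, map_smul, hX, hY]; simp)
    rw [lv, lvp_add_left, lvp_comm hρ, lvp_comm hρ z (t • Y), lvp_add_left, lvp_add_left,
      lvp_comm hρ z X (t • Y), lvp_smul_left, lvp_smul_left, lvp_comm hρ z Y (t • Y),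
      lvp_smul_left, lvp_comm hρ z Y X] at h1
    rw [lv] at h0
    rw [lv]
    linarith
  have ha := h.lv_nonneg hρ hY
  generalize lvp ρ z X Y = b at *
  generalize lv ρ z Y = a at *
  have h1 := key (-(b / (a + 1)))
  have h2 : b = b / (a + 1) * (a + 1) := by field_simp
  generalize b / (a + 1) = s at *
  subst h2
  have : s = 0 := by nlinarith
  simp [this]

lemma finrank_cTangent (hρ : ContDiff ℝ ∞ ρ) (h : dzL ρ z e ≠ 0) :
    Module.finrank ℂ (cTangent n ρ z) + 1 = n := by
  have h1 : cTangentMap n ρ z ≠ 0 := fun h0 => h (by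
    simpa [dzL_apply, cTangentMap_apply (hρ.differentiable (by simp) z)] using LinearMap.congr_fun h0 e)
  have := Module.Dual.finrank_ker_add_one_of_ne_zero h1
  rwa [Module.finrank_fin_fun] at this

lemma finrank_leviKernel_eq (hρ : ContDiff ℝ ∞ ρ) {l} (hz : dzL ρ z e ≠ 0)
    (hw : dzL ρ w e ≠ 0) (hzl : LeviRankAt n ρ z l) (hwl : LeviRankAt n ρ w l) :
    Module.finrank ℂ (leviKernel n ρ z) = Module.finrank ℂ (leviKernel n ρ w) := by
  have h1 := finrank_cTangent hρ hz
  have h2 := finrank_cTangent hρ hw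
  have h3 : Module.finrank ℂ (leviKernel n ρ z) ≤ Module.finrank ℂ (cTangent n ρ z) :=
    Submodule.finrank_mono inf_le_left
  have h4 : Module.finrank ℂ (leviKernel n ρ w) ≤ Module.finrank ℂ (cTangent n ρ w) :=
    Submodule.finrank_mono inf_le_left
  unfold LeviRankAt at hzl hwl
  omega

lemma IsLeviFrame.lvp_eq_zero
    (h : IsLeviFrame P A c ρ e z) (hc : 0 < c) (hρ : ContDiff ℝ ∞ ρ) (hPP : ∀ X, P (P X) = P X)
    (hdim : Module.finrank ℂ P.range ≤ Module.finrank ℂ (leviKernel n ρ z)) (X)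
    {Y} (hY : dzL ρ z Y = 0) : lvp ρ z (A z X) Y = 0 := by
  let A' : ℂ^n →ₗ[ℂ] ℂ^n :=
    { toFun := A z
      map_add' := map_add _
      map_smul' := map_smul_of_I (A z).toLinearMap (h.apply_I_smul hc) }
  have hle : leviKernel n ρ z ≤ P.range.map A' := fun W hW => by
    obtain ⟨hW1, hW2⟩ := (mem_leviKernel_iff hρ).1 hW
    refine ⟨P W, ⟨W, rfl⟩, ?_⟩
    exact (h.apply_proj hc hPP W).trans (h.apply_eq hc rfl hW1 fun Y _ => hW2 _ (dzL_tproj h.ne Y))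
  have heq := Submodule.eq_of_le_of_finrank_le hle ((Submodule.finrank_map_le _ _).trans hdim)
  have hmem : A z X ∈ leviKernel n ρ z := by
    rw [heq]
    exact ⟨P X, ⟨X, rfl⟩, h.apply_proj hc hPP X⟩
  exact ((mem_leviKernel_iff hρ).1 hmem).2 Y hY

/-- The Levi form on tangential parts, as a bilinear form. -/
noncomputable def leviForm (ρ : ℂ^n → ℝ) (z : ℂ^n) : ℂ^n →L[ℝ] ℂ^n →L[ℝ] ℝ :=
  (1 / 4 : ℝ) • (fderiv ℝ (fderiv ℝ ρ) z + (fderiv ℝ (fderiv ℝ ρ) z).bilinearComp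
    (I • ContinuousLinearMap.id ℝ _) (I • ContinuousLinearMap.id ℝ _))

lemma leviForm_apply (z X Y) : leviForm ρ z X Y = lvp ρ z X Y := by
  simp [leviForm, lvp, D2]
  ring

lemma contDiffAt_lvp (hρ : ContDiff ℝ ∞ ρ) {f g}
    (hf : ContDiffAt ℝ ∞ f z) (hg : ContDiffAt ℝ ∞ g z) :
    ContDiffAt ℝ ∞ (fun w => lvp ρ w (f w) (g w)) z := by
  have h2 : ContDiffAt ℝ ∞ (fderiv ℝ (fderiv ℝ ρ)) z :=
    ((hρ.fderiv_right (m := ∞) (by simp)).fderiv_right (by simp)).contDiffAt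
  exact (((h2.clm_apply hf).clm_apply hg).add
    ((h2.clm_apply (hf.const_smul I)).clm_apply (hg.const_smul I))).div_const 4

theorem IsDefining.exists_leviFrame (hΩ : IsOpen Ω) (hρ : IsDefining n Ω ρ)
    (hpsc : LeviPSDAt n ρ z₁) (hz₁ : z₁ ∈ frontier Ω) (he : 0 < fderiv ℝ ρ z₁ e) {l}
    (hrank : ∀ᶠ q in 𝓝 z₁, q ∈ frontier Ω → LeviRankAt n ρ q l) :
    ∃ (P : ℂ^n →L[ℂ] ℂ^n) (A : ℂ^n → ℂ^n →L[ℝ] ℂ^n),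
      ∃ c > 0, P e = 0 ∧ (∀ X, P (P X) = P X) ∧ (∀ X, dzL ρ z₁ (P X) = 0) ∧
        ∀ᶠ z in 𝓝 z₁, IsLeviFrame P A c ρ e z ∧
          (ρ z = 0 → ∀ X Y, dzL ρ z Y = 0 → lvp ρ z (A z X) Y = 0) := by
  have hs := hρ.1
  have hne := dzL_ne_zero_of_pos he
  obtain ⟨q, hq⟩ := (leviKernel n ρ z₁).exists_isCompl
  let T : ℂ^n →ₗ[ℂ] ℂ^n :=
    { toFun := tproj ρ e z₁
      map_add' := map_add _
      map_smul' := map_smul_of_I (tproj ρ e z₁).toLinearMap tproj_I_smul }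
  let P :=
    ((leviKernel n ρ z₁).projection q hq ∘ₗ T).toContinuousLinearMap
  have hPmem : ∀ X, P X ∈ leviKernel n ρ z₁ := fun X => by
    rw [← Submodule.range_projection hq]; exact ⟨T X, rfl⟩
  have hPd := fun X => ((mem_leviKernel_iff hs).1 (hPmem X)).1
  have hPid : ∀ X ∈ leviKernel n ρ z₁, P X = X := fun X hX => by
    change (leviKernel n ρ z₁).projection q hq (tproj ρ e z₁ X) = X
    rw [tproj_of_dzL_eq_zero ((mem_leviKernel_iff hs).1 hX).1]
    exact Submodule.projection_apply_left hq ⟨X, hX⟩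
  have hPP := fun X => hPid _ (hPmem X)
  have hPe : ∀ a : ℂ, P (a • e) = 0 := fun a => by
    change (leviKernel n ρ z₁).projection q hq (tproj ρ e z₁ (a • e)) = 0
    rw [tproj_smul_self hne, map_zero]
  have hPr : P.range = leviKernel n ρ z₁ :=
    le_antisymm (by rintro _ ⟨X, rfl⟩; exact hPmem X) fun X hX => ⟨X, hPid X hX⟩
  let p := P.restrictScalars ℝ
  let Q := ContinuousLinearMap.id ℝ _ - p
  let inn : ℂ →L[ℝ] ℂ →L[ℝ] ℝ := innerSL ℝ
  let G := ∑ j : Fin n, inn.bilinearComp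
    ((proj j).comp p)
    ((proj j).comp p)
  have hG : ∀ X Y, G X Y = ∑ j, inner ℝ (P X j) (P Y j) := fun X Y => by
    simp only [G, sum_apply]
    rfl
  have hG0 : ∀ X, G X X = 0 → P X = 0 := fun X hX => by
    rw [hG, Finset.sum_eq_zero_iff_of_nonneg fun _ _ => real_inner_self_nonneg] at hX
    exact funext fun j => inner_self_eq_zero.1 (hX j (Finset.mem_univ j))
  let L := fun z =>
    (leviForm ρ z).bilinearComp (tproj ρ e z) ((tproj ρ e z).comp Q) +
      inn.bilinearComp (dzL ρ z) ((dzL ρ z).comp Q) + G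
  have hLa : ∀ z X Y, L z X Y = lvp ρ z (tproj ρ e z X) (tproj ρ e z (Y - P Y)) +
      inner ℝ (dzL ρ z X) (dzL ρ z (Y - P Y)) + G X Y := fun z X Y => by
    rw [← leviForm_apply]
    rfl
  have hLs : ∀ᶠ z in 𝓝 z₁, ContDiffAt ℝ ∞ L z := by
    filter_upwards [(eventually_dzL_ne_zero hs hne).eventually_nhds] with z hz
    refine ContDiffOn.contDiffAt (contDiffOn_clm_apply.2 fun X => contDiffOn_clm_apply.2 fun Y w hw =>
      ContDiffAt.contDiffWithinAt ?_) hz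
    have hT : ∀ V, ContDiffAt ℝ ∞ (fun w => tproj ρ e w V) w := fun V =>
      (contDiffAt_tproj hs hw).clm_apply contDiffAt_const
    have hd : ∀ V, ContDiffAt ℝ ∞ (fun w => dzL ρ w V) w := fun V =>
      (contDiff_dzL hs).contDiffAt.clm_apply contDiffAt_const
    simp only [hLa]
    exact ((contDiffAt_lvp hs (hT _) (hT _)).add ((hd _).inner ℝ (hd _))).add contDiffAt_const
  have hpos : ∀ Y ≠ 0, 0 < L z₁ Y Y := fun Y hY => by
    have h1 : tproj ρ e z₁ (Y - P Y) = tproj ρ e z₁ Y - P Y := by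
      rw [map_sub, tproj_of_dzL_eq_zero (hPd Y)]
    have h2 : lvp ρ z₁ (tproj ρ e z₁ Y) (tproj ρ e z₁ (Y - P Y)) = lv ρ z₁ (tproj ρ e z₁ Y) := by
      rw [h1, lvp_comm hs, sub_eq_add_neg, lvp_add_left, ← neg_one_smul ℝ, lvp_smul_left,
        ((mem_leviKernel_iff hs).1 (hPmem Y)).2 _ (dzL_tproj hne Y), lv, mul_zero, add_zero]
    rw [hLa, h2, map_sub, hPd, sub_zero]
    have h3 := hpsc.lv_nonneg hs (dzL_tproj hne Y)
    have h4 : 0 ≤ G Y Y := by rw [hG]; exact sum_nonneg fun _ _ => real_inner_self_nonneg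
    have h5 : 0 ≤ inner ℝ (dzL ρ z₁ Y) (dzL ρ z₁ Y) := real_inner_self_nonneg
    refine lt_of_le_of_ne (by positivity) fun h0 => hY ?_
    have h6 := inner_self_eq_zero.1 (by linarith : inner ℝ (dzL ρ z₁ Y) (dzL ρ z₁ Y) = 0)
    have h7 := hG0 Y (by linarith)
    rw [← h7]
    refine (hPid Y (hpsc.mem_leviKernel hs h6 ?_)).symm
    rw [tproj_of_dzL_eq_zero h6] at h3 h0
    linarith
  obtain ⟨A, c, hc, hA⟩ := exists_smooth_form_inverse G hLs hpos
  refine ⟨P, A, c, hc, by simpa using hPe 1, hPP, hPd, ?_⟩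
  filter_upwards [hA, eventually_dzL_ne_zero hs hne, hρ.eventually_mem_frontier hΩ hz₁ he, hrank]
    with z ⟨hAs, hAG, hAc⟩ hz hfr hrk
  have hGP : ∀ X Y, G X (P Y) = G X Y := fun X Y => by simp [hG, hPP]
  have hF : IsLeviFrame P A c ρ e z := by
    have htang := fun X => by
      have h1 := hAG X ((dzL ρ z (A z X) / dzL ρ z e) • e)
      rw [hLa, hPe, sub_zero, tproj_smul_self hz, dzL_smul, div_mul_cancel₀ _ hz, ← hGP, hPe,
        map_zero, add_zero, ← lvp_comm hs, show (0 : ℂ^n) = (0 : ℝ) • 0 by simp,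
        lvp_smul_left, ← hGP, hPe, map_zero, zero_mul, zero_add] at h1
      exact inner_self_eq_zero.1 h1
    refine ⟨hz, hAs, fun X => ?_, htang, fun X Y hY => ?_, fun Y hY => ?_⟩
    · have h1 : ∀ Y, G (A z X - X) Y = 0 := fun Y => by
        have h2 := hAG X (P Y)
        rw [hLa, hPP, sub_self, map_zero, map_zero, inner_zero_right, lvp_comm hs,
          show (0 : ℂ^n) = (0 : ℝ) • 0 by simp, lvp_smul_left, hGP, hGP] at h2
        rw [map_sub, sub_apply]
        linarith
      rw [← sub_eq_zero, ← map_sub]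
      exact hG0 _ (h1 _)
    · have h1 := hAG X Y
      rw [hLa, hY, sub_zero, htang, inner_zero_left, tproj_of_dzL_eq_zero (htang X), ← hGP, hY,
        map_zero, ← hGP, hY, map_zero] at h1
      linarith
    · have h1 := hAc Y
      rw [hLa, hY, sub_zero, ← hGP, hY, map_zero, real_inner_self_eq_norm_sq] at h1
      rw [pg_eq_norm_dzL_sq, lv]
      linarith
  refine ⟨hF, fun hz0 X Y hY => hF.lvp_eq_zero hc hs hPP ?_ X hY⟩
  rw [hPr]
  exact (finrank_leviKernel_eq hs hne hz (hrank.self_of_nhds hz₁) (hrk (hfr hz0))).le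

section Commutation

lemma contDiff_leviForm (hρ : ContDiff ℝ ∞ ρ) : ContDiff ℝ ∞ (leviForm ρ) := by
  refine contDiff_clm_apply_iff.2 fun X => contDiff_clm_apply_iff.2 fun Y => ?_
  simp [leviForm_apply]
  exact contDiff_iff_contDiffAt.2 fun z => contDiffAt_lvp hρ contDiffAt_const contDiffAt_const

lemma fderiv_leviForm_cyclic (hρ : ContDiff ℝ ∞ ρ) (q U V T) :
    fderiv ℝ (leviForm ρ) q U V (I • T) - fderiv ℝ (leviForm ρ) q V U (I • T)
      + fderiv ℝ (leviForm ρ) q T U (I • V) = 0 := by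
  have h1 : ContDiff ℝ ∞ (fderiv ℝ ρ) := hρ.fderiv_right (by simp)
  have h2 : ContDiff ℝ ∞ (fderiv ℝ (fderiv ℝ ρ)) := h1.fderiv_right (by simp)
  have happ := fun X Y => by
    simpa using ((h2.differentiable (by simp) q).hasFDerivAt.clm_apply
      (hasFDerivAt_const X q)).clm_apply (hasFDerivAt_const Y q)
  have hM : ∀ W X Y, fderiv ℝ (leviForm ρ) q W X Y =
      (fderiv ℝ (fderiv ℝ (fderiv ℝ ρ)) q W X Y
        + fderiv ℝ (fderiv ℝ (fderiv ℝ ρ)) q W (I • X) (I • Y)) / 4 := fun W X Y => by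
    have h3 := by
      simpa using (((contDiff_leviForm hρ).differentiable (by simp) q).hasFDerivAt.clm_apply
        (hasFDerivAt_const X q)).clm_apply (hasFDerivAt_const Y q)
    have h4 := ((happ X Y).fun_add (happ (I • X) (I • Y))).const_mul (1 / 4)
    have h5 := h3.unique (h4.congr_of_eventuallyEq (.of_forall fun z => by
      simp [leviForm_apply, lvp, D2]
      ring))
    have h6 := DFunLike.congr_fun h5 W
    simp [flip_apply, smul_apply, add_apply] at h6
    rw [h6]
    ring
  have hs1 : ∀ W X Y, fderiv ℝ (fderiv ℝ (fderiv ℝ ρ)) q W X Y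
      = fderiv ℝ (fderiv ℝ (fderiv ℝ ρ)) q X W Y := fun W X Y => by
    rw [fderiv_fderiv_apply_comm (h1.contDiffAt.of_le two_le_infty)]
  have hs2 := fun W X Y => by
    have h5 := (happ X Y).unique ((happ Y X).congr_of_eventuallyEq (.of_forall fun z =>
      D2_comm hρ z X Y))
    simpa using DFunLike.congr_fun h5 W
  have hII : ∀ X : ℂ^n, I • I • X = -X := fun X => by
    rw [smul_smul, I_mul_I, neg_one_smul]
  simp [hM, hII, map_neg]
  rw [hs1 V U, hs2 U (I • V), hs1 U T, hs2 V (I • U), hs1 V T, hs2 T V]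
  ring

lemma fderiv_eq_zero_of_eqOn_level (hρ : ContDiff ℝ ∞ ρ) {q T} (hq : ρ q = 0)
    (hne : fderiv ℝ ρ q ≠ 0) {F : ℂ^n → ℝ} (hF : ContDiffAt ℝ ∞ F q)
    (h0 : ∀ᶠ z in 𝓝 q, ρ z = 0 → F z = 0) (hT : fderiv ℝ ρ q T = 0) : fderiv ℝ F q T = 0 := by
  have hF0 := h0.self_of_nhds hq
  have hext : IsLocalExtrOn F {z | ρ z = ρ q} q := inl (by
    filter_upwards [mem_nhdsWithin_of_mem_nhds h0, self_mem_nhdsWithin] with z hz hz'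
    rw [hF0, hz (by rw [← hq]; exact hz')])
  obtain ⟨a, b, hab, h⟩ := hext.exists_multipliers_of_hasStrictFDerivAt_1d
    (hρ.contDiffAt.hasStrictFDerivAt (by simp)) (hF.hasStrictFDerivAt (by simp))
  have hb : b ≠ 0 := by
    rintro rfl
    rw [zero_smul, add_zero] at h
    exact (smul_eq_zero.1 h).elim (fun ha => hab (by rw [ha]; rfl)) hne
  have h1 := DFunLike.congr_fun h T
  simpa [hT, hb] using h1

/-- The frame exists near `q` and spans the Levi kernels of the boundary there. -/
def IsLeviFoliation (P : ℂ^n →L[ℂ] ℂ^n) (A) (c) (ρ)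
    (e q) :=
  ∀ᶠ z in 𝓝 q, IsLeviFrame P A c ρ e z ∧ (ρ z = 0 → ∀ X Y, dzL ρ z Y = 0 → lvp ρ z (A z X) Y = 0)

namespace IsLeviFoliation

variable {q : ℂ^n}

lemma hasFDerivAt_apply (h : IsLeviFoliation P A c ρ e q) (ζ) :
    HasFDerivAt (fun z => A z ζ) ((fderiv ℝ A q).flip ζ) q := by
  simpa using ((h.self_of_nhds.1.smooth.differentiableAt (by simp)).hasFDerivAt.clm_apply
    (hasFDerivAt_const ζ q))

lemma dzL_fderiv (hρ : ContDiff ℝ ∞ ρ) {f}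
    {f' : ℂ^n →L[ℝ] ℂ^n} (hf : HasFDerivAt f f' q) (h0 : ∀ᶠ z in 𝓝 q, dzL ρ z (f z) = 0) (U) :
    dzL ρ q (f' U) = - fderiv ℝ (dzL ρ) q U (f q) := by
  have h1 := ((contDiff_dzL hρ).differentiable (by simp) q).hasFDerivAt.clm_apply hf
  have h2 := DFunLike.congr_fun (h1.unique ((hasFDerivAt_const 0 q).congr_of_eventuallyEq h0)) U
  exact eq_neg_of_add_eq_zero_left h2

lemma lvp_add_lvp_fderiv (hρ : ContDiff ℝ ∞ ρ) {f g}
    {f' g' : ℂ^n →L[ℝ] ℂ^n} (hf : HasFDerivAt f f' q) (hg : HasFDerivAt g g' q)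
    {U} (h0 : fderiv ℝ (fun z => lvp ρ z (f z) (I • g z)) q U = 0) :
    fderiv ℝ (leviForm ρ) q U (f q) (I • g q) + lvp ρ q (f' U) (I • g q)
      + lvp ρ q (f q) (I • g' U) = 0 := by
  have h1 := (((contDiff_leviForm hρ).differentiable (by simp) q).hasFDerivAt.clm_apply hf).clm_apply
    (hg.fun_const_smul I)
  simp [leviForm_apply] at h1
  rw [h1.fderiv] at h0
  simp [add_apply, comp_apply, flip_apply, smul_apply,
    leviForm_apply] at h0
  linarith

theorem fderiv_comm (h : IsLeviFoliation P A c ρ e q) (hc : 0 < c) (hρ : ContDiff ℝ ∞ ρ)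
    (hq : ρ q = 0) (ζ η) : fderiv ℝ A q (A q ζ) η = fderiv ℝ A q (A q η) ζ := by
  have hF := h.self_of_nhds.1
  have hker := h.self_of_nhds.2 hq
  have hne : fderiv ℝ ρ q ≠ 0 := fun h0 => hF.ne (by
    rw [dzL_apply, dz, h0]
    simp)
  have hpart := fun ζ U => by
    have h1 := ((P.restrictScalars ℝ).hasFDerivAt).comp q (h.hasFDerivAt_apply ζ)
    have h2 := h1.unique ((hasFDerivAt_const (P ζ) q).congr_of_eventuallyEq
      (h.mono fun z hz => hz.1.proj ζ))
    simpa using DFunLike.congr_fun h2 U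
  have hdz : ∀ ζ U, dzL ρ q (fderiv ℝ A q U ζ) = - fderiv ℝ (dzL ρ) q U (A q ζ) := fun ζ U =>
    dzL_fderiv hρ (h.hasFDerivAt_apply ζ) (h.mono fun z hz => hz.1.tang ζ) U
  have hI : ∀ {Y}, dzL ρ q Y = 0 → dzL ρ q (I • Y) = 0 := fun hY => by rw [dzL_smul, hY, mul_zero]
  rw [← sub_eq_zero]
  refine hF.eq_zero hc (by rw [map_sub, hpart, hpart, sub_zero]) ?_ fun V' hV' => ?_
  · rw [map_sub, hdz, hdz, fderiv_dzL_symm hρ (hker ζ _ (hI (hF.tang η)))]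
    ring
  obtain ⟨V, rfl⟩ : ∃ V, I • V = V' := ⟨-(I • V'), by rw [smul_neg, smul_smul]; simp⟩
  have hσ := contDiffAt_tproj hρ hF.ne
  have hσd : HasFDerivAt (fun z => tproj ρ e z V) ((fderiv ℝ (tproj ρ e) q).flip V) q := by
    simpa using (hσ.differentiableAt (by simp)).hasFDerivAt.clm_apply (hasFDerivAt_const V q)
  have hA : ∀ ζ, ContDiffAt ℝ ∞ (fun z => A z ζ) q := fun ζ => hF.smooth.clm_apply contDiffAt_const
  have hnull : ∀ ζ, (fun z => lvp ρ z (A z ζ) (I • tproj ρ e z V)) =ᶠ[𝓝 q] fun _ => 0 := fun ζ =>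
    h.mono fun z hz => by simpa [← tproj_I_smul] using hz.1.null ζ (I • V) hV'
  have hda := fun ζ U => lvp_add_lvp_fderiv hρ (h.hasFDerivAt_apply ζ) hσd (U := U)
    (by rw [(hnull ζ).fderiv_eq]; simp)
  have hT := dzL_tproj hF.ne V
  have hab := lvp_add_lvp_fderiv hρ (h.hasFDerivAt_apply ζ) (h.hasFDerivAt_apply η)
    (fderiv_eq_zero_of_eqOn_level hρ hq hne
      (contDiffAt_lvp hρ (hA ζ) ((hA η).const_smul I))
      (h.mono fun z hz hz0 => hz.2 hz0 ζ _ (by rw [dzL_smul, hz.1.tang, mul_zero]))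
      (by rw [fderiv_eq_re_dzL, hT]; simp))
  have hTd := fun U => dzL_fderiv hρ hσd
    (h.mono fun z hz => dzL_tproj hz.1.ne V) U
  have hbr : ∀ ζ η, lvp ρ q (A q ζ) (I • ((fderiv ℝ (tproj ρ e) q).flip V (A q η)
      - fderiv ℝ A q (tproj ρ e q V) η)) = 0 := fun ζ η => hker ζ _ (hI (by
    rw [map_sub, hTd, hdz, fderiv_dzL_symm hρ (hker η _ (hI hT))]
    ring))
  have h1 := hda ζ (A q η)
  have h2 := hda η (A q ζ)
  have hcl := fderiv_leviForm_cyclic hρ q (A q ζ) (A q η) (tproj ρ e q V)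
  have h3 := hbr ζ η
  have h4 := hbr η ζ
  have h5 : lvp ρ q (fderiv ℝ A q (tproj ρ e q V) ζ) (I • A q η) =
      - lvp ρ q (A q η) (I • fderiv ℝ A q (tproj ρ e q V) ζ) := by
    rw [lvp_comm hρ, lvp_I_smul_left]
  simp [← leviForm_apply, tproj_I_smul, flip_apply, map_sub, sub_apply,
    smul_sub] at h1 h2 h3 h4 h5 hab ⊢
  linarith

end IsLeviFoliation

lemma fderiv_tcoord (hρ : ContDiff ℝ ∞ ρ) {q} (hne : dzL ρ q e ≠ 0) (U V) :
    dzL ρ q e * fderiv ℝ (tcoord ρ e) q U V = fderiv ℝ (dzL ρ) q U (tproj ρ e q V) := by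
  have hd := ((contDiff_dzL hρ).differentiable (by simp) q).hasFDerivAt
  have h1 :=
    (((contDiffAt_tcoord hρ hne).differentiableAt (by simp)).hasFDerivAt.clm_apply
      (hasFDerivAt_const V q)).mul (hd.clm_apply (hasFDerivAt_const e q))
  have h2 := DFunLike.congr_fun (h1.unique ((hd.clm_apply (hasFDerivAt_const V q)).congr_of_eventuallyEq
    ((eventually_dzL_ne_zero hρ hne).mono fun z hz => (dzL_eq_tcoord hz V).symm))) U
  simp at h2
  have h3 := map_smul_of_I (fderiv ℝ (dzL ρ) q U).toLinearMap (fun X => by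
    simp [coe_coe, fderiv_dzL hρ, smul_smul, I_mul_I, neg_one_smul, D2,
      map_neg]
    push_cast
    linear_combination ((fderiv ℝ (fderiv ℝ ρ) q U (I • X) : ℂ) / 2) * I_mul_I) (tcoord ρ e q V) e
  simp [coe_coe] at h3
  rw [tproj_apply, map_sub, h3]
  linear_combination h2

lemma fderiv_tcoord_I_smul (hρ : ContDiff ℝ ∞ ρ) {q U} (hne : dzL ρ q e ≠ 0)
    (hU : ∀ Y, dzL ρ q Y = 0 → lvp ρ q U Y = 0) (V) :
    fderiv ℝ (tcoord ρ e) q (I • U) V = I * fderiv ℝ (tcoord ρ e) q U V := by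
  have hV := dzL_tproj hne V
  refine mul_left_cancel₀ hne ?_
  rw [fderiv_tcoord hρ hne, fderiv_dzL_I_smul hρ (hU _ hV) (hU _ (by rw [dzL_smul, hV, mul_zero])),
    ← fderiv_tcoord hρ hne]
  ring

end Commutation

section Leaf

variable {E : Type*} [NormedAddCommGroup E] [NormedSpace ℝ E] [CompleteSpace E]

lemma exists_integralCurve {v : E → E} {q} {a L K} (hL : 0 ≤ L) (hK : 0 ≤ K) (hLa : L ≤ a)
    (hv : ∀ x ∈ closedBall q a, ‖v x‖ ≤ L)
    (hlip : ∀ x ∈ closedBall q a, ∀ y ∈ closedBall q a, ‖v x - v y‖ ≤ K * ‖x - y‖) :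
    ∃ g : ℝ → E, g 0 = q ∧ ∀ t ∈ Icc 0 1, g t ∈ closedBall q a ∧
      HasDerivWithinAt g (v (g t)) (Icc 0 1) t := by
  lift L to NNReal using hL
  lift K to NNReal using hK
  lift a to NNReal using L.2.trans hLa
  have hmax : (L : ℝ) * max (1 - 0) (0 - 0) ≤ a - 0 := by simpa using hLa
  have h0 : (0 : ℝ) ∈ Icc 0 1 := ⟨le_rfl, zero_le_one⟩
  have hf : IsPicardLindelof (fun _ => v) ⟨0, h0⟩ q a 0 L K :=
    .of_time_independent hv (LipschitzOnWith.of_dist_le_mul fun x hx y hy => by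
      simpa [dist_eq_norm] using hlip x hx y hy) hmax
  obtain ⟨α, hα⟩ := ODE.FunSpace.exists_isFixedPt_next hf (mem_closedBall_self le_rfl)
  have hfix : ∀ t ∈ Icc 0 1, α.compProj t = ODE.picard (fun _ => v) 0 q α.compProj t := fun t ht => by
    conv_lhs => rw [← hα]
    rw [ODE.FunSpace.compProj_of_mem ht, ODE.FunSpace.next_apply]
  have hmem : ∀ t, α.compProj t ∈ closedBall q a := fun t => α.compProj_mem_closedBall hmax
  refine ⟨α.compProj, by rw [hfix 0 h0]; simp, fun t ht => ⟨hmem t, ?_⟩⟩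
  exact (ODE.hasDerivWithinAt_picard_Icc h0 hf.continuousOn_uncurry α.continuous_compProj.continuousOn
    (fun t _ => hmem t) q ht).congr hfix (hfix t ht)

/-- The Frobenius theorem for a commuting frame, with uniform size of the leaves. -/
theorem TaylorOn.exists_leaf {A : E → E →L[ℝ] E} {z₁} {ρ : E → ℝ} (hM : 0 < M) (hr : 0 < r)
    (hA : TaylorOn A (ball z₁ r) M) (hρ : ∀ z ∈ ball z₁ r, DifferentiableAt ℝ ρ z)
    (hρA : ∀ z ∈ ball z₁ r, ∀ ζ, fderiv ℝ ρ z (A z ζ) = 0)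
    (hcomm : ∀ z ∈ ball z₁ r, ρ z = 0 → ∀ ζ η, fderiv ℝ A z (A z ζ) η = fderiv ℝ A z (A z η) ζ) :
    ∃ a > 0, ∀ q ∈ ball z₁ (r / 2), ρ q = 0 → ∃ h, h 0 = q ∧ ∀ ζ ∈ ball 0 a,
      h ζ ∈ ball z₁ r ∧ ρ (h ζ) = 0 ∧ HasFDerivAt h (A (h ζ)) ζ ∧ ‖h ζ - q‖ ≤ M * ‖ζ‖ := by
  refine ⟨r / (4 * M), by positivity, fun q hq hρq => ?_⟩
  have hsub : ∀ {x}, ‖x - q‖ < r / 2 → x ∈ ball z₁ r := fun {x} hx => by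
    rw [mem_ball_iff_norm] at hq ⊢
    calc _ ≤ ‖x - q‖ + ‖q - z₁‖ := norm_sub_le_norm_sub_add_norm_sub ..
      _ < r := by linarith
  have hcb : ∀ {x}, x ∈ closedBall q (r / 4) → x ∈ ball z₁ r := fun {x} hx =>
    hsub (by rw [mem_closedBall_iff_norm] at hx; linarith)
  have hA1 := fun x hx ζ =>
    (A x).le_of_opNorm_le (hA.norm_le x hx) ζ
  have hA2 : ∀ x ∈ ball z₁ r, ∀ y ∈ ball z₁ r, ∀ ζ, ‖A x ζ - A y ζ‖ ≤ M * ‖ζ‖ * ‖x - y‖ :=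
    fun x hx y hy ζ => by
      calc _ ≤ M * ‖x - y‖ * ‖ζ‖ := (A x - A y).le_of_opNorm_le (hA.lip y hy x hx) ζ
        _ = _ := by ring
  have hsmall : ∀ ζ ∈ ball (0 : E) (r / (4 * M)), M * ‖ζ‖ < r / 4 := fun ζ hζ => by
    rw [mem_ball_zero_iff, lt_div_iff₀ (by positivity)] at hζ
    linarith
  have hex : ∀ ζ, ∃ g : ℝ → E, ζ ∈ ball 0 (r / (4 * M)) → g 0 = q ∧ ∀ t ∈ Icc 0 1,
      g t ∈ closedBall q (r / 4) ∧ HasDerivWithinAt g (A (g t) ζ) (Icc 0 1) t := fun ζ => by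
    by_cases hζ : ζ ∈ ball 0 (r / (4 * M))
    · obtain ⟨g, hg⟩ := exists_integralCurve (by positivity)
        (by positivity) (hsmall ζ hζ).le (fun x hx => hA1 x (hcb hx) ζ)
        fun x hx y hy => hA2 x (hcb hx) y (hcb hy) ζ
      exact ⟨g, fun _ => hg⟩
    · exact ⟨0, fun h => (hζ h).elim⟩
  choose g hg using hex
  have h1m : (1 : ℝ) ∈ Icc 0 1 := ⟨zero_le_one, le_rfl⟩
  have hIci : ∀ {f : ℝ → E} {f'} {t}, t ∈ Ico 0 1 → HasDerivWithinAt f f' (Icc 0 1) t →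
      HasDerivWithinAt f f' (Ici t) t := fun ht h => h.mono_of_mem_nhdsWithin (Icc_mem_nhdsGE_of_mem ht)
  have hbd := fun ζ hζ => by
    have := norm_image_sub_le_of_norm_deriv_le_segment' (fun t ht => ((hg ζ hζ).2 t ht).2)
      (fun t ht => hA1 _ (hcb ((hg ζ hζ).2 t (Ico_subset_Icc_self ht)).1) ζ) 1 h1m
    simpa [(hg ζ hζ).1] using this
  have hlev : ∀ ζ ∈ ball 0 (r / (4 * M)), ∀ t ∈ Icc 0 1, ρ (g ζ t) = 0 := fun ζ hζ t ht => by
    have hd : ∀ t ∈ Icc 0 1, HasDerivWithinAt (fun t => ρ (g ζ t)) 0 (Icc 0 1) t := fun t ht => by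
      have hb := hcb ((hg ζ hζ).2 t ht).1
      have := (hρ _ hb).hasFDerivAt.comp_hasDerivWithinAt t ((hg ζ hζ).2 t ht).2
      rwa [hρA _ hb] at this
    have := constant_of_has_deriv_right_zero (fun t ht => (hd t ht).continuousWithinAt)
      (fun t ht => (hd t (Ico_subset_Icc_self ht)).mono_of_mem_nhdsWithin (Icc_mem_nhdsGE_of_mem ht)) t ht
    rw [this, (hg ζ hζ).1, hρq]
  refine ⟨fun ζ => g ζ 1, ?_, fun ζ hζ => ⟨hcb ((hg ζ hζ).2 1 h1m).1, hlev ζ hζ 1 h1m, ?_, hbd ζ hζ⟩⟩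
  · simpa [sub_eq_zero] using hbd 0 (mem_ball_self (by positivity))
  obtain ⟨C, hC⟩ : ∃ C, C = (M ^ 2 + M ^ 3 * (r / (4 * M))) / (M * (r / (4 * M)))
    * (rexp (M * (r / (4 * M)) * 1) - 1) := ⟨_, rfl⟩
  refine (Asymptotics.IsBigO.of_bound C ?_ : (fun ξ => g ξ 1 - g ζ 1 - A (g ζ 1) (ξ - ζ)) =O[𝓝 ζ]
    fun ξ => ‖ξ - ζ‖ ^ 2).trans_isLittleO (Asymptotics.isLittleO_pow_sub_sub ζ (by norm_num)) |> .of_isLittleO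
  filter_upwards [isOpen_ball.mem_nhds hζ,
    ball_mem_nhds ζ (show 0 < r / (4 * M) by positivity)] with ξ hξ hξζ
  obtain ⟨η, rfl⟩ : ∃ η, ξ = ζ + η := ⟨ξ - ζ, by simp⟩
  simp only [add_sub_cancel_left] at hξζ ⊢
  have hη := hsmall η (by simpa using hξζ)
  have hgm := fun t ht => hcb ((hg ζ hζ).2 t ht).1
  have hkd := fun t ht => by
    have h1 := ((hg ζ hζ).2 t ht).2
    have h2 := ((hA.diff _ (hgm t ht)).hasFDerivAt.comp_hasDerivWithinAt t h1).clm_apply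
      (hasDerivWithinAt_const t _ η)
    have h3 := h1.fun_add ((hasDerivWithinAt_id t _).fun_smul h2)
    simpa using h3
  have hkm : ∀ t ∈ Icc 0 1, g ζ t + t • A (g ζ t) η ∈ ball z₁ r ∧ ‖t • A (g ζ t) η‖ ≤ M * ‖η‖ :=
    fun t ht => by
      have h1 : ‖t • A (g ζ t) η‖ ≤ M * ‖η‖ := by
        rw [norm_smul, Real.norm_of_nonneg ht.1]
        exact (mul_le_of_le_one_left (norm_nonneg _) ht.2).trans (hA1 _ (hgm t ht) η)
      refine ⟨hsub ?_, h1⟩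
      have h2 := mem_closedBall_iff_norm.1 ((hg ζ hζ).2 t ht).1
      calc _ = ‖(g ζ t - q) + t • A (g ζ t) η‖ := by abel
        _ ≤ ‖g ζ t - q‖ + ‖t • A (g ζ t) η‖ := norm_add_le _ _
        _ < r / 2 := by linarith
  have hK : 0 < M * (r / (4 * M)) := by positivity
  obtain ⟨K, hKe⟩ : ∃ K : NNReal, K = M * (r / (4 * M)) := ⟨⟨_, hK.le⟩, rfl⟩
  have hgr := dist_le_of_approx_trajectories_ODE_of_mem (v := fun _ x => A x (ζ + η))
    (K := K) (δ := 0)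
   
   
    (εf := (M ^ 2 + M ^ 3 * (r / (4 * M))) * ‖η‖ ^ 2)
    ?_ (fun t ht => (hkd t ht).continuousWithinAt) (fun t ht => hIci ht (hkd t (Ico_subset_Icc_self ht)))
    ?_ (fun t ht => (hkm t (Ico_subset_Icc_self ht)).1)
    (fun t ht => ((hg _ hξ).2 t ht).2.continuousWithinAt)
    (fun t ht => hIci ht ((hg _ hξ).2 t (Ico_subset_Icc_self ht)).2) (fun t _ => (dist_self _).le)
    (fun t ht => hcb ((hg _ hξ).2 t (Ico_subset_Icc_self ht)).1) (by simp [(hg _ hξ).1, (hg ζ hζ).1]) 1 h1m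
  · rw [hKe, gronwallBound_of_K_ne_0 hK.ne', dist_comm, dist_eq_norm] at hgr
    simp [one_smul, ← sub_sub] at hgr
    rw [norm_pow, norm_norm]
    refine hgr.trans (le_of_eq ?_)
    rw [hC]
    ring
  · refine fun t _ => LipschitzOnWith.of_dist_le_mul fun x hx y hy => ?_
    rw [dist_eq_norm, dist_eq_norm]
    refine (hA2 x hx y hy _).trans ?_
    have := (mem_ball_zero_iff.1 hξ).le
    rw [hKe]
    gcongr
  · intro t ht
    have ht' := Ico_subset_Icc_self ht
    obtain ⟨hk1⟩ := hkm t ht'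
    have hy := hgm t ht'
    have h1 := hA.taylor _ hy _ hk1
    rw [add_sub_cancel_left] at h1
    have h2 : ‖(A (g ζ t + t • A (g ζ t) η) - A (g ζ t) - fderiv ℝ A (g ζ t) (t • A (g ζ t) η)) (ζ + η)‖
        ≤ M ^ 3 * (r / (4 * M)) * ‖η‖ ^ 2 := by
      calc _ ≤ M * ‖t • A (g ζ t) η‖ ^ 2 * ‖ζ + η‖ := le_of_opNorm_le _ h1 _
        _ ≤ M * (M * ‖η‖) ^ 2 * (r / (4 * M)) := by
          have := (mem_ball_zero_iff.1 hξ).le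
          gcongr
        _ = _ := by ring
    have h3 : ‖t • fderiv ℝ A (g ζ t) (A (g ζ t) η) η‖ ≤ M ^ 2 * ‖η‖ ^ 2 := by
      rw [norm_smul, Real.norm_of_nonneg ht.1]
      calc _ ≤ ‖fderiv ℝ A (g ζ t) (A (g ζ t) η) η‖ := mul_le_of_le_one_left (norm_nonneg _) ht'.2
        _ ≤ ‖fderiv ℝ A (g ζ t)‖ * ‖A (g ζ t) η‖ * ‖η‖ := le_opNorm₂ ..
        _ ≤ M * (M * ‖η‖) * ‖η‖ := by
          gcongr
          exacts [hA.norm_fderiv_le _ hy, hA1 _ hy _]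
        _ = _ := by ring
    have h4 := hcomm _ hy (hlev ζ hζ t ht') ζ η
    rw [dist_eq_norm]
    calc _ = ‖-((A (g ζ t + t • A (g ζ t) η) - A (g ζ t) - fderiv ℝ A (g ζ t) (t • A (g ζ t) η)) (ζ + η))
          - t • fderiv ℝ A (g ζ t) (A (g ζ t) η) η‖ := by
          congr 1
          rw [h4]
          simp [sub_apply, map_add, map_smul, smul_apply]
          module
      _ ≤ _ := norm_sub_le _ _
      _ ≤ (M ^ 2 + M ^ 3 * (r / (4 * M))) * ‖η‖ ^ 2 := by
          rw [norm_neg]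
          linarith

end Leaf

section LeafChart

lemma LinearMap.det_one_add_of_isNilpotent {K M} [Field K] [AddCommGroup M] [Module K M]
    [FiniteDimensional K M] {ν : Module.End K M} (h : IsNilpotent ν) : LinearMap.det (1 + ν) = 1 := by
  have h1 := LinearMap.eval_charpoly (-ν) 1
  rw [h.neg.charpoly_eq_X_pow_finrank] at h1
  simpa using h1.symm

variable {a s : ℝ} {h : ℂ^n → ℂ^n}

/-- `h` parametrizes a piece of a leaf of the Levi foliation of the level set `ρ = 0`. -/
structure IsLeviLeaf (P)
    (A) (c) (ρ)
    (e) (h : ℂ^n → ℂ^n) (w) where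
  frame : IsLeviFrame P A c ρ e (h w)
  hasFDerivAt : HasFDerivAt h (A (h w)) w
  level : ρ (h w) = 0
  null : ∀ X Y, dzL ρ (h w) Y = 0 → lvp ρ (h w) (A (h w) X) Y = 0

/-- The complementary projection of `P`, over the reals. -/
noncomputable def coproj (P : ℂ^n →L[ℂ] ℂ^n) :=
  .id ℝ _ - P.restrictScalars ℝ

lemma coproj_apply (X) : coproj P X = X - P X := rfl

/-- A leaf of the Levi foliation, thickened in the transversal directions and pushed inside. -/
noncomputable def leafChart (P) (ρ)
    (e z₁) (h : ℂ^n → ℂ^n) (s : ℝ) (w) :=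
  h w + s • coproj P w +
    lineC e (s ^ 2 • (tcoord ρ e z₁ w - 1) - s • tcoord ρ e (h w) (coproj P w))

/-- The derivative of `leafChart`. -/
noncomputable def leafChartDeriv (P) (A : ℂ^n → ℂ^n →L[ℝ] ℂ^n) (ρ)
    (e z₁ z) (s : ℝ) (w) :=
  A z + s • coproj P + (lineC e).comp (s ^ 2 • tcoord ρ e z₁ - s • ((tcoord ρ e z).comp (coproj P) +
    ((fderiv ℝ (tcoord ρ e) z).comp (A z)).flip (coproj P w)))

lemma leafChart_eq (w) : leafChart P ρ e z₁ h s w =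
    h w + s • tproj ρ e (h w) (coproj P w) + (s ^ 2 * (tcoord ρ e z₁ w - 1)) • e := by
  rw [leafChart, tproj_apply, lineC_apply]
  simp [← coe_smul]
  module

lemma leafChartDeriv_apply (z w Y) : leafChartDeriv P A ρ e z₁ z s w Y =
    A z Y + s • tproj ρ e z (coproj P Y) +
      (s ^ 2 * tcoord ρ e z₁ Y - s * fderiv ℝ (tcoord ρ e) z (A z Y) (coproj P w)) • e := by
  simp [leafChartDeriv, tproj_apply, add_apply, smul_apply, comp_apply,
    sub_apply, lineC_apply, flip_apply, ← coe_smul]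
  module

namespace IsLeviLeaf

lemma hasFDerivAt_leafChart (H : IsLeviLeaf P A c ρ e h w) (hρ : ContDiff ℝ ∞ ρ) :
    HasFDerivAt (leafChart P ρ e z₁ h s) (leafChartDeriv P A ρ e z₁ (h w) s w) w := by
  have h1 := (((contDiffAt_tcoord hρ H.frame.ne).differentiableAt (by simp)).hasFDerivAt.comp w
    H.hasFDerivAt).clm_apply (coproj P).hasFDerivAt
  have h2 := (((tcoord ρ e z₁).hasFDerivAt (x := w)).sub_const 1).const_smul (s ^ 2)
  exact (H.hasFDerivAt.add ((coproj P).hasFDerivAt.const_smul s)).add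
    ((lineC e).hasFDerivAt.comp w (h2.sub (h1.const_smul s)))

lemma leafChartDeriv_I_smul (H : IsLeviLeaf P A c ρ e h w) (hρ : ContDiff ℝ ∞ ρ) (hc : 0 < c)
    (Y) : leafChartDeriv P A ρ e z₁ (h w) s w (I • Y) =
      I • leafChartDeriv P A ρ e z₁ (h w) s w Y := by
  have h1 : coproj P (I • Y) = I • coproj P Y := by simp [coproj_apply, smul_sub]
  rw [leafChartDeriv_apply, leafChartDeriv_apply, H.frame.apply_I_smul hc, h1, tproj_I_smul,
    tcoord_I_smul, fderiv_tcoord_I_smul hρ H.frame.ne (H.null Y)]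
  module

lemma differentiableAt_leafChart (H : IsLeviLeaf P A c ρ e h w) (hρ : ContDiff ℝ ∞ ρ) (hc : 0 < c) :
    DifferentiableAt ℂ (leafChart P ρ e z₁ h s) w := by
  have h1 := H.hasFDerivAt_leafChart (z₁ := z₁) (s := s) hρ
  refine differentiableAt_complex_of_fderiv_I_smul h1.differentiableAt fun X => ?_
  rw [h1.fderiv, H.leafChartDeriv_I_smul hρ hc]

end IsLeviLeaf

/-- The constant linear map to which the derivative of `leafChart` is unipotently equivalent. -/
noncomputable def leafChartModel (P : ℂ^n →L[ℂ] ℂ^n) (ρ)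
    (e z₁) (s : ℝ) :=
  P.restrictScalars ℝ + s • (tproj ρ e z₁).comp (coproj P) + (lineC e).comp (s ^ 2 • tcoord ρ e z₁)

lemma leafChartModel_apply (Y) : leafChartModel P ρ e z₁ s Y =
    P Y + s • tproj ρ e z₁ (coproj P Y) + (s ^ 2 * tcoord ρ e z₁ Y) • e := by
  simp [leafChartModel, lineC_apply, ← coe_smul, mul_smul]

section Model

variable (hPP : ∀ X, P (P X) = P X) (hPe : P e = 0) (hPz : ∀ X, dzL ρ z₁ (P X) = 0) (hne : dzL ρ z₁ e ≠ 0)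

include hPP hPe in
lemma proj_tproj_coproj (z Y) : P (tproj ρ e z (coproj P Y)) = 0 := by
  rw [tproj_apply, map_sub, map_smul, hPe, smul_zero, coproj_apply, map_sub, hPP, sub_self, sub_zero]

lemma tcoord_tproj (hne : dzL ρ z e ≠ 0) (Y) : tcoord ρ e z (tproj ρ e z Y) = 0 := by
  rw [tcoord_apply, dzL_tproj hne, mul_zero]

include hPz in
lemma tcoord_proj (Y) : tcoord ρ e z₁ (P Y) = 0 := by
  rw [tcoord_apply, hPz, mul_zero]

include hPP hPe in
lemma proj_leafChartModel (Y) : P (leafChartModel P ρ e z₁ s Y) = P Y := by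
  rw [leafChartModel_apply, map_add, map_add, hPP, ← coe_smul, map_smul, map_smul, hPe, smul_zero,
    add_zero, proj_tproj_coproj hPP hPe, smul_zero, add_zero]

include hPz hne in
lemma tcoord_leafChartModel (Y) :
    tcoord ρ e z₁ (leafChartModel P ρ e z₁ s Y) = s ^ 2 * tcoord ρ e z₁ Y := by
  rw [leafChartModel_apply, map_add, map_add, tcoord_proj hPz, map_smul, tcoord_tproj hne, smul_zero,
    tcoord_smul, tcoord_self hne, mul_one, add_zero, zero_add]

include hPP hPe hPz hne in
lemma leafChartModel_det_ne_zero (hs : s ≠ 0) : (leafChartModel P ρ e z₁ s).det ≠ 0 := by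
  refine fun h0 => ?_
  obtain ⟨Y, hY, hY0⟩ := (Submodule.ne_bot_iff _).1 (LinearMap.bot_lt_ker_of_det_eq_zero h0).ne'
  have hY : leafChartModel P ρ e z₁ s Y = 0 := hY
  have h1 : P Y = 0 := by rw [← proj_leafChartModel hPP hPe, hY, map_zero]
  have hs' := by exact_mod_cast hs
  have h2 := by
    have := tcoord_leafChartModel (s := s) hPz hne Y
    rw [hY] at this
    simpa [hs'] using this.symm
  have h3 : coproj P Y = Y := by rw [coproj_apply, h1, sub_zero]
  rw [leafChartModel_apply, h1, h3, tproj_apply, h2] at hY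
  exact hY0 (by simpa [hs] using hY)

include hPP hPe hPz hne in
lemma det_leafChartDeriv (H : IsLeviFrame P A c ρ e z) (hc : 0 < c) :
    (leafChartDeriv P A ρ e z₁ z s w).det = (leafChartModel P ρ e z₁ s).det := by
  obtain ⟨ν, hν⟩ : ∃ ν, ∀ V, ν V = A z V - P V +
      (tcoord ρ e z₁ V - tcoord ρ e z (V - P V)
        - s * fderiv ℝ (tcoord ρ e) z (A z V) (coproj P w)) • e :=
    ⟨(A z - P.restrictScalars ℝ + (lineC e).comp (tcoord ρ e z₁ - (tcoord ρ e z).comp (coproj P)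
      - s • ((fderiv ℝ (tcoord ρ e) z).comp (A z)).flip (coproj P w))).toLinearMap,
      fun V => by
        rfl⟩
  have hA0 : ∀ {V}, P V = 0 → A z V = 0 := fun {V} hV => by
    rw [← H.apply_proj hc hPP, hV, map_zero]
  have h1 : ∀ V, P (ν V) = 0 := fun V => by rw [hν]; simp [H.proj, hPP, hPe]
  have h2 : ∀ V, P V = 0 → ν V = (tcoord ρ e z₁ V - tcoord ρ e z V) • e := fun V hV => by
    rw [hν, hV, hA0 hV]; simp
  have h3 : ∀ b, ν (b • e) = 0 := fun b => by
    rw [h2 _ (by rw [map_smul, hPe, smul_zero]), tcoord_smul, tcoord_smul, tcoord_self hne,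
      tcoord_self H.ne, sub_self, zero_smul]
  have hnil : IsNilpotent (show Module.End ℝ ℂ^n from ν) := ⟨3, LinearMap.ext fun V => by
    change ν (ν (ν V)) = 0
    rw [h2 _ (h1 V), h3]⟩
  have hcomp : (leafChartDeriv P A ρ e z₁ z s w).toLinearMap =
      (1 + ν) ∘ₗ (leafChartModel P ρ e z₁ s).toLinearMap := by
    refine LinearMap.ext fun Y => ?_
    have hV1 := proj_leafChartModel (ρ := ρ) (z₁ := z₁) (s := s) hPP hPe Y
    have hV2 := tcoord_leafChartModel (s := s) hPz hne Y
    have hV3 := leafChartModel_apply (P := P) (ρ := ρ) (e := e) (z₁ := z₁) (s := s) Y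
    change leafChartDeriv P A ρ e z₁ z s w Y = leafChartModel P ρ e z₁ s Y
      + ν (leafChartModel P ρ e z₁ s Y)
    generalize leafChartModel P ρ e z₁ s Y = V at *
    have hAV : A z V = A z Y := by rw [← H.apply_proj hc hPP V, hV1, H.apply_proj hc hPP]
    have hσ : V - P V = s • coproj P Y + (s ^ 2 * tcoord ρ e z₁ Y
        - s * tcoord ρ e z₁ (coproj P Y)) • e := by
      rw [hV1, hV3, tproj_apply]
      module
    rw [hν, hV2, hAV, hσ, map_add, map_smul, tcoord_smul, tcoord_self H.ne, leafChartDeriv_apply,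
      tproj_apply, hV1, hV3, tproj_apply]
    simp [← coe_smul]
    module
  calc _ = LinearMap.det ((1 + ν) ∘ₗ (leafChartModel P ρ e z₁ s).toLinearMap) := by
        rw [← hcomp]
    _ = _ := by
      rw [LinearMap.det_comp, LinearMap.det_one_add_of_isNilpotent hnil, one_mul]

end Model

end LeafChart

section LeafEstimate

variable {a s : ℝ} {h : ℂ^n → ℂ^n}

lemma injOn_leafChart (hPP : ∀ X, P (P X) = P X) (hPe : P e = 0)
    (hne : dzL ρ z₁ e ≠ 0) (hc : 0 < c) (hs : s ≠ 0)
    (H : ∀ w ∈ ball 0 a, IsLeviLeaf P A c ρ e h w) :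
    InjOn (leafChart P ρ e z₁ h s) (ball 0 a) := by
  intro w hw w' hw' hww
  have hs' : (s : ℂ) ≠ 0 := by exact_mod_cast hs
  have hd : ∀ w ∈ ball 0 a,
      HasFDerivAt (fun w => P (h w) - P w) 0 w := fun w hw => by
    refine (((P.restrictScalars ℝ).hasFDerivAt.comp w (H w hw).hasFDerivAt).sub
      (P.restrictScalars ℝ).hasFDerivAt).congr_fderiv (ContinuousLinearMap.ext fun X => ?_)
    simp [(H w hw).frame.proj]
  have h1 := isOpen_ball.is_const_of_fderiv_eq_zero (convex_ball _ _).isPreconnected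
    (fun w hw => (hd w hw).differentiableAt.differentiableWithinAt) (fun w hw => (hd w hw).fderiv) hw hw'
  have hPΨ : ∀ w, P (leafChart P ρ e z₁ h s w) = P (h w) := fun w => by
    rw [leafChart_eq, map_add, map_add, ← coe_smul, map_smul, map_smul, hPe,
      proj_tproj_coproj hPP hPe, smul_zero, smul_zero, add_zero, add_zero]
  have hPw := by
    have h2 := hPΨ w
    rw [hww, hPΨ] at h2
    rw [h2] at h1
    exact sub_right_inj.1 h1
  have hh := by
    have hmem : ∀ t ∈ Icc (0 : ℝ) 1, w + t • (w' - w) ∈ ball 0 a := fun t ht =>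
      (convex_ball _ _).add_smul_sub_mem hw hw' ht
    have hd := fun t ht => by
      have h3 := H _ (hmem t ht)
      have h4 : HasDerivAt (fun t => w + t • (w' - w)) (w' - w) t := by
        simpa using ((hasDerivAt_id t).smul_const (w' - w)).const_add w
      have h5 := h3.hasFDerivAt.comp_hasDerivAt t h4
      rwa [← h3.frame.apply_proj hc hPP, map_sub, hPw, sub_self, map_zero] at h5
    have := constant_of_has_deriv_right_zero (fun t ht => (hd t ht).continuousAt.continuousWithinAt)
      (fun t ht => (hd t (Ico_subset_Icc_self ht)).hasDerivWithinAt) 1 ⟨zero_le_one, le_rfl⟩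
    simpa using this.symm
  obtain ⟨u, rfl⟩ : ∃ u, w' = w + u := ⟨w' - w, by simp⟩
  have hPu := by simpa using hPw
  have hne' := (H w hw).frame.ne
  have hQ : coproj P (w + u) = coproj P w + u := by rw [coproj_apply, coproj_apply, map_add, hPu]; abel
  rw [leafChart_eq, leafChart_eq, ← hh, hQ] at hww
  have h3 : s • tproj ρ e (h w) u + (s ^ 2 * tcoord ρ e z₁ u) • e = 0 := by
    rw [map_add, map_add] at hww
    rw [← sub_eq_zero.2 hww.symm]
    module
  have h4 := congrArg (tcoord ρ e (h w)) h3
  rw [map_add, map_smul, tcoord_tproj hne', tcoord_smul, tcoord_self hne', map_zero, smul_zero,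
    zero_add, mul_one, mul_eq_zero, or_iff_right (pow_ne_zero 2 hs')] at h4
  rw [h4, mul_zero, zero_smul, add_zero, smul_eq_zero, or_iff_right hs, tproj_apply, sub_eq_zero] at h3
  rw [h3, tcoord_smul, tcoord_self hne, mul_one] at h4
  rw [h4, zero_smul] at h3
  rw [h3, add_zero]

/-- Uniform control of the Levi frame on a ball. -/
structure IsLeviBall (P)
    (A : ℂ^n → ℂ^n →L[ℝ] ℂ^n) (c) (ρ)
    (e z₁) (r M κ : ℝ) where
  one_le : 1 ≤ M
  pos : 0 < κ
  taylor_frame : TaylorOn A (ball z₁ r) M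
  taylor_tcoord : TaylorOn (tcoord ρ e) (ball z₁ r) M
  taylor_dzL : TaylorOn (dzL ρ) (ball z₁ r) M
  taylor_rho : TaylorOn ρ (ball z₁ r) M
  frame : ∀ z ∈ ball z₁ r, IsLeviFrame P A c ρ e z
  le_fderiv : ∀ z ∈ ball z₁ r, κ ≤ fderiv ℝ ρ z e
  norm_proj_le : ∀ X, ‖P X‖ ≤ M * ‖X‖
  norm_le : ‖e‖ ≤ M

namespace IsLeviBall

variable {κ : ℝ}

lemma norm_frame_le (B : IsLeviBall P A c ρ e z₁ r M κ) (hz : z ∈ ball z₁ r)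
    (X) : ‖A z X‖ ≤ M * ‖X‖ :=
  (A z).le_of_opNorm_le (B.taylor_frame.norm_le z hz) X

lemma norm_tcoord_le (B : IsLeviBall P A c ρ e z₁ r M κ) (hz : z ∈ ball z₁ r)
    (X) : ‖tcoord ρ e z X‖ ≤ M * ‖X‖ :=
  (tcoord ρ e z).le_of_opNorm_le (B.taylor_tcoord.norm_le z hz) X

lemma norm_dzL_le (B : IsLeviBall P A c ρ e z₁ r M κ) (hz : z ∈ ball z₁ r)
    (X) : ‖dzL ρ z X‖ ≤ M * ‖X‖ :=
  (dzL ρ z).le_of_opNorm_le (B.taylor_dzL.norm_le z hz) X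

lemma norm_tproj_le (B : IsLeviBall P A c ρ e z₁ r M κ) (hz : z ∈ ball z₁ r)
    (X) : ‖tproj ρ e z X‖ ≤ 2 * M ^ 2 * ‖X‖ := by
  have hM := B.one_le
  calc ‖X - tcoord ρ e z X • e‖ ≤ ‖X‖ + ‖tcoord ρ e z X • e‖ := norm_sub_le _ _
    _ ≤ M ^ 2 * ‖X‖ + M * ‖X‖ * M := by
      rw [norm_smul]
      have h1 := B.norm_tcoord_le hz X
      have h2 := B.norm_le
      have : ‖X‖ ≤ M ^ 2 * ‖X‖ := le_mul_of_one_le_left (norm_nonneg _) (one_le_pow₀ hM)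
      gcongr
    _ = _ := by ring

lemma norm_coproj_le (B : IsLeviBall P A c ρ e z₁ r M κ) (X) :
    ‖coproj P X‖ ≤ 2 * M * ‖X‖ := by
  have h1 : ‖X‖ ≤ M * ‖X‖ := le_mul_of_one_le_left (norm_nonneg _) B.one_le
  calc ‖X - P X‖ ≤ ‖X‖ + ‖P X‖ := norm_sub_le _ _
    _ ≤ _ := by linarith [B.norm_proj_le X]

lemma le_norm_dzL (B : IsLeviBall P A c ρ e z₁ r M κ) (hz : z ∈ ball z₁ r) :
    κ / 2 ≤ ‖dzL ρ z e‖ := by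
  have h1 := B.le_fderiv z hz
  rw [fderiv_eq_re_dzL] at h1
  linarith [re_le_norm (dzL ρ z e)]

lemma norm_tcoord_center_le (B : IsLeviBall P A c ρ e z₁ r M κ) (hr : 0 < r) (hw : ‖w‖ ≤ a) :
    ‖tcoord ρ e z₁ w‖ ≤ M * a :=
  (B.norm_tcoord_le (mem_ball_self hr) w).trans
    (mul_le_mul_of_nonneg_left hw (zero_le_one.trans B.one_le))

lemma norm_leafChart_sub_le (B : IsLeviBall P A c ρ e z₁ r M κ) (hr : 0 < r) (hs : 0 < s)
    (hw : ‖w‖ ≤ a) (ha : a ≤ 1) (hz : h w ∈ ball z₁ r) :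
    ‖leafChart P ρ e z₁ h s w - h w‖ ≤ 4 * M ^ 3 * (s * (a + s)) := by
  have hM := B.one_le
  have ha0 := (norm_nonneg w).trans hw
  have h1 : ‖s • tproj ρ e (h w) (coproj P w)‖ ≤ s * (2 * M ^ 2 * (2 * M * a)) := by
    rw [norm_smul, Real.norm_of_nonneg hs.le]
    gcongr
    refine (B.norm_tproj_le hz _).trans ?_
    gcongr
    exact (B.norm_coproj_le w).trans (by gcongr)
  have h2 : ‖(s ^ 2 * (tcoord ρ e z₁ w - 1)) • e‖ ≤ s ^ 2 * (M * a + 1) * M := by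
    rw [norm_smul, norm_mul, norm_pow, norm_real, Real.norm_of_nonneg hs.le]
    gcongr
    · refine (norm_sub_le _ _).trans ?_
      rw [norm_one]
      gcongr
      exact B.norm_tcoord_center_le hr hw
    · exact B.norm_le
  have h3 : (M * a + 1) * M ≤ 4 * M ^ 3 := by
    nlinarith
  rw [leafChart_eq, add_assoc, add_sub_cancel_left]
  refine (norm_add_le _ _).trans ((add_le_add h1 h2).trans ?_)
  have := mul_le_mul_of_nonneg_left h3 (sq_nonneg s)
  linarith

lemma abs_rho_leafChart_add_le (B : IsLeviBall P A c ρ e z₁ r M κ) (hr : 0 < r) (hs : 0 < s)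
    (hw : ‖w‖ ≤ a) (ha : a ≤ 1) (hs1 : s ≤ 1) (H : IsLeviLeaf P A c ρ e h w)
    (hz : h w ∈ ball z₁ r) (hx : leafChart P ρ e z₁ h s w ∈ ball z₁ r) :
    |ρ (leafChart P ρ e z₁ h s w) + s ^ 2 * fderiv ℝ ρ (h w) e| ≤ 34 * M ^ 7 * (a + s) * s ^ 2 := by
  have hM := B.one_le
  have ha0 := (norm_nonneg w).trans hw
  have h1 := B.taylor_rho.taylor _ hz _ hx
  rw [H.level] at h1
  have h2 : fderiv ℝ ρ (h w) (leafChart P ρ e z₁ h s w - h w) = -(s ^ 2 * fderiv ℝ ρ (h w) e)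
      + s ^ 2 * (2 * (tcoord ρ e z₁ w * dzL ρ (h w) e).re) := by
    rw [leafChart_eq, add_assoc, add_sub_cancel_left, fderiv_eq_re_dzL, fderiv_eq_re_dzL, map_add,
      map_smul, dzL_tproj H.frame.ne, smul_zero, zero_add, dzL_smul, mul_assoc, ← ofReal_pow,
      re_ofReal_mul, sub_mul, sub_re]
    ring
  have h3 : |s ^ 2 * (2 * (tcoord ρ e z₁ w * dzL ρ (h w) e).re)| ≤ s ^ 2 * (2 * (M * a * (M * M))) := by
    rw [abs_mul, abs_of_nonneg (sq_nonneg s), abs_mul, abs_two]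
    gcongr
    refine (abs_re_le_norm _).trans ?_
    rw [norm_mul]
    gcongr
    · exact B.norm_tcoord_center_le hr hw
    · exact (B.norm_dzL_le hz e).trans (by gcongr; exact B.norm_le)
  have h4 := B.norm_leafChart_sub_le hr hs hw ha hz
  have h5 : M * ‖leafChart P ρ e z₁ h s w - h w‖ ^ 2 ≤ 32 * M ^ 7 * (a + s) * s ^ 2 := by
    calc _ ≤ M * (4 * M ^ 3 * (s * (a + s))) ^ 2 := by gcongr
      _ = 16 * M ^ 7 * s ^ 2 * (a + s) * (a + s) := by ring
      _ ≤ 16 * M ^ 7 * s ^ 2 * (a + s) * 2 := by gcongr; linarith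
      _ = _ := by ring
  have h6 : s ^ 2 * (2 * (M * a * (M * M))) ≤ 2 * M ^ 7 * (a + s) * s ^ 2 := by
    calc _ = 2 * M ^ 3 * a * s ^ 2 := by ring
      _ ≤ _ := by
        gcongr
        · norm_num
        · linarith
  rw [norm_eq_abs] at h1
  rw [abs_le] at *
  constructor <;> linarith

lemma norm_le_of_leafChartDeriv (B : IsLeviBall P A c ρ e z₁ r M κ) (hr : 0 < r) (hc : 0 < c)
    (hρ : ContDiff ℝ ∞ ρ) (hPP : ∀ X, P (P X) = P X) (hPe : P e = 0) (hPz : ∀ X, dzL ρ z₁ (P X) = 0)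
    (hs : 0 < s) (hs1 : s ≤ 1) (hw : ‖w‖ ≤ 1) (H : IsLeviLeaf P A c ρ e h w) (hz : h w ∈ ball z₁ r)
    {x Y} (hxe : x = leafChart P ρ e z₁ h s w) (hx : x ∈ ball z₁ r)
    (hX : X = leafChartDeriv P A ρ e z₁ (h w) s w Y) {L G} (hL : 1 ≤ L)
    (hG : ‖X‖ ≤ G) (hd : ‖dzL ρ x X‖ ≤ L * G * s ^ 2) (hA : ‖X - A x X‖ ≤ L * G * s) :
    ‖Y‖ ≤ 500 * L * M ^ 12 * (1 + 1 / κ) * G := by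
  have hM := B.one_le
  have hM0 := zero_le_one.trans hM
  have hκ := B.pos
  have hG0 := (norm_nonneg X).trans hG
  have hv : ‖x - h w‖ ≤ 8 * M ^ 3 * s := by
    rw [hxe]
    refine (B.norm_leafChart_sub_le hr hs hw le_rfl hz).trans ?_
    calc _ = 4 * M ^ 3 * s * (1 + s) := by ring
      _ ≤ 4 * M ^ 3 * s * 2 := by gcongr; linarith
      _ = _ := by ring
  have hve : x - h w = s • tproj ρ e (h w) (coproj P w) + (s ^ 2 * (tcoord ρ e z₁ w - 1)) • e := by
    rw [hxe, leafChart_eq, add_assoc, add_sub_cancel_left]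
  have hfx := B.frame x hx
  have hne := H.frame.ne
  have hnull := H.null
  have hAz := H.frame.apply_proj hc hPP Y
  rw [leafChartDeriv_apply, ← hAz] at hX
  have hPX : P X = P Y := by
    rw [hX, map_add, map_add, H.frame.proj, hPP, ← coe_smul, map_smul, proj_tproj_coproj hPP hPe,
      map_smul, hPe, smul_zero, smul_zero, add_zero, add_zero]
  have hAx : A x X = A x (P Y) := by rw [← hPX, hfx.apply_proj hc hPP]
  have hQw : ‖coproj P w‖ ≤ 2 * M := (B.norm_coproj_le w).trans (by nlinarith)
  have hθw : ‖tcoord ρ e z₁ w - 1‖ ≤ 2 * M := by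
    refine (norm_sub_le _ _).trans ?_
    rw [norm_one]
    linarith [B.norm_tcoord_center_le hr hw]
  have htang : dzL ρ (h w) (A (h w) (P Y)) = 0 := H.frame.tang _
  have hβ : ‖P Y‖ ≤ M * G := by
    rw [← hPX]
    exact (B.norm_proj_le X).trans (by gcongr)
  have hAβ : ‖A (h w) (P Y)‖ ≤ M ^ 2 * G :=
    (B.norm_frame_le hz _).trans ((mul_le_mul_of_nonneg_left hβ hM0).trans_eq (by ring))
  have hγ : ‖tproj ρ e (h w) (coproj P Y)‖ ≤ 18 * L * M ^ 7 * G := by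
    have h1 : s • tproj ρ e (h w) (coproj P Y) = tproj ρ e (h w) (X - A x X)
        + tproj ρ e (h w) ((A x - A (h w)) (P Y)) := by
      have h2 : X - A x X + (A x - A (h w)) (P Y) = s • tproj ρ e (h w) (coproj P Y) +
          (s ^ 2 * tcoord ρ e z₁ Y - s * fderiv ℝ (tcoord ρ e) (h w) (A (h w) (P Y)) (coproj P w)) • e := by
        rw [hAx, hX, sub_apply]
        abel
      rw [← map_add, h2, map_add, tproj_smul_self hne, add_zero, map_smul,
        tproj_of_dzL_eq_zero (dzL_tproj hne _)]
    have h3 : ‖(A x - A (h w)) (P Y)‖ ≤ M * (8 * M ^ 3 * s) * (M * G) := by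
      refine (le_of_opNorm_le _ (B.taylor_frame.lip _ hz _ hx) _).trans ?_
      gcongr
    have h4 : s * ‖tproj ρ e (h w) (coproj P Y)‖ ≤ s * (2 * L * M ^ 2 * G + 16 * M ^ 7 * G) := by
      rw [← Real.norm_of_nonneg hs.le, ← norm_smul, h1, Real.norm_of_nonneg hs.le]
      refine (norm_add_le _ _).trans ?_
      calc _ ≤ 2 * M ^ 2 * (L * G * s) + 2 * M ^ 2 * (M * (8 * M ^ 3 * s) * (M * G)) := by
            gcongr
            · exact (B.norm_tproj_le hz _).trans (by gcongr)
            · exact (B.norm_tproj_le hz _).trans (by gcongr)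
        _ = _ := by ring
    have h5 := le_of_mul_le_mul_left h4 hs
    have h6 : 2 * L * M ^ 2 * G ≤ 2 * L * M ^ 7 * G := by gcongr; norm_num
    have h7 : 16 * 1 * M ^ 7 * G ≤ 16 * L * M ^ 7 * G := by gcongr
    linarith
  have hτ : ‖tcoord ρ e z₁ Y‖ ≤ 454 / κ * (L * M ^ 11 * G) := by
    have h1 : (s ^ 2 * (tcoord ρ e z₁ Y * dzL ρ x e)) = dzL ρ x X
        - (dzL ρ x - dzL ρ (h w) - fderiv ℝ (dzL ρ) (h w) (x - h w)) (A (h w) (P Y))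
        - s ^ 2 * fderiv ℝ (dzL ρ) (h w) ((tcoord ρ e z₁ w - 1) • e) (A (h w) (P Y))
        - s * (dzL ρ x - dzL ρ (h w)) (tproj ρ e (h w) (coproj P Y))
        + s * (fderiv ℝ (tcoord ρ e) (h w) (A (h w) (P Y)) (coproj P w)
          * (dzL ρ x - dzL ρ (h w)) e) := by
      have hsym : fderiv ℝ (dzL ρ) (h w) (tproj ρ e (h w) (coproj P w)) (A (h w) (P Y)) =
          dzL ρ (h w) e * fderiv ℝ (tcoord ρ e) (h w) (A (h w) (P Y)) (coproj P w) := by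
        rw [fderiv_tcoord hρ hne]
        exact (fderiv_dzL_symm hρ (hnull _ _ (by rw [dzL_smul, dzL_tproj hne, mul_zero]))).symm
      have hsq : (s ^ 2 * (tcoord ρ e z₁ w - 1)) • e = (s ^ 2) • ((tcoord ρ e z₁ w - 1) • e) := by
        rw [mul_smul, ← ofReal_pow, coe_smul]
      have h2 : dzL ρ x X = dzL ρ x (A (h w) (P Y)) + s * dzL ρ x (tproj ρ e (h w) (coproj P Y)) +
          (s ^ 2 * tcoord ρ e z₁ Y
            - s * fderiv ℝ (tcoord ρ e) (h w) (A (h w) (P Y)) (coproj P w)) * dzL ρ x e := by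
        rw [hX, map_add, map_add, map_smul, dzL_smul, real_smul]
      rw [h2, hve, hsq]
      simp [sub_apply, map_add, map_smul, add_apply, smul_apply, real_smul, hsym, htang,
        dzL_tproj hne, ofReal_pow]
      ring
    have hD := B.taylor_dzL
    have h2 : ‖(dzL ρ x - dzL ρ (h w) - fderiv ℝ (dzL ρ) (h w) (x - h w)) (A (h w) (P Y))‖
        ≤ M * (8 * M ^ 3 * s) ^ 2 * (M ^ 2 * G) := by
      refine (le_of_opNorm_le _ (hD.taylor _ hz _ hx) _).trans ?_
      gcongr
    have h3 : ‖s ^ 2 * fderiv ℝ (dzL ρ) (h w) ((tcoord ρ e z₁ w - 1) • e) (A (h w) (P Y))‖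
        ≤ s ^ 2 * (M * (2 * M * M) * (M ^ 2 * G)) := by
      rw [norm_mul, norm_pow, norm_real, Real.norm_of_nonneg hs.le]
      gcongr
      refine (le_of_opNorm_le _ (le_of_opNorm_le _
        (hD.norm_fderiv_le _ hz) _) _).trans ?_
      rw [norm_smul]
      have := B.norm_le
      gcongr
    have hlip : ∀ V, ‖(dzL ρ x - dzL ρ (h w)) V‖ ≤ M * (8 * M ^ 3 * s) * ‖V‖ := fun V =>
      (le_of_opNorm_le _ (hD.lip _ hz _ hx) _).trans (by gcongr)
    have h4 : ‖s * (dzL ρ x - dzL ρ (h w)) (tproj ρ e (h w) (coproj P Y))‖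
        ≤ s * (M * (8 * M ^ 3 * s) * (18 * L * M ^ 7 * G)) := by
      rw [norm_mul, norm_real, Real.norm_of_nonneg hs.le]
      gcongr
      exact (hlip _).trans (by gcongr)
    have h5 : ‖s * (fderiv ℝ (tcoord ρ e) (h w) (A (h w) (P Y)) (coproj P w)
        * (dzL ρ x - dzL ρ (h w)) e)‖ ≤ s * (M * (M ^ 2 * G) * (2 * M) * (M * (8 * M ^ 3 * s) * M)) := by
      rw [norm_mul, norm_mul, norm_real, Real.norm_of_nonneg hs.le]
      gcongr
      · refine (le_of_opNorm_le _ (le_of_opNorm_le _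
          (B.taylor_tcoord.norm_fderiv_le _ hz) _) _).trans ?_
        gcongr
      · exact (hlip _).trans (by gcongr; exact B.norm_le)
    have h6 := norm_add_le_of_le (norm_sub_le_of_le (norm_sub_le_of_le (norm_sub_le_of_le hd h2) h3) h4) h5
    rw [← h1, norm_mul, norm_pow, norm_real, Real.norm_of_nonneg hs.le, norm_mul] at h6
    have h7 : s ^ 2 * (‖tcoord ρ e z₁ Y‖ * (κ / 2)) ≤ s ^ 2 * (227 * (L * M ^ 11 * G)) := by
      have e1 : 1 * L * G ≤ M ^ 11 * L * G := by gcongr; exact one_le_pow₀ hM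
      have e2 : 1 * M ^ 9 * G ≤ L * M ^ 11 * G := by gcongr; norm_num
      have e3 : 1 * M ^ 5 * G ≤ L * M ^ 11 * G := by gcongr; norm_num
      have e4 : s ^ 2 * (L * G + 64 * (M ^ 9 * G) + 2 * (M ^ 5 * G) + 144 * (L * M ^ 11 * G)
          + 16 * (M ^ 9 * G)) ≤ s ^ 2 * (227 * (L * M ^ 11 * G)) := by gcongr; linarith
      refine le_trans ?_ (h6.trans ?_)
      · gcongr
        exact B.le_norm_dzL hx
      · linarith
    have h8 := le_of_mul_le_mul_left h7 (by positivity)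
    rw [div_mul_eq_mul_div, le_div_iff₀ hκ]
    linarith
  have hμ : ‖tcoord ρ e (h w) (coproj P Y)‖ ≤ 454 / κ * (L * M ^ 11 * G) + M * (18 * L * M ^ 7 * G) := by
    have hz₁ := mem_ball_self (x := z₁) hr
    have h1 : tcoord ρ e (h w) (coproj P Y) =
        tcoord ρ e z₁ Y - tcoord ρ e z₁ (tproj ρ e (h w) (coproj P Y)) := by
      rw [tproj_apply, map_sub, tcoord_smul, tcoord_self (B.frame z₁ hz₁).ne]
      simp only [coproj_apply, map_sub, tcoord_proj hPz]
      ring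
    rw [h1]
    exact norm_sub_le_of_le hτ ((B.norm_tcoord_le hz₁ _).trans (by gcongr))
  have h9 : Y = P Y + (tproj ρ e (h w) (coproj P Y) + tcoord ρ e (h w) (coproj P Y) • e) := by
    rw [tproj_apply, coproj_apply]; abel
  have h10 := norm_add_le_of_le hβ (norm_add_le_of_le hγ ((norm_smul_le _ _).trans
    (mul_le_mul hμ B.norm_le (norm_nonneg _) (by positivity))))
  rw [← h9] at h10
  refine h10.trans ?_
  have e1 : 1 * M ^ 1 * G ≤ L * M ^ 12 * G := by gcongr; norm_num
  have e2 : L * M ^ 7 * G ≤ L * M ^ 12 * G := by gcongr; norm_num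
  have e3 : L * M ^ 9 * G ≤ L * M ^ 12 * G := by gcongr; norm_num
  have e4 : 0 ≤ L * M ^ 12 * G / κ := by positivity
  have e5 : 0 ≤ L * M ^ 12 * G := by positivity
  calc _ = 1 * M ^ 1 * G + 18 * (L * M ^ 7 * G) + 454 * (L * M ^ 12 * G / κ) + 18 * (L * M ^ 9 * G) := by ring
    _ ≤ 500 * (L * M ^ 12 * G) + 500 * (L * M ^ 12 * G / κ) := by linarith
    _ = _ := by ring

end IsLeviBall

end LeafEstimate

section LeafChartIsChart

variable {a s κ : ℝ} {h : ℂ^n → ℂ^n}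

namespace IsLeviBall

lemma neg_rho_leafChart_mem (B : IsLeviBall P A c ρ e z₁ r M κ) (hr : 0 < r) (hs : 0 < s)
    (hw : ‖w‖ ≤ a) (ha : a ≤ 1) (hs1 : s ≤ 1) (has : 34 * M ^ 7 * (a + s) ≤ κ / 2)
    (H : IsLeviLeaf P A c ρ e h w) (hz : h w ∈ ball z₁ r)
    (hx : leafChart P ρ e z₁ h s w ∈ ball z₁ r) :
    -ρ (leafChart P ρ e z₁ h s w) ∈ Icc (κ / 2 * s ^ 2) (3 * M ^ 2 * s ^ 2) := by
  have hM := B.one_le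
  have h1 := B.abs_rho_leafChart_add_le hr hs hw ha hs1 H hz hx
  have h2 := mul_le_mul_of_nonneg_right has (sq_nonneg s)
  have h3 := mul_le_mul_of_nonneg_right (B.le_fderiv _ hz) (sq_nonneg s)
  have h4 : fderiv ℝ ρ (h w) e ≤ 2 * M ^ 2 := by
    rw [fderiv_eq_re_dzL]
    calc _ ≤ 2 * (M * M) := by
          gcongr
          exact (re_le_norm _).trans ((B.norm_dzL_le hz e).trans (by gcongr; exact B.norm_le))
      _ = _ := by ring
  have h5 := mul_le_mul_of_nonneg_right h4 (sq_nonneg s)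
  rw [abs_le] at h1
  constructor <;> linarith

lemma abs_log_sub_le {t u v} (hs : 0 < s) (hu : 0 < u) (ht : t ∈ Icc (u * s ^ 2) (v * s ^ 2)) :
    |-Real.log t - -Real.log (s ^ 2)| ≤ |Real.log u| + |Real.log v| := by
  have hs2 : 0 < s ^ 2 := by positivity
  have ht0 := (by positivity : 0 < u * s ^ 2).trans_le ht.1
  have hv := pos_of_mul_pos_left (ht0.trans_le ht.2) hs2.le
  have h1 := log_le_log (by positivity) ht.1
  have h2 := log_le_log ht0 ht.2
  rw [Real.log_mul hu.ne' hs2.ne'] at h1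
  rw [Real.log_mul hv.ne' hs2.ne'] at h2
  rw [abs_le]
  constructor <;>
    linarith [neg_abs_le (Real.log u), le_abs_self (Real.log v), abs_nonneg (Real.log u),
      abs_nonneg (Real.log v)]

lemma exists_isChart (B : IsLeviBall P A c ρ e z₁ r M κ) (hr : 0 < r) (hc : 0 < c) (hΩ : IsOpen Ω)
    (hρ : IsDefining n Ω ρ) (hPP : ∀ X, P (P X) = P X) (hPe : P e = 0)
    (hPz : ∀ X, dzL ρ z₁ (P X) = 0) {η} {C b c₁} (hc₁ : 0 < c₁)
    (hη : ∀ z ∈ Ω, -Real.log (-ρ z) ≤ η z ∧ η z ≤ -Real.log (-ρ z) + C)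
    (hlow : ∀ z ∈ ball z₁ r, z ∈ Ω → ∀ X,
      c * ‖X - A z X‖ ^ 2 / |ρ z| + pg ρ z X / ρ z ^ 2 / 2 + ‖X‖ ^ 2 ≤ lv η z X)
    (hb : |Real.log (κ / 2)| + |Real.log (3 * M ^ 2)| + C ≤ b) (ha : 0 < a) (ha1 : a ≤ 1) :
    ∃ c' > 0, ∀ (s) (h) (p) (φ),
      0 < s → s ≤ 1 → 34 * M ^ 7 * (a + s) ≤ κ / 2 →
      (∀ w ∈ ball 0 a, IsLeviLeaf P A c ρ e h w ∧ h w ∈ ball z₁ r ∧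
        leafChart P ρ e z₁ h s w ∈ ball z₁ r) →
      h 0 = p + s ^ 2 • e → p ∈ Ω → ContDiffOn ℝ ∞ φ Ω → (∀ z ∈ Ω, φ z ∈ Icc 0 1) →
      (∀ z ∈ Ω, ∀ X, 0 ≤ lv φ z X) →
      (∀ z ∈ Ω, |η z - -Real.log (s ^ 2)| ≤ b → ∀ X, c₁ * lv η z X ≤ lv φ z X) →
      ∃ Φ J, IsChart Ω c' p Φ J φ := by
  have hM := B.one_le
  have hκ := B.pos
  set L := 6 * M ^ 2 + Real.sqrt (3 * M ^ 2 / c) with hL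
  set K := 500 * L * M ^ 12 * (1 + 1 / κ) with hK
  refine ⟨c₁ * a ^ 2 / K ^ 2, by positivity, fun s h p φ hs hs1 has H h0 hp hφ hφI hφ0 hφ1 => ?_⟩
  have hne := (B.frame z₁ (mem_ball_self hr)).ne
  have hsm : ∀ ξ ∈ ball (0 : ℂ^n) 1, a • ξ ∈ ball 0 a := fun ξ hξ => by
    rw [mem_ball_zero_iff] at hξ ⊢
    rw [norm_smul, Real.norm_of_nonneg ha.le]
    exact mul_lt_of_lt_one_right ha hξ
  have hwa : ∀ {w}, w ∈ ball (0 : ℂ^n) a → ‖w‖ ≤ a := fun hw => (mem_ball_zero_iff.1 hw).le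
  have hrho := fun w hw =>
    B.neg_rho_leafChart_mem hr hs (hwa hw) ha1 hs1 has (H w hw).1 (H w hw).2.1 (H w hw).2.2
  have hD : ∀ w ∈ ball 0 a, HasFDerivAt (leafChart P ρ e z₁ h s)
      (leafChartDeriv P A ρ e z₁ (h w) s w) w := fun w hw => (H w hw).1.hasFDerivAt_leafChart hρ.1
  have hmap0 : leafChart P ρ e z₁ h s 0 = p := by simp [leafChart_eq, h0, ← coe_smul]
  have hmem := by
    have := hρ.subset_of_isPreconnected hΩ
      ((convex_ball _ _).isPreconnected.image _ fun w hw =>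
        (hD w hw).continuousAt.continuousWithinAt) (by
        rintro _ ⟨w, hw, rfl⟩
        have h1 : 0 < κ / 2 * s ^ 2 := by positivity
        linarith [(hrho w hw).1])
      ⟨p, ⟨0, mem_ball_self ha, hmap0⟩, hp⟩
    exact fun w hw => this ⟨w, hw, rfl⟩
  have hderiv : ∀ ξ ∈ ball 0 1, HasFDerivAt (fun ξ => leafChart P ρ e z₁ h s (a • ξ))
      (a • leafChartDeriv P A ρ e z₁ (h (a • ξ)) s (a • ξ)) ξ := fun ξ hξ => by
    have h1 := (hD _ (hsm ξ hξ)).comp ξ ((hasFDerivAt_id ξ).const_smul a)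
    refine h1.congr_fderiv (ContinuousLinearMap.ext fun X => ?_)
    simp
  have hest : ∀ w ∈ ball 0 a, ∀ Y, c₁ * ‖Y‖ ^ 2 / K ^ 2 ≤
      lv φ (leafChart P ρ e z₁ h s w) (leafChartDeriv P A ρ e z₁ (h w) s w Y) := fun w hw Y => by
    obtain ⟨x, hx⟩ : ∃ x, x = leafChart P ρ e z₁ h s w := ⟨_, rfl⟩
    obtain ⟨X, hX⟩ : ∃ X, X = leafChartDeriv P A ρ e z₁ (h w) s w Y := ⟨_, rfl⟩
    have hxB := (H w hw).2.2
    have hxΩ := hmem w hw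
    have hxρ := hrho w hw
    rw [← hx] at hxB hxΩ hxρ ⊢
    rw [← hX]
    have h1 := hlow x hxB hxΩ X
    have h2 : |η x - -Real.log (s ^ 2)| ≤ b := by
      have h3 := abs_log_sub_le hs (by positivity) hxρ
      have h4 := hη x hxΩ
      rw [abs_le] at h3 ⊢
      constructor <;> linarith
    refine le_trans ?_ (hφ1 x hxΩ h2 X)
    have hρ0 := (by positivity : 0 < κ / 2 * s ^ 2).trans_le hxρ.1
    have hρx : |ρ x| ≤ 3 * M ^ 2 * s ^ 2 := by rw [abs_of_neg (by linarith)]; exact hxρ.2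
    have hρa : 0 < |ρ x| := abs_pos.2 (by linarith)
    rw [pg_eq_norm_dzL_sq] at h1
    have t1 : 0 ≤ c * ‖X - A x X‖ ^ 2 / |ρ x| := by positivity
    have t2 : 0 ≤ ‖dzL ρ x X‖ ^ 2 / ρ x ^ 2 / 2 := by positivity
    have t3 := sq_nonneg ‖X‖
    generalize lv η x X = g at *
    have hg : 0 ≤ g := by linarith
    have hg2 := sq_sqrt hg
    have b1 : ‖X‖ ≤ Real.sqrt g := Real.le_sqrt_of_sq_le (by linarith)
    have b2 : ‖dzL ρ x X‖ ≤ L * Real.sqrt g * s ^ 2 := by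
      have h3 : ‖dzL ρ x X‖ ≤ 2 * |ρ x| * Real.sqrt g := by
        refine (sq_le_sq₀ (norm_nonneg _) (by positivity)).1 ?_
        have h4 : ‖dzL ρ x X‖ ^ 2 / ρ x ^ 2 / 2 ≤ g := by linarith
        rw [div_div, div_le_iff₀ (by rw [← sq_abs]; positivity)] at h4
        rw [mul_pow, mul_pow, sq_abs]
        nlinarith
      calc _ ≤ 2 * (3 * M ^ 2 * s ^ 2) * Real.sqrt g := h3.trans (by gcongr)
        _ = 6 * M ^ 2 * Real.sqrt g * s ^ 2 := by ring
        _ ≤ _ := by gcongr; exact le_add_of_nonneg_right (sqrt_nonneg _)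
    have b3 : ‖X - A x X‖ ≤ L * Real.sqrt g * s := by
      have h3 : ‖X - A x X‖ ≤ Real.sqrt (3 * M ^ 2 / c) * Real.sqrt g * s := by
        refine (sq_le_sq₀ (norm_nonneg _) (by positivity)).1 ?_
        have h4 : c * ‖X - A x X‖ ^ 2 / |ρ x| ≤ g := by linarith
        rw [div_le_iff₀ hρa] at h4
        rw [mul_pow, mul_pow, hg2, sq_sqrt (by positivity), div_mul_eq_mul_div, div_mul_eq_mul_div,
          le_div_iff₀ hc]
        have := mul_le_mul_of_nonneg_left hρx hg
        linarith
      refine h3.trans ?_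
      gcongr
      exact le_add_of_nonneg_left (by positivity)
    have h3 := B.norm_le_of_leafChartDeriv hr hc hρ.1 hPP hPe hPz hs hs1 ((hwa hw).trans ha1)
      (H w hw).1 (H w hw).2.1 hx hxB hX (by nlinarith [sqrt_nonneg (3 * M ^ 2 / c)]) b1 b2 b3
    rw [mul_div_assoc]
    gcongr
    rw [div_le_iff₀ (by positivity)]
    calc _ ≤ (K * Real.sqrt g) ^ 2 := by gcongr
      _ = _ := by rw [mul_pow, hg2, mul_comm]
  refine ⟨fun ξ => leafChart P ρ e z₁ h s (a • ξ),
    |a ^ Module.finrank ℝ ℂ^n * (leafChartModel P ρ e z₁ s).det|, ?_⟩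
  exact
    { diff := fun ξ hξ => (((H _ (hsm ξ hξ)).1.differentiableAt_leafChart hρ.1 hc).comp ξ
        ((differentiableAt_id).fun_const_smul a)).differentiableWithinAt
      mapsTo := fun ξ hξ => hmem _ (hsm ξ hξ)
      injOn := fun ξ hξ ξ' hξ' he => by
        have := injOn_leafChart hPP hPe hne hc hs.ne' (fun w hw => (H w hw).1) (hsm ξ hξ) (hsm ξ' hξ') he
        exact smul_right_injective _ ha.ne' this
      map_zero := by rw [smul_zero, hmap0]
      J_pos := by
        rw [abs_pos]
        exact mul_ne_zero (pow_ne_zero (Module.finrank ℝ ℂ^n) ha.ne')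
          (leafChartModel_det_ne_zero hPP hPe hPz hne hs.ne')
      abs_det := fun ξ hξ => by
        rw [(hderiv ξ hξ).fderiv, ← det_leafChartDeriv hPP hPe hPz hne (H _ (hsm ξ hξ)).1.frame hc]
        exact congrArg abs (LinearMap.det_smul a _)
      contDiffOn := hφ
      mem_Icc := hφI
      lv_nonneg := hφ0
      le_lv := fun ξ hξ Y => by
        have := hest _ (hsm ξ hξ) (a • Y)
        rw [norm_smul, Real.norm_of_nonneg ha.le] at this
        rw [(hderiv ξ hξ).fderiv, smul_apply, ← map_smul]
        refine le_trans (le_of_eq ?_) this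
        ring }

end IsLeviBall

end LeafChartIsChart

lemma IsLeviFrame.norm_sub_sq_le (F : IsLeviFrame P A c ρ e z₁) (hρ : ContDiff ℝ ∞ ρ)
    (hnull : ∀ X Y, dzL ρ z₁ Y = 0 → lvp ρ z₁ (A z₁ X) Y = 0) (X) :
    c * ‖X - A z₁ X‖ ^ 2 ≤ lv ρ z₁ (tproj ρ e z₁ X) + pg ρ z₁ X := by
  have h := F.coer (X - A z₁ X) (by rw [map_sub, F.proj, sub_self])
  rw [pg_eq_norm_dzL_sq, map_sub, map_sub, F.tang, sub_zero, ← pg_eq_norm_dzL_sq,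
    tproj_of_dzL_eq_zero (F.tang X)] at h
  have hU := dzL_tproj F.ne X
  generalize tproj ρ e z₁ X = U at *
  have h1 : lv ρ z₁ (U - A z₁ X) = lv ρ z₁ U := by
    have h2 : lvp ρ z₁ (A z₁ X) (U - A z₁ X) = 0 := hnull X _ (by rw [map_sub, hU, F.tang, sub_zero])
    have h4 := lvp_add_left (ρ := ρ) z₁ (U - A z₁ X) (A z₁ X) (U - A z₁ X)
    have h5 := lvp_add_left (ρ := ρ) z₁ (U - A z₁ X) (A z₁ X) U
    rw [sub_add_cancel] at h4 h5
    rw [h2, add_zero] at h4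
    rw [hnull X U hU, add_zero] at h5
    change lvp _ _ _ _ = lvp _ _ _ _
    rw [← h4, h5, lvp_comm hρ]
  rwa [h1] at h

lemma IsLeviFoliation.exists_isLeviBall (hF : IsLeviFoliation P A c ρ e z₁) (hρ : ContDiff ℝ ∞ ρ)
    (he : 0 < fderiv ℝ ρ z₁ e) : ∃ M, ∃ r₀ > 0, ∀ r ≤ r₀,
      IsLeviBall P A c ρ e z₁ r M (fderiv ℝ ρ z₁ e / 2) := by
  have F := hF.self_of_nhds.1
  obtain ⟨M₁, hM₁, r₁, hr₁, T₁⟩ := (F.smooth.of_le two_le_infty).exists_taylorOn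
  obtain ⟨M₂, hM₂, r₂, hr₂, T₂⟩ := ((contDiffAt_tcoord hρ F.ne).of_le two_le_infty).exists_taylorOn
  obtain ⟨M₃, hM₃, r₃, hr₃, T₃⟩ :=
    ((contDiff_dzL hρ).contDiffAt |>.of_le two_le_infty).exists_taylorOn
  obtain ⟨M₄, hM₄, r₄, hr₄, T₄⟩ := (hρ.contDiffAt |>.of_le two_le_infty).exists_taylorOn
  have hd := by
    have : ContinuousAt (fun z => fderiv ℝ ρ z e) z₁ :=
      ((hρ.continuous_fderiv (by simp)).clm_apply continuous_const).continuousAt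
    exact (this.eventually (lt_mem_nhds (half_lt_self he))).mono fun z hz => hz.le
  obtain ⟨r₅, hr₅, H⟩ := eventually_nhds_iff_ball.1 (hF.and hd)
  have hN := norm_nonneg P
  have hE := norm_nonneg e
  refine ⟨1 + M₁ + M₂ + M₃ + M₄ + ‖P‖ + ‖e‖, min (min r₁ r₂) (min (min r₃ r₄) r₅), by positivity,
    fun r hr => ?_⟩
  simp [le_min_iff] at hr
  obtain ⟨⟨h1, h2⟩, ⟨h3, h4⟩, h5⟩ := hr
  exact
    { one_le := by linarith
      pos := half_pos he
      taylor_frame := T₁.mono (ball_subset_ball h1) (by linarith)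
      taylor_tcoord := T₂.mono (ball_subset_ball h2) (by linarith)
      taylor_dzL := T₃.mono (ball_subset_ball h3) (by linarith)
      taylor_rho := T₄.mono (ball_subset_ball h4) (by linarith)
      frame := fun z hz => (H z (ball_subset_ball h5 hz)).1.1
      le_fderiv := fun z hz => (H z (ball_subset_ball h5 hz)).2
      norm_proj_le := fun X => (P.le_opNorm X).trans (by gcongr; linarith)
      norm_le := by linarith }

lemma IsDefining.exists_exhaustion_of_isLeviFoliation (hΩ : IsOpen Ω) (hb : Bornology.IsBounded Ω)
    (hρ : IsDefining n Ω ρ) (hpsc : ∀ q ∈ frontier Ω, LeviPSDAt n ρ q) (hz₁ : z₁ ∈ frontier Ω)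
    (he : 0 < fderiv ℝ ρ z₁ e) (hc : 0 < c) (hF : IsLeviFoliation P A c ρ e z₁) :
    ∃ η, ∃ C > 0, ContDiffOn ℝ ∞ η Ω ∧ IsGoodExhaustion (fun z => rexp (η z)) Ω ∧
      (∀ z ∈ Ω, -Real.log (-ρ z) ≤ η z ∧ η z ≤ -Real.log (-ρ z) + C) ∧
      (∀ z ∈ Ω, ∀ X, pg η z X ≤ C * lv η z X) ∧ ∀ᶠ z in 𝓝 z₁, z ∈ Ω → ∀ X,
        c * ‖X - A z X‖ ^ 2 / |ρ z| + pg ρ z X / ρ z ^ 2 / 2 + ‖X‖ ^ 2 ≤ lv η z X := by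
  have hR (z X) : ‖(√c • (ContinuousLinearMap.id ℝ ℂ^n - A z)) X‖ ^ 2 =
      c * ‖X - A z X‖ ^ 2 := by
    rw [smul_apply, norm_smul, mul_pow, Real.norm_of_nonneg (sqrt_nonneg c), sq_sqrt hc.le]
    rfl
  have h := hρ.exists_exhaustion hΩ hb hpsc hz₁ he
   
    ((contDiffAt_const.sub (hF.self_of_nhds.1.smooth.of_le two_le_infty)).const_smul _)
    (hF.mono fun q hq hqΩ X => by
      rw [hR]
      exact hq.1.norm_sub_sq_le hρ.1 (hq.2 (hρ.2.2.1 q hqΩ)) X)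
  simpa only [hR] using h

/-- For a bounded pseudoconvex domain with smooth boundary whose Levi form has constant
rank `l`, `0 ≤ l ≤ n−1`, near `z₀ ∈ ∂Ω`, there are a neighborhood `W` of `z₀` and a
constant `C > 0` with `I¹_Ω(p;X) · I¹_Ω(p;Y) ≤ C · I⁰_Ω(p) · I²_Ω(p;X,Y)` for all
`p ∈ W ∩ Ω` and `X, Y ∈ ℂⁿ`. -/
theorem minimum_integral_ratio_bounded_of_constant_levi_rank
    (Ω) (hΩ : IsOpen Ω) (hb : Bornology.IsBounded Ω)
    (hconn : IsPreconnected Ω) (ρ) (hρ : IsDefining n Ω ρ)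
    (hpsc : ∀ q ∈ frontier Ω, LeviPSDAt n ρ q) (z₀) (hz₀ : z₀ ∈ frontier Ω)
    (l) (hl : l ≤ n - 1) (V) (hV : V ∈ 𝓝 z₀)
    (hrank : ∀ q ∈ V ∩ frontier Ω, LeviRankAt n ρ q l) :
    ∃ W ∈ 𝓝 z₀, ∃ C > 0, ∀ p ∈ W ∩ Ω, ∀ X Y,
      I1 n Ω p X * I1 n Ω p Y ≤ C * (I0 n Ω p * I2 n Ω p X Y) := by
  obtain ⟨e, he⟩ := hρ.exists_direction hz₀
  obtain ⟨P, A, c, hc, hPe, hPP, hPz, hF⟩ := hρ.exists_leviFrame hΩ (hpsc z₀ hz₀) hz₀ he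
    (by filter_upwards [hV] with q hq hqΩ using hrank q ⟨hq, hqΩ⟩)
  change IsLeviFoliation P A c ρ e z₀ at hF
  obtain ⟨M, r₀, hr₀, hB⟩ := hF.exists_isLeviBall hρ.1 he
  obtain ⟨η, C, hC, hη, hexh, hηρ, hpg, hlow⟩ :=
    hρ.exists_exhaustion_of_isLeviFoliation hΩ hb hpsc hz₀ he hc hF
  obtain ⟨r₁, hr₁, H₁⟩ := eventually_nhds_iff_ball.1 ((eventually_eventually_nhds.2 hF).and hlow)
  obtain ⟨r, hr, hrr₀, hrr₁⟩ : ∃ r > 0, r ≤ r₀ ∧ r ≤ r₁ :=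
    ⟨min r₀ r₁, lt_min hr₀ hr₁, min_le_left _ _, min_le_right _ _⟩
  replace hB := hB r hrr₀
  have hM := hB.one_le
  set κ := fderiv ℝ ρ z₀ e / 2
  have hfol : ∀ z ∈ ball z₀ r, IsLeviFoliation P A c ρ e z := fun z hz =>
    (H₁ z (ball_subset_ball hrr₁ hz)).1
  obtain ⟨a₀, ha₀, hleaf⟩ := hB.taylor_frame.exists_leaf (zero_lt_one.trans_le hM) hr
    hB.taylor_rho.diff (fun z hz ζ => by rw [fderiv_eq_re_dzL, (hB.frame z hz).tang]; simp)
    fun z hz h0 ζ η => (hfol z hz).fderiv_comm hc hρ.1 h0 ζ η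
  obtain ⟨c₁, hc₁, hφ⟩ := exists_level_weight hΩ hC hη hpg
    (|Real.log (κ / 2)| + |Real.log (3 * M ^ 2)| + C)
  obtain ⟨a, ha, haa₀, ha1, haκ, har⟩ : ∃ a > 0, a ≤ a₀ ∧ a ≤ 1 ∧ a ≤ κ / (136 * M ^ 7) ∧
      a ≤ r / (8 * M) :=
    ⟨min (min a₀ 1) (min (κ / (136 * M ^ 7)) (r / (8 * M))), by positivity, by simp⟩
  obtain ⟨c', hc', hchart⟩ := hB.exists_isChart hr hc hΩ hρ hPP hPe hPz hc₁ hηρ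
    (fun z hz => (H₁ z (ball_subset_ball hrr₁ hz)).2) le_rfl ha ha1
  obtain ⟨K, hK, hbound⟩ := exists_minimum_integral_bound hΩ hb hexh hc'
  obtain ⟨s₀, hs₀, hs1, hsκ, hsr⟩ : ∃ s₀ > 0, s₀ ≤ 1 ∧ s₀ ≤ κ / (136 * M ^ 7) ∧
      s₀ ≤ r / (32 * M ^ 3) :=
    ⟨min 1 (min (κ / (136 * M ^ 7)) (r / (32 * M ^ 3))), by positivity, by simp⟩
  rw [le_div_iff₀ (by positivity)] at haκ har hsκ hsr
  obtain ⟨D, hD, hhit⟩ := hρ.exists_hit hΩ hz₀ he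
  have hsmall : ∀ᶠ p in 𝓝 z₀, D * |ρ p| < min (s₀ ^ 2) (r / (8 * M)) := by
    have h1 : ContinuousAt (fun p => D * |ρ p|) z₀ :=
      (continuous_const.mul hρ.1.continuous.abs).continuousAt
    refine h1.eventually (gt_mem_nhds ?_)
    simp only [hρ.2.2.1 z₀ hz₀, abs_zero, mul_zero]
    positivity
  refine ⟨_, (hhit.and (hsmall.and (ball_mem_nhds z₀ (by positivity : 0 < r / 8)))), K, hK, ?_⟩
  rintro p ⟨⟨hp, hpρ, hpr⟩, hpΩ⟩
  obtain ⟨t, ht, htD, htρ, -⟩ := hp hpΩ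
  obtain ⟨htS, htr⟩ := lt_min_iff.1 (htD.trans_lt hpρ)
  rw [lt_div_iff₀ (by positivity)] at htr
  obtain ⟨s, hs, rfl⟩ : ∃ s > 0, s ^ 2 = t := ⟨√t, Real.sqrt_pos.2 ht, sq_sqrt ht.le⟩
  have hss₀ := ((sq_lt_sq₀ hs.le hs₀.le).1 htS).le
  have hq : ‖p + s ^ 2 • e - z₀‖ ≤ r / 4 := by
    rw [dist_eq_norm] at hpr
    calc _ = ‖(p - z₀) + s ^ 2 • e‖ := by abel
      _ ≤ r / 8 + s ^ 2 * M := by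
        refine (norm_add_le _ _).trans (add_le_add hpr.le ?_)
        rw [norm_smul, Real.norm_of_nonneg (by positivity)]
        gcongr
        exact hB.norm_le
      _ ≤ _ := by linarith
  obtain ⟨h, hh0, hh⟩ := hleaf (p + s ^ 2 • e)
    (by rw [mem_ball, dist_eq_norm]; linarith) htρ
  obtain ⟨φ, hφs, hφI, hφ0, hφ1⟩ := hφ (-Real.log (s ^ 2))
  obtain ⟨Φ, J, hΦ⟩ := hchart s h p φ hs (hss₀.trans hs1)
    (by nlinarith [mul_le_mul_of_nonneg_right hss₀ (by positivity : 0 ≤ 136 * M ^ 7)])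
    (fun w hw => by
      obtain ⟨h1, h2, h3, h4⟩ := hh w (ball_subset_ball haa₀ hw)
      have hwa := (mem_ball_zero_iff.1 hw).le
      have h5 := hB.norm_leafChart_sub_le hr hs hwa ha1 h1
      have h6 : M * ‖w‖ ≤ r / 8 := by nlinarith
      have h7 : 4 * M ^ 3 * (s * (a + s)) ≤ r / 4 := by
        calc _ ≤ 4 * M ^ 3 * (s₀ * (1 + 1)) := by gcongr; exact hss₀.trans hs1
          _ ≤ _ := by linarith
      refine ⟨⟨hB.frame _ h1, h3, h2, (hfol _ h1).self_of_nhds.2 h2⟩, h1, ?_⟩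
      rw [mem_ball, dist_eq_norm]
      calc _ = ‖(leafChart P ρ e z₀ h s w - h w) + (h w - (p + s ^ 2 • e)) + (p + s ^ 2 • e - z₀)‖ := by
            abel
        _ ≤ r / 4 + r / 8 + r / 4 :=
          norm_add₃_le.trans (by gcongr <;> linarith)
        _ < r := by linarith)
    hh0 hpΩ hφs hφI hφ0 hφ1
  exact hbound p Φ J φ hΦ
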